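/- Let G be a finite simple graph with minimum degree at least 2 and feedback edge number ℓ ≥ 1, and let P_1, …, P_p (with p ≤ 3ℓ − 3) be maximal degree-2 paths partitioning the edge set of G, sorted by nondecreasing length. For i > 1 call P_i very long if |E(P_i)| ≥ 2(p − 1 + Σ_{j=1}^{i−1} |E(P_j)|). Define the graph Ḡ' as follows: if |E(P_1)| ≥ p − 1, let Ḡ' = K_2; if no P_i is very long, let Ḡ' = G; otherwise, with j the smallest index such that P_j is very long, let Ḡ' be the union of all P_i with i < j together with all P_i with i ≥ j shortened to length |E(P_j)| (preserving endpoints). Then G is geometric 1-planar if and only if Ḡ' is geometric 1-planar. -/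

import Mathlib

open Set

noncomputable section

/-- The union of all (closed) straight-line edge segments of a geometric drawing. -/
def drawnSet {V : Type*} (G : SimpleGraph V) (pos : V → ℝ × ℝ) : Set (ℝ × ℝ) :=
  {x | ∃ u v, G.Adj u v ∧ x ∈ segment ℝ (pos u) (pos v)}

/-- `pos` is a geometric (straight-line) drawing of `G`: vertices are distinct points,
no edge passes through a vertex other than its endpoints, and any two distinct edges
meet only in common endpoints or in a single proper crossing point interior to both. -/
def IsGeomDrawing {V : Type*} (G : SimpleGraph V) (pos : V → ℝ × ℝ) : Prop :=
  Function.Injective pos ∧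
  (∀ u v, G.Adj u v → ∀ w : V, pos w ∈ segment ℝ (pos u) (pos v) → w = u ∨ w = v) ∧
  (∀ u v x y, G.Adj u v → G.Adj x y → s(u, v) ≠ s(x, y) →
    (segment ℝ (pos u) (pos v) ∩ segment ℝ (pos x) (pos y) ⊆
        (pos '' {u, v}) ∩ (pos '' {x, y})) ∨
    (∃ p, segment ℝ (pos u) (pos v) ∩ segment ℝ (pos x) (pos y) = {p} ∧
        p ∈ openSegment ℝ (pos u) (pos v) ∧ p ∈ openSegment ℝ (pos x) (pos y)))

/-- The straight-line edges `uv` and `xy` cross properly: they meet in exactly one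
point, interior to both segments. -/
def SegCross {V : Type*} (pos : V → ℝ × ℝ) (u v x y : V) : Prop :=
  ∃ p, segment ℝ (pos u) (pos v) ∩ segment ℝ (pos x) (pos y) = {p} ∧
    p ∈ openSegment ℝ (pos u) (pos v) ∧ p ∈ openSegment ℝ (pos x) (pos y)

/-- The set of edges of `G` that cross the edge `uv` in the geometric drawing `pos`. -/
def crossingEdges {V : Type*} (G : SimpleGraph V) (pos : V → ℝ × ℝ) (u v : V) :
    Set (Sym2 V) :=
  {e | e ∈ G.edgeSet ∧ ∃ x y, e = s(x, y) ∧ SegCross pos u v x y}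

/-- `pos` is a geometric 1-planar drawing of `G`: a geometric drawing in which every
edge is crossed at most once. -/
def IsGeom1Planar {V : Type*} (G : SimpleGraph V) (pos : V → ℝ × ℝ) : Prop :=
  IsGeomDrawing G pos ∧ ∀ u v, G.Adj u v → (crossingEdges G pos u v).Subsingleton

/-- `G` is geometric 1-planar. -/
def GeomOnePlanar {V : Type*} (G : SimpleGraph V) : Prop :=
  ∃ pos : V → ℝ × ℝ, IsGeom1Planar G pos

/-- The feedback edge number of `G`: the least number of edges whose deletion makes `G`
acyclic. -/
noncomputable def feedbackEdgeNumber {V : Type*} (G : SimpleGraph V) : ℕ :=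
  sInf {n | ∃ F : Set (Sym2 V), F ⊆ G.edgeSet ∧ F.ncard = n ∧ (G.deleteEdges F).IsAcyclic}

/-- The edge set of the path obtained from the path `w` (from `a` to `b`) by shortening
it to length `t` while preserving its endpoints: we keep the first `t − 1` edges of `w`
and join the `(t−1)`-st vertex of `w` directly to the endpoint `b` (the vertices of `w`
beyond the `(t−1)`-st become isolated). -/
def shortEdges {V : Type*} {G : SimpleGraph V} {a b : V} (w : G.Walk a b) (t : ℕ) :
    Set (Sym2 V) :=
  {e | ∃ j : ℕ, j + 2 ≤ t ∧ e = s(w.getVert j, w.getVert (j + 1))} ∪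
    {s(w.getVert (t - 1), b)}

/-- Path `P i` is *very long*: `i > 1` (in 0-based indexing, `i > 0`) and
`|E(P_i)| ≥ 2(p − 1 + ∑_{j<i} |E(P_j)|)`. -/
def VeryLong {V : Type*} {G : SimpleGraph V} {p : ℕ} {u v : Fin p → V}
    (P : ∀ i, G.Walk (u i) (v i)) (i : Fin p) : Prop :=
  0 < (i : ℕ) ∧
    2 * (p - 1 + ∑ j ∈ Finset.univ.filter (fun j : Fin p => j < i), (P j).length) ≤
      (P i).length

namespace OnePlanar

/-- The Euclidean plane, as used by the drawings. -/
abbrev Pl := ℝ × ℝ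

/-- Signed doubled area of the triangle `a b c`. -/
def crs (a b c : Pl) : ℝ := (b.1 - a.1) * (c.2 - a.2) - (b.2 - a.2) * (c.1 - a.1)

/-- The point with parameter `t` on the line through `a` and `b`. -/
def pt (a b : Pl) (t : ℝ) : Pl := a + t • (b - a)

@[simp] lemma pt_fst (a b : Pl) (t : ℝ) : (pt a b t).1 = a.1 + t * (b.1 - a.1) := by simp [pt]
@[simp] lemma pt_snd (a b : Pl) (t : ℝ) : (pt a b t).2 = a.2 + t * (b.2 - a.2) := by simp [pt]
@[simp] lemma pt_zero (a b : Pl) : pt a b 0 = a := by simp [pt]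
@[simp] lemma pt_one (a b : Pl) : pt a b 1 = b := by simp [pt]

lemma pt_pt (a b : Pl) (r t s : ℝ) : pt (pt a b r) (pt a b t) s = pt a b (r + s * (t - r)) := by
  ext <;> simp <;> ring

lemma pt_comm (a b : Pl) (t : ℝ) : pt a b t = pt b a (1 - t) := by
  ext <;> simp <;> ring

lemma continuous_pt (a b : Pl) : Continuous (pt a b) := by
  unfold pt; fun_prop

lemma mem_seg {a b z : Pl} : z ∈ segment ℝ a b ↔ ∃ t : ℝ, 0 ≤ t ∧ t ≤ 1 ∧ z = pt a b t := by
  rw [segment_eq_image']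
  constructor
  · rintro ⟨t, ⟨h0, h1⟩, rfl⟩; exact ⟨t, h0, h1, rfl⟩
  · rintro ⟨t, h0, h1, rfl⟩; exact ⟨t, ⟨h0, h1⟩, rfl⟩

lemma mem_oseg {a b z : Pl} : z ∈ openSegment ℝ a b ↔ ∃ t : ℝ, 0 < t ∧ t < 1 ∧ z = pt a b t := by
  rw [openSegment_eq_image']
  constructor
  · rintro ⟨t, ⟨h0, h1⟩, rfl⟩; exact ⟨t, h0, h1, rfl⟩
  · rintro ⟨t, h0, h1, rfl⟩; exact ⟨t, ⟨h0, h1⟩, rfl⟩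

lemma pt_mem_seg (a b : Pl) {t : ℝ} (h0 : 0 ≤ t) (h1 : t ≤ 1) : pt a b t ∈ segment ℝ a b :=
  mem_seg.2 ⟨t, h0, h1, rfl⟩

lemma pt_mem_oseg (a b : Pl) {t : ℝ} (h0 : 0 < t) (h1 : t < 1) : pt a b t ∈ openSegment ℝ a b :=
  mem_oseg.2 ⟨t, h0, h1, rfl⟩

lemma pt_inj {a b : Pl} (h : a ≠ b) {s t : ℝ} (e : pt a b s = pt a b t) : s = t := by
  have h2 : (s - t) • (b - a) = 0 := by
    have : a + s • (b - a) = a + t • (b - a) := e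
    rw [sub_smul, sub_eq_zero]; exact add_left_cancel this
  rcases smul_eq_zero.1 h2 with h3 | h3
  · linarith
  · exact absurd (sub_eq_zero.1 h3).symm h

lemma crs_pt (a b : Pl) (x y : Pl) (t : ℝ) :
    crs x y (pt a b t) = (1 - t) * crs x y a + t * crs x y b := by
  simp [crs]; ring

lemma crs_rot (a b c : Pl) : crs a b c = crs b c a := by simp only [crs]; ring
@[simp] lemma crs_self_left (a c : Pl) : crs a a c = 0 := by simp [crs]
@[simp] lemma crs_self_right (a c : Pl) : crs a c c = 0 := by simp only [crs]; ring
@[simp] lemma crs_self_outer (a c : Pl) : crs a c a = 0 := by simp [crs]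

lemma crs_eq_zero_of_mem {a b z : Pl} (h : z ∈ segment ℝ a b) : crs a b z = 0 := by
  obtain ⟨t, -, -, rfl⟩ := mem_seg.1 h
  rw [crs_pt]; simp

lemma ne_of_crs_ne {a b c : Pl} (h : crs a b c ≠ 0) : a ≠ b ∧ a ≠ c ∧ b ≠ c := by
  refine ⟨?_, ?_, ?_⟩ <;> rintro rfl <;> simp at h

/-- A point on a line is a parametrized point. -/
lemma exists_pt_of_crs {a b z : Pl} (hab : a ≠ b) (h : crs a b z = 0) : ∃ t, z = pt a b t := by
  have hn : (b.1 - a.1) ≠ 0 ∨ (b.2 - a.2) ≠ 0 := by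
    by_contra! hc
    exact hab (Prod.ext (by linarith [hc.1]) (by linarith [hc.2]))
  simp only [crs] at h
  rcases hn with hn | hn
  · refine ⟨(z.1 - a.1) / (b.1 - a.1), Prod.ext ?_ ?_⟩
    · simp only [pt_fst]; field_simp; ring
    · simp only [pt_snd]; field_simp; linarith
  · refine ⟨(z.2 - a.2) / (b.2 - a.2), Prod.ext ?_ ?_⟩
    · simp only [pt_fst]; field_simp; linarith
    · simp only [pt_snd]; field_simp; ring

/-- Two points on two non-parallel lines coincide. -/
lemma eq_of_crs_zero {a b c d z w : Pl} (hz : crs a b z = 0) (hw : crs a b w = 0)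
    (hcd : c ≠ d) (hz' : crs c d z = 0) (hw' : crs c d w = 0)
    (h : crs a b c ≠ 0 ∨ crs a b d ≠ 0) : z = w := by
  obtain ⟨s, rfl⟩ := exists_pt_of_crs hcd hz'
  obtain ⟨t, rfl⟩ := exists_pt_of_crs hcd hw'
  rw [crs_pt] at hz hw
  by_cases hst : s = t
  · rw [hst]
  exfalso
  have h1 : (t - s) * (crs a b d - crs a b c) = 0 := by linear_combination hw - hz
  rcases mul_eq_zero.1 h1 with h1 | h1
  · exact hst (by linarith)
  · have h2 : crs a b d = crs a b c := by linarith
    rw [h2] at hz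
    have h3 : crs a b c = 0 := by linear_combination hz
    rw [h2, h3] at h
    simp at h

/-- The closed segments `ab` and `cd` intersect. -/
def Touch (a b c d : Pl) : Prop := (segment ℝ a b ∩ segment ℝ c d).Nonempty

lemma touch_comm {a b c d : Pl} : Touch a b c d ↔ Touch c d a b := by
  unfold Touch; rw [inter_comm]

lemma touch_swap_left {a b c d : Pl} : Touch a b c d ↔ Touch b a c d := by
  unfold Touch; rw [segment_symm]

lemma touch_swap_right {a b c d : Pl} : Touch a b c d ↔ Touch a b d c := by
  unfold Touch; rw [segment_symm ℝ c d]

lemma isCompact_seg (a b : Pl) : IsCompact (segment ℝ a b) := by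
  rw [segment_eq_image']
  exact isCompact_Icc.image (by fun_prop)

lemma isClosed_seg (a b : Pl) : IsClosed (segment ℝ a b) := (isCompact_seg a b).isClosed

/-- Disjointness of two segments is stable under small perturbations of the endpoints. -/
lemma exists_stable_of_not_touch {a b c d : Pl} (h : ¬ Touch a b c d) :
    ∃ ε > 0, ∀ a' b' c' d' : Pl, dist a' a < ε → dist b' b < ε → dist c' c < ε →
      dist d' d < ε → ¬ Touch a' b' c' d' := by
  have hd : Disjoint (segment ℝ a b) (segment ℝ c d) := by
    rw [Set.disjoint_iff_inter_eq_empty]; exact Set.not_nonempty_iff_eq_empty.1 h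
  obtain ⟨δ, hδ, hdis⟩ := hd.exists_thickenings (isCompact_seg a b) (isClosed_seg c d)
  refine ⟨δ, hδ, fun a' b' c' d' ha hb hc hd' => ?_⟩
  have key : ∀ x y x' y' : Pl, dist x' x < δ → dist y' y < δ →
      segment ℝ x' y' ⊆ Metric.thickening δ (segment ℝ x y) := fun x y x' y' hx hy =>
    ((convex_segment x y).thickening δ).segment_subset
      (Metric.mem_thickening_iff.2 ⟨x, left_mem_segment ℝ x y, hx⟩)
      (Metric.mem_thickening_iff.2 ⟨y, right_mem_segment ℝ x y, hy⟩)
  rintro ⟨z, hz1, hz2⟩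
  exact Set.disjoint_left.1 hdis (key a b a' b' ha hb hz1) (key c d c' d' hc hd' hz2)

/-- Moving off finitely many lines inside a nonempty open set. -/
lemma exists_generic (F : Finset (Pl × Pl)) (hF : ∀ e ∈ F, e.1 ≠ e.2) (U : Set Pl)
    (hU : IsOpen U) (hne : U.Nonempty) : ∃ w ∈ U, ∀ e ∈ F, crs e.1 e.2 w ≠ 0 := by
  classical
  induction F using Finset.induction_on generalizing U with
  | empty => obtain ⟨w, hw⟩ := hne; exact ⟨w, hw, by simp⟩
  | insert e F he ih =>
    have hopen : IsOpen (U ∩ {w | crs e.1 e.2 w ≠ 0}) := by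
      refine hU.inter (isOpen_ne_fun ?_ continuous_const)
      unfold crs; fun_prop
    have hn : (U ∩ {w | crs e.1 e.2 w ≠ 0}).Nonempty := by
      obtain ⟨w, hw⟩ := hne
      by_cases hc : crs e.1 e.2 w = 0
      · have hcont : Continuous (fun t : ℝ => (w.1 - t * (e.2.2 - e.1.2), w.2 + t * (e.2.1 - e.1.1))) := by
          fun_prop
        have hnh : ∀ᶠ t in nhds (0 : ℝ),
            (w.1 - t * (e.2.2 - e.1.2), w.2 + t * (e.2.1 - e.1.1)) ∈ U := by
          apply hcont.continuousAt
          apply hU.mem_nhds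
          simpa using hw
        obtain ⟨ε, hε, hb⟩ := Metric.eventually_nhds_iff.1 hnh
        refine ⟨_, hb (y := ε / 2) (by simp [abs_of_pos hε]; linarith), ?_⟩
        have hpos : 0 < (e.2.1 - e.1.1) ^ 2 + (e.2.2 - e.1.2) ^ 2 := by
          have := hF e (Finset.mem_insert_self _ _)
          rcases (not_and_or.1 (fun h => this (Prod.ext h.1 h.2))) with h | h
          · have : 0 < (e.2.1 - e.1.1) ^ 2 := by
              apply sq_pos_of_ne_zero
              exact fun h' => h (by linarith)
            positivity
          · have : 0 < (e.2.2 - e.1.2) ^ 2 := by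
              apply sq_pos_of_ne_zero
              exact fun h' => h (by linarith)
            positivity
        have : crs e.1 e.2 (w.1 - ε / 2 * (e.2.2 - e.1.2), w.2 + ε / 2 * (e.2.1 - e.1.1))
            = ε / 2 * ((e.2.1 - e.1.1) ^ 2 + (e.2.2 - e.1.2) ^ 2) := by
          simp only [crs] at hc ⊢
          linear_combination hc
        change crs _ _ _ ≠ 0
        rw [this]
        positivity
      · exact ⟨w, hw, hc⟩
    obtain ⟨w, hw, hw2⟩ := ih (fun e' he' => hF e' (Finset.mem_insert_of_mem he')) _ hopen hn
    refine ⟨w, hw.1, fun e' he' => ?_⟩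
    rcases Finset.mem_insert.1 he' with rfl | h
    · exact hw.2
    · exact hw2 e' h

/-- A point of a nonempty open set which is off all lines spanned by a finite set, and not in it. -/
lemma exists_generic_point {S : Set Pl} (hS : S.Finite) (U : Set Pl)
    (hU : IsOpen U) (hne : U.Nonempty) :
    ∃ w ∈ U, w ∉ S ∧ ∀ a ∈ S, ∀ b ∈ S, a ≠ b → crs a b w ≠ 0 := by
  classical
  obtain ⟨w, hw, h⟩ := exists_generic
    (((hS.toFinset ×ˢ hS.toFinset).filter (fun e => e.1 ≠ e.2)) ∪
      hS.toFinset.image (fun a => (a, (a.1 + 1, a.2)))) (by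
      intro e he
      rcases Finset.mem_union.1 he with he | he
      · exact (Finset.mem_filter.1 he).2
      · obtain ⟨a, -, rfl⟩ := Finset.mem_image.1 he
        intro h
        have := congrArg Prod.fst h
        simp at this) U hU hne
  refine ⟨w, hw, fun hwS => ?_, fun a ha b hb hab => ?_⟩
  · have := h (w, (w.1 + 1, w.2)) (Finset.mem_union_right _ (Finset.mem_image.2
      ⟨w, hS.mem_toFinset.2 hwS, rfl⟩))
    simp at this
  · exact h (a, b) (Finset.mem_union_left _ (by simp [ha, hb, hab]))

/-- General position of a labelled family of points: distinct, no three collinear, and no three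
segments with six distinct ends concurrent. -/
structure GP {Λ : Type*} (A : Set Λ) (f : Λ → Pl) : Prop where
  inj : InjOn f A
  col : ∀ a ∈ A, ∀ b ∈ A, ∀ c ∈ A, a ≠ b → a ≠ c → b ≠ c → crs (f a) (f b) (f c) ≠ 0
  conc : ∀ a ∈ A, ∀ b ∈ A, ∀ c ∈ A, ∀ d ∈ A, ∀ e ∈ A, ∀ g ∈ A, [a, b, c, d, e, g].Nodup →
    ∀ z, z ∈ segment ℝ (f a) (f b) → z ∈ segment ℝ (f c) (f d) → z ∉ segment ℝ (f e) (f g)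

lemma GP.finite_crossings {Λ : Type*} [Finite Λ] {A : Set Λ} {f : Λ → Pl} (h : GP A f) :
    {z | ∃ a ∈ A, ∃ b ∈ A, ∃ c ∈ A, ∃ d ∈ A, [a, b, c, d].Nodup ∧ z ∈ segment ℝ (f a) (f b) ∧
      z ∈ segment ℝ (f c) (f d)}.Finite := by
  have : {z | ∃ a ∈ A, ∃ b ∈ A, ∃ c ∈ A, ∃ d ∈ A, [a, b, c, d].Nodup ∧
      z ∈ segment ℝ (f a) (f b) ∧ z ∈ segment ℝ (f c) (f d)} ⊆
      ⋃ q : Λ × Λ × Λ × Λ, {z | (q.1 ∈ A ∧ q.2.1 ∈ A ∧ q.2.2.1 ∈ A ∧ q.2.2.2 ∈ A) ∧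
        [q.1, q.2.1, q.2.2.1, q.2.2.2].Nodup ∧ z ∈ segment ℝ (f q.1) (f q.2.1) ∧
        z ∈ segment ℝ (f q.2.2.1) (f q.2.2.2)} := by
    rintro z ⟨a, ha, b, hb, c, hc, d, hd, h1, h2, h3⟩
    exact mem_iUnion.2 ⟨(a, b, c, d), ⟨ha, hb, hc, hd⟩, h1, h2, h3⟩
  refine (Set.finite_iUnion fun q => Set.Subsingleton.finite ?_).subset this
  rintro z ⟨⟨ha, hb, hc, hd⟩, h1, h2, h3⟩ w ⟨-, -, h2', h3'⟩
  simp only [List.nodup_cons, List.mem_cons, List.not_mem_nil, not_or] at h1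
  refine eq_of_crs_zero (crs_eq_zero_of_mem h2) (crs_eq_zero_of_mem h2') ?_
    (crs_eq_zero_of_mem h3) (crs_eq_zero_of_mem h3') (Or.inl (h.col _ ha _ hb _ hc ?_ ?_ ?_))
  · exact fun e => h1.2.2.1.1 (h.inj hc hd e)
  · exact h1.1.1
  · exact h1.1.2.1
  · exact h1.2.1.1

set_option maxHeartbeats 1000000 in
lemma exists_GP {Λ : Type*} [Fintype Λ] (f : Λ → Pl) (ε : ℝ) (hε : 0 < ε) :
    ∃ f' : Λ → Pl, (∀ a, dist (f' a) (f a) < ε) ∧ GP univ f' := by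
  classical
  suffices h : ∀ A : Finset Λ, ∃ f' : Λ → Pl, (∀ a, dist (f' a) (f a) < ε) ∧ GP (A : Set Λ) f' by
    obtain ⟨f', h1, h2⟩ := h Finset.univ
    exact ⟨f', h1, by simpa using h2⟩
  intro A
  induction A using Finset.induction_on with
  | empty =>
    refine ⟨f, fun a => by simpa using hε, ⟨by simp, by simp, by simp⟩⟩
  | insert x A hx ih =>
    obtain ⟨f', hd, hGP⟩ := ih
    have hfin := hGP.finite_crossings
    set X := {z | ∃ a ∈ (A : Set Λ), ∃ b ∈ (A : Set Λ), ∃ c ∈ (A : Set Λ), ∃ d ∈ (A : Set Λ),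
      [a, b, c, d].Nodup ∧ z ∈ segment ℝ (f' a) (f' b) ∧ z ∈ segment ℝ (f' c) (f' d)} with hX
    have hS : (f' '' (A : Set Λ) ∪ X).Finite := ((Finset.finite_toSet A).image _).union hfin
    obtain ⟨w, hw, hwS, hwc⟩ := exists_generic_point hS (Metric.ball (f x) ε) Metric.isOpen_ball
      ⟨f x, Metric.mem_ball_self hε⟩
    have hxA : ∀ a ∈ A, a ≠ x := fun a ha h => hx (h ▸ ha)
    have hup : ∀ a ∈ A, Function.update f' x w a = f' a := fun a ha =>
      Function.update_of_ne (hxA a ha) _ _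
    have hself : Function.update f' x w x = w := Function.update_self _ _ _
    have hmem : ∀ a ∈ A, f' a ∈ f' '' (A : Set Λ) ∪ X := fun a ha => Or.inl ⟨a, ha, rfl⟩
    have hcol : ∀ a ∈ A, ∀ b ∈ A, a ≠ b → crs (f' a) (f' b) w ≠ 0 := fun a ha b hb hab =>
      hwc _ (hmem a ha) _ (hmem b hb) (fun e => hab (hGP.inj ha hb e))
    have hwne : ∀ a ∈ A, f' a ≠ w := fun a ha e => hwS (e ▸ hmem a ha)
    have hconc : ∀ b ∈ A, ∀ c ∈ A, ∀ d ∈ A, ∀ e ∈ A, ∀ g ∈ A, [b, c, d, e, g].Nodup →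
        ∀ z, z ∈ segment ℝ w (f' b) → z ∈ segment ℝ (f' c) (f' d) →
        z ∈ segment ℝ (f' e) (f' g) → False := by
      intro b hb c hc d hd e he g hg hnd z h1 h2 h3
      simp only [List.nodup_cons, List.mem_cons, List.not_mem_nil, not_or] at hnd
      have hzX : z ∈ X := ⟨c, hc, d, hd, e, he, g, hg, by clear * - hnd; grind, h2, h3⟩
      have hzb : f' b ≠ z := by
        intro hz
        exact hGP.col c hc d hd b hb (by clear * - hnd; grind) (by clear * - hnd; grind) (by clear * - hnd; grind)
          (hz ▸ crs_eq_zero_of_mem h2)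
      apply hwc _ (hmem b hb) _ (Or.inr hzX) hzb
      rw [crs_rot, crs_rot]
      exact crs_eq_zero_of_mem h1
    refine ⟨Function.update f' x w, ?_, ?_, ?_, ?_⟩
    · intro a
      by_cases h : a = x
      · subst h; simpa using hw
      · simpa [h] using hd a
    · intro a ha b hb hab
      rcases Finset.mem_insert.1 (Finset.mem_coe.1 ha) with rfl | ha' <;>
        rcases Finset.mem_insert.1 (Finset.mem_coe.1 hb) with rfl | hb'
      · rfl
      · rw [hself, hup b hb'] at hab; exact absurd hab.symm (hwne b hb')
      · rw [hself, hup a ha'] at hab; exact absurd hab (hwne a ha')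
      · rw [hup a ha', hup b hb'] at hab; exact hGP.inj ha' hb' hab
    · intro a ha b hb c hc hab hac hbc
      rcases Finset.mem_insert.1 (Finset.mem_coe.1 ha) with rfl | ha' <;>
      rcases Finset.mem_insert.1 (Finset.mem_coe.1 hb) with rfl | hb' <;>
      rcases Finset.mem_insert.1 (Finset.mem_coe.1 hc) with rfl | hc' <;>
      first
      | exact absurd rfl hab
      | exact absurd rfl hac
      | exact absurd rfl hbc
      | skip
      · rw [hself, hup b hb', hup c hc', crs_rot]; exact hcol b hb' c hc' hbc
      · rw [hself, hup a ha', hup c hc', crs_rot, crs_rot]; exact hcol c hc' a ha' hac.symm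
      · rw [hself, hup a ha', hup b hb']; exact hcol a ha' b hb' hab
      · rw [hup a ha', hup b hb', hup c hc']; exact hGP.col a ha' b hb' c hc' hab hac hbc
    · intro a ha0 b hb0 c hc0 d hd0 e he0 g hg0 hnd z h1 h2 h3
      simp only [List.nodup_cons, List.mem_cons, List.not_mem_nil, not_or] at hnd
      have hA : ∀ y ∈ ((insert x A : Finset Λ) : Set Λ), y ≠ x → y ∈ A := fun y hy hyx =>
        (Finset.mem_insert.1 (Finset.mem_coe.1 hy)).resolve_left hyx
      by_cases hax : a = x
      · subst hax
        have hb := hA b hb0 (by clear * - hnd; grind)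
        have hc := hA c hc0 (by clear * - hnd; grind)
        have hd := hA d hd0 (by clear * - hnd; grind)
        have he := hA e he0 (by clear * - hnd; grind)
        have hg := hA g hg0 (by clear * - hnd; grind)
        rw [hself, hup b hb] at h1
        rw [hup c hc, hup d hd] at h2
        rw [hup e he, hup g hg] at h3
        exact hconc b hb c hc d hd e he g hg (by clear * - hnd; grind) z h1 h2 h3
      have ha := hA a ha0 hax
      by_cases hbx : b = x
      · subst hbx
        have hc := hA c hc0 (by clear * - hnd; grind)
        have hd := hA d hd0 (by clear * - hnd; grind)
        have he := hA e he0 (by clear * - hnd; grind)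
        have hg := hA g hg0 (by clear * - hnd; grind)
        rw [hself, hup a ha, segment_symm] at h1
        rw [hup c hc, hup d hd] at h2
        rw [hup e he, hup g hg] at h3
        exact hconc a ha c hc d hd e he g hg (by clear * - hnd; grind) z h1 h2 h3
      have hb := hA b hb0 hbx
      rw [hup a ha, hup b hb] at h1
      by_cases hcx : c = x
      · subst hcx
        have hd := hA d hd0 (by clear * - hnd; grind)
        have he := hA e he0 (by clear * - hnd; grind)
        have hg := hA g hg0 (by clear * - hnd; grind)
        rw [hself, hup d hd] at h2
        rw [hup e he, hup g hg] at h3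
        exact hconc d hd a ha b hb e he g hg (by clear * - hnd; grind) z h2 h1 h3
      have hc := hA c hc0 hcx
      by_cases hdx : d = x
      · subst hdx
        have he := hA e he0 (by clear * - hnd; grind)
        have hg := hA g hg0 (by clear * - hnd; grind)
        rw [hself, hup c hc, segment_symm] at h2
        rw [hup e he, hup g hg] at h3
        exact hconc c hc a ha b hb e he g hg (by clear * - hnd; grind) z h2 h1 h3
      have hd := hA d hd0 hdx
      rw [hup c hc, hup d hd] at h2
      by_cases hex : e = x
      · subst hex
        have hg := hA g hg0 (by clear * - hnd; grind)
        rw [hself, hup g hg] at h3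
        exact hconc g hg a ha b hb c hc d hd (by clear * - hnd; grind) z h3 h1 h2
      have he := hA e he0 hex
      by_cases hgx : g = x
      · subst hgx
        rw [hself, hup e he, segment_symm] at h3
        exact hconc e he a ha b hb c hc d hd (by clear * - hnd; grind) z h3 h1 h2
      have hg := hA g hg0 hgx
      rw [hup e he, hup g hg] at h3
      exact hGP.conc a ha b hb c hc d hd e he g hg (by clear * - hnd; grind) z h1 h2 h3

end OnePlanar

namespace OnePlanar

/-- Any labelled family can be put in general position without creating new touchings. -/
lemma exists_GP_stable {Λ : Type*} [Fintype Λ] (f : Λ → Pl) :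
    ∃ f' : Λ → Pl, GP univ f' ∧ ∀ a b c d, Touch (f' a) (f' b) (f' c) (f' d) →
      Touch (f a) (f b) (f c) (f d) := by
  have h : ∀ q : Λ × Λ × Λ × Λ, ∃ ε > 0, ∀ f' : Λ → Pl, (∀ a, dist (f' a) (f a) < ε) →
      Touch (f' q.1) (f' q.2.1) (f' q.2.2.1) (f' q.2.2.2) →
      Touch (f q.1) (f q.2.1) (f q.2.2.1) (f q.2.2.2) := by
    intro q
    by_cases hq : Touch (f q.1) (f q.2.1) (f q.2.2.1) (f q.2.2.2)
    · exact ⟨1, one_pos, fun _ _ _ => hq⟩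
    · obtain ⟨ε, hε, h⟩ := exists_stable_of_not_touch hq
      exact ⟨ε, hε, fun f' hf' ht => absurd ht (h _ _ _ _ (hf' _) (hf' _) (hf' _) (hf' _))⟩
  choose ε hε h using h
  obtain ⟨δ, hδ, hδε⟩ : ∃ δ > 0, ∀ q, δ ≤ ε q := by
    rcases isEmpty_or_nonempty (Λ × Λ × Λ × Λ) with he | he
    · exact ⟨1, one_pos, fun q => (he.false q).elim⟩
    · obtain ⟨q, hq⟩ := Finite.exists_min ε
      exact ⟨ε q, hε q, hq⟩
  obtain ⟨f', hd, hGP⟩ := exists_GP f δ hδ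
  exact ⟨f', hGP, fun a b c d => h (a, b, c, d) f' (fun x => (hd x).trans_le (hδε _))⟩

lemma seg_inter_of_common {a b c z : Pl} (h : crs a b c ≠ 0) (h1 : z ∈ segment ℝ a b)
    (h2 : z ∈ segment ℝ a c) : z = a := by
  refine eq_of_crs_zero (crs_eq_zero_of_mem h1) (by simp) (ne_of_crs_ne h).2.1
    (crs_eq_zero_of_mem h2) (by simp) (Or.inr h)

lemma mem_oseg_of_mem_seg {a b z : Pl} (h : z ∈ segment ℝ a b) (ha : z ≠ a) (hb : z ≠ b) :
    z ∈ openSegment ℝ a b :=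
  mem_openSegment_of_ne_left_right ha.symm hb.symm h

lemma ne_of_mem_oseg {a b z : Pl} (h : z ∈ openSegment ℝ a b) (hab : a ≠ b) : z ≠ a ∧ z ≠ b := by
  obtain ⟨t, h0, h1, rfl⟩ := mem_oseg.1 h
  constructor <;> intro e
  · have := pt_inj hab (e.trans (pt_zero a b).symm); linarith
  · have := pt_inj hab (e.trans (pt_one a b).symm); linarith

lemma seg_inter_subsingleton {a b c d : Pl} (h : crs a b c ≠ 0) (hcd : c ≠ d) :
    (segment ℝ a b ∩ segment ℝ c d).Subsingleton := fun _ hz _ hw =>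
  eq_of_crs_zero (crs_eq_zero_of_mem hz.1) (crs_eq_zero_of_mem hw.1) hcd
    (crs_eq_zero_of_mem hz.2) (crs_eq_zero_of_mem hw.2) (Or.inl h)

/-- In a family in general position, a point common to two segments with four different ends is
interior to both. -/
lemma GP.mem_oseg {Λ : Type*} {f : Λ → Pl} (h : GP univ f) {a b c d : Λ}
    (hac : a ≠ c) (hbc : b ≠ c) (hbd : b ≠ d) (had : a ≠ d) (hcd : c ≠ d) {z : Pl}
    (h1 : z ∈ segment ℝ (f a) (f b)) (h2 : z ∈ segment ℝ (f c) (f d)) :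
    z ∈ openSegment ℝ (f a) (f b) := by
  refine mem_oseg_of_mem_seg h1 ?_ ?_ <;> rintro rfl
  · exact h.col c trivial d trivial a trivial hcd hac.symm had.symm (crs_eq_zero_of_mem h2)
  · exact h.col c trivial d trivial b trivial hcd hbc.symm hbd.symm (crs_eq_zero_of_mem h2)

/-- The edges `ab` and `cd` have no common end. -/
def Apart {V : Type*} (a b c d : V) : Prop := a ≠ c ∧ a ≠ d ∧ b ≠ c ∧ b ≠ d

/-- Every edge touches at most one edge it has no vertex in common with. -/
def TouchOne {V : Type*} (Γ : SimpleGraph V) (pos : V → Pl) : Prop :=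
  ∀ a b, Γ.Adj a b → ∀ c d c' d', Γ.Adj c d → Γ.Adj c' d' → Apart a b c d → Apart a b c' d' →
    Touch (pos a) (pos b) (pos c) (pos d) → Touch (pos a) (pos b) (pos c') (pos d') →
    s(c, d) = s(c', d')

theorem geomOnePlanar_of_touchOne {V : Type*} [Fintype V] {Γ : SimpleGraph V} {pos : V → Pl}
    (h : TouchOne Γ pos) : GeomOnePlanar Γ := by
  obtain ⟨f, hf, ht⟩ := exists_GP_stable pos
  have hinj : Function.Injective f := fun a b e => hf.inj trivial trivial e
  -- a common point of two edges sharing a vertex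
  have share : ∀ a b c z, a ≠ b → a ≠ c → b ≠ c → z ∈ segment ℝ (f a) (f b) →
      z ∈ segment ℝ (f a) (f c) → z = f a := fun a b c z hab hac hbc =>
    seg_inter_of_common (hf.col a trivial b trivial c trivial hab hac hbc)
  have common : ∀ u v x y z, u ≠ v → x ≠ y → s(u, v) ≠ s(x, y) → ¬ Apart u v x y →
      z ∈ segment ℝ (f u) (f v) → z ∈ segment ℝ (f x) (f y) →
      z ∈ f '' {u, v} ∩ f '' {x, y} := by
    intro u v x y z huv hxy hne hap h1 h2
    simp only [Apart, not_and_or, not_not] at hap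
    simp only [ne_eq, Sym2.eq_iff, not_or, not_and_or] at hne
    rcases hap with rfl | rfl | rfl | rfl
    · have := share u v y z huv hxy (by tauto) h1 h2
      subst this; simp
    · rw [segment_symm] at h2
      have := share u v x z huv hxy.symm (by tauto) h1 h2
      subst this; simp
    · rw [segment_symm] at h1
      have := share v u y z huv.symm hxy (by tauto) h1 h2
      subst this; simp
    · rw [segment_symm] at h1 h2
      have := share v u x z huv.symm hxy.symm (by tauto) h1 h2
      subst this; simp
  have endsNot : ∀ u v z, u ≠ v → z ∈ f '' {u, v} → z ∉ openSegment ℝ (f u) (f v) := by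
    rintro u v z huv ⟨w, hw, rfl⟩ hz
    have := ne_of_mem_oseg hz (hinj.ne huv)
    rcases hw with rfl | rfl
    · exact this.1 rfl
    · exact this.2 rfl
  refine ⟨f, ⟨hinj, ?_, ?_⟩, ?_⟩
  · intro u v huv w hw
    by_contra! hc
    exact hf.col u trivial v trivial w trivial huv.ne hc.1.symm hc.2.symm (crs_eq_zero_of_mem hw)
  · intro u v x y huv hxy hne
    by_cases hap : Apart u v x y
    · by_cases hT : Touch (f u) (f v) (f x) (f y)
      · obtain ⟨z, hz⟩ := hT
        obtain ⟨h1, h2, h3, h4⟩ := hap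
        refine Or.inr ⟨z, ?_, ?_, ?_⟩
        · exact (seg_inter_subsingleton (hf.col u trivial v trivial x trivial huv.ne h1 h3)
            (hinj.ne hxy.ne)).eq_singleton_of_mem hz
        · exact hf.mem_oseg h1 h3 h4 h2 hxy.ne hz.1 hz.2
        · exact hf.mem_oseg h1.symm h2.symm h4.symm h3.symm huv.ne hz.2 hz.1
      · left
        intro z hz
        exact (hT ⟨z, hz⟩).elim
    · left
      intro z hz
      exact common u v x y z huv.ne hxy.ne hne hap hz.1 hz.2
  · have key : ∀ u v x y, Γ.Adj u v → Γ.Adj x y → SegCross f u v x y →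
        Apart u v x y ∧ Touch (pos u) (pos v) (pos x) (pos y) := by
      rintro u v x y huv hxy ⟨z, hz, hz1, hz2⟩
      have hz' : z ∈ segment ℝ (f u) (f v) ∩ segment ℝ (f x) (f y) := by rw [hz]; rfl
      refine ⟨?_, ht _ _ _ _ ⟨z, hz'⟩⟩
      by_contra hap
      by_cases hne : s(u, v) = s(x, y)
      · have hseg : segment ℝ (f u) (f v) = segment ℝ (f x) (f y) := by
          rcases Sym2.eq_iff.1 hne with ⟨rfl, rfl⟩ | ⟨rfl, rfl⟩
          · rfl
          · rw [segment_symm]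
        rw [hseg, inter_self] at hz
        have h1 : f x ∈ ({z} : Set Pl) := hz ▸ left_mem_segment ℝ _ _
        have h2 : f y ∈ ({z} : Set Pl) := hz ▸ right_mem_segment ℝ _ _
        exact hxy.ne (hinj (h1.trans h2.symm))
      · exact endsNot u v z huv.ne (common u v x y z huv.ne hxy.ne hne hap hz'.1 hz'.2).1 hz1
    rintro u v huv e ⟨he, x, y, rfl, hxy⟩ e' ⟨he', x', y', rfl, hxy'⟩
    have k1 := key u v x y huv he hxy
    have k2 := key u v x' y' huv he' hxy'
    exact h u v huv x y x' y' he he' k1.1 k2.1 k1.2 k2.2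

theorem exists_GP_touchOne {V : Type*} [Fintype V] {Γ : SimpleGraph V} (h : GeomOnePlanar Γ) :
    ∃ pos : V → Pl, GP univ pos ∧ TouchOne Γ pos := by
  obtain ⟨pos, ⟨hinj, -, hcr⟩, h1⟩ := h
  obtain ⟨f, hf, ht⟩ := exists_GP_stable pos
  refine ⟨f, hf, ?_⟩
  have key : ∀ u v x y, Γ.Adj u v → Γ.Adj x y → Apart u v x y →
      Touch (f u) (f v) (f x) (f y) → SegCross pos u v x y := by
    rintro u v x y huv hxy ⟨a1, a2, a3, a4⟩ hT
    obtain ⟨z, hz⟩ := ht _ _ _ _ hT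
    rcases hcr u v x y huv hxy (by rw [ne_eq, Sym2.eq_iff]; tauto) with hc | hc
    · obtain ⟨⟨p, hp, rfl⟩, ⟨q, hq, hpq⟩⟩ := hc hz
      have := hinj hpq
      subst this
      simp only [mem_insert_iff, mem_singleton_iff] at hp hq
      rcases hp with rfl | rfl <;> tauto
    · exact hc
  intro a b hab c d c' d' hcd hcd' hA hA' hT hT'
  exact h1 a b hab ⟨hcd, c, d, rfl, key _ _ _ _ hab hcd hA hT⟩
    ⟨hcd', c', d', rfl, key _ _ _ _ hab hcd' hA' hT'⟩

end OnePlanar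

namespace OnePlanar

/-- `[a, b]` can be cut into `N` intervals by points outside `Z`, including those of `I`, with at
most one point of `Z` in each interval. -/
def Cut (Z : Finset ℝ) (a b : ℝ) (N : ℕ) (I : Set ℝ) : Prop :=
  ∃ S : ℕ → ℝ, S 0 = a ∧ S N = b ∧ (∀ K < N, S K < S (K + 1)) ∧ (∀ K ≤ N, S K ∉ Z) ∧
    (∀ K < N, ∀ z ∈ Z, ∀ z' ∈ Z, S K < z → z < S (K + 1) → S K < z' → z' < S (K + 1) → z = z') ∧
    ∀ t ∈ I, ∃ K ≤ N, S K = t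

lemma Cut.concat {Z : Finset ℝ} {a b c : ℝ} {N M : ℕ} {I J : Set ℝ} (h : Cut Z a b N I)
    (h' : Cut Z b c M J) : Cut Z a c (N + M) (I ∪ J) := by
  obtain ⟨S, s0, sN, sm, sZ, ss, sI⟩ := h
  obtain ⟨T, t0, tM, tm, tZ, ts, tJ⟩ := h'
  have e1 : ∀ K ≤ N, (fun K => if K ≤ N then S K else T (K - N)) K = S K := fun K hK => by
    simp [hK]
  have e2 : ∀ K, N ≤ K → (fun K => if K ≤ N then S K else T (K - N)) K = T (K - N) := by
    intro K hK
    rcases hK.eq_or_lt with rfl | hK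
    · simp [sN, t0]
    · simp [not_le.2 hK]
  refine ⟨fun K => if K ≤ N then S K else T (K - N), ?_, ?_, ?_, ?_, ?_, ?_⟩
  · rw [e1 0 (Nat.zero_le _), s0]
  · rw [e2 _ (by lia)]; simpa using tM
  · intro K hK
    rcases lt_or_ge K N with h | h
    · rw [e1 K h.le, e1 (K + 1) h]; exact sm K h
    · rw [e2 K h, e2 (K + 1) (by lia), Nat.sub_add_comm h]; exact tm _ (by lia)
  · intro K hK
    rcases le_or_gt K N with h | h
    · rw [e1 K h]; exact sZ K h
    · rw [e2 K h.le]; exact tZ _ (by lia)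
  · intro K hK
    rcases lt_or_ge K N with h | h
    · rw [e1 K h.le, e1 (K + 1) h]; exact ss K h
    · rw [e2 K h, e2 (K + 1) (by lia), Nat.sub_add_comm h]; exact ts _ (by lia)
  · rintro t (ht | ht)
    · obtain ⟨K, hK, rfl⟩ := sI t ht
      exact ⟨K, by lia, e1 K hK⟩
    · obtain ⟨K, hK, rfl⟩ := tJ t ht
      exact ⟨K + N, by lia, by rw [e2 _ (by lia)]; simp⟩

lemma Cut.mono {Z : Finset ℝ} {a b : ℝ} {N : ℕ} {I J : Set ℝ} (h : Cut Z a b N I)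
    (hJ : J ⊆ I) : Cut Z a b N J := by
  obtain ⟨S, s0, sN, sm, sZ, ss, sI⟩ := h
  exact ⟨S, s0, sN, sm, sZ, ss, fun t ht => sI t (hJ ht)⟩

lemma cut_one {Z : Finset ℝ} {a b : ℝ} (hab : a < b) (ha : a ∉ Z) (hb : b ∉ Z)
    (h : (Z.filter (fun z => a < z ∧ z < b)).card ≤ 1) : Cut Z a b 1 {a, b} := by
  refine ⟨fun K => if K = 0 then a else b, by simp, by simp, ?_, ?_, ?_, ?_⟩
  · intro K hK; obtain rfl : K = 0 := by lia
    simpa using hab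
  · intro K hK; dsimp only; split_ifs <;> assumption
  · intro K hK; obtain rfl : K = 0 := by lia
    intro z hz z' hz' h1 h2 h3 h4
    simp at h1 h2 h3 h4
    exact Finset.card_le_one.1 h z (by simp [*]) z' (by simp [*])
  · rintro t (rfl | rfl)
    · exact ⟨0, by lia, by simp⟩
    · exact ⟨1, by lia, by simp⟩

lemma cut_interval {Z : Finset ℝ} {N : ℕ} (hN : 1 ≤ N) {a b : ℝ} (hab : a < b) (ha : a ∉ Z)
    (hb : b ∉ Z) (h : (Z.filter (fun z => a < z ∧ z < b)).card ≤ N) : Cut Z a b N {a, b} := by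
  classical
  induction N, hN using Nat.le_induction generalizing a with
  | base => exact cut_one hab ha hb h
  | succ N hN ih =>
    obtain ⟨c, hac, hcb, hc, h1, h2⟩ : ∃ c, a < c ∧ c < b ∧ c ∉ Z ∧
        (Z.filter (fun z => a < z ∧ z < c)).card ≤ 1 ∧
        (Z.filter (fun z => c < z ∧ z < b)).card ≤ N := by
      set W := Z.filter (fun z => a < z ∧ z < b) with hW
      rcases W.eq_empty_or_nonempty with he | hne
      · have hno : ∀ z ∈ Z, a < z → z < b → False := fun z hz h1 h2 => by
          have : z ∈ W := by simp [hW, hz, h1, h2]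
          simp [he] at this
        refine ⟨(a + b) / 2, by linarith, by linarith, fun hc => hno _ hc (by linarith)
          (by linarith), ?_, ?_⟩
        · rw [Finset.card_eq_zero.2] <;> [lia; skip]
          refine Finset.filter_eq_empty_iff.2 fun z hz hh => hno z hz hh.1 (by linarith)
        · rw [Finset.card_eq_zero.2] <;> [lia; skip]
          refine Finset.filter_eq_empty_iff.2 fun z hz hh => hno z hz (by linarith) hh.2
      · have hz0 := W.min'_mem hne
        set z0 := W.min' hne
        have hz0' : z0 ∈ Z ∧ a < z0 ∧ z0 < b := by simpa [hW] using hz0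
        have hy := (insert b (W.erase z0)).min'_mem (by simp)
        have hyle := fun t ht => (insert b (W.erase z0)).min'_le t ht
        set y := (insert b (W.erase z0)).min' (by simp)
        have hyz : z0 < y := by
          rcases Finset.mem_insert.1 hy with h | h
          · rw [h]; exact hz0'.2.2
          · exact lt_of_le_of_ne (W.min'_le _ (Finset.mem_of_mem_erase h))
              (Finset.ne_of_mem_erase h).symm
        have hyb : y ≤ b := hyle b (by simp)
        have hall : ∀ z ∈ Z, a < z → z < b → z = z0 ∨ y ≤ z := by
          intro z hz h1 h2
          by_cases hzz : z = z0
          · exact Or.inl hzz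
          · refine Or.inr (hyle z ?_)
            simp [hW, hz, h1, h2, hzz]
        refine ⟨(z0 + y) / 2, by linarith, by linarith, fun hc => ?_, ?_, ?_⟩
        · rcases hall _ hc (by linarith) (by linarith) with h | h <;> linarith
        · refine Finset.card_le_one.2 fun z hz w hw => ?_
          simp only [Finset.mem_filter] at hz hw
          have e1 : z = z0 := (hall z hz.1 hz.2.1 (by linarith)).resolve_right (by linarith)
          have e2 : w = z0 := (hall w hw.1 hw.2.1 (by linarith)).resolve_right (by linarith)
          rw [e1, e2]
        · have hsub : Z.filter (fun z => (z0 + y) / 2 < z ∧ z < b) ⊆ W.erase z0 := by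
            intro z hz
            simp only [Finset.mem_filter] at hz
            simp only [Finset.mem_erase, hW, Finset.mem_filter]
            exact ⟨by rintro rfl; linarith, hz.1, by linarith, hz.2.2⟩
          have := Finset.card_le_card hsub
          rw [Finset.card_erase_of_mem hz0] at this
          lia
    have := (cut_one hac ha hc h1).concat (ih hcb hc h2)
    rw [add_comm]
    exact this.mono (by grind)

lemma exists_cut {m N : ℕ} (hm : 1 ≤ m) {Z : Finset ℝ} (hZ : ∀ k : ℕ, (k : ℝ) ∉ Z) {x : ℕ → ℕ}
    (hx : ∀ k < m, (Z.filter (fun z => (k : ℝ) < z ∧ z < k + 1)).card ≤ x k)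
    (hN : ∑ k ∈ Finset.range m, max 1 (x k) ≤ N) :
    Cut Z 0 m N {t | ∃ k : ℕ, k ≤ m ∧ t = k} := by
  induction m, hm using Nat.le_induction generalizing N with
  | base =>
    simp at hN
    have := cut_interval (Z := Z) (a := 0) (b := 1) (N := N) hN.1 one_pos (by simpa using hZ 0)
      (by simpa using hZ 1) (le_trans (by simpa using hx 0 (by lia)) hN.2)
    refine (Nat.cast_one (R := ℝ)).symm ▸ this.mono ?_
    rintro t ⟨k, hk, rfl⟩
    interval_cases k <;> simp
  | succ m hm ih =>
    rw [Finset.sum_range_succ] at hN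
    have h1 := ih (N := N - max 1 (x m)) (fun k hk => hx k (by lia)) (by lia)
    have h2 := cut_interval (Z := Z) (a := m) (b := (m + 1 : ℕ)) (N := max 1 (x m)) (by simp)
      (by simp) (hZ m) (hZ (m + 1)) (le_trans (by simpa using hx m (by lia)) (le_max_right _ _))
    have := h1.concat h2
    rw [show N - max 1 (x m) + max 1 (x m) = N by lia] at this
    refine this.mono ?_
    rintro t ⟨k, hk, rfl⟩
    rcases Nat.lt_or_ge m k with h | h
    · right; right
      have : k = m + 1 := by lia
      simp [this]
    · left; exact ⟨k, h, rfl⟩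

end OnePlanar

namespace OnePlanar

/-- A graph is covered by chains `vert i 0, …, vert i (N i)` with pairwise distinct inner vertices. -/
structure Chains {V ι : Type*} (Γ : SimpleGraph V) (u v : ι → V) (N : ι → ℕ)
    (vert : ι → ℕ → V) : Prop where
  left : ∀ i, vert i 0 = u i
  right : ∀ i, vert i (N i) = v i
  inner : ∀ i k i' k', 0 < k → k < N i → k' ≤ N i' → vert i k = vert i' k' → i = i' ∧ k = k'
  cover : ∀ a b, Γ.Adj a b → ∃ i, ∃ k < N i, s(a, b) = s(vert i k, vert i (k + 1))

/-- A system of node sequences `ν i 0, …, ν i (m i)` joining the labels of `u i` and `v i`. -/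
structure Net {V ι Λ : Type*} (u v : ι → V) (m : ι → ℕ) (e : V → Λ) (ν : ι → ℕ → Λ) : Prop where
  pos : ∀ i, 1 ≤ m i
  inj : Function.Injective e
  ne : ∀ i, u i ≠ v i
  left : ∀ i, ν i 0 = e (u i)
  right : ∀ i, ν i (m i) = e (v i)
  inner : ∀ i k i' k', 0 < k → k < m i → k' ≤ m i' → ν i k = ν i' k' → i = i' ∧ k = k'

/-- The pieces touched by the `k`-th piece of the `i`-th node sequence, without common ends. -/
def touched {ι Λ : Type*} [Fintype ι] (m : ι → ℕ) (ν : ι → ℕ → Λ) (f : Λ → Pl) (i : ι) (k : ℕ) :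
    Finset ((_ : ι) × ℕ) :=
  open Classical in
  (Finset.univ.sigma fun i' => Finset.range (m i')).filter fun q =>
    Apart (ν i k) (ν i (k + 1)) (ν q.1 q.2) (ν q.1 (q.2 + 1)) ∧
    Touch (f (ν i k)) (f (ν i (k + 1))) (f (ν q.1 q.2)) (f (ν q.1 (q.2 + 1)))

lemma mem_touched {ι Λ : Type*} [Fintype ι] {m : ι → ℕ} {ν : ι → ℕ → Λ} {f : Λ → Pl} {i : ι}
    {k : ℕ} {q : (_ : ι) × ℕ} : q ∈ touched m ν f i k ↔ q.2 < m q.1 ∧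
      Apart (ν i k) (ν i (k + 1)) (ν q.1 q.2) (ν q.1 (q.2 + 1)) ∧
      Touch (f (ν i k)) (f (ν i (k + 1))) (f (ν q.1 q.2)) (f (ν q.1 (q.2 + 1))) := by
  simp [touched]

/-- The point with parameter `t` on the polygonal path with the given nodes. -/
def poly (g : ℕ → Pl) (t : ℝ) : Pl := pt (g ⌊t⌋₊) (g (⌊t⌋₊ + 1)) (t - ⌊t⌋₊)

lemma poly_eq (g : ℕ → Pl) {k : ℕ} {t : ℝ} (h1 : k ≤ t) (h2 : t ≤ k + 1) :
    poly g t = pt (g k) (g (k + 1)) (t - k) := by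
  rcases h2.eq_or_lt with rfl | h2
  · have : ⌊(k : ℝ) + 1⌋₊ = k + 1 := by exact_mod_cast Nat.floor_natCast (k + 1)
    simp [poly, this]
  · have : ⌊t⌋₊ = k := (Nat.floor_eq_iff ((Nat.cast_nonneg k).trans h1)).2 ⟨h1, h2⟩
    simp [poly, this]

lemma poly_nat (g : ℕ → Pl) (k : ℕ) : poly g k = g k := by
  rw [poly_eq g le_rfl (by linarith)]; simp

lemma Net.node_ne {V ι Λ : Type*} {u v : ι → V} {m : ι → ℕ} {e : V → Λ} {ν : ι → ℕ → Λ}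
    (hn : Net u v m e ν) {i : ι} {k : ℕ} (hk : k < m i) : ν i k ≠ ν i (k + 1) := by
  intro h
  rcases Nat.eq_zero_or_pos k with rfl | h0
  · rcases Nat.eq_or_lt_of_le hk with h1 | h1
    · have := h1 ▸ hn.right i
      simp only [Nat.succ_eq_add_one] at this
      rw [hn.left, this] at h
      exact hn.ne i (hn.inj h)
    · have := (hn.inner i 1 i 0 (by lia) h1 (by lia) h.symm).2
      lia
  · have := (hn.inner i k i (k + 1) h0 hk hk h).2
    lia

/-- Realizing a covered graph along a system of polygonal paths. -/
theorem realize {V ι Λ : Type*} [Fintype V] [Fintype ι] [Fintype Λ] {Γ : SimpleGraph V}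
    {u v : ι → V} {N m : ι → ℕ} {vert : ι → ℕ → V} {e : V → Λ} {ν : ι → ℕ → Λ}
    (hc : Chains Γ u v N vert) (hn : Net u v m e ν) (f : Λ → Pl)
    (hsame : ∀ i, ∀ k < m i, ∀ i', ∀ k' < m i',
      s(ν i k, ν i (k + 1)) = s(ν i' k', ν i' (k' + 1)) → i = i' ∧ k = k')
    (hN : ∀ i, ∑ k ∈ Finset.range (m i), max 1 (touched m ν f i k).card ≤ N i) :
    GeomOnePlanar Γ := by
  classical
  obtain ⟨f, hf, hN⟩ : ∃ f : Λ → Pl, GP univ f ∧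
      ∀ i, ∑ k ∈ Finset.range (m i), max 1 (touched m ν f i k).card ≤ N i := by
    obtain ⟨f', hf', ht⟩ := exists_GP_stable f
    refine ⟨f', hf', fun i => le_trans (Finset.sum_le_sum fun k _ => ?_) (hN i)⟩
    refine max_le_max le_rfl (Finset.card_le_card fun q hq => ?_)
    rw [mem_touched] at hq ⊢
    exact ⟨hq.1, hq.2.1, ht _ _ _ _ hq.2.2⟩
  have hinj : Function.Injective f := fun a b h => hf.inj trivial trivial h
  -- crossing parameters
  have hpar : ∀ i k q, ∃ τ : ℝ, k < m i → q ∈ touched m ν f i k → 0 < τ ∧ τ < 1 ∧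
      ∀ s, pt (f (ν i k)) (f (ν i (k + 1))) s ∈
        segment ℝ (f (ν q.1 q.2)) (f (ν q.1 (q.2 + 1))) → 0 ≤ s → s ≤ 1 → s = τ := by
    intro i k q
    by_cases h : k < m i ∧ q ∈ touched m ν f i k
    · obtain ⟨hk, hq⟩ := h
      obtain ⟨hq1, hA, z, hz1, hz2⟩ := mem_touched.1 hq
      obtain ⟨a1, a2, a3, a4⟩ := hA
      have hp := hf.mem_oseg a1 a3 a4 a2 (hn.node_ne hq1) hz1 hz2
      obtain ⟨τ, h0, h1, rfl⟩ := mem_oseg.1 hp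
      refine ⟨τ, fun _ _ => ⟨h0, h1, fun s hs hs0 hs1 => ?_⟩⟩
      refine pt_inj (hinj.ne (hn.node_ne hk)) ?_
      exact seg_inter_subsingleton (hf.col _ trivial _ trivial _ trivial (hn.node_ne hk) a1 a3)
        (hinj.ne (hn.node_ne hq1)) ⟨pt_mem_seg _ _ hs0 hs1, hs⟩ ⟨hz1, hz2⟩
    · exact ⟨0, fun h1 h2 => absurd ⟨h1, h2⟩ h⟩
  choose par hpar using hpar
  let Z : ι → Finset ℝ := fun i => (Finset.range (m i)).biUnion fun k =>
    (touched m ν f i k).image fun q => k + par i k q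
  have hZ : ∀ i z, z ∈ Z i ↔ ∃ k < m i, ∃ q ∈ touched m ν f i k, (k : ℝ) + par i k q = z := by
    intro i z; simp [Z]
  have hcut : ∀ i, Cut (Z i) 0 (m i) (N i) {t | ∃ k : ℕ, k ≤ m i ∧ t = k} := by
    intro i
    refine exists_cut (hn.pos i) (fun k hk => ?_) (fun k hk => ?_) (hN i)
    · obtain ⟨k', hk', q, hq, h⟩ := (hZ i _).1 hk
      obtain ⟨h0, h1, -⟩ := hpar i k' q hk' hq
      have h2 : (k' : ℝ) < k := by linarith
      have h3 : (k : ℝ) < (k' + 1 : ℕ) := by push_cast; linarith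
      have := Nat.cast_lt.1 h2; have := Nat.cast_lt.1 h3
      lia
    · refine le_trans (Finset.card_le_card (t := (touched m ν f i k).image
        fun q => k + par i k q) fun z hz => ?_) Finset.card_image_le
      obtain ⟨hz, h4, h5⟩ := Finset.mem_filter.1 hz
      obtain ⟨k', hk', q, hq, rfl⟩ := (hZ i _).1 hz
      obtain ⟨h0, h1, -⟩ := hpar i k' q hk' hq
      have h2 : (k' : ℝ) < (k + 1 : ℕ) := by push_cast; linarith
      have h3 : (k : ℝ) < (k' + 1 : ℕ) := by push_cast; linarith
      have := Nat.cast_lt.1 h2; have := Nat.cast_lt.1 h3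
      obtain rfl : k = k' := by lia
      exact Finset.mem_image_of_mem _ hq
  choose S S0 SN Sm SZ Ss SI using hcut
  have Smono : ∀ i K K', K ≤ K' → K' ≤ N i → S i K ≤ S i K' := by
    intro i K K' h
    induction K', h using Nat.le_induction with
    | base => exact fun _ => le_rfl
    | succ K' _ ih => exact fun h => (ih (by lia)).trans (Sm i K' h).le
  have Sstrict : ∀ i K K', K < K' → K' ≤ N i → S i K < S i K' := fun i K K' h h' =>
    (Sm i K (by lia)).trans_le (Smono i _ _ h h')
  -- the unit interval of an elementary interval
  have hunit : ∀ i, ∀ K < N i, ∃ k < m i, (k : ℝ) ≤ S i K ∧ S i (K + 1) ≤ k + 1 := by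
    intro i K hK
    have hS0 : 0 ≤ S i K := S0 i ▸ Smono i 0 K (by lia) hK.le
    have hSm : S i K < m i := SN i ▸ Sstrict i K (N i) hK le_rfl
    refine ⟨⌊S i K⌋₊, (Nat.floor_lt hS0).2 hSm, Nat.floor_le hS0, ?_⟩
    by_contra! hlt
    have hle : ⌊S i K⌋₊ + 1 ≤ m i := (Nat.floor_lt hS0).2 hSm
    obtain ⟨K', hK', hK2⟩ := SI i ((⌊S i K⌋₊ + 1 : ℕ) : ℝ) ⟨_, hle, rfl⟩
    have h1 : S i K < S i K' := by rw [hK2]; push_cast; exact Nat.lt_floor_add_one _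
    have h2 : S i K' < S i (K + 1) := by rw [hK2]; push_cast; exact hlt
    rcases Nat.lt_or_ge K K' with h | h
    · exact absurd (Smono i (K + 1) K' h hK') (not_le.2 h2)
    · exact absurd (Smono i K' K h hK.le) (not_le.2 h1)
  obtain ⟨pos, hpos⟩ : ∃ pos : V → Pl, ∀ i, ∀ K ≤ N i,
      pos (vert i K) = poly (fun k => f (ν i k)) (S i K) := by
    refine ⟨fun w => if h : ∃ i K, 0 < K ∧ K < N i ∧ vert i K = w then
      poly (fun k => f (ν h.choose k)) (S h.choose h.choose_spec.choose) else f (e w), ?_⟩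
    intro i K hK
    by_cases h : ∃ i' K', 0 < K' ∧ K' < N i' ∧ vert i' K' = vert i K
    · simp only [dif_pos h]
      obtain ⟨h1, h2, h3⟩ := h.choose_spec.choose_spec
      obtain ⟨h4, h5⟩ := hc.inner _ _ _ _ h1 h2 hK h3
      rw [h5, h4]
    · simp only [dif_neg h]
      have hor : K = 0 ∨ K = N i := by
        by_contra! hcon
        exact h ⟨i, K, by lia, by lia, rfl⟩
      rcases hor with rfl | rfl
      · have := poly_nat (fun k => f (ν i k)) 0
        simp only [Nat.cast_zero] at this
        rw [S0, this, hc.left, hn.left]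
      · rw [SN, poly_nat, hc.right, hn.right]
  -- equality of nodes gives equality of vertices
  have hnode : ∀ i i' k k' K K', k ≤ m i → k' ≤ m i' → K ≤ N i → K' ≤ N i' → S i K = k →
      S i' K' = k' → ν i k = ν i' k' → vert i K = vert i' K' := by
    intro i i' k k' K K' hk hk' hK hK' h1 h2 h
    have hSinj : ∀ i K K', K ≤ N i → K' ≤ N i → S i K = S i K' → K = K' := by
      intro i K K' hK hK' h
      rcases lt_trichotomy K K' with h' | h' | h'
      · exact absurd h (Sstrict i K K' h' hK').ne
      · exact h'
      · exact absurd h (Sstrict i K' K h' hK).ne'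
    have hends : ∀ i (k : ℕ) K, K ≤ N i → S i K = k → (k = 0 → K = 0) ∧ (k = m i → K = N i) := by
      intro i k K hK h
      constructor
      · rintro rfl
        exact hSinj i K 0 hK (by lia) (by rw [h, S0]; simp)
      · rintro rfl
        exact hSinj i K _ hK le_rfl (by rw [h, SN])
    by_cases hin : 0 < k ∧ k < m i
    · obtain ⟨rfl, rfl⟩ := hn.inner i k i' k' hin.1 hin.2 hk' h
      rw [hSinj i K K' hK hK' (h1.trans h2.symm)]
    · by_cases hin' : 0 < k' ∧ k' < m i'
      · obtain ⟨rfl, rfl⟩ := hn.inner i' k' i k hin'.1 hin'.2 hk h.symm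
        rw [hSinj i' K K' hK hK' (h1.trans h2.symm)]
      · have key : ∀ i k K, k ≤ m i → K ≤ N i → S i K = k → ¬ (0 < k ∧ k < m i) →
            ν i k = e (vert i K) := by
          intro i k K hk hK h hin
          rcases (show k = 0 ∨ k = m i by lia) with hk0 | hk0
          · rw [(hends i k K hK h).1 hk0, hk0, hn.left, hc.left]
          · rw [(hends i k K hK h).2 hk0, hk0, hn.right, hc.right]
        rw [key i k K hk hK h1 hin, key i' k' K' hk' hK' h2 hin'] at h
        exact hn.inj h
  -- points of elementary segments
  have hseg : ∀ i K, K < N i → ∀ k : ℕ, (k : ℝ) ≤ S i K → S i (K + 1) ≤ k + 1 → ∀ z,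
      z ∈ segment ℝ (pos (vert i K)) (pos (vert i (K + 1))) →
      ∃ τ : ℝ, 0 ≤ τ ∧ τ ≤ 1 ∧ S i K ≤ k + τ ∧ k + τ ≤ S i (K + 1) ∧
        z = pt (f (ν i k)) (f (ν i (k + 1))) τ := by
    intro i K hK k h1 h2 z hz
    have hlt := Sm i K hK
    rw [hpos i K hK.le, hpos i (K + 1) hK, poly_eq _ h1 (by linarith),
      poly_eq _ (by linarith) h2] at hz
    obtain ⟨t, ht0, ht1, rfl⟩ := mem_seg.1 hz
    rw [pt_pt]
    refine ⟨_, ?_, ?_, ?_, ?_, rfl⟩ <;> nlinarith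
  -- a touching of elementary segments is a crossing of pieces
  have key : ∀ i, ∀ K < N i, ∀ i', ∀ K' < N i', ∀ k < m i, (k : ℝ) ≤ S i K →
      S i (K + 1) ≤ k + 1 → ∀ k' < m i', (k' : ℝ) ≤ S i' K' → S i' (K' + 1) ≤ k' + 1 →
      Apart (vert i K) (vert i (K + 1)) (vert i' K') (vert i' (K' + 1)) →
      ∀ τ τ' : ℝ, 0 ≤ τ → τ ≤ 1 → S i K ≤ k + τ → k + τ ≤ S i (K + 1) →
      0 ≤ τ' → τ' ≤ 1 → S i' K' ≤ k' + τ' → k' + τ' ≤ S i' (K' + 1) →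
      pt (f (ν i k)) (f (ν i (k + 1))) τ = pt (f (ν i' k')) (f (ν i' (k' + 1))) τ' →
      Apart (ν i k) (ν i (k + 1)) (ν i' k') (ν i' (k' + 1)) ∧ (k : ℝ) + τ ∈ Z i ∧
        S i K < k + τ ∧ k + τ < S i (K + 1) := by
    intro i K hK i' K' hK' k hk h1 h2 k' hk' h1' h2' hA τ τ' t0 t1 t2 t3 t0' t1' t2' t3' heq
    have hlt := Sm i K hK
    have hlt' := Sm i' K' hK'
    -- a shared node leads to a shared vertex
    have hshare : ∀ a a' : ℕ, a ≤ m i → a' ≤ m i' → (k : ℝ) + τ = a → (k' : ℝ) + τ' = a' →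
        ν i a = ν i' a' → False := by
      intro a a' ha ha' hta hta' hν
      have hvert : ∀ i K a, K < N i → a ≤ m i → S i K ≤ (a : ℝ) → (a : ℝ) ≤ S i (K + 1) →
          ∃ L ≤ N i, S i L = a ∧ (L = K ∨ L = K + 1) := by
        intro i K a hK ha h1 h2
        obtain ⟨L, hL, hLa⟩ := SI i a ⟨a, ha, rfl⟩
        refine ⟨L, hL, hLa, ?_⟩
        by_contra! hne
        rcases Nat.lt_or_ge L K with h | h
        · exact absurd (Sstrict i L K h hK.le) (by rw [hLa]; exact not_lt.2 h1)
        · exact absurd (Sstrict i (K + 1) L (by lia) hL) (by rw [hLa]; exact not_lt.2 h2)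
      obtain ⟨L, hL, hLa, hLK⟩ := hvert i K a hK ha (hta ▸ t2) (hta ▸ t3)
      obtain ⟨L', hL', hLa', hLK'⟩ := hvert i' K' a' hK' ha' (hta' ▸ t2') (hta' ▸ t3')
      have := hnode i i' a a' L L' ha ha' hL hL' hLa hLa' hν
      obtain ⟨a1, a2, a3, a4⟩ := hA
      rcases hLK with rfl | rfl <;> rcases hLK' with rfl | rfl <;> contradiction
    have hApart : Apart (ν i k) (ν i (k + 1)) (ν i' k') (ν i' (k' + 1)) := by
      by_contra hnA
      by_cases hs : s(ν i k, ν i (k + 1)) = s(ν i' k', ν i' (k' + 1))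
      · obtain ⟨rfl, rfl⟩ := hsame i k hk i' k' hk' hs
        have hττ := pt_inj (hinj.ne (hn.node_ne hk)) heq
        subst hττ
        rcases lt_trichotomy K K' with h | rfl | h
        · have e1 := Smono i (K + 1) K' h hK'.le
          have : K + 1 = K' := by
            by_contra hne
            have := Sstrict i (K + 1) K' (by lia) hK'.le
            linarith
          exact hA.2.2.1 (by rw [this])
        · exact hA.1 rfl
        · have e1 := Smono i (K' + 1) K h hK.le
          have : K' + 1 = K := by
            by_contra hne
            have := Sstrict i (K' + 1) K (by lia) hK.le
            linarith
          exact hA.2.1 (by rw [this])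
      · have hm1 := pt_mem_seg (f (ν i k)) (f (ν i (k + 1))) t0 t1
        have hm2 := pt_mem_seg (f (ν i' k')) (f (ν i' (k' + 1))) t0' t1'
        rw [← heq] at hm2
        have hn1 := hn.node_ne hk
        have hn2 := hn.node_ne hk'
        have zero : ∀ a b τ, a ≠ b → pt (f a) (f b) τ = f a → τ = 0 := fun a b τ hab h =>
          pt_inj (hinj.ne hab) (h.trans (pt_zero _ _).symm)
        have one : ∀ a b τ, a ≠ b → pt (f a) (f b) τ = f b → τ = 1 := fun a b τ hab h =>
          pt_inj (hinj.ne hab) (h.trans (pt_one _ _).symm)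
        have share : ∀ a b c z, a ≠ b → a ≠ c → b ≠ c → z ∈ segment ℝ (f a) (f b) →
            z ∈ segment ℝ (f a) (f c) → z = f a := fun a b c z hab hac hbc =>
          seg_inter_of_common (hf.col a trivial b trivial c trivial hab hac hbc)
        simp only [Apart, not_and_or, not_not] at hnA
        rw [Sym2.eq_iff, not_or, not_and_or, not_and_or] at hs
        rcases hnA with h | h | h | h
        · have hz := share (ν i k) (ν i (k + 1)) (ν i' (k' + 1)) _ hn1 (h ▸ hn2) (by tauto) hm1
            (h ▸ hm2)
          have e1 := zero _ _ _ hn1 hz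
          have e2 := zero _ _ _ hn2 (by rw [← heq, hz, h])
          exact hshare k k' hk.le hk'.le (by simp [e1]) (by simp [e2]) h
        · rw [segment_symm] at hm2
          have hz := share (ν i k) (ν i (k + 1)) (ν i' k') _ hn1 (h ▸ hn2.symm) (by tauto) hm1
            (h ▸ hm2)
          have e1 := zero _ _ _ hn1 hz
          have e2 := one _ _ _ hn2 (by rw [← heq, hz, h])
          exact hshare k (k' + 1) hk.le hk' (by simp [e1]) (by simp [e2]) h
        · rw [segment_symm] at hm1
          have hz := share (ν i (k + 1)) (ν i k) (ν i' (k' + 1)) _ hn1.symm (h ▸ hn2) (by tauto)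
            hm1 (h ▸ hm2)
          have e1 := one _ _ _ hn1 hz
          have e2 := zero _ _ _ hn2 (by rw [← heq, hz, h])
          exact hshare (k + 1) k' hk hk'.le (by simp [e1]) (by simp [e2]) h
        · rw [segment_symm] at hm1 hm2
          have hz := share (ν i (k + 1)) (ν i k) (ν i' k') _ hn1.symm (h ▸ hn2.symm) (by tauto)
            hm1 (h ▸ hm2)
          have e1 := one _ _ _ hn1 hz
          have e2 := one _ _ _ hn2 (by rw [← heq, hz, h])
          exact hshare (k + 1) (k' + 1) hk hk' (by simp [e1]) (by simp [e2]) h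
    have hm2 := pt_mem_seg (f (ν i' k')) (f (ν i' (k' + 1))) t0' t1'
    rw [← heq] at hm2
    have hq : (⟨i', k'⟩ : (_ : ι) × ℕ) ∈ touched m ν f i k :=
      mem_touched.2 ⟨hk', hApart, _, pt_mem_seg _ _ t0 t1, hm2⟩
    have hZτ : (k : ℝ) + τ ∈ Z i :=
      (hZ i _).2 ⟨k, hk, _, hq, by rw [(hpar i k _ hk hq).2.2 τ hm2 t0 t1]⟩
    refine ⟨hApart, hZτ, lt_of_le_of_ne t2 fun h => SZ i K hK.le (h ▸ hZτ),
      lt_of_le_of_ne t3 fun h => SZ i (K + 1) hK (h ▸ hZτ)⟩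
  have main : ∀ i, ∀ K < N i, ∀ i₁, ∀ K₁ < N i₁, ∀ i₂, ∀ K₂ < N i₂,
      Apart (vert i K) (vert i (K + 1)) (vert i₁ K₁) (vert i₁ (K₁ + 1)) →
      Apart (vert i K) (vert i (K + 1)) (vert i₂ K₂) (vert i₂ (K₂ + 1)) →
      Touch (pos (vert i K)) (pos (vert i (K + 1))) (pos (vert i₁ K₁)) (pos (vert i₁ (K₁ + 1))) →
      Touch (pos (vert i K)) (pos (vert i (K + 1))) (pos (vert i₂ K₂)) (pos (vert i₂ (K₂ + 1))) →
      i₁ = i₂ ∧ K₁ = K₂ := by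
    intro i K hK i₁ K₁ hK₁ i₂ K₂ hK₂ hA₁ hA₂ ⟨z₁, hz₁, hz₁'⟩ ⟨z₂, hz₂, hz₂'⟩
    obtain ⟨k, hk, k1, k2⟩ := hunit i K hK
    obtain ⟨l₁, hl₁, l1, l2⟩ := hunit i₁ K₁ hK₁
    obtain ⟨l₂, hl₂, l3, l4⟩ := hunit i₂ K₂ hK₂
    obtain ⟨τ₁, a0, a1, a2, a3, rfl⟩ := hseg i K hK k k1 k2 _ hz₁
    obtain ⟨τ₂, b0, b1, b2, b3, rfl⟩ := hseg i K hK k k1 k2 _ hz₂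
    obtain ⟨σ₁, c0, c1, c2, c3, e1⟩ := hseg i₁ K₁ hK₁ l₁ l1 l2 _ hz₁'
    obtain ⟨σ₂, d0, d1, d2, d3, e2⟩ := hseg i₂ K₂ hK₂ l₂ l3 l4 _ hz₂'
    obtain ⟨A1, Z1, s1, s2⟩ := key i K hK i₁ K₁ hK₁ k hk k1 k2 l₁ hl₁ l1 l2 hA₁ τ₁ σ₁ a0 a1 a2 a3
      c0 c1 c2 c3 e1
    obtain ⟨A2, Z2, s3, s4⟩ := key i K hK i₂ K₂ hK₂ k hk k1 k2 l₂ hl₂ l3 l4 hA₂ τ₂ σ₂ b0 b1 b2 b3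
      d0 d1 d2 d3 e2
    have hτ : τ₁ = τ₂ := by
      have := Ss i K hK _ Z1 _ Z2 s1 s2 s3 s4
      linarith
    subst hτ
    have hmem := pt_mem_seg (f (ν i k)) (f (ν i (k + 1))) a0 a1
    have hmem1 := e1 ▸ pt_mem_seg (f (ν i₁ l₁)) (f (ν i₁ (l₁ + 1))) c0 c1
    have hmem2 := e2 ▸ pt_mem_seg (f (ν i₂ l₂)) (f (ν i₂ (l₂ + 1))) d0 d1
    have hn0 := hn.node_ne hk
    have hn1 := hn.node_ne hl₁
    have hn2 := hn.node_ne hl₂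
    obtain ⟨p1, p2, p3, p4⟩ := A1
    obtain ⟨q1, q2, q3, q4⟩ := A2
    have hs : s(ν i₁ l₁, ν i₁ (l₁ + 1)) = s(ν i₂ l₂, ν i₂ (l₂ + 1)) := by
      by_contra hne
      rw [Sym2.eq_iff, not_or, not_and_or, not_and_or] at hne
      have share : ∀ a b c z, a ≠ b → a ≠ c → b ≠ c → ν i k ≠ a → ν i (k + 1) ≠ a →
          z ∈ segment ℝ (f (ν i k)) (f (ν i (k + 1))) → z ∈ segment ℝ (f a) (f b) →
          z ∈ segment ℝ (f a) (f c) → False := by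
        intro a b c z hab hac hbc h1 h2 h3 h4 h5
        have := seg_inter_of_common (hf.col a trivial b trivial c trivial hab hac hbc) h4 h5
        subst this
        exact hf.col _ trivial _ trivial _ trivial hn0 h1 h2 (crs_eq_zero_of_mem h3)
      by_cases g1 : ν i₁ l₁ = ν i₂ l₂
      · exact share _ _ _ _ hn1 (g1 ▸ hn2) (by tauto) p1 p3 hmem hmem1 (g1 ▸ hmem2)
      by_cases g2 : ν i₁ l₁ = ν i₂ (l₂ + 1)
      · rw [segment_symm] at hmem2
        exact share _ _ _ _ hn1 (g2 ▸ hn2.symm) (by tauto) p1 p3 hmem hmem1 (g2 ▸ hmem2)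
      by_cases g3 : ν i₁ (l₁ + 1) = ν i₂ l₂
      · rw [segment_symm] at hmem1
        exact share _ _ _ _ hn1.symm (g3 ▸ hn2) (by tauto) p2 p4 hmem hmem1 (g3 ▸ hmem2)
      by_cases g4 : ν i₁ (l₁ + 1) = ν i₂ (l₂ + 1)
      · rw [segment_symm] at hmem1 hmem2
        exact share _ _ _ _ hn1.symm (g4 ▸ hn2.symm) (by tauto) p2 p4 hmem hmem1 (g4 ▸ hmem2)
      refine hf.conc _ trivial _ trivial _ trivial _ trivial _ trivial _ trivial ?_ _
        hmem hmem1 hmem2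
      simp only [List.nodup_cons, List.mem_cons, List.not_mem_nil, not_or, or_false,
        not_false_eq_true, List.nodup_nil, and_true]
      exact ⟨⟨hn0, p1, p2, q1, q2⟩, ⟨p3, p4, q3, q4⟩, ⟨hn1, g1, g2⟩, ⟨g3, g4⟩, hn2⟩
    obtain ⟨rfl, rfl⟩ := hsame _ _ hl₁ _ _ hl₂ hs
    refine ⟨rfl, ?_⟩
    have hσ := pt_inj (hinj.ne hn1) (e1.symm.trans e2)
    subst hσ
    have flip : ∀ {a b c d : V}, Apart a b c d → Apart c d a b := fun h =>
      ⟨h.1.symm, h.2.2.1.symm, h.2.1.symm, h.2.2.2.symm⟩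
    obtain ⟨-, -, r1, r2⟩ := key i₁ K₁ hK₁ i K hK l₁ hl₁ l1 l2 k hk k1 k2 (flip hA₁) σ₁ τ₁ c0 c1
      c2 c3 a0 a1 a2 a3 e1.symm
    obtain ⟨-, -, r3, r4⟩ := key i₁ K₂ hK₂ i K hK l₁ hl₁ l3 l4 k hk k1 k2 (flip hA₂) σ₁ τ₁ c0 c1
      d2 d3 a0 a1 a2 a3 e1.symm
    rcases lt_trichotomy K₁ K₂ with h | h | h
    · have := Smono i₁ _ _ h hK₂.le; linarith
    · exact h
    · have := Smono i₁ _ _ h hK₁.le; linarith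
  refine geomOnePlanar_of_touchOne (pos := pos) ?_
  intro a b hab c d c' d' hcd hcd' hA hA' hT hT'
  obtain ⟨i, K, hK, h⟩ := hc.cover a b hab
  obtain ⟨i₁, K₁, hK₁, h₁⟩ := hc.cover c d hcd
  obtain ⟨i₂, K₂, hK₂, h₂⟩ := hc.cover c' d' hcd'
  have e : ∀ {a b c d a' b' c' d' : V}, s(a, b) = s(a', b') → s(c, d) = s(c', d') →
      Apart a b c d → Touch (pos a) (pos b) (pos c) (pos d) →
      Apart a' b' c' d' ∧ Touch (pos a') (pos b') (pos c') (pos d') := by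
    intro a b c d a' b' c' d' e1 e2 h1 h2
    unfold Apart at h1 ⊢
    rcases Sym2.eq_iff.1 e1 with ⟨rfl, rfl⟩ | ⟨rfl, rfl⟩ <;>
    rcases Sym2.eq_iff.1 e2 with ⟨rfl, rfl⟩ | ⟨rfl, rfl⟩
    · exact ⟨h1, h2⟩
    · exact ⟨by tauto, touch_swap_right.1 h2⟩
    · exact ⟨by tauto, touch_swap_left.1 h2⟩
    · exact ⟨by tauto, touch_swap_left.1 (touch_swap_right.1 h2)⟩
  obtain ⟨x1, x2⟩ := e h h₁ hA hT
  obtain ⟨x3, x4⟩ := e h h₂ hA' hT'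
  obtain ⟨rfl, rfl⟩ := main i K hK i₁ K₁ hK₁ i₂ K₂ hK₂ x1 x3 x2 x4
  rw [h₁, h₂]

end OnePlanar

namespace OnePlanar

lemma exists_param_avoiding {S : Set ℝ} (hS : S.Finite) : ∃ t : ℝ, 0 < t ∧ t < 1 ∧ t ∉ S := by
  obtain ⟨t, ht, hS'⟩ := ((Set.Ioo_infinite (zero_lt_one (α := ℝ))).sdiff hS).nonempty
  exact ⟨t, ht.1, ht.2, hS'⟩

set_option maxHeartbeats 1000000 in
/-- Realization with some paths drawn as single segments, where parallel ones are allowed. -/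
theorem realize_direct {V ι : Type*} [Fintype V] [Fintype ι] {Γ : SimpleGraph V}
    {u v : ι → V} {N : ι → ℕ} {vert : ι → ℕ → V} (hc : Chains Γ u v N vert) (D : Finset ι)
    {Λ : Type*} [Fintype Λ] {m : ι → ℕ} {e : V → Λ} {ν : ι → ℕ → Λ}
    (hn : Net u v m e ν) (f : Λ → Pl) (hD : ∀ i ∈ D, m i = 1)
    (hsame : ∀ i, ∀ k < m i, ∀ i', ∀ k' < m i',
      s(ν i k, ν i (k + 1)) = s(ν i' k', ν i' (k' + 1)) → (i = i' ∧ k = k') ∨ i ∈ D ∨ i' ∈ D)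
    (hN : ∀ i ∉ D, ∑ k ∈ Finset.range (m i), max 1 (touched m ν f i k).card ≤ N i)
    (hND : ∀ i ∈ D, 2 + (touched m ν f i 0).card ≤ N i) :
    GeomOnePlanar Γ := by
  classical
  induction hcard : D.card generalizing D Λ m with
  | zero =>
    obtain rfl := Finset.card_eq_zero.1 hcard
    exact realize hc hn f (fun i k hk i' k' hk' h => by simpa using hsame i k hk i' k' hk' h)
      (fun i => hN i (by simp))
  | succ n ih =>
    obtain ⟨i₀, hi₀⟩ : D.Nonempty := Finset.card_pos.1 (by lia)
    obtain ⟨g, hg, hgt⟩ := exists_GP_stable f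
    have hinj : Function.Injective g := fun a b h => hg.inj trivial trivial h
    have hsub : ∀ i k, touched m ν g i k ⊆ touched m ν f i k := fun i k q hq => by
      rw [mem_touched] at hq ⊢
      exact ⟨hq.1, hq.2.1, hgt _ _ _ _ hq.2.2⟩
    have hm₀ := hD i₀ hi₀
    have hν0 : ν i₀ 0 = e (u i₀) := hn.left i₀
    have hν1 : ν i₀ 1 = e (v i₀) := hm₀ ▸ hn.right i₀
    have huv : e (u i₀) ≠ e (v i₀) := hn.inj.ne (hn.ne i₀)
    -- a point of the segment that is no crossing point
    obtain ⟨t, t0, t1, ht⟩ : ∃ t : ℝ, 0 < t ∧ t < 1 ∧ ∀ q ∈ touched m ν g i₀ 0,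
        pt (g (e (u i₀))) (g (e (v i₀))) t ∉
          segment ℝ (g (ν q.1 q.2)) (g (ν q.1 (q.2 + 1))) := by
      obtain ⟨t, t0, t1, ht⟩ := exists_param_avoiding (S := ⋃ q ∈ touched m ν g i₀ 0,
          {t | pt (g (e (u i₀))) (g (e (v i₀))) t ∈ segment ℝ (g (ν q.1 q.2)) (g (ν q.1 (q.2 + 1)))})
        (by
          refine Set.Finite.biUnion (Finset.finite_toSet _) fun q hq => Set.Subsingleton.finite ?_
          obtain ⟨hq1, ⟨a1, a2, a3, a4⟩, -⟩ := mem_touched.1 hq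
          rw [hν0] at a1 a2
          rw [zero_add, hν1] at a3 a4
          intro s hs s' hs'
          refine pt_inj (hinj.ne huv) ?_
          exact eq_of_crs_zero (a := g (e (u i₀))) (b := g (e (v i₀))) (by rw [crs_pt]; simp)
            (by rw [crs_pt]; simp) (hinj.ne (hn.node_ne hq1)) (crs_eq_zero_of_mem hs)
            (crs_eq_zero_of_mem hs')
            (Or.inl (hg.col _ trivial _ trivial _ trivial huv a1 a3)))
      exact ⟨t, t0, t1, fun q hq h => ht (mem_biUnion hq h)⟩
    set x := pt (g (e (u i₀))) (g (e (v i₀))) t with hx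
    let m' : ι → ℕ := Function.update m i₀ 2
    let ν' : ι → ℕ → Option Λ := fun i k => if i = i₀ then
      (if k = 0 then some (ν i₀ 0) else if k = 1 then none else some (ν i₀ 1)) else some (ν i k)
    let f' : Option Λ → Pl := fun a => a.elim x g
    have m'0 : m' i₀ = 2 := by simp [m']
    have m'ne : ∀ i, i ≠ i₀ → m' i = m i := fun i hi => by simp [m', hi]
    have ν'ne : ∀ i, i ≠ i₀ → ∀ k, ν' i k = some (ν i k) := fun i hi k => by simp [ν', hi]
    have ν'0 : ν' i₀ 0 = some (e (u i₀)) := by simp [ν', hν0]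
    have ν'1 : ν' i₀ 1 = none := by simp [ν']
    have ν'2 : ν' i₀ 2 = some (e (v i₀)) := by simp [ν', hν1]
    -- touching one half means touching the whole
    have half : ∀ i k, i ≠ i₀ → k < m i → ∀ j < 2,
        Apart (ν' i₀ j) (ν' i₀ (j + 1)) (ν' i k) (ν' i (k + 1)) →
        ∀ z, z ∈ segment ℝ (f' (ν' i₀ j)) (f' (ν' i₀ (j + 1))) →
          z ∈ segment ℝ (f' (ν' i k)) (f' (ν' i (k + 1))) →
        Apart (ν i₀ 0) (ν i₀ 1) (ν i k) (ν i (k + 1)) ∧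
          z ∈ segment ℝ (g (ν i₀ 0)) (g (ν i₀ 1)) ∧
          z ∈ segment ℝ (g (ν i k)) (g (ν i (k + 1))) ∧
          (j = 0 → z ∈ segment ℝ (g (ν i₀ 0)) x) ∧ (j = 1 → z ∈ segment ℝ x (g (ν i₀ 1))) := by
      intro i k hi hk j hj hA z hz hz'
      rw [ν'ne i hi, ν'ne i hi] at hA hz'
      have hz' : z ∈ segment ℝ (g (ν i k)) (g (ν i (k + 1))) := hz'
      have hnk := hn.node_ne hk
      have sub1 : segment ℝ (g (ν i₀ 0)) x ⊆ segment ℝ (g (ν i₀ 0)) (g (ν i₀ 1)) := by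
        refine (convex_segment _ _).segment_subset (left_mem_segment _ _ _) ?_
        rw [hx, hν0, hν1]; exact pt_mem_seg _ _ t0.le t1.le
      have sub2 : segment ℝ x (g (ν i₀ 1)) ⊆ segment ℝ (g (ν i₀ 0)) (g (ν i₀ 1)) := by
        refine (convex_segment _ _).segment_subset ?_ (right_mem_segment _ _ _)
        rw [hx, hν0, hν1]; exact pt_mem_seg _ _ t0.le t1.le
      have huv' : ν i₀ 0 ≠ ν i₀ 1 := by rw [hν0, hν1]; exact huv
      -- a segment at `b` meets the half of `ab` at `a` only if it is `ab` itself
      have noend : ∀ a b c : Λ, a ≠ b → a ≠ c → b ≠ c → ∀ s : ℝ, 0 < s → s < 1 →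
          z ∈ segment ℝ (g a) (pt (g a) (g b) s) → z ∈ segment ℝ (g b) (g c) → False := by
        intro a b c hab hac hbc s s0 s1 h1 h2
        obtain ⟨r, r0, r1, rfl⟩ := mem_seg.1 h1
        have hr : pt (g a) (pt (g a) (g b) s) r = pt (g a) (g b) (r * s) := by
          have := pt_pt (g a) (g b) 0 s r
          simpa using this
        rw [hr] at h2
        have := seg_inter_of_common (hg.col b trivial a trivial c trivial hab.symm hbc hac)
          (segment_symm ℝ (g a) (g b) ▸ pt_mem_seg (g a) (g b) (by positivity) (by nlinarith)) h2
        have := pt_inj (hinj.ne hab) (this.trans (pt_one _ _).symm)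
        nlinarith
      interval_cases j
      · rw [zero_add, ν'0, ν'1] at hA hz
        rw [← hν0] at hA hz
        have hz : z ∈ segment ℝ (g (ν i₀ 0)) x := hz
        obtain ⟨a1, a2, -, -⟩ := hA
        have a1 : ν i₀ 0 ≠ ν i k := fun h => a1 (by rw [h])
        have a2 : ν i₀ 0 ≠ ν i (k + 1) := fun h => a2 (by rw [h])
        refine ⟨⟨a1, a2, ?_, ?_⟩, sub1 hz, hz', fun _ => hz, by simp⟩
        · intro h
          rw [hx, ← hν0, ← hν1] at hz
          exact noend _ _ _ huv' a2 (h ▸ hnk) t t0 t1 hz (h ▸ hz')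
        · intro h
          rw [hx, ← hν0, ← hν1] at hz
          rw [segment_symm, ← h] at hz'
          exact noend _ _ _ huv' a1 (h ▸ hnk.symm) t t0 t1 hz hz'
      · rw [ν'1, ν'2] at hA hz
        rw [← hν1] at hA hz
        have hz : z ∈ segment ℝ x (g (ν i₀ 1)) := hz
        obtain ⟨-, -, a3, a4⟩ := hA
        have a3 : ν i₀ 1 ≠ ν i k := fun h => a3 (by rw [h])
        have a4 : ν i₀ 1 ≠ ν i (k + 1) := fun h => a4 (by rw [h])
        refine ⟨⟨?_, ?_, a3, a4⟩, sub2 hz, hz', by simp, fun _ => hz⟩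
        · intro h
          rw [hx, ← hν0, ← hν1, pt_comm, segment_symm] at hz
          exact noend _ _ _ huv'.symm a4 (h ▸ hnk) (1 - t) (by linarith) (by linarith) hz (h ▸ hz')
        · intro h
          rw [hx, ← hν0, ← hν1, pt_comm, segment_symm] at hz
          rw [segment_symm, ← h] at hz'
          exact noend _ _ _ huv'.symm a3 (h ▸ hnk.symm) (1 - t) (by linarith) (by linarith) hz hz'
    have flip : ∀ {Λ : Type _} {a b c d : Λ}, Apart a b c d → Apart c d a b := fun h =>
      ⟨h.1.symm, h.2.2.1.symm, h.2.1.symm, h.2.2.2.symm⟩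
    -- the two halves are not touched by the same piece
    have notboth : ∀ i k, i ≠ i₀ → k < m i →
        Apart (ν' i₀ 0) (ν' i₀ 1) (ν' i k) (ν' i (k + 1)) →
        Touch (f' (ν' i₀ 0)) (f' (ν' i₀ 1)) (f' (ν' i k)) (f' (ν' i (k + 1))) →
        Apart (ν' i₀ 1) (ν' i₀ 2) (ν' i k) (ν' i (k + 1)) →
        Touch (f' (ν' i₀ 1)) (f' (ν' i₀ 2)) (f' (ν' i k)) (f' (ν' i (k + 1))) → False := by
      intro i k hi hk hA1 ⟨z, hz1, hz2⟩ hA2 ⟨w, hw1, hw2⟩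
      obtain ⟨b1, b2, b3, b4, -⟩ := half i k hi hk 0 (by lia) hA1 z hz1 hz2
      obtain ⟨-, c2, c3, -, c5⟩ := half i k hi hk 1 (by lia) hA2 w hw1 hw2
      have b4 := b4 rfl
      have c5 := c5 rfl
      have huv' : ν i₀ 0 ≠ ν i₀ 1 := by rw [hν0, hν1]; exact huv
      have hq : (⟨i, k⟩ : (_ : ι) × ℕ) ∈ touched m ν g i₀ 0 :=
        mem_touched.2 ⟨hk, b1, z, b2, b3⟩
      have hzw : z = w := seg_inter_subsingleton (hg.col _ trivial _ trivial _ trivial huv'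
        b1.1 b1.2.2.1) (hinj.ne (hn.node_ne hk)) ⟨b2, b3⟩ ⟨c2, c3⟩
      subst hzw
      have : z = x := by
        rw [hx, ← hν0, ← hν1] at b4 c5
        obtain ⟨r, r0, r1, h1⟩ := mem_seg.1 b4
        obtain ⟨s, s0, s1, h2⟩ := mem_seg.1 c5
        have e1 := pt_pt (g (ν i₀ 0)) (g (ν i₀ 1)) 0 t r
        have e2 := pt_pt (g (ν i₀ 0)) (g (ν i₀ 1)) t 1 s
        simp only [pt_zero, pt_one] at e1 e2
        have := pt_inj (hinj.ne huv') (e1.symm.trans (h1.symm.trans (h2.trans e2)))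
        have hr : r = 1 := by nlinarith
        rw [hx, ← hν0, ← hν1, h1, hr, pt_one]
      exact ht _ hq (this ▸ b3)
    have hne' : ∀ i, i ≠ i₀ → ∀ k < m i,
        (touched m' ν' f' i k).card ≤ (touched m ν f i k).card := by
      intro i hi k hk
      refine le_trans (Finset.card_le_card_of_injOn
        (fun q => ⟨q.1, if q.1 = i₀ then 0 else q.2⟩) (t := touched m ν g i k) ?_ ?_)
        (Finset.card_le_card (hsub i k))
      · rintro ⟨i', k'⟩ hq
        obtain ⟨h1, h2, h3⟩ := mem_touched.1 (Finset.mem_coe.1 hq)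
        rw [Finset.mem_coe, mem_touched]
        by_cases hi' : i' = i₀
        · subst hi'
          obtain ⟨z, hz1, hz2⟩ := h3
          simp only [m'0] at h1
          obtain ⟨b1, b2, b3, -⟩ := half i k hi hk k' h1 (flip h2) z hz2 hz1
          simp only [if_true]
          exact ⟨by lia, flip b1, z, b3, b2⟩
        · simp only [m'ne i' hi', ν'ne i' hi', ν'ne i hi, if_neg hi'] at h1 h2 h3 ⊢
          refine ⟨h1, ?_, h3⟩
          obtain ⟨a1, a2, a3, a4⟩ := h2
          exact ⟨fun h => a1 (by rw [h]), fun h => a2 (by rw [h]), fun h => a3 (by rw [h]),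
            fun h => a4 (by rw [h])⟩
      · rintro ⟨i', k'⟩ hq ⟨i'', k''⟩ hq' heq
        simp only [Sigma.mk.injEq, heq_eq_eq] at heq
        obtain ⟨rfl, heq⟩ := heq
        by_cases hi' : i' = i₀
        · subst hi'
          obtain ⟨h1, h2, h3⟩ := mem_touched.1 (Finset.mem_coe.1 hq)
          obtain ⟨h1', h2', h3'⟩ := mem_touched.1 (Finset.mem_coe.1 hq')
          simp only [m'0] at h1 h1'
          interval_cases k' <;> interval_cases k''
          · rfl
          · exact (notboth i k hi hk (flip h2) (touch_comm.1 h3) (flip h2') (touch_comm.1 h3')).elim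
          · exact (notboth i k hi hk (flip h2') (touch_comm.1 h3') (flip h2) (touch_comm.1 h3)).elim
          · rfl
        · simp only [if_neg hi'] at heq
          rw [heq]
    have hself : (touched m' ν' f' i₀ 0).card + (touched m' ν' f' i₀ 1).card ≤
        (touched m ν f i₀ 0).card := by
      have hmem : ∀ j < 2, ∀ q ∈ touched m' ν' f' i₀ j, q.1 ≠ i₀ := by
        rintro j hj ⟨i', k'⟩ hq rfl
        obtain ⟨h1, ⟨a1, a2, a3, a4⟩, -⟩ := mem_touched.1 hq
        simp only [m'0] at h1 a1 a2 a3 a4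
        interval_cases j <;> interval_cases k'
        · exact a1 rfl
        · exact a3 rfl
        · exact a2 rfl
        · exact a1 rfl
      rw [← Finset.card_union_of_disjoint]
      · refine Finset.card_le_card (Finset.Subset.trans ?_ (hsub i₀ 0))
        have : ∀ j < 2, touched m' ν' f' i₀ j ⊆ touched m ν g i₀ 0 := by
          rintro j hj ⟨i', k'⟩ hq
          have hi' := hmem j hj _ hq
          obtain ⟨h1, h2, z, hz1, hz2⟩ := mem_touched.1 hq
          simp only [m'ne i' hi'] at h1
          obtain ⟨b1, b2, b3, -⟩ := half i' k' hi' h1 j hj h2 z hz1 hz2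
          exact mem_touched.2 ⟨h1, b1, z, b2, b3⟩
        exact Finset.union_subset (this 0 (by lia)) (this 1 (by lia))
      · rw [Finset.disjoint_left]
        rintro ⟨i', k'⟩ hq hq'
        have hi' := hmem 0 (by lia) _ hq
        obtain ⟨h1, h2, h3⟩ := mem_touched.1 hq
        obtain ⟨-, h2', h3'⟩ := mem_touched.1 hq'
        simp only [m'ne i' hi'] at h1
        exact notboth i' k' hi' h1 h2 h3 h2' h3'
    have hnet : Net u v m' (fun w => some (e w)) ν' := by
      refine ⟨fun i => ?_, fun a b h => hn.inj (Option.some.inj h), hn.ne, fun i => ?_,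
        fun i => ?_, ?_⟩
      · by_cases hi : i = i₀
        · subst hi; lia
        · rw [m'ne i hi]; exact hn.pos i
      · by_cases hi : i = i₀
        · subst hi; exact ν'0
        · rw [ν'ne i hi, hn.left]
      · by_cases hi : i = i₀
        · subst hi; rw [m'0]; exact ν'2
        · rw [ν'ne i hi, m'ne i hi, hn.right]
      · intro i k i' k' h0 hk hk' heq
        by_cases hi : i = i₀ <;> by_cases hi' : i' = i₀
        · subst hi; subst hi'
          rw [m'0] at hk hk'
          refine ⟨rfl, ?_⟩
          interval_cases k
          rw [ν'1] at heq
          interval_cases k'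
          · rw [ν'0] at heq; simp at heq
          · rfl
          · rw [ν'2] at heq; simp at heq
        · subst hi
          rw [m'0] at hk
          interval_cases k
          rw [ν'1, ν'ne i' hi'] at heq
          simp at heq
        · subst hi'
          rw [ν'ne i hi] at heq
          rw [m'0] at hk'
          rw [m'ne i hi] at hk
          have hp := hm₀
          interval_cases k'
          · rw [ν'0, Option.some_inj, ← hν0] at heq
            exact absurd (hn.inner i k i' 0 h0 hk (by lia) heq).1 hi
          · rw [ν'1] at heq; simp at heq
          · rw [ν'2, Option.some_inj, ← hν1] at heq
            exact absurd (hn.inner i k i' 1 h0 hk (by lia) heq).1 hi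
        · rw [ν'ne i hi, ν'ne i' hi', Option.some_inj] at heq
          rw [m'ne i hi] at hk
          rw [m'ne i' hi'] at hk'
          exact hn.inner i k i' k' h0 hk hk' heq
    refine ih (D.erase i₀) hnet f' ?_ ?_ ?_ ?_ ?_
    · intro i hi
      rw [m'ne i (Finset.ne_of_mem_erase hi)]
      exact hD i (Finset.mem_of_mem_erase hi)
    · intro i k hk i' k' hk' heq
      by_cases hi : i = i₀ <;> by_cases hi' : i' = i₀
      · subst hi; subst hi'
        rw [m'0] at hk hk'
        left
        refine ⟨rfl, ?_⟩
        interval_cases k <;> interval_cases k' <;> first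
          | rfl
          | (simp only [zero_add, one_add_one_eq_two, ν'0, ν'1, ν'2] at heq
             simp [huv, huv.symm] at heq)
      · subst hi
        rw [m'0] at hk
        rw [ν'ne i' hi', ν'ne i' hi'] at heq
        interval_cases k <;> simp only [zero_add, one_add_one_eq_two, ν'0, ν'1, ν'2] at heq <;>
          simp at heq
      · subst hi'
        rw [m'0] at hk'
        rw [ν'ne i hi, ν'ne i hi] at heq
        interval_cases k' <;> simp only [zero_add, one_add_one_eq_two, ν'0, ν'1, ν'2] at heq <;>
          simp at heq
      · rw [ν'ne i hi, ν'ne i hi, ν'ne i' hi', ν'ne i' hi'] at heq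
        rw [m'ne i hi] at hk
        rw [m'ne i' hi'] at hk'
        have := hsame i k hk i' k' hk' (by simpa [Sym2.eq_iff] using heq)
        simpa [hi, hi'] using this
    · intro i hi
      by_cases hi' : i = i₀
      · subst hi'
        have h1 := hND i hi₀
        rw [m'0, Finset.sum_range_succ, Finset.sum_range_one]
        lia
      · have hiD : i ∉ D := fun h => hi (Finset.mem_erase.2 ⟨hi', h⟩)
        rw [m'ne i hi']
        refine le_trans (Finset.sum_le_sum fun k hk => ?_) (hN i hiD)
        exact max_le_max le_rfl (hne' i hi' k (Finset.mem_range.1 hk))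
    · intro i hi
      have := hND i (Finset.mem_of_mem_erase hi)
      have h2 := hne' i (Finset.ne_of_mem_erase hi) 0 (by rw [hD i (Finset.mem_of_mem_erase hi)]; lia)
      lia
    · rw [Finset.card_erase_of_mem hi₀]; lia

end OnePlanar

namespace OnePlanar

/-- Paths of positive length partitioning the edges of a graph, whose inner vertices are the
vertices of degree two. -/
structure PathSys {V ι : Type*} [Fintype V] (G : SimpleGraph V) [DecidableRel G.Adj]
    (u v : ι → V) (P : ∀ i, G.Walk (u i) (v i)) : Prop where
  min : ∀ w, 2 ≤ G.degree w
  path : ∀ i, (P i).IsPath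
  deg2 : ∀ i, ∀ w ∈ (P i).support, w ≠ u i → w ≠ v i → G.degree w = 2
  max : ∀ i, G.degree (u i) ≠ 2 ∧ G.degree (v i) ≠ 2
  disj : ∀ i j, i ≠ j → ∀ e ∈ (P i).edges, e ∉ (P j).edges
  cover : ∀ e : Sym2 V, e ∈ G.edgeSet → ∃ i, e ∈ (P i).edges
  pos : ∀ i, 1 ≤ (P i).length

lemma mem_edges_iff_getVert {V : Type*} {G : SimpleGraph V} {a b : V} (w : G.Walk a b)
    (e : Sym2 V) : e ∈ w.edges ↔ ∃ k < w.length, e = s(w.getVert k, w.getVert (k + 1)) := by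
  induction w with
  | nil => simp
  | cons h q ih =>
    simp only [SimpleGraph.Walk.edges_cons, List.mem_cons, ih, SimpleGraph.Walk.length_cons]
    constructor
    · rintro (rfl | ⟨k, hk, rfl⟩)
      · exact ⟨0, by lia, by simp⟩
      · exact ⟨k + 1, by lia, by simp⟩
    · rintro ⟨k, hk, rfl⟩
      rcases k with _ | k
      · left; simp
      · right; exact ⟨k, by lia, by simp⟩

/-- The nodes of the paths shortened to lengths `N i`. -/
def shortVert {V ι : Type*} {G : SimpleGraph V} {u v : ι → V} (P : ∀ i, G.Walk (u i) (v i))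
    (N : ι → ℕ) (i : ι) (k : ℕ) : V := if k < N i then (P i).getVert k else v i

lemma shortVert_zero {V ι : Type*} {G : SimpleGraph V} {u v : ι → V} {P : ∀ i, G.Walk (u i) (v i)}
    {N : ι → ℕ} {i : ι} (h : 1 ≤ N i) :
    shortVert P N i 0 = u i := by
  simp [shortVert, show 0 < N i from h]

lemma shortVert_right {V ι : Type*} {G : SimpleGraph V} {u v : ι → V} {P : ∀ i, G.Walk (u i) (v i)}
    {N : ι → ℕ} {i : ι} : shortVert P N i (N i) = v i := by
  simp [shortVert]

lemma shortVert_full {V ι : Type*} {G : SimpleGraph V} {u v : ι → V} {P : ∀ i, G.Walk (u i) (v i)}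
    {i : ι} {k : ℕ} (hk : k ≤ (P i).length) :
    shortVert P (fun i => (P i).length) i k = (P i).getVert k := by
  rcases hk.eq_or_lt with rfl | hk
  · simp [shortVert]
  · simp [shortVert, hk]

namespace PathSys
variable {V ι : Type*} [Fintype V] {G : SimpleGraph V} [DecidableRel G.Adj]
  {u v : ι → V} {P : ∀ i, G.Walk (u i) (v i)}

lemma ne (h : PathSys G u v P) (i : ι) : u i ≠ v i := by
  intro e
  have := h.pos i
  have h0 : (P i).getVert 0 = (P i).getVert (P i).length := by simp [e]
  have := (h.path i).getVert_injOn (by simp) (by simp) h0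
  lia

lemma degree_inner (h : PathSys G u v P) {i : ι} {k : ℕ} (h0 : 0 < k) (hk : k < (P i).length) :
    G.degree ((P i).getVert k) = 2 := by
  refine h.deg2 i _ ((P i).getVert_mem_support k) ?_ ?_
  · intro e
    have := (h.path i).getVert_injOn (x₁ := k) (x₂ := 0) (by simp; lia) (by simp) (by simpa using e)
    lia
  · intro e
    have := (h.path i).getVert_injOn (x₁ := k) (x₂ := (P i).length) (by simp; lia) (by simp)
      (by simpa using e)
    lia

lemma inner (h : PathSys G u v P) {i i' : ι} {k k' : ℕ} (h0 : 0 < k) (hk : k < (P i).length)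
    (hk' : k' ≤ (P i').length) (e : (P i).getVert k = (P i').getVert k') : i = i' ∧ k = k' := by
  classical
  have hd := h.degree_inner h0 hk
  by_cases hi : i = i'
  · subst hi
    exact ⟨rfl, (h.path i).getVert_injOn (by simp; lia) (by simpa using hk') e⟩
  exfalso
  rcases Nat.eq_zero_or_pos k' with rfl | h0'
  · rw [e, SimpleGraph.Walk.getVert_zero] at hd
    exact (h.max i').1 hd
  rcases hk'.eq_or_lt with rfl | hk'
  · rw [e, SimpleGraph.Walk.getVert_length] at hd
    exact (h.max i').2 hd
  have a1 := (P i).adj_getVert_succ hk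
  have a2 := (P i).adj_getVert_succ (i := k - 1) (by lia)
  have a3 := (P i').adj_getVert_succ hk'
  rw [Nat.sub_add_cancel h0] at a2
  have m1 : s((P i).getVert k, (P i).getVert (k + 1)) ∈ (P i).edges :=
    (mem_edges_iff_getVert _ _).2 ⟨k, hk, rfl⟩
  have m2 : s((P i).getVert k, (P i).getVert (k - 1)) ∈ (P i).edges :=
    (mem_edges_iff_getVert _ _).2 ⟨k - 1, by lia, by rw [Nat.sub_add_cancel h0]; exact Sym2.eq_swap⟩
  have m3 : s((P i).getVert k, (P i').getVert (k' + 1)) ∈ (P i').edges :=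
    (mem_edges_iff_getVert _ _).2 ⟨k', hk', by rw [e]⟩
  have d12 : (P i).getVert (k + 1) ≠ (P i).getVert (k - 1) := fun e' => by
    have := (h.path i).getVert_injOn (x₁ := k + 1) (x₂ := k - 1) (by simp; lia) (by simp; lia) e'
    lia
  have d13 : (P i).getVert (k + 1) ≠ (P i').getVert (k' + 1) := fun e' =>
    h.disj i i' hi _ m1 (e' ▸ m3)
  have d23 : (P i).getVert (k - 1) ≠ (P i').getVert (k' + 1) := fun e' =>
    h.disj i i' hi _ m2 (e' ▸ m3)
  have hsub : ({(P i).getVert (k + 1), (P i).getVert (k - 1), (P i').getVert (k' + 1)} : Finset V) ⊆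
      G.neighborFinset ((P i).getVert k) := by
    intro x hx
    simp only [Finset.mem_insert, Finset.mem_singleton] at hx
    rw [SimpleGraph.mem_neighborFinset]
    rcases hx with rfl | rfl | rfl
    · exact a1
    · exact a2.symm
    · rw [e]; exact a3
  have := Finset.card_le_card hsub
  rw [Finset.card_eq_three.2 ⟨_, _, _, d12, d13, d23, rfl⟩, SimpleGraph.card_neighborFinset_eq_degree,
    hd] at this
  lia

lemma shortVert_inner (h : PathSys G u v P) {N : ι → ℕ} (hN : ∀ i, N i ≤ (P i).length)
    {i i' : ι} {k k' : ℕ} (h0 : 0 < k) (hk : k < N i) (hk' : k' ≤ N i')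
    (e : shortVert P N i k = shortVert P N i' k') : i = i' ∧ k = k' := by
  have hl := hN i
  have hl' := hN i'
  rw [shortVert, if_pos hk] at e
  by_cases hk2 : k' < N i'
  · rw [shortVert, if_pos hk2] at e
    exact h.inner h0 (by lia) (by lia) e
  · rw [shortVert, if_neg hk2, ← SimpleGraph.Walk.getVert_length (P i')] at e
    have := h.inner h0 (by lia) le_rfl e
    obtain ⟨rfl, h2⟩ := this
    lia

lemma chains (h : PathSys G u v P) {N : ι → ℕ} (hN : ∀ i, N i ≤ (P i).length) (h1 : ∀ i, 1 ≤ N i)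
    {Γ : SimpleGraph V} (hΓ : ∀ a b, Γ.Adj a b → ∃ i, ∃ k < N i,
      s(a, b) = s(shortVert P N i k, shortVert P N i (k + 1))) :
    Chains Γ u v N (shortVert P N) :=
  ⟨fun i => shortVert_zero (h1 i), fun _ => shortVert_right,
    fun _ _ _ _ h0 hk hk' e => h.shortVert_inner hN h0 hk hk' e, hΓ⟩

lemma chains_self (h : PathSys G u v P) :
    Chains G u v (fun i => (P i).length) (shortVert P fun i => (P i).length) := by
  refine h.chains (fun _ => le_rfl) h.pos fun a b hab => ?_
  obtain ⟨i, hi⟩ := h.cover _ ((SimpleGraph.mem_edgeSet G).2 hab)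
  obtain ⟨k, hk, he⟩ := (mem_edges_iff_getVert _ _).1 hi
  exact ⟨i, k, hk, by rw [shortVert_full hk.le, shortVert_full hk, he]⟩

lemma net (h : PathSys G u v P) {N : ι → ℕ} (hN : ∀ i, N i ≤ (P i).length) (h1 : ∀ i, 1 ≤ N i) :
    Net u v N id (shortVert P N) :=
  ⟨h1, Function.injective_id, h.ne, fun i => shortVert_zero (h1 i), fun _ => shortVert_right,
    fun _ _ _ _ h0 hk hk' e => h.shortVert_inner hN h0 hk hk' e⟩

/-- Different pieces of the shortened paths are different edges. -/
lemma shortVert_same (h : PathSys G u v P) {N : ι → ℕ} (hN : ∀ i, N i ≤ (P i).length)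
    (h1 : ∀ i, 1 ≤ N i) (h2 : ∀ i, N i = 1 → (P i).length = 1) {i i' : ι} {k k' : ℕ}
    (hk : k < N i) (hk' : k' < N i')
    (e : s(shortVert P N i k, shortVert P N i (k + 1)) =
      s(shortVert P N i' k', shortVert P N i' (k' + 1))) : i = i' ∧ k = k' := by
  have key : ∀ i i' k k', k < N i → k' < N i' → 1 < N i →
      s(shortVert P N i k, shortVert P N i (k + 1)) =
      s(shortVert P N i' k', shortVert P N i' (k' + 1)) → i = i' ∧ k = k' := by
    intro i i' k k' hk hk' h1i e
    have hn := h.net hN h1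
    rcases Nat.eq_zero_or_pos k with rfl | h0
    · rcases Sym2.eq_iff.1 e with ⟨e1, e2⟩ | ⟨e1, e2⟩
      · have := h.shortVert_inner hN (i := i) (k := 0 + 1) (by lia) (by lia) (by lia) e2
        exact ⟨this.1, by lia⟩
      · have := h.shortVert_inner hN (i := i) (k := 0 + 1) (by lia) (by lia) (by lia) e2
        obtain ⟨rfl, h3⟩ := this
        have h4 : k' + 1 = 2 := by lia
        rw [h4] at e1
        rcases Nat.lt_or_ge 2 (N i) with h5 | h5
        · have := (h.shortVert_inner hN (by lia) h5 (by lia) e1.symm).2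
          lia
        · have h6 : N i = 2 := by lia
          have := shortVert_right (P := P) (N := N) (i := i)
          rw [h6] at this
          rw [shortVert_zero (h1 i), this] at e1
          exact absurd e1 (h.ne i)
    · rcases Sym2.eq_iff.1 e with ⟨e1, e2⟩ | ⟨e1, e2⟩
      · exact h.shortVert_inner hN h0 hk (by lia) e1
      · obtain ⟨rfl, h3⟩ := h.shortVert_inner hN h0 hk (by lia) e1
        rcases Nat.eq_zero_or_pos k' with rfl | h0'
        · rcases Nat.lt_or_ge (k + 1) (N i) with h5 | h5
          · have := (h.shortVert_inner hN (by lia) h5 (by lia) e2).2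
            lia
          · have h6 : N i = k + 1 := by lia
            have := shortVert_right (P := P) (N := N) (i := i)
            rw [h6] at this
            rw [shortVert_zero (h1 i), this] at e2
            exact absurd e2.symm (h.ne i)
        · have := (h.shortVert_inner hN h0' hk' (by lia) e2.symm).2
          lia
  by_cases ha : 1 < N i
  · exact key i i' k k' hk hk' ha e
  by_cases hb : 1 < N i'
  · have := key i' i k' k hk' hk hb e.symm
    exact ⟨this.1.symm, this.2.symm⟩
  have hNi : N i = 1 := by have := h1 i; lia
  have hNi' : N i' = 1 := by have := h1 i'; lia
  have hk0 : k = 0 := by lia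
  have hk0' : k' = 0 := by lia
  subst hk0 hk0'
  refine ⟨?_, rfl⟩
  by_contra hi
  have f : ∀ i, N i = 1 → s(shortVert P N i 0, shortVert P N i (0 + 1)) ∈ (P i).edges := by
    intro i hi
    refine (mem_edges_iff_getVert _ _).2 ⟨0, h.pos i, ?_⟩
    have := h2 i hi
    have h3 : (P i).getVert 1 = v i := by rw [← this, SimpleGraph.Walk.getVert_length]
    simp [shortVert, hi, h3]
  exact h.disj i i' hi _ (f i hNi) (e ▸ f i' hNi')

/-- At least three paths end at every branch vertex. -/
lemma three_le (h : PathSys G u v P) [Fintype ι] [DecidableEq V] {b : V}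
    (hb : G.degree b ≠ 2) : 3 ≤ (Finset.univ.filter fun i => u i = b ∨ v i = b).card := by
  classical
  have h3 : 3 ≤ G.degree b := by have := h.min b; lia
  refine h3.trans ?_
  rw [← SimpleGraph.card_neighborFinset_eq_degree]
  have key : ∀ x ∈ G.neighborFinset b, ∃ i, (u i = b ∧ x = (P i).getVert 1) ∨
      (v i = b ∧ x = (P i).getVert ((P i).length - 1)) := by
    intro x hx
    rw [SimpleGraph.mem_neighborFinset] at hx
    obtain ⟨i, hi⟩ := h.cover _ ((SimpleGraph.mem_edgeSet G).2 hx)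
    refine ⟨i, ?_⟩
    obtain ⟨k, hk, he⟩ := (mem_edges_iff_getVert _ _).1 hi
    have hno : ∀ j, 0 < j → j < (P i).length → b ≠ (P i).getVert j := fun j j0 j1 e =>
      hb (e ▸ h.degree_inner j0 j1)
    rcases Sym2.eq_iff.1 he with ⟨e1, e2⟩ | ⟨e1, e2⟩
    · rcases Nat.eq_zero_or_pos k with rfl | h0
      · left; exact ⟨by simpa using e1.symm, e2⟩
      · exact absurd e1 (hno k h0 hk)
    · rcases Nat.eq_or_lt_of_le (Nat.succ_le_of_lt hk) with hk' | hk'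
      · right
        have : k + 1 = (P i).length := hk'
        rw [this, SimpleGraph.Walk.getVert_length] at e1
        exact ⟨e1.symm, by rw [← this]; exact e2⟩
      · exact absurd e1 (hno (k + 1) (by lia) hk')
  have : Nonempty ι := by
    obtain ⟨x, hx⟩ : (G.neighborFinset b).Nonempty := by
      rw [← Finset.card_pos, SimpleGraph.card_neighborFinset_eq_degree]; lia
    exact ⟨(key x hx).choose⟩
  choose! g hg using key
  refine Finset.card_le_card_of_injOn g (fun x hx => ?_) (fun x hx y hy e => ?_)
  · simp only [Finset.coe_filter, Finset.mem_univ, true_and, mem_ofPred_eq]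
    exact (hg x hx).imp And.left And.left
  · have h1 := hg x hx
    have h2 := hg y hy
    rw [← e] at h2
    have hne := h.ne (g x)
    rcases h1 with ⟨a1, b1⟩ | ⟨a1, b1⟩ <;> rcases h2 with ⟨a2, b2⟩ | ⟨a2, b2⟩
    · rw [b1, b2]
    · exact absurd (a1.trans a2.symm) hne
    · exact absurd (a2.trans a1.symm) hne
    · rw [b1, b2]

lemma card_branch_le (h : PathSys G u v P) [Fintype ι] [DecidableEq V] :
    (Finset.univ.filter fun b => ∃ i, u i = b ∨ v i = b).card ≤ Fintype.card ι := by
  classical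
  set B := Finset.univ.filter fun b => ∃ i, u i = b ∨ v i = b
  have h1 : ∑ b ∈ B, 3 ≤ ∑ b ∈ B, (Finset.univ.filter fun i => u i = b ∨ v i = b).card := by
    refine Finset.sum_le_sum fun b hb => h.three_le ?_
    obtain ⟨i, rfl | rfl⟩ := (Finset.mem_filter.1 hb).2
    · exact (h.max i).1
    · exact (h.max i).2
  have h2 : ∑ b ∈ B, (Finset.univ.filter fun i => u i = b ∨ v i = b).card =
      ∑ i : ι, (B.filter fun b => u i = b ∨ v i = b).card := by
    simp only [Finset.card_filter]
    exact Finset.sum_comm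
  have h3 : ∑ i : ι, (B.filter fun b => u i = b ∨ v i = b).card ≤ ∑ i : ι, 2 := by
    refine Finset.sum_le_sum fun i _ => ?_
    refine (Finset.card_le_card (t := {u i, v i}) fun b hb => ?_).trans Finset.card_le_two
    have := (Finset.mem_filter.1 hb).2
    simp only [Finset.mem_insert, Finset.mem_singleton]
    exact this.imp Eq.symm Eq.symm
  simp only [Finset.sum_const, smul_eq_mul, Finset.card_univ] at h1 h2 h3
  lia

end PathSys
end OnePlanar

namespace OnePlanar
namespace PathSys
variable {V ι : Type*} [Fintype V] [Fintype ι] {G : SimpleGraph V} [DecidableRel G.Adj]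
  {u v : ι → V} {P : ∀ i, G.Walk (u i) (v i)}

/-- If all paths are long enough, they may be drawn as straight segments. -/
theorem geomOnePlanar_of_long (h : PathSys G u v P)
    (hlen : ∀ i, Fintype.card ι ≤ (P i).length + 1) : GeomOnePlanar G := by
  classical
  have hn := h.net (N := fun _ => 1) h.pos (fun _ => le_rfl)
  refine realize_direct h.chains_self Finset.univ hn (fun _ => 0) (fun _ _ => rfl)
    (fun _ _ _ _ _ _ _ => Or.inr (Or.inl (Finset.mem_univ _))) (by simp) fun i _ => ?_
  set T := touched (fun _ => 1) (shortVert P fun _ => 1) (fun _ => (0 : Pl)) i 0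
  set S := Finset.univ.filter fun i' => u i' = u i ∨ v i' = u i
  have h1 : T.card ≤ Sᶜ.card := by
    refine Finset.card_le_card_of_injOn (fun q => q.1) (fun q hq => ?_) ?_
    · obtain ⟨h1, ⟨a1, a2, -, -⟩, -⟩ := mem_touched.1 (Finset.mem_coe.1 hq)
      have h0 : q.2 = 0 := by lia
      rw [h0, hn.left, hn.left] at a1
      rw [h0, hn.left, zero_add, hn.right] at a2
      simp only [S, Finset.coe_compl, mem_compl_iff, Finset.mem_coe, Finset.mem_filter,
        Finset.mem_univ, true_and, not_or]
      exact ⟨Ne.symm a1, Ne.symm a2⟩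
    · rintro ⟨i1, k1⟩ hq ⟨i2, k2⟩ hq' e
      have h1 := (mem_touched.1 (Finset.mem_coe.1 hq)).1
      have h2 := (mem_touched.1 (Finset.mem_coe.1 hq')).1
      simp only at h1 h2 e
      subst e
      have : k1 = k2 := by lia
      rw [this]
  have h3 := h.three_le (h.max i).1
  have h4 := Finset.card_compl_add_card S
  have h5 := hlen i
  lia

/-- A drawing of the shortened graph yields a drawing of the graph. -/
theorem geomOnePlanar_of_short (h : PathSys G u v P) {N : ι → ℕ} (hN : ∀ i, N i ≤ (P i).length)
    (h1 : ∀ i, 1 ≤ N i) (h2 : ∀ i, N i = 1 → (P i).length = 1) {Γ : SimpleGraph V}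
    (hadj : ∀ i, ∀ k < N i, Γ.Adj (shortVert P N i k) (shortVert P N i (k + 1)))
    (hΓ : GeomOnePlanar Γ) : GeomOnePlanar G := by
  obtain ⟨pos, -, hT⟩ := exists_GP_touchOne hΓ
  refine realize h.chains_self (h.net hN h1) pos
    (fun i k hk i' k' hk' e => h.shortVert_same hN h1 h2 hk hk' e) fun i => ?_
  refine le_trans (Finset.sum_le_card_nsmul _ _ 1 fun k hk => ?_) (by simpa using hN i)
  rw [Finset.mem_range] at hk
  refine max_le le_rfl (Finset.card_le_one.2 ?_)
  rintro ⟨i1, k1⟩ hq ⟨i2, k2⟩ hq'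
  obtain ⟨a1, a2, a3⟩ := mem_touched.1 hq
  obtain ⟨b1, b2, b3⟩ := mem_touched.1 hq'
  obtain ⟨rfl, rfl⟩ := h.shortVert_same hN h1 h2 a1 b1
    (hT _ _ (hadj i k hk) _ _ _ _ (hadj _ _ a1) (hadj _ _ b1) a2 b2 a3 b3)
  rfl

end PathSys
end OnePlanar

namespace OnePlanar
open Filter Topology

lemma continuous_crs (a b : Pl) : Continuous (crs a b) := by unfold crs; fun_prop

lemma crs_pt_last (c d x y : Pl) (t : ℝ) :
    crs c d (pt x y t) = crs c d x + t * (crs c d y - crs c d x) := by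
  rw [crs_pt]; ring

lemma eq_of_mem_seg_of_mem_seg {x y z : Pl} (h1 : x ∈ segment ℝ y z) (h2 : y ∈ segment ℝ x z) :
    x = y := by
  rw [mem_segment_iff_wbtw] at h1 h2
  exact (wbtw_swap_left_iff ℝ z).1 ⟨h2, h1⟩

lemma oseg_symm (a b : Pl) : openSegment ℝ a b = openSegment ℝ b a := openSegment_symm ℝ a b

/-- Points of the line near an inner point of a segment are inner points. -/
lemma eventually_mem_oseg {a b z : Pl} (hab : a ≠ b) (hz : z ∈ openSegment ℝ a b) :
    ∀ᶠ w in 𝓝 z, crs a b w = 0 → w ∈ openSegment ℝ a b := by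
  set τ : Pl → ℝ := fun w => ((w.1 - a.1) * (b.1 - a.1) + (w.2 - a.2) * (b.2 - a.2)) /
    ((b.1 - a.1) ^ 2 + (b.2 - a.2) ^ 2) with hτ
  have hD : (b.1 - a.1) ^ 2 + (b.2 - a.2) ^ 2 ≠ 0 := by
    intro h
    refine hab (Prod.ext ?_ ?_) <;> nlinarith [sq_nonneg (b.1 - a.1), sq_nonneg (b.2 - a.2)]
  have hpt : ∀ t, τ (pt a b t) = t := by
    intro t
    simp only [hτ, pt_fst, pt_snd]
    field_simp
    ring
  have hc : Continuous τ := by simp only [hτ]; fun_prop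
  obtain ⟨t, t0, t1, rfl⟩ := mem_oseg.1 hz
  have h1 : ∀ᶠ w in 𝓝 (pt a b t), 0 < τ w :=
    hc.continuousAt.eventually (lt_mem_nhds (by rwa [hpt]))
  have h2 : ∀ᶠ w in 𝓝 (pt a b t), τ w < 1 :=
    hc.continuousAt.eventually (gt_mem_nhds (by rwa [hpt]))
  filter_upwards [h1, h2] with w w0 w1 hw
  obtain ⟨r, rfl⟩ := exists_pt_of_crs hab hw
  rw [hpt] at w0 w1
  exact pt_mem_oseg _ _ w0 w1

lemma tendsto_pt (x y : Pl) : Tendsto (pt x y) (𝓝[>] 0) (𝓝 x) := by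
  have := (continuous_pt x y).tendsto 0
  rw [pt_zero] at this
  exact this.mono_left nhdsWithin_le_nhds

lemma eventually_small : ∀ᶠ ε : ℝ in 𝓝[>] 0, 0 < ε ∧ ε < 1 :=
  Ioo_mem_nhdsGT one_pos

/-- An arrangement of walls in a convex open set: the inner points of the walls with index at
least `h` avoid all previous walls, and at every point of the arrangement that is not an inner
point of a wall, no half plane contains all walls nearby. -/
structure Arr where
  Ω : Set Pl
  n : ℕ
  h : ℕ
  X : ℕ → Pl
  Y : ℕ → Pl
  convex : Convex ℝ Ω
  isOpen : IsOpen Ω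
  ne : ∀ s < n, X s ≠ Y s
  sub : ∀ s < n, ∀ t < n, s ≠ t → (segment ℝ (X s) (Y s) ∩ segment ℝ (X t) (Y t)).Subsingleton
  order : ∀ t < n, h ≤ t → ∀ s < t, Disjoint (segment ℝ (X s) (Y s)) (openSegment ℝ (X t) (Y t))
  span : ∀ z ∈ Ω, ∀ s < n, z ∈ segment ℝ (X s) (Y s) →
    (∃ t < n, z ∈ openSegment ℝ (X t) (Y t)) ∨
    ∀ c d : Pl, c ≠ d → ∃ y, (∀ w ∈ segment ℝ z y, ∃ t < n, w ∈ segment ℝ (X t) (Y t)) ∧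
      crs c d z < crs c d y

namespace Arr
variable (W : Arr)

/-- The `s`-th wall. -/
def seg (s : ℕ) : Set Pl := segment ℝ (W.X s) (W.Y s)
/-- The inner points of the `s`-th wall. -/
def oseg (s : ℕ) : Set Pl := openSegment ℝ (W.X s) (W.Y s)
/-- The union of all walls. -/
def K : Set Pl := {z | ∃ s < W.n, z ∈ W.seg s}
/-- The position of a point with respect to the line of a wall. -/
def side (s : ℕ) (z : Pl) : ℝ := crs (W.X s) (W.Y s) z

/-- The segment from `x` to `a` avoids the walls, except possibly at `x`. -/
def Sees (x a : Pl) : Prop :=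
  x ∈ W.Ω ∧ a ∈ W.Ω ∧ a ∉ W.K ∧ ∀ z ∈ segment ℝ x a, z ≠ x → z ∉ W.K

/-- The segment from `a` to `c` avoids the walls. -/
def Vis (a c : Pl) : Prop := a ∈ W.Ω ∧ c ∈ W.Ω ∧ ∀ z ∈ segment ℝ a c, z ∉ W.K

variable {W}

lemma oseg_subset (s : ℕ) : W.oseg s ⊆ W.seg s := openSegment_subset_segment ℝ _ _

lemma isCompact_K : IsCompact W.K := by
  have : W.K = ⋃ s ∈ Finset.range W.n, W.seg s := by ext z; simp [K]
  rw [this]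
  exact (Finset.range W.n).isCompact_biUnion fun s _ => isCompact_seg _ _

lemma side_seg {s : ℕ} {z : Pl} (hz : z ∈ W.seg s) : W.side s z = 0 := crs_eq_zero_of_mem hz

lemma Vis.symm {a c : Pl} (h : W.Vis a c) : W.Vis c a :=
  ⟨h.2.1, h.1, fun z hz => h.2.2 z (by rwa [segment_symm])⟩

lemma Vis.sees {a c : Pl} (h : W.Vis a c) : W.Sees a c :=
  ⟨h.1, h.2.1, h.2.2 c (right_mem_segment _ _ _), fun z hz _ => h.2.2 z hz⟩

lemma Sees.vis {a c : Pl} (h : W.Sees a c) (ha : a ∉ W.K) : W.Vis a c :=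
  ⟨h.1, h.2.1, fun z hz => by
    by_cases hza : z = a
    · rwa [hza]
    · exact h.2.2.2 z hz hza⟩

lemma Vis.refl {a : Pl} (h : a ∈ W.Ω) (ha : a ∉ W.K) : W.Vis a a :=
  ⟨h, h, fun z hz => by rw [segment_same] at hz; rwa [hz]⟩

/-- Points seen from `x` along the way. -/
lemma Sees.mid {x a y : Pl} (h : W.Sees x a) (hy : y ∈ segment ℝ x a) (hne : y ≠ x) :
    W.Vis y a := by
  refine ⟨W.convex.segment_subset h.1 h.2.1 hy, h.2.1, fun z hz => h.2.2.2 z ?_ ?_⟩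
  · exact (convex_segment x a).segment_subset hy (right_mem_segment _ _ _) hz
  · rintro rfl
    exact hne (eq_of_mem_seg_of_mem_seg hy hz)

lemma Sees.near {x a y : Pl} (h : W.Sees x a) (hy : y ∈ segment ℝ x a) (hne : y ≠ x) :
    W.Sees x y := by
  refine ⟨h.1, W.convex.segment_subset h.1 h.2.1 hy, h.2.2.2 y hy hne, fun z hz hzx => ?_⟩
  exact h.2.2.2 z ((convex_segment x a).segment_subset (left_mem_segment _ _ _) hy hz) hzx

/-- Distinct walls do not overlap. -/
lemma no_overlap {s t : ℕ} (hs : s < W.n) (ht : t < W.n) (hst : s ≠ t) {z w : Pl}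
    (hz : z ∈ W.oseg t) (hz' : z ∈ W.seg s) (hw : w ∈ W.seg s) (hzw : w ≠ z) :
    W.side t w ≠ 0 := by
  intro h0
  have h1 : ∀ᶠ ε in 𝓝[>] (0 : ℝ), crs (W.X t) (W.Y t) (pt z w ε) = 0 → pt z w ε ∈ W.oseg t :=
    (tendsto_pt z w).eventually (eventually_mem_oseg (W.ne t ht) hz)
  obtain ⟨ε, h2, ε0, ε1⟩ := (h1.and eventually_small).exists
  have hz0 := side_seg (oseg_subset t hz)
  have h3 := h2 (by rw [crs_pt]; simp only [side] at h0 hz0; rw [h0, hz0]; ring)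
  have h4 : pt z w ε ∈ W.seg s := (convex_segment _ _).segment_subset hz' hw (pt_mem_seg _ _ ε0.le ε1.le)
  have h5 := W.sub s hs t ht hst ⟨hz', oseg_subset t hz⟩ ⟨h4, oseg_subset t h3⟩
  have := pt_inj hzw.symm ((pt_zero z w).trans h5)
  linarith

/-- One step of the triangle argument: from an inner point one can move along the walls. -/
lemma step {n n' a z y : Pl} (h1 : 0 < crs n' a z) (h3 : 0 < crs a n z)
    (hy : ∀ w ∈ segment ℝ z y, w ∈ W.K) (h2 : 0 < crs n n' z ∨ 0 ≤ crs n n' z ∧ 0 < crs n n' y) :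
    ∃ ε : ℝ, 0 < ε ∧ ε < 1 ∧ pt z y ε ∈ W.K ∧ 0 < crs n' a (pt z y ε) ∧
      0 < crs n n' (pt z y ε) ∧ 0 < crs a n (pt z y ε) := by
  have key : ∀ c d : Pl, 0 < crs c d z → ∀ᶠ ε in 𝓝[>] (0 : ℝ), 0 < crs c d (pt z y ε) :=
    fun c d h => (tendsto_pt z y).eventually
      ((continuous_crs c d).continuousAt.eventually (lt_mem_nhds h))
  have hb : ∀ᶠ ε in 𝓝[>] (0 : ℝ), 0 < crs n n' (pt z y ε) := by
    rcases h2 with h2 | ⟨h2, h2'⟩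
    · exact key _ _ h2
    · filter_upwards [eventually_small] with ε hε
      rw [crs_pt]
      nlinarith [hε.1, hε.2, mul_pos hε.1 h2', mul_nonneg (sub_nonneg.2 hε.2.le) h2]
  obtain ⟨ε, a1, a2, a3, ε0, ε1⟩ :=
    ((key _ _ h1).and (hb.and ((key _ _ h3).and eventually_small))).exists
  exact ⟨ε, ε0, ε1, hy _ (pt_mem_seg _ _ ε0.le ε1.le), a1, a2, a3⟩

lemma mem_seg_of_crs {a b c z : Pl} (hD : 0 < crs a b c) (h0 : crs a b z = 0) (h1 : 0 ≤ crs b c z)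
    (h2 : 0 ≤ crs c a z) : z ∈ segment ℝ a b := by
  have hab : a ≠ b := (ne_of_crs_ne hD.ne').1
  obtain ⟨t, rfl⟩ := exists_pt_of_crs hab h0
  rw [crs_pt] at h1 h2
  have e1 : crs b c a = crs a b c := (crs_rot a b c).symm
  have e2 : crs c a b = crs a b c := crs_rot c a b
  simp only [crs_self_outer, mul_zero, add_zero, crs_self_right, zero_add, e1, e2] at h1 h2
  exact pt_mem_seg _ _ (by nlinarith) (by nlinarith)

lemma coords (a b c z : Pl) : crs a b c * z.1 = crs b c z * a.1 + crs c a z * b.1 + crs a b z * c.1 ∧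
    crs a b c * z.2 = crs b c z * a.2 + crs c a z * b.2 + crs a b z * c.2 := by
  constructor <;> simp only [crs] <;> ring

/-- A triangle two sides of which avoid the walls contains no walls off the third side. -/
lemma triangle_aux {n n' a : Pl} (h : W.Sees n a) (h' : W.Sees n' a) (hD : 0 < crs n n' a) {z : Pl}
    (h1 : 0 ≤ crs n' a z) (h2 : 0 < crs n n' z) (h3 : 0 ≤ crs a n z) : z ∉ W.K := by
  intro hz
  set T : Set Pl := {z | 0 ≤ crs n' a z ∧ 0 ≤ crs n n' z ∧ 0 ≤ crs a n z} with hT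
  have hTc : IsClosed T := by
    refine ((isClosed_le continuous_const (continuous_crs _ _)).inter
      ((isClosed_le continuous_const (continuous_crs _ _)).inter
        (isClosed_le continuous_const (continuous_crs _ _))))
  have hKT : IsCompact (W.K ∩ T) := isCompact_K.inter_right hTc
  obtain ⟨z1, hz1, hm1⟩ := hKT.exists_isMaxOn ⟨z, hz, h1, h2.le, h3⟩
    (continuous_crs n n').continuousOn
  have hKT2 : IsCompact ((W.K ∩ T) ∩ {w | crs n n' w = crs n n' z1}) :=
    hKT.inter_right (isClosed_eq (continuous_crs _ _) continuous_const)
  obtain ⟨z2, ⟨⟨hz2K, hz2T⟩, hz2⟩, hm2⟩ := hKT2.exists_isMaxOn ⟨z1, hz1, rfl⟩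
    (continuous_crs n' a).continuousOn
  have hz2 : crs n n' z2 = crs n n' z1 := hz2
  have hpos : 0 < crs n n' z2 := by
    rw [hz2]; exact h2.trans_le (hm1 ⟨hz, h1, h2.le, h3⟩)
  have hα : 0 < crs n' a z2 := by
    refine lt_of_le_of_ne hz2T.1 fun e => ?_
    have hm : z2 ∈ segment ℝ n' a := mem_seg_of_crs (c := n) (by rwa [← crs_rot]) e.symm hz2T.2.2
      hz2T.2.1
    refine h'.2.2.2 z2 hm ?_ hz2K
    rintro rfl
    simp at hpos
  have hγ : 0 < crs a n z2 := by
    refine lt_of_le_of_ne hz2T.2.2 fun e => ?_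
    have hm : z2 ∈ segment ℝ a n := mem_seg_of_crs (c := n') (by rwa [crs_rot]) e.symm hz2T.2.1
      hz2T.1
    rw [segment_symm] at hm
    refine h.2.2.2 z2 hm ?_ hz2K
    rintro rfl
    simp at hpos
  have hΩ : z2 ∈ W.Ω := by
    have hin : ∀ i : Fin 3, ![n, n', a] i ∈ W.Ω := by
      intro i; fin_cases i
      · exact h.1
      · exact h'.1
      · exact h.2.1
    have hc := coords n n' a z2
    have hsum : crs n' a z2 + crs a n z2 + crs n n' z2 = crs n n' a := by simp only [crs]; ring
    have e : z2 = (crs n' a z2 / crs n n' a) • n + (crs a n z2 / crs n n' a) • n' +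
        (crs n n' z2 / crs n n' a) • a := by
      ext <;> simp <;> field_simp <;> linarith [hc.1, hc.2]
    have := W.convex.sum_mem (t := Finset.univ)
      (w := ![crs n' a z2 / crs n n' a, crs a n z2 / crs n n' a, crs n n' z2 / crs n n' a])
      (z := ![n, n', a]) (by intro i _; fin_cases i <;> simp <;> positivity)
      (by simp [Fin.sum_univ_three]; field_simp; linarith) (fun i _ => hin i)
    rw [e]
    simpa [Fin.sum_univ_three] using this
  have hmove : ∀ y, (∀ w ∈ segment ℝ z2 y, w ∈ W.K) → crs n n' y ≤ crs n n' z2 ∧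
      (crs n n' y = crs n n' z2 → crs n' a y ≤ crs n' a z2) := by
    intro y hy
    obtain ⟨ε, ε0, ε1, k, a1, a2, a3⟩ := step hα hγ hy (Or.inl hpos)
    have hmem : pt z2 y ε ∈ W.K ∩ T := ⟨k, a1.le, a2.le, a3.le⟩
    have b1 := hm1 hmem
    simp only [mem_ofPred_eq, crs_pt_last, ← hz2] at b1
    refine ⟨by nlinarith, fun e => ?_⟩
    have b2 := hm2 (a := pt z2 y ε) ⟨hmem, by
      simp only [mem_ofPred_eq, crs_pt_last, e, ← hz2]; ring⟩
    simp only [mem_ofPred_eq, crs_pt_last] at b2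
    nlinarith
  obtain ⟨s, hs, hzs⟩ := hz2K
  rcases W.span z2 hΩ s hs hzs with ⟨t, ht, hzt⟩ | hsp
  · obtain ⟨r, r0, r1, hr⟩ := mem_oseg.1 hzt
    have hzt' := oseg_subset (W := W) t hzt
    have mX := hmove (W.X t) fun w hw => ⟨t, ht, (convex_segment _ _).segment_subset hzt'
      (left_mem_segment _ _ _) hw⟩
    have mY := hmove (W.Y t) fun w hw => ⟨t, ht, (convex_segment _ _).segment_subset hzt'
      (right_mem_segment _ _ _) hw⟩
    have e1 : crs n n' z2 = (1 - r) * crs n n' (W.X t) + r * crs n n' (W.Y t) := by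
      conv_lhs => rw [hr, crs_pt]
    have e2 : crs n' a z2 = (1 - r) * crs n' a (W.X t) + r * crs n' a (W.Y t) := by
      conv_lhs => rw [hr, crs_pt]
    have q1 : crs n n' (W.X t) = crs n n' z2 := by nlinarith [mX.1, mY.1]
    have q2 : crs n n' (W.Y t) = crs n n' z2 := by nlinarith [mX.1, mY.1]
    have p1 := mX.2 q1
    have p2 := mY.2 q2
    have q3 : crs n' a (W.X t) = crs n' a (W.Y t) := by nlinarith
    have q4 : crs a n (W.X t) = crs a n (W.Y t) := by
      have s1 : ∀ w, crs n' a w + crs a n w + crs n n' w = crs n n' a := by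
        intro w; simp only [crs]; ring
      linarith [s1 (W.X t), s1 (W.Y t)]
    have c1 := coords n n' a (W.X t)
    have c2 := coords n n' a (W.Y t)
    rw [q3, q4, q1] at c1
    rw [q2] at c2
    refine W.ne t ht (Prod.ext ?_ ?_)
    · exact mul_left_cancel₀ hD.ne' (c1.1.trans c2.1.symm)
    · exact mul_left_cancel₀ hD.ne' (c1.2.trans c2.2.symm)
  · obtain ⟨y, hy, hlt⟩ := hsp n n' (ne_of_crs_ne hD.ne').1
    exact absurd (hmove y hy).1 (not_le.2 hlt)

end Arr
end OnePlanar

namespace OnePlanar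
open Filter Topology

lemma pt_eq_lineMap (a b : Pl) (t : ℝ) : pt a b t = AffineMap.lineMap a b t := by
  simp [pt, AffineMap.lineMap_apply, add_comm]

lemma pt_mem_seg_pt {a b : Pl} (hab : a ≠ b) {r s t : ℝ} :
    pt a b t ∈ segment ℝ (pt a b r) (pt a b s) ↔ t ∈ uIcc r s := by
  rw [pt_eq_lineMap a b r, pt_eq_lineMap a b s, ← image_segment, segment_eq_uIcc]
  constructor
  · rintro ⟨x, hx, h⟩
    rw [← pt_eq_lineMap] at h
    rwa [← pt_inj hab h]
  · exact fun h => ⟨t, h, (pt_eq_lineMap a b t).symm⟩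

lemma pt_mem_oseg_pt {a b : Pl} (hab : a ≠ b) {r s t : ℝ} (hrs : r ≠ s) :
    pt a b t ∈ openSegment ℝ (pt a b r) (pt a b s) ↔ t ∈ Ioo (min r s) (max r s) := by
  rw [pt_eq_lineMap a b r, pt_eq_lineMap a b s, ← image_openSegment, openSegment_eq_Ioo' hrs]
  constructor
  · rintro ⟨x, hx, h⟩
    rw [← pt_eq_lineMap] at h
    rwa [← pt_inj hab h]
  · exact fun h => ⟨t, h, (pt_eq_lineMap a b t).symm⟩

lemma crs_pt_pt_pt (a b : Pl) (r s t : ℝ) : crs (pt a b r) (pt a b s) (pt a b t) = 0 := by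
  simp only [crs, pt_fst, pt_snd]; ring

lemma crs_eq_zero_of_line {a b x y z : Pl} (hab : a ≠ b) (hx : crs a b x = 0) (hy : crs a b y = 0)
    (hz : crs a b z = 0) : crs x y z = 0 := by
  obtain ⟨r, rfl⟩ := exists_pt_of_crs hab hx
  obtain ⟨s, rfl⟩ := exists_pt_of_crs hab hy
  obtain ⟨t, rfl⟩ := exists_pt_of_crs hab hz
  exact crs_pt_pt_pt a b r s t

/-- A point of a segment lies between any point of the line and one of the ends. -/
lemma mem_seg_or_of_line {n n' a z : Pl} (hn : n ≠ n') (ha : crs n n' a = 0)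
    (hz : z ∈ segment ℝ n n') : z ∈ segment ℝ n a ∨ z ∈ segment ℝ n' a := by
  obtain ⟨t, rfl⟩ := exists_pt_of_crs hn ha
  obtain ⟨r, r0, r1, rfl⟩ := mem_seg.1 hz
  have e0 : n = pt n n' 0 := (pt_zero n n').symm
  have e1 : n' = pt n n' 1 := (pt_one n n').symm
  rcases le_total r t with h | h
  · left
    have := (pt_mem_seg_pt hn (r := 0) (s := t) (t := r)).2 (by rw [mem_uIcc]; exact Or.inl ⟨r0, h⟩)
    rwa [pt_zero] at this
  · right
    have := (pt_mem_seg_pt hn (r := 1) (s := t) (t := r)).2 (by rw [mem_uIcc]; exact Or.inr ⟨h, r1⟩)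
    rwa [pt_one] at this

namespace Arr
variable {W : Arr}

lemma bottom_ne {n n' a z : Pl} (h : W.Sees n a) (h' : W.Sees n' a) (hn : n ≠ n')
    (hz : z ∈ openSegment ℝ n n') (hzK : z ∈ W.K) : crs n n' a ≠ 0 := by
  intro h0
  have hz' := ne_of_mem_oseg hz hn
  rcases mem_seg_or_of_line hn h0 (openSegment_subset_segment ℝ _ _ hz) with h1 | h1
  · exact h.2.2.2 z h1 hz'.1 hzK
  · exact h'.2.2.2 z h1 hz'.2 hzK

lemma bottom_wall {n n' a z : Pl} (h : W.Sees n a) (h' : W.Sees n' a) (hD : 0 < crs n n' a)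
    (hz : z ∈ openSegment ℝ n n') {s : ℕ} (hs : s < W.n) (hzs : z ∈ W.oseg s) :
    crs n n' (W.X s) = 0 ∧ crs n n' (W.Y s) = 0 := by
  have key : ∀ y, (∀ w ∈ segment ℝ z y, w ∈ W.K) → crs n n' y ≤ 0 := by
    intro y hy
    by_contra! hpos
    obtain ⟨r, r0, r1, rfl⟩ := mem_oseg.1 hz
    have e1 : crs n' a n = crs n n' a := (crs_rot n n' a).symm
    have e2 : crs a n n' = crs n n' a := crs_rot a n n'
    have p1 : 0 < crs n' a (pt n n' r) := by
      rw [crs_pt]; simp only [crs_self_outer, mul_zero, add_zero, e1]; nlinarith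
    have p2 : 0 < crs a n (pt n n' r) := by
      rw [crs_pt]; simp only [crs_self_right, mul_zero, zero_add, e2]; nlinarith
    have p3 : crs n n' (pt n n' r) = 0 := by rw [crs_pt]; simp
    obtain ⟨ε, _, _, k, a1, a2, a3⟩ := step p1 p2 hy (Or.inr ⟨p3.ge, hpos⟩)
    exact triangle_aux h h' hD a1.le a2 a3.le k
  have hz0 : crs n n' z = 0 := crs_eq_zero_of_mem (openSegment_subset_segment ℝ _ _ hz)
  have hzs' := oseg_subset s hzs
  have m1 := key (W.X s) fun w hw => ⟨s, hs, (convex_segment _ _).segment_subset hzs'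
      (left_mem_segment _ _ _) hw⟩
  have m2 := key (W.Y s) fun w hw => ⟨s, hs, (convex_segment _ _).segment_subset hzs'
      (right_mem_segment _ _ _) hw⟩
  obtain ⟨r, r0, r1, rfl⟩ := mem_oseg.1 hzs
  rw [crs_pt] at hz0
  constructor <;> nlinarith

lemma bottom_exists {n n' a z : Pl} (h : W.Sees n a) (h' : W.Sees n' a) (hD : 0 < crs n n' a)
    (hz : z ∈ openSegment ℝ n n') (hzK : z ∈ W.K) : ∃ s < W.n, z ∈ W.oseg s := by
  have hΩ : z ∈ W.Ω := W.convex.segment_subset h.1 h'.1 (openSegment_subset_segment ℝ _ _ hz)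
  obtain ⟨s, hs, hzs⟩ := hzK
  rcases W.span z hΩ s hs hzs with h1 | hsp
  · exact h1
  exfalso
  obtain ⟨y, hy, hlt⟩ := hsp n n' (ne_of_crs_ne hD.ne').1
  rw [crs_eq_zero_of_mem (openSegment_subset_segment ℝ _ _ hz)] at hlt
  obtain ⟨r, r0, r1, rfl⟩ := mem_oseg.1 hz
  have e1 : crs n' a n = crs n n' a := (crs_rot n n' a).symm
  have e2 : crs a n n' = crs n n' a := crs_rot a n n'
  have p1 : 0 < crs n' a (pt n n' r) := by
    rw [crs_pt]; simp only [crs_self_outer, mul_zero, add_zero, e1]; nlinarith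
  have p2 : 0 < crs a n (pt n n' r) := by
    rw [crs_pt]; simp only [crs_self_right, mul_zero, zero_add, e2]; nlinarith
  have p3 : crs n n' (pt n n' r) = 0 := by rw [crs_pt]; simp
  obtain ⟨ε, _, _, k, a1, a2, a3⟩ := step p1 p2 hy (Or.inr ⟨p3.ge, hlt⟩)
  exact triangle_aux h h' hD a1.le a2 a3.le k

lemma bottom_left {n n' a z : Pl} (h : W.Sees n a) (h' : W.Sees n' a) (hD : 0 < crs n n' a)
    (hz : z ∈ openSegment ℝ n n') {s : ℕ} (hs : s < W.n) (hzs : z ∈ W.oseg s) :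
    n ∈ W.seg s ∧ n' ∈ W.seg s := by
  have hn := (ne_of_crs_ne hD.ne').1
  have hend : ∀ e ∈ W.seg s, e ∉ W.oseg s → e ∉ openSegment ℝ n n' := by
    intro e he heo hen
    obtain ⟨s', hs', hes'⟩ := bottom_exists h h' hD hen ⟨s, hs, he⟩
    have hne : s ≠ s' := by rintro rfl; exact heo hes'
    obtain ⟨b1, b2⟩ := bottom_wall h h' hD hen hs' hes'
    refine no_overlap hs hs' hne hes' he (oseg_subset s hzs) (by rintro rfl; exact heo hzs) ?_
    exact crs_eq_zero_of_line hn b1 b2 (crs_eq_zero_of_mem (openSegment_subset_segment ℝ _ _ hz))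
  obtain ⟨b1, b2⟩ := bottom_wall h h' hD hz hs hzs
  have hX : W.X s ∉ W.oseg s := fun hX => W.ne s hs (left_mem_openSegment_iff.1 hX)
  have hY : W.Y s ∉ W.oseg s := fun hY => W.ne s hs (right_mem_openSegment_iff.1 hY)
  have eX := hend _ (left_mem_segment _ _ _) hX
  have eY := hend _ (right_mem_segment _ _ _) hY
  obtain ⟨α, hα⟩ := exists_pt_of_crs hn b1
  obtain ⟨β, hβ⟩ := exists_pt_of_crs hn b2
  obtain ⟨r, r0, r1, rfl⟩ := mem_oseg.1 hz
  have hαβ : α ≠ β := by rintro rfl; exact W.ne s hs (hα.trans hβ.symm)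
  have hzs2 := hzs
  unfold oseg at hzs2
  rw [hα, hβ, pt_mem_oseg_pt hn hαβ] at hzs2
  have fX : ¬ (0 < α ∧ α < 1) := fun hh => eX (by rw [hα]; exact pt_mem_oseg _ _ hh.1 hh.2)
  have fY : ¬ (0 < β ∧ β < 1) := fun hh => eY (by rw [hβ]; exact pt_mem_oseg _ _ hh.1 hh.2)
  have key : ∀ t : ℝ, 0 ≤ t → t ≤ 1 → pt n n' t ∈ W.seg s := by
    intro t t0 t1
    unfold seg
    rw [hα, hβ, pt_mem_seg_pt hn, mem_uIcc]
    rcases lt_or_gt_of_ne hαβ with hlt | hlt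
    · rw [min_eq_left hlt.le, max_eq_right hlt.le] at hzs2
      have : α ≤ 0 := by by_contra! hc; exact fX ⟨hc, hzs2.1.trans r1⟩
      have : 1 ≤ β := by by_contra! hc; exact fY ⟨r0.trans hzs2.2, hc⟩
      left; constructor <;> linarith
    · rw [min_eq_right hlt.le, max_eq_left hlt.le] at hzs2
      have : β ≤ 0 := by by_contra! hc; exact fY ⟨hc, hzs2.1.trans r1⟩
      have : 1 ≤ α := by by_contra! hc; exact fX ⟨r0.trans hzs2.2, hc⟩
      right; constructor <;> linarith
  constructor
  · simpa using key 0 le_rfl zero_le_one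
  · simpa using key 1 zero_le_one le_rfl

/-- If both ends of a segment see a point, then the inner part of the segment only meets the
walls if it is contained in one of them; it meets no inner point of any other wall. -/
lemma bottom {n n' a z : Pl} (h : W.Sees n a) (h' : W.Sees n' a) (hn : n ≠ n')
    (hz : z ∈ openSegment ℝ n n') (hzK : z ∈ W.K) :
    ∃ s < W.n, n ∈ W.seg s ∧ n' ∈ W.seg s ∧ z ∈ W.oseg s ∧
      ∀ t < W.n, ∀ z' ∈ openSegment ℝ n n', z' ∈ W.oseg t → t = s := by
  wlog hD : 0 < crs n n' a generalizing n n'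
  · have hne := bottom_ne h h' hn hz hzK
    have hD' : 0 < crs n' n a := by
      have e : crs n' n a = - crs n n' a := by simp only [crs]; ring
      rw [e]; push Not at hD; have := lt_of_le_of_ne hD hne; linarith
    obtain ⟨s, hs, a1, a2, a3, a4⟩ := this h' h hn.symm (by rwa [oseg_symm]) hD'
    exact ⟨s, hs, a2, a1, a3, fun t ht z' hz' => a4 t ht z' (by rwa [oseg_symm])⟩
  obtain ⟨s, hs, hzs⟩ := bottom_exists h h' hD hz hzK
  obtain ⟨l1, l2⟩ := bottom_left h h' hD hz hs hzs
  refine ⟨s, hs, l1, l2, hzs, fun t ht z' hz' hzt => ?_⟩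
  by_contra hne
  obtain ⟨b1, b2⟩ := bottom_wall h h' hD hz' ht hzt
  refine no_overlap hs ht (Ne.symm hne) hzt ((convex_segment _ _).segment_subset l1 l2
    (openSegment_subset_segment ℝ _ _ hz')) l1 (ne_of_mem_oseg hz' hn).1.symm ?_
  exact crs_eq_zero_of_line hn b1 b2 (by simp)

lemma Sees.sees_vis {x a c : Pl} (h : W.Sees x a) (h' : W.Vis a c) : W.Sees x c := by
  have hc : c ∉ W.K := h'.2.2 c (right_mem_segment _ _ _)
  refine ⟨h.1, h'.2.1, hc, fun z hz hzx hzK => ?_⟩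
  by_cases hxc : x = c
  · subst hxc; rw [segment_same] at hz; exact hzx hz
  by_cases hzc : z = c
  · rw [hzc] at hzK; exact hc hzK
  obtain ⟨s, hs, _, l2, _⟩ := bottom h h'.symm.sees hxc (mem_oseg_of_mem_seg hz hzx hzc) hzK
  exact hc ⟨s, hs, l2⟩

lemma Vis.trans {a b c : Pl} (h : W.Vis a b) (h' : W.Vis b c) : W.Vis a c :=
  (h.sees.sees_vis h').vis (h.2.2 a (left_mem_segment _ _ _))

lemma Sees.ne {x a : Pl} (h : W.Sees x a) (hx : x ∈ W.K) : x ≠ a := by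
  rintro rfl; exact h.2.2.1 hx

/-- The points of a segment outside the walls see whatever both ends see. -/
lemma Sees.seg_vis {n n' a x : Pl} (h : W.Sees n a) (h' : W.Sees n' a)
    (hx : x ∈ segment ℝ n n') (hxK : x ∉ W.K) : W.Vis a x := by
  wlog hD : 0 ≤ crs n n' a generalizing n n'
  · refine this h' h (by rwa [segment_symm]) ?_
    have e : crs n' n a = - crs n n' a := by simp only [crs]; ring
    rw [e]; linarith
  by_cases hxn : x = n
  · subst hxn; exact (h.vis hxK).symm
  by_cases hxn' : x = n'
  · subst hxn'; exact (h'.vis hxK).symm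
  have hn : n ≠ n' := by rintro rfl; rw [segment_same] at hx; exact hxn hx
  rcases hD.eq_or_lt with h0 | hD
  · rcases mem_seg_or_of_line hn h0.symm hx with h1 | h1
    · exact (h.mid h1 hxn).symm
    · exact (h'.mid h1 hxn').symm
  refine Vis.symm ⟨W.convex.segment_subset h.1 h'.1 hx, h.2.1, fun z hz => ?_⟩
  obtain ⟨t, t0, t1, rfl⟩ := mem_seg.1 hz
  rcases t0.eq_or_lt with rfl | t0
  · rwa [pt_zero]
  obtain ⟨r, r0, r1, rfl⟩ := mem_seg.1 hx
  have e1 : crs n' a n = crs n n' a := (crs_rot n n' a).symm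
  have e2 : crs a n n' = crs n n' a := crs_rot a n n'
  refine triangle_aux h h' hD ?_ ?_ ?_
  · rw [crs_pt, crs_pt]; simp only [crs_self_outer, crs_self_right, mul_zero, add_zero, e1]
    have := sub_nonneg.2 t1; have := sub_nonneg.2 r1; positivity
  · rw [crs_pt, crs_pt]; simp only [crs_self_outer, crs_self_right, mul_zero, add_zero, zero_add]
    positivity
  · rw [crs_pt, crs_pt]
    simp only [crs_self_outer, crs_self_right, mul_zero, add_zero, zero_add, e2]
    have := sub_nonneg.2 t1; positivity

/-- `q` is an inner point of the wall `s` that lies on no other wall. -/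
def Reg (W : Arr) (s : ℕ) (q : Pl) : Prop :=
  s < W.n ∧ q ∈ W.Ω ∧ q ∈ W.oseg s ∧ ∀ t < W.n, t ≠ s → q ∉ W.seg t

lemma Reg.mem_K {s : ℕ} {q : Pl} (h : W.Reg s q) : q ∈ W.K := ⟨s, h.1, oseg_subset s h.2.2.1⟩

lemma side_pt (s : ℕ) (a b : Pl) (t : ℝ) :
    W.side s (pt a b t) = (1 - t) * W.side s a + t * W.side s b := crs_pt a b _ _ t

/-- Near a regular point the walls look like a line. -/
lemma Reg.exists_ball {s : ℕ} {q : Pl} (h : W.Reg s q) : ∃ r > 0,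
    Metric.ball q r ⊆ W.Ω ∧ (∀ w ∈ Metric.ball q r, w ∈ W.K → w ∈ W.oseg s) ∧
    (∀ w ∈ Metric.ball q r, w ∈ W.oseg s → W.Reg s w) ∧
    (∀ w ∈ Metric.ball q r, W.side s w = 0 → w ∈ W.oseg s) := by
  have h1 : ∀ᶠ w in 𝓝 q, w ∈ W.Ω := W.isOpen.mem_nhds h.2.1
  have h2 : ∀ᶠ w in 𝓝 q, W.side s w = 0 → w ∈ W.oseg s :=
    eventually_mem_oseg (W.ne s h.1) h.2.2.1
  have h3 : ∀ᶠ w in 𝓝 q, ∀ t ∈ Finset.range W.n, t ≠ s → w ∉ W.seg t := by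
    rw [Filter.eventually_all_finset]
    intro t ht
    by_cases hts : t = s
    · simp [hts]
    have := (isClosed_seg (W.X t) (W.Y t)).isOpen_compl.mem_nhds
      (h.2.2.2 t (Finset.mem_range.1 ht) hts)
    filter_upwards [this] with w hw _ using hw
  obtain ⟨r, r0, hr⟩ := Metric.eventually_nhds_iff_ball.1 (h1.and (h2.and h3))
  refine ⟨r, r0, fun w hw => (hr w hw).1, fun w hw hK => ?_, fun w hw hs => ?_, fun w hw =>
    (hr w hw).2.1⟩
  · obtain ⟨t, ht, hwt⟩ := hK
    by_cases hts : t = s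
    · subst hts; exact (hr w hw).2.1 (side_seg hwt)
    · exact absurd hwt ((hr w hw).2.2 t (Finset.mem_range.2 ht) hts)
  · exact ⟨h.1, (hr w hw).1, hs, fun t ht => (hr w hw).2.2 t (Finset.mem_range.2 ht)⟩

lemma Reg.side_ne {s : ℕ} {q a : Pl} (h : W.Reg s q) (hqa : W.Sees q a) : W.side s a ≠ 0 := by
  intro h0
  obtain ⟨r, r0, -, -, -, h4⟩ := h.exists_ball
  have h1 : ∀ᶠ ε in 𝓝[>] (0 : ℝ), pt q a ε ∈ Metric.ball q r :=
    (tendsto_pt q a).eventually (Metric.ball_mem_nhds q r0)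
  obtain ⟨ε, h2, ε0, ε1⟩ := (h1.and eventually_small).exists
  have h5 := h4 _ h2 (by rw [side_pt, h0, side_seg (oseg_subset s h.2.2.1)]; ring)
  refine hqa.2.2.2 _ (pt_mem_seg _ _ ε0.le ε1.le) (fun e => ?_) ⟨s, h.1, oseg_subset s h5⟩
  have := pt_inj (hqa.ne h.mem_K) (e.trans (pt_zero q a).symm)
  linarith

lemma Reg.exists_near {s : ℕ} {q : Pl} (h : W.Reg s q) : ∃ r > 0,
    Metric.ball q r ⊆ W.Ω ∧
    (∀ w ∈ Metric.ball q r, W.side s w = 0 → W.Reg s w) ∧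
    (∀ x ∈ Metric.ball q r, ∀ a ∈ Metric.ball q r, W.side s x = 0 → W.side s a ≠ 0 →
      W.Sees x a) ∧
    (∀ a ∈ Metric.ball q r, ∀ c ∈ Metric.ball q r, 0 < W.side s a * W.side s c → W.Vis a c) := by
  obtain ⟨r, r0, h1, h2, h3, h4⟩ := h.exists_ball
  have hsub : ∀ x ∈ Metric.ball q r, ∀ a ∈ Metric.ball q r, segment ℝ x a ⊆ Metric.ball q r :=
    fun x hx a ha => (convex_ball q r).segment_subset hx ha
  have hK : ∀ w ∈ Metric.ball q r, W.side s w ≠ 0 → w ∉ W.K :=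
    fun w hw hs hwK => hs (side_seg (oseg_subset s (h2 w hw hwK)))
  refine ⟨r, r0, h1, fun w hw hs => h3 w hw (h4 w hw hs), fun x hx a ha hx0 ha0 => ?_,
    fun a ha c hc hac => ?_⟩
  · refine ⟨h1 hx, h1 ha, hK a ha ha0, fun z hz hzx => hK z (hsub x hx a ha hz) ?_⟩
    obtain ⟨t, t0, t1, rfl⟩ := mem_seg.1 hz
    rw [side_pt, hx0]
    have : t ≠ 0 := by rintro rfl; exact hzx (pt_zero _ _)
    simp [this, ha0]
  · refine ⟨h1 ha, h1 hc, fun z hz => hK z (hsub a ha c hc hz) ?_⟩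
    obtain ⟨t, t0, t1, rfl⟩ := mem_seg.1 hz
    rw [side_pt]
    intro h0
    rcases pos_and_pos_or_neg_and_neg_of_mul_pos hac with ⟨p1, p2⟩ | ⟨p1, p2⟩ <;>
    rcases t0.eq_or_lt with rfl | t0 <;> nlinarith

lemma Reg.exists_pt_near {s : ℕ} {q a : Pl} (h : W.Reg s q) (hqa : W.Sees q a) {r : ℝ}
    (hr : 0 < r) : ∃ a' ∈ Metric.ball q r, W.Sees q a' ∧ W.Vis a' a ∧
      0 < W.side s a' * W.side s a := by
  have h1 : ∀ᶠ ε in 𝓝[>] (0 : ℝ), pt q a ε ∈ Metric.ball q r :=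
    (tendsto_pt q a).eventually (Metric.ball_mem_nhds q hr)
  obtain ⟨ε, h2, ε0, ε1⟩ := (h1.and eventually_small).exists
  have hne : pt q a ε ≠ q := fun e => by
    have := pt_inj (hqa.ne h.mem_K) (e.trans (pt_zero q a).symm)
    linarith
  have hm := pt_mem_seg q a ε0.le ε1.le
  refine ⟨_, h2, hqa.near hm hne, hqa.mid hm hne, ?_⟩
  rw [side_pt, side_seg (oseg_subset s h.2.2.1)]
  have := mul_pos ε0 (mul_self_pos.2 (h.side_ne hqa))
  nlinarith

/-- Points seen from a regular point on the same side see each other. -/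
lemma Reg.vis {s : ℕ} {q a c : Pl} (h : W.Reg s q) (ha : W.Sees q a) (hc : W.Sees q c)
    (hac : 0 < W.side s a * W.side s c) : W.Vis a c := by
  obtain ⟨r, r0, h1, h2, h3, h4⟩ := h.exists_near
  obtain ⟨a', ha', _, a2, a3⟩ := h.exists_pt_near ha r0
  obtain ⟨c', hc', _, c2, c3⟩ := h.exists_pt_near hc r0
  have : 0 < W.side s a' * W.side s c' := by
    have := mul_pos (mul_pos a3 c3) hac
    have e : W.side s a' * W.side s a * (W.side s c' * W.side s c) * (W.side s a * W.side s c) =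
      (W.side s a' * W.side s c') * (W.side s a * W.side s c) ^ 2 := by ring
    rw [e] at this
    exact pos_of_mul_pos_left this (sq_nonneg _)
  exact a2.symm.trans ((h4 a' ha' c' hc' this).trans c2)

lemma Reg.not_vis {s : ℕ} {q a c : Pl} (h : W.Reg s q) (ha : W.Sees q a)
    (hac : W.side s a * W.side s c < 0) : ¬ W.Vis a c := by
  intro hv
  have hne : W.side s c - W.side s a ≠ 0 := by
    intro e; rw [sub_eq_zero.1 e] at hac; exact absurd hac (not_lt.2 (mul_self_nonneg _))
  set t := - W.side s a / (W.side s c - W.side s a) with ht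
  have hte : t * (W.side s c - W.side s a) = - W.side s a := div_mul_cancel₀ _ hne
  have h0 : W.side s (pt a c t) = 0 := by rw [side_pt]; linarith
  have t0 : 0 ≤ t := by
    by_contra! hc
    rcases mul_neg_iff.1 hac with ⟨p1, p2⟩ | ⟨p1, p2⟩ <;> nlinarith
  have t1 : t ≤ 1 := by
    by_contra! hc
    rcases mul_neg_iff.1 hac with ⟨p1, p2⟩ | ⟨p1, p2⟩ <;> nlinarith
  have hm := pt_mem_seg a c t0 t1
  by_cases e : pt a c t = a
  · rw [e] at h0; rw [h0] at hac; simp at hac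
  · exact h.side_ne (ha.sees_vis (hv.sees.near hm e |>.vis (hv.2.2 a (left_mem_segment _ _ _)))) h0

/-- The points near a regular point on the same wall see the same points. -/
lemma Reg.slide {s : ℕ} {q a : Pl} (h : W.Reg s q) (ha : W.Sees q a) :
    ∀ᶠ x in 𝓝 q, x ∈ W.oseg s → W.Reg s x ∧ W.Sees x a := by
  obtain ⟨r, r0, h1, h2, h3, h4⟩ := h.exists_near
  obtain ⟨a', ha', a1, a2, a3⟩ := h.exists_pt_near ha r0
  filter_upwards [Metric.ball_mem_nhds q r0] with x hx hxs
  have h0 := side_seg (oseg_subset s hxs)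
  refine ⟨h2 x hx h0, (h3 x hx a' ha' h0 (h.side_ne a1)).sees_vis a2⟩

end Arr
end OnePlanar

namespace OnePlanar
open Filter Topology

lemma oseg_left_subset {x y z : Pl} (hz : z ∈ openSegment ℝ x y) :
    openSegment ℝ x z ⊆ openSegment ℝ x y := by
  intro w hw
  obtain ⟨r, r0, r1, rfl⟩ := mem_oseg.1 hz
  obtain ⟨s, s0, s1, rfl⟩ := mem_oseg.1 hw
  have := pt_pt x y 0 r s
  rw [pt_zero] at this
  rw [this]
  refine pt_mem_oseg _ _ ?_ ?_ <;> nlinarith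

lemma oseg_right_subset {x y z : Pl} (hz : z ∈ openSegment ℝ x y) :
    openSegment ℝ z y ⊆ openSegment ℝ x y := by
  rw [oseg_symm x y, oseg_symm z y]
  exact oseg_left_subset (by rwa [oseg_symm])

lemma eventually_affine_ne {f g : ℝ} (h : f ≠ 0 ∨ g ≠ 0) :
    ∀ᶠ ε in 𝓝[>] (0 : ℝ), (1 - ε) * f + ε * g ≠ 0 := by
  by_cases hf : f = 0
  · subst hf
    filter_upwards [eventually_small] with ε hε
    simp only [ne_eq, not_true_eq_false, false_or] at h
    simpa using ⟨hε.1.ne', h⟩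
  · have : Continuous fun ε : ℝ => (1 - ε) * f + ε * g := by fun_prop
    have h1 := this.continuousAt.eventually_ne (x := 0) (y := 0) (by simpa using hf)
    exact h1.filter_mono nhdsWithin_le_nhds

namespace Arr
variable {W : Arr}

/-- Walls that are not crossed by one of the first `h` walls. -/
def Free (W : Arr) (s : ℕ) : Prop :=
  s < W.n ∧ (W.h ≤ s ∨ ∀ t < W.h, t < W.n → t ≠ s → Disjoint (W.seg t) (W.oseg s))

lemma Free.lt_of_mem {s t : ℕ} (hs : W.Free s) (ht : t < W.n) (hts : t ≠ s) {z : Pl}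
    (hz : z ∈ W.seg t) (hz' : z ∈ W.oseg s) : W.h ≤ t ∧ s < t := by
  rcases hs with ⟨hs, h | h⟩
  · rcases lt_or_gt_of_ne hts with hlt | hlt
    · exact absurd hz' (Set.disjoint_left.1 (W.order s hs h t hlt) hz)
    · exact ⟨h.trans hlt.le, hlt⟩
  · have hth : W.h ≤ t := by
      by_contra! hc
      exact Set.disjoint_left.1 (h t hc ht hts) hz hz'
    refine ⟨hth, lt_of_le_of_ne ?_ hts.symm⟩
    by_contra! hc
    exact Set.disjoint_left.1 (W.order s hs (hth.trans hc.le) t hc) hz hz'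

/-- `l` lists the walls crossed, with the points where they are crossed, by a curve from `a` to
`b`. -/
def Route (W : Arr) : Pl → List (ℕ × Pl) → Pl → Prop
  | a, [], b => W.Vis a b
  | a, e :: l, b => W.Free e.1 ∧ W.Reg e.1 e.2 ∧ W.Sees e.2 a ∧
      ∃ c, W.Sees e.2 c ∧ W.side e.1 a * W.side e.1 c < 0 ∧ Route W c l b

lemma Reg.side_pos {s : ℕ} {q a c : Pl} (h : W.Reg s q) (ha : W.Sees q a) (hac : W.Vis a c) :
    0 < W.side s a * W.side s c := by
  by_contra! hc
  rcases hc.lt_or_eq with hc | hc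
  · exact h.not_vis ha hc hac
  · rcases mul_eq_zero.1 hc with h0 | h0
    · exact h.side_ne ha h0
    · exact h.side_ne (ha.sees_vis hac) h0

lemma mul_neg_of_mul_pos {x y z : ℝ} (h : 0 < x * y) (h' : x * z < 0) : y * z < 0 := by
  rcases mul_neg_iff.1 h' with ⟨p1, p2⟩ | ⟨p1, p2⟩
  · exact mul_neg_of_pos_of_neg ((mul_pos_iff_of_pos_left p1).1 h) p2
  · exact mul_neg_of_neg_of_pos (by nlinarith) p2

lemma Route.vis_left {a a' b : Pl} {l : List (ℕ × Pl)} (h : W.Route a l b) (ha : W.Vis a a') :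
    W.Route a' l b := by
  cases l with
  | nil => exact ha.symm.trans h
  | cons e l =>
    obtain ⟨h1, h2, h3, c, h4, h5, h6⟩ := h
    exact ⟨h1, h2, h3.sees_vis ha, c, h4, mul_neg_of_mul_pos (h2.side_pos h3 ha) h5, h6⟩

lemma Route.append {a b c : Pl} {l l' : List (ℕ × Pl)} (h : W.Route a l b) (h' : W.Route b l' c) :
    W.Route a (l ++ l') c := by
  induction l generalizing a with
  | nil => exact h'.vis_left (Vis.symm h)
  | cons e l ih =>
    obtain ⟨h1, h2, h3, d, h4, h5, h6⟩ := h
    exact ⟨h1, h2, h3, d, h4, h5, ih h6⟩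

lemma Route.vis_right {a b b' : Pl} {l : List (ℕ × Pl)} (h : W.Route a l b) (hb : W.Vis b b') :
    W.Route a l b' := by
  have := h.append (l' := []) (c := b') hb
  rwa [List.append_nil] at this

lemma Sees.self_right {x b : Pl} (h : W.Sees x b) : W.Vis b b := Vis.refl h.2.1 h.2.2.1

lemma Route.single {s : ℕ} {q a c : Pl} (h1 : W.Free s) (h2 : W.Reg s q) (h3 : W.Sees q a)
    (h4 : W.Sees q c) (h5 : W.side s a * W.side s c < 0) : W.Route a [(s, q)] c :=
  ⟨h1, h2, h3, c, h4, h5, h4.self_right⟩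

lemma Route.reverse {a b : Pl} {l : List (ℕ × Pl)} (h : W.Route a l b) :
    W.Route b l.reverse a := by
  induction l generalizing a with
  | nil => exact Vis.symm h
  | cons e l ih =>
    obtain ⟨h1, h2, h3, d, h4, h5, h6⟩ := h
    rw [List.reverse_cons]
    exact (ih h6).append (Route.single h1 h2 h4 h3 (by rwa [mul_comm]))

/-- The part of the segment between `x` and `y` crosses the walls properly at free places. -/
def Clean (W : Arr) (x y : Pl) : Prop :=
  ∀ z ∈ openSegment ℝ x y, z ∈ W.K → ∃ t, W.Free t ∧ W.Reg t z ∧ W.side t x ≠ W.side t y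

lemma Clean.left {x y z : Pl} (h : W.Clean x y) (hz : z ∈ openSegment ℝ x y) : W.Clean x z := by
  intro w hw hK
  obtain ⟨t, h1, h2, h3⟩ := h w (oseg_left_subset hz hw) hK
  refine ⟨t, h1, h2, ?_⟩
  obtain ⟨r, r0, r1, rfl⟩ := mem_oseg.1 hz
  rw [side_pt]
  intro e
  exact h3 (mul_left_cancel₀ r0.ne' (by linarith))

lemma Clean.symm {x y : Pl} (h : W.Clean x y) : W.Clean y x := by
  intro w hw hK
  obtain ⟨t, h1, h2, h3⟩ := h w (by rwa [oseg_symm]) hK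
  exact ⟨t, h1, h2, h3.symm⟩

lemma Clean.right {x y z : Pl} (h : W.Clean x y) (hz : z ∈ openSegment ℝ x y) : W.Clean z y :=
  (h.symm.left (by rwa [oseg_symm])).symm

lemma Reg.eq {s t : ℕ} {z : Pl} (h : W.Reg t z) (hs : s < W.n) (hz : z ∈ W.seg s) : s = t := by
  by_contra hne
  exact h.2.2.2 s hs hne hz

lemma Clean.uniq {x y z z' : Pl} (h : W.Clean x y) (hz : z ∈ openSegment ℝ x y)
    (hz' : z' ∈ openSegment ℝ x y) {s : ℕ} (hs : s < W.n) (h1 : z ∈ W.seg s) (h2 : z' ∈ W.seg s) :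
    z = z' := by
  obtain ⟨t, _, ht, hne⟩ := h z hz ⟨s, hs, h1⟩
  obtain rfl := ht.eq hs h1
  have e1 := side_seg h1
  have e2 := side_seg h2
  obtain ⟨r, r0, r1, rfl⟩ := mem_oseg.1 hz
  obtain ⟨r', r0', r1', rfl⟩ := mem_oseg.1 hz'
  rw [side_pt] at e1 e2
  have : (r - r') * (W.side s x - W.side s y) = 0 := by linarith
  rcases mul_eq_zero.1 this with h0 | h0
  · rw [sub_eq_zero.1 h0]
  · exact absurd (sub_eq_zero.1 h0) hne

/-- The curve running along a clean segment. -/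
lemma Clean.exists_route {x y : Pl} (hxy : x ≠ y) (hx : x ∈ W.Ω) (hy : y ∈ W.Ω)
    (h : W.Clean x y) : ∃ a ∈ openSegment ℝ x y, ∃ b ∈ openSegment ℝ x y, ∃ l, W.Sees x a ∧
      W.Route a l b ∧ W.Sees y b ∧ (∀ e ∈ l, e.2 ∈ openSegment ℝ x y ∧ W.Reg e.1 e.2) ∧
      (l.map Prod.fst).Nodup := by
  classical
  generalize hk : ((Finset.range W.n).filter fun t => ∃ z ∈ openSegment ℝ x y, z ∈ W.seg t).card = k
  induction k using Nat.strong_induction_on generalizing x y with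
  | _ k ih =>
  by_cases hK : ∃ z ∈ openSegment ℝ x y, z ∈ W.K
  · obtain ⟨z, hz, hzK⟩ := hK
    obtain ⟨t, t1, t2, t3⟩ := h z hz hzK
    have hzt := oseg_subset t t2.2.2.1
    have hzΩ := t2.2.1
    have hzne := ne_of_mem_oseg hz hxy
    have htn := t2.1
    have c1 : ((Finset.range W.n).filter fun t => ∃ w ∈ openSegment ℝ x z, w ∈ W.seg t).card < k := by
      rw [← hk]
      refine Finset.card_lt_card (Finset.ssubset_iff_of_subset ?_ |>.2 ⟨t, ?_, ?_⟩)
      · intro s hs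
        simp only [Finset.mem_filter] at hs ⊢
        obtain ⟨hs, w, hw, hws⟩ := hs
        exact ⟨hs, w, oseg_left_subset hz hw, hws⟩
      · simp only [Finset.mem_filter, Finset.mem_range]
        exact ⟨htn, z, hz, hzt⟩
      · simp only [Finset.mem_filter, not_and]
        rintro _ ⟨w, hw, hwt⟩
        have := h.uniq (oseg_left_subset hz hw) hz htn hwt hzt
        exact (ne_of_mem_oseg hw hzne.1.symm).2 this
    have c2 : ((Finset.range W.n).filter fun t => ∃ w ∈ openSegment ℝ z y, w ∈ W.seg t).card < k := by
      rw [← hk]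
      refine Finset.card_lt_card (Finset.ssubset_iff_of_subset ?_ |>.2 ⟨t, ?_, ?_⟩)
      · intro s hs
        simp only [Finset.mem_filter] at hs ⊢
        obtain ⟨hs, w, hw, hws⟩ := hs
        exact ⟨hs, w, oseg_right_subset hz hw, hws⟩
      · simp only [Finset.mem_filter, Finset.mem_range]
        exact ⟨htn, z, hz, hzt⟩
      · simp only [Finset.mem_filter, not_and]
        rintro _ ⟨w, hw, hwt⟩
        have := h.uniq (oseg_right_subset hz hw) hz htn hwt hzt
        exact (ne_of_mem_oseg hw hzne.2).1 this
    obtain ⟨a, ha, b, hb, l, l1, l2, l3, l4, l5⟩ := ih _ c1 hzne.1.symm hx hzΩ (h.left hz) rfl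
    obtain ⟨a', ha', b', hb', l', l1', l2', l3', l4', l5'⟩ :=
      ih _ c2 hzne.2 hzΩ hy (h.right hz) rfl
    have hopp : W.side t b * W.side t a' < 0 := by
      obtain ⟨s, s0, s1, rfl⟩ := mem_oseg.1 hb
      obtain ⟨s', s0', s1', rfl⟩ := mem_oseg.1 ha'
      have hz0 := side_seg hzt
      rw [side_pt, side_pt, hz0]
      obtain ⟨r, r0, r1, rfl⟩ := mem_oseg.1 hz
      rw [side_pt] at hz0
      have hyne : W.side t y ≠ 0 := by
        intro h0
        rw [h0] at hz0 t3
        simp only [mul_zero, add_zero, mul_eq_zero] at hz0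
        rcases hz0 with h1 | h1
        · linarith
        · exact t3 h1
      have hprod : (1 - r) * (W.side t x * W.side t y) = - (r * (W.side t y * W.side t y)) := by
        linear_combination (W.side t y) * hz0
      have hneg : W.side t x * W.side t y < 0 := by
        have := mul_pos r0 (mul_self_pos.2 hyne)
        by_contra! hc
        have := mul_nonneg (sub_nonneg.2 r1.le) hc
        linarith
      have := mul_pos (sub_pos.2 s1) s0'
      nlinarith
    refine ⟨a, oseg_left_subset hz ha, b', oseg_right_subset hz hb', l ++ (t, z) :: l', l1,
      l2.append ⟨t1, t2, l3, a', l1', hopp, l2'⟩, l3', ?_, ?_⟩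
    · intro e he
      rcases List.mem_append.1 he with he | he
      · exact ⟨oseg_left_subset hz (l4 e he).1, (l4 e he).2⟩
      rcases List.mem_cons.1 he with rfl | he
      · exact ⟨hz, t2⟩
      · exact ⟨oseg_right_subset hz (l4' e he).1, (l4' e he).2⟩
    · rw [List.map_append, List.map_cons]
      have k1 : ∀ e ∈ l, ∀ w ∈ openSegment ℝ x y, w ∈ W.seg e.1 → w ∈ openSegment ℝ x z := by
        intro e he w hw hwe
        have := h.uniq hw (oseg_left_subset hz (l4 e he).1) (l4 e he).2.1 hwe
          (oseg_subset _ (l4 e he).2.2.2.1)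
        rw [this]; exact (l4 e he).1
      have k2 : ∀ e ∈ l', ∀ w ∈ openSegment ℝ x y, w ∈ W.seg e.1 → w ∈ openSegment ℝ z y := by
        intro e he w hw hwe
        have := h.uniq hw (oseg_right_subset hz (l4' e he).1) (l4' e he).2.1 hwe
          (oseg_subset _ (l4' e he).2.2.2.1)
        rw [this]; exact (l4' e he).1
      have kd : ∀ w, w ∈ openSegment ℝ x z → w ∉ openSegment ℝ z y := by
        intro w hw hw'
        obtain ⟨r, r0, r1, rfl⟩ := mem_oseg.1 hz
        have e1 : openSegment ℝ x (pt x y r) = openSegment ℝ (pt x y 0) (pt x y r) := by rw [pt_zero]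
        have e2 : openSegment ℝ (pt x y r) y = openSegment ℝ (pt x y r) (pt x y 1) := by rw [pt_one]
        obtain ⟨s, s0, s1, rfl⟩ := mem_oseg.1 (oseg_left_subset hz hw)
        rw [e1, pt_mem_oseg_pt hxy r0.ne, min_eq_left r0.le, max_eq_right r0.le] at hw
        rw [e2, pt_mem_oseg_pt hxy r1.ne, min_eq_left r1.le, max_eq_right r1.le] at hw'
        linarith [hw.2, hw'.1]
      refine List.nodup_append.2 ⟨l5, List.nodup_cons.2 ⟨?_, l5'⟩, ?_⟩
      · intro hm
        obtain ⟨e, he, rfl⟩ := List.mem_map.1 hm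
        exact (ne_of_mem_oseg (k2 e he z hz hzt) hzne.2).1 rfl
      · intro s hs s' hs' hss
        obtain ⟨e, he, rfl⟩ := List.mem_map.1 hs
        rcases List.mem_cons.1 hs' with h1 | h1
        · rw [h1] at hss
          exact (ne_of_mem_oseg (k1 e he z hz (by rwa [hss])) hzne.1.symm).2 rfl
        · obtain ⟨e', he', rfl⟩ := List.mem_map.1 h1
          refine kd e.2 (l4 e he).1 (k2 e' he' e.2 (oseg_left_subset hz (l4 e he).1) ?_)
          rw [← hss]; exact oseg_subset _ (l4 e he).2.2.2.1
  · push Not at hK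
    have hm : pt x y (1 / 2) ∈ openSegment ℝ x y := pt_mem_oseg _ _ (by norm_num) (by norm_num)
    have hmΩ := W.convex.openSegment_subset hx hy hm
    refine ⟨_, hm, _, hm, [], ⟨hx, hmΩ, hK _ hm, fun w hw hwx => ?_⟩, Vis.refl hmΩ (hK _ hm),
      ⟨hy, hmΩ, hK _ hm, fun w hw hwx => ?_⟩, by simp, by simp⟩
    · by_cases e : w = pt x y (1 / 2)
      · rw [e]; exact hK _ hm
      · exact hK _ (oseg_left_subset hm (mem_oseg_of_mem_seg hw hwx e))
    · by_cases e : w = pt x y (1 / 2)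
      · rw [e]; exact hK _ hm
      · refine hK _ (oseg_right_subset hm ?_)
        rw [oseg_symm]; exact mem_oseg_of_mem_seg hw hwx e

/-- A curve that runs close along a wall. -/
lemma Reg.exists_chain {s : ℕ} {q b x : Pl} (hs : W.Free s) (hq : W.Reg s q) (hb : W.Sees q b)
    (hx : x ∈ W.seg s) (hxΩ : x ∈ W.Ω) : ∃ a l, W.Sees x a ∧ W.Route a l b ∧
      0 < W.side s a * W.side s b ∧ (l.map Prod.fst).Nodup ∧ ∀ e ∈ l, s < e.1 ∧ W.h ≤ e.1 := by
  have hbs := hq.side_ne hb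
  by_cases hxq : x = q
  · subst hxq
    exact ⟨b, [], hb, hb.self_right, mul_self_pos.2 hbs, by simp, by simp⟩
  have hqs := hq.2.2.1
  have hq0 := side_seg (oseg_subset s hqs)
  have hx0 := side_seg hx
  have hb0 : crs x q b ≠ 0 := by
    intro h0
    refine hbs ?_
    have e1 : crs x q (W.X s) = 0 := crs_eq_zero_of_line (W.ne s hq.1) hx0 hq0 (by simp)
    have e2 : crs x q (W.Y s) = 0 := crs_eq_zero_of_line (W.ne s hq.1) hx0 hq0 (by simp)
    exact crs_eq_zero_of_line hxq e1 e2 h0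
  have hwit : ∀ᶠ δ in 𝓝[>] (0 : ℝ), ∀ z ∈ {z | (∃ t < W.n, z = W.X t ∨ z = W.Y t) ∨
      ∃ t < W.n, ∃ t' < W.n, t ≠ t' ∧ z ∈ W.seg t ∧ z ∈ W.seg t'}, z ≠ x →
      crs x z (pt q b δ) ≠ 0 := by
    refine (Filter.eventually_all_finite ?_).2 fun z _ => ?_
    · refine Set.Finite.union ?_ ?_
      · have : {z | ∃ t < W.n, z = W.X t ∨ z = W.Y t} ⊆
            ((Finset.range W.n).image W.X ∪ (Finset.range W.n).image W.Y : Finset Pl) := by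
          rintro z ⟨t, ht, rfl | rfl⟩
          · simp only [Finset.coe_union, Finset.coe_image, mem_union]
            exact Or.inl ⟨t, by simpa using ht, rfl⟩
          · simp only [Finset.coe_union, Finset.coe_image, mem_union]
            exact Or.inr ⟨t, by simpa using ht, rfl⟩
        exact (Finset.finite_toSet _).subset this
      · have : {z | ∃ t < W.n, ∃ t' < W.n, t ≠ t' ∧ z ∈ W.seg t ∧ z ∈ W.seg t'} ⊆
            ⋃ t ∈ Finset.range W.n, ⋃ t' ∈ Finset.range W.n,
              {z | t < W.n ∧ t' < W.n ∧ t ≠ t' ∧ z ∈ W.seg t ∧ z ∈ W.seg t'} := by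
          rintro z ⟨t, ht, t', ht', hne, h1, h2⟩
          simp only [mem_iUnion]
          exact ⟨t, by simpa using ht, t', by simpa using ht', ht, ht', hne, h1, h2⟩
        refine Set.Finite.subset ?_ this
        refine Set.Finite.biUnion (Finset.finite_toSet _) fun t _ =>
          Set.Finite.biUnion (Finset.finite_toSet _) fun t' _ => Set.Subsingleton.finite ?_
        rintro z ⟨ht, ht', hne, h1, h2⟩ w ⟨_, _, _, h1', h2'⟩
        exact W.sub t ht t' ht' hne ⟨h1, h2⟩ ⟨h1', h2'⟩
    · by_cases hzx : z = x
      · simp [hzx]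
      have : crs x z q ≠ 0 ∨ crs x z b ≠ 0 := by
        by_contra! hc
        exact hb0 (crs_eq_zero_of_line (Ne.symm hzx) (by simp) hc.1 hc.2)
      filter_upwards [eventually_affine_ne this] with δ hδ _
      rwa [crs_pt]
  have hthru : ∀ᶠ δ in 𝓝[>] (0 : ℝ), ∀ t ∈ Finset.range W.n, x ∈ W.seg t →
      W.side t (pt q b δ) ≠ 0 := by
    refine (Filter.eventually_all_finset _).2 fun t ht => ?_
    by_cases hxt : x ∈ W.seg t
    · have hx1 := side_seg hxt
      have : W.side t q ≠ 0 ∨ W.side t b ≠ 0 := by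
        by_contra! hc
        exact hb0 (crs_eq_zero_of_line (W.ne t (Finset.mem_range.1 ht)) hx1 hc.1 hc.2)
      filter_upwards [eventually_affine_ne this] with δ hδ _
      rwa [side_pt]
    · simp [hxt]
  have hdis : ∀ᶠ δ in 𝓝[>] (0 : ℝ), ∀ t ∈ Finset.range W.n,
      ¬ Touch x q (W.X t) (W.Y t) → ¬ Touch x (pt q b δ) (W.X t) (W.Y t) := by
    refine (Filter.eventually_all_finset _).2 fun t _ => ?_
    by_cases hT : Touch x q (W.X t) (W.Y t)
    · simp [hT]
    obtain ⟨ε, ε0, hε⟩ := exists_stable_of_not_touch hT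
    have := (tendsto_pt q b).eventually (Metric.ball_mem_nhds q ε0)
    filter_upwards [this] with δ hδ _
    exact hε _ _ _ _ (by simpa using ε0) hδ (by simpa using ε0) (by simpa using ε0)
  obtain ⟨δ, h1, h2, h3, δ0, δ1⟩ := (hwit.and (hthru.and (hdis.and eventually_small))).exists
  have hqb := hb.ne hq.mem_K
  have hcne : pt q b δ ≠ q := fun e => by
    have := pt_inj hqb (e.trans (pt_zero q b).symm)
    linarith
  have hcm := pt_mem_seg q b δ0.le δ1.le
  have hcb : W.Vis (pt q b δ) b := hb.mid hcm hcne
  have hcK := hcb.2.2 _ (left_mem_segment _ _ _)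
  have hcs : W.side s (pt q b δ) = δ * W.side s b := by rw [side_pt, hq0]; ring
  set c := pt q b δ with hc
  have hxc : x ≠ c := by
    rintro e
    have : W.side s c = 0 := by rw [← e]; exact hx0
    rw [this] at hcs
    exact (mul_ne_zero δ0.ne' hbs) hcs.symm
  have hopen : ∀ z ∈ openSegment ℝ x c, 0 < W.side s z * W.side s b := by
    intro z hz
    obtain ⟨r, r0, r1, rfl⟩ := mem_oseg.1 hz
    rw [side_pt, hx0, hcs]
    have := mul_pos (mul_pos r0 δ0) (mul_self_pos.2 hbs)
    nlinarith
  have key : ∀ z ∈ openSegment ℝ x c, ∀ t < W.n, z ∈ W.seg t →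
      s < t ∧ W.h ≤ t ∧ W.side t x ≠ 0 := by
    intro z hz t ht hzt
    have hts : t ≠ s := by
      rintro rfl
      have := hopen z hz
      rw [side_seg hzt] at this
      simp at this
    have hzx := (ne_of_mem_oseg hz hxc).1
    have hxt : x ∉ W.seg t := by
      intro hxt
      refine h2 t (Finset.mem_range.2 ht) hxt ?_
      have e1 : crs x z c = 0 := by
        obtain ⟨r, r0, r1, rfl⟩ := mem_oseg.1 hz
        have := crs_pt_pt_pt x c 0 r 1
        rwa [pt_zero, pt_one] at this
      have g1 : crs x z (W.X t) = 0 := crs_eq_zero_of_line (W.ne t ht) (side_seg hxt)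
        (side_seg hzt) (by simp)
      have g2 : crs x z (W.Y t) = 0 := crs_eq_zero_of_line (W.ne t ht) (side_seg hxt)
        (side_seg hzt) (by simp)
      exact crs_eq_zero_of_line hzx.symm g1 g2 e1
    have hT : Touch x q (W.X t) (W.Y t) := by
      by_contra hT
      exact h3 t (Finset.mem_range.2 ht) hT ⟨z, openSegment_subset_segment ℝ _ _ hz, hzt⟩
    obtain ⟨w, hw, hwt⟩ := hT
    have hwx : w ≠ x := by rintro rfl; exact hxt hwt
    have hwq : w ≠ q := by rintro rfl; exact hq.2.2.2 t ht hts hwt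
    have hws : w ∈ W.oseg s := by
      have hw' := mem_oseg_of_mem_seg hw hwx hwq
      have : openSegment ℝ x q ⊆ W.oseg s := by
        intro v hv
        obtain ⟨α, α0, α1, hα⟩ := mem_seg.1 hx
        obtain ⟨β, β0, β1, hβ⟩ := mem_oseg.1 hqs
        obtain ⟨γ, γ0, γ1, rfl⟩ := mem_oseg.1 hv
        rw [hα, hβ, pt_pt]
        refine pt_mem_oseg _ _ ?_ ?_ <;> nlinarith
      exact this hw'
    obtain ⟨k1, k2⟩ := hs.lt_of_mem ht hts hwt hws
    refine ⟨k2, k1, fun h0 => ?_⟩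
    have hw0 := side_seg hwt
    have hws0 := side_seg (oseg_subset s hws)
    have g : ∀ y, W.side t y = 0 → W.side s y = 0 := by
      intro y hy
      have e1 : crs x w y = 0 := crs_eq_zero_of_line (W.ne t ht) h0 hw0 hy
      have e2 : crs x w (W.X s) = 0 := crs_eq_zero_of_line (W.ne s hq.1) hx0 hws0 (by simp)
      have e3 : crs x w (W.Y s) = 0 := crs_eq_zero_of_line (W.ne s hq.1) hx0 hws0 (by simp)
      exact crs_eq_zero_of_line hwx.symm e2 e3 e1
    by_cases hwX : W.X t = w
    · exact no_overlap ht hq.1 hts hws hwt (right_mem_segment _ _ _)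
        (fun e => W.ne t ht (hwX.trans e.symm)) (g _ (by simp [side]))
    · exact no_overlap ht hq.1 hts hws hwt (left_mem_segment _ _ _) hwX (g _ (by simp [side]))
  have hclean : W.Clean x c := by
    intro z hz hzK
    obtain ⟨t, ht, hzt⟩ := hzK
    obtain ⟨k1, k2, k3⟩ := key z hz t ht hzt
    have hzx := (ne_of_mem_oseg hz hxc).1
    have hcrs : crs x z c = 0 := by
      obtain ⟨r, r0, r1, rfl⟩ := mem_oseg.1 hz
      have := crs_pt_pt_pt x c 0 r 1
      rwa [pt_zero, pt_one] at this
    refine ⟨t, ⟨ht, Or.inl k2⟩, ⟨ht, W.convex.openSegment_subset hxΩ hcb.1 hz, ?_, ?_⟩, ?_⟩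
    · refine mem_oseg_of_mem_seg hzt ?_ ?_ <;> intro e
      · exact h1 z (Or.inl ⟨t, ht, Or.inl e⟩) hzx hcrs
      · exact h1 z (Or.inl ⟨t, ht, Or.inr e⟩) hzx hcrs
    · intro t' ht' hne hzt'
      exact h1 z (Or.inr ⟨t, ht, t', ht', hne.symm, hzt, hzt'⟩) hzx hcrs
    · intro e
      have e1 := side_seg hzt
      obtain ⟨r, r0, r1, rfl⟩ := mem_oseg.1 hz
      rw [side_pt, ← e] at e1
      exact k3 (by linarith)
  obtain ⟨a, ha, b', hb', l, l1, l2, l3, l4, l5⟩ := hclean.exists_route hxc hxΩ hcb.1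
  refine ⟨a, l, l1, l2.vis_right ((l3.vis hcK).symm.trans hcb), hopen a ha, l5, fun e he => ?_⟩
  obtain ⟨m1, m2⟩ := l4 e he
  obtain ⟨k1, k2, _⟩ := key e.2 m1 e.1 m2.1 (oseg_subset _ m2.2.2.1)
  exact ⟨k1, k2⟩

end Arr
end OnePlanar

namespace OnePlanar
open Filter Topology

lemma crs_pt_pt (o y z : Pl) (α β : ℝ) : crs (pt o y α) (pt o y β) z = (β - α) * crs o y z := by
  simp only [crs, pt_fst, pt_snd]; ring

lemma crs_pt_mid (o y z : Pl) (α : ℝ) : crs o (pt o y α) z = α * crs o y z := by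
  simp only [crs, pt_fst, pt_snd]; ring

/-- A ray leaves every bounded set. -/
lemma exists_pt_notMem {Ω : Set Pl} (hΩ : Bornology.IsBounded Ω) {o y : Pl} (hy : o ≠ y) :
    ∃ r > 0, pt o y r ∉ Ω := by
  obtain ⟨C, hC⟩ := hΩ.exists_norm_le
  have hd : 0 < ‖y - o‖ := norm_pos_iff.2 (sub_ne_zero.2 hy.symm)
  refine ⟨(|C| + ‖o‖ + 1) / ‖y - o‖, by positivity, fun hm => ?_⟩
  have h1 := hC _ hm
  have h2 : ‖((|C| + ‖o‖ + 1) / ‖y - o‖) • (y - o)‖ = |C| + ‖o‖ + 1 := by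
    rw [norm_smul, Real.norm_of_nonneg (by positivity)]; field_simp
  have h3 : ‖((|C| + ‖o‖ + 1) / ‖y - o‖) • (y - o)‖ ≤
      ‖pt o y ((|C| + ‖o‖ + 1) / ‖y - o‖)‖ + ‖o‖ := by
    have : ((|C| + ‖o‖ + 1) / ‖y - o‖) • (y - o) =
        pt o y ((|C| + ‖o‖ + 1) / ‖y - o‖) - o := by simp [pt]
    rw [this]; exact norm_sub_le _ _
  linarith [le_abs_self C]

/-- The first point on a ray that lies on a wall or outside the bounded set. -/
lemma exists_first_hit {Ω : Set Pl} (hΩ : Bornology.IsBounded Ω) {n : ℕ} {X Y : ℕ → Pl} {o y : Pl}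
    (hy : o ≠ y) (hne : ∀ s < n, X s ≠ Y s) (hX : ∀ s < n, X s ≠ o → crs o y (X s) ≠ 0)
    (hY : ∀ s < n, Y s ≠ o → crs o y (Y s) ≠ 0) :
    ∃ r > 0, (pt o y r ∉ Ω ∨ ∃ t < n, pt o y r ∈ openSegment ℝ (X t) (Y t)) ∧
      ∀ r', 0 < r' → r' < r → ∀ s < n, pt o y r' ∉ segment ℝ (X s) (Y s) := by
  obtain ⟨r₀, hr₀, hout⟩ := exists_pt_notMem hΩ hy
  set S : Set ℝ := {r | 0 < r ∧ ∃ s < n, pt o y r ∈ segment ℝ (X s) (Y s)} with hS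
  have hfin : S.Finite := by
    have : S ⊆ ⋃ s ∈ Finset.range n, {r | s < n ∧ pt o y r ∈ segment ℝ (X s) (Y s)} := by
      rintro r ⟨_, s, hs, hr⟩
      simp only [mem_iUnion]
      exact ⟨s, by simpa using hs, hs, hr⟩
    refine Set.Finite.subset (Set.Finite.biUnion (Finset.finite_toSet _) fun s _ =>
      Set.Subsingleton.finite ?_) this
    rintro r ⟨hs, hr⟩ r' ⟨_, hr'⟩
    have hor : crs o y (X s) ≠ 0 ∨ crs o y (Y s) ≠ 0 := by
      by_cases h : X s = o
      · right; exact hY s hs fun e => hne s hs (h.trans e.symm)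
      · left; exact hX s hs h
    have hz : ∀ t, crs o y (pt o y t) = 0 := fun t => by rw [crs_pt]; simp
    exact pt_inj hy (eq_of_crs_zero (hz r) (hz r') (hne s hs) (crs_eq_zero_of_mem hr)
      (crs_eq_zero_of_mem hr') hor)
  obtain ⟨r, hr, hmin⟩ := (hfin.insert r₀).exists_minimalFor id _ ⟨r₀, mem_insert _ _⟩
  have hpos : 0 < r := by
    rcases hr with rfl | hr
    · exact hr₀
    · exact hr.1
  refine ⟨r, hpos, ?_, fun r' h0 hlt s hs hm => ?_⟩
  · rcases hr with rfl | ⟨_, s, hs, hr⟩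
    · exact Or.inl hout
    · right
      have hz : crs o y (pt o y r) = 0 := by rw [crs_pt]; simp
      have hno : pt o y r ≠ o := fun e => by
        have := pt_inj hy (e.trans (pt_zero o y).symm); linarith
      refine ⟨s, hs, mem_oseg_of_mem_seg hr ?_ ?_⟩ <;> intro e
      · exact hX s hs (by rwa [← e]) (by rw [← e]; exact hz)
      · exact hY s hs (by rwa [← e]) (by rw [← e]; exact hz)
  · have := hmin (j := r') (Or.inr ⟨h0, s, hs, hm⟩) hlt.le
    simp only [id] at this
    linarith

/-- Partial arrangements: the first `h` walls are given, the others are rays based at vertices. -/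
structure Conf {V : Type*} (pos : V → Pl) (Ω : Set Pl) (h : ℕ) (Lg : V → V → Prop) (n : ℕ)
    (X Y : ℕ → Pl) (base : ℕ → V) : Prop where
  hn : h ≤ n
  ne : ∀ s < n, X s ≠ Y s
  sub : ∀ s < n, ∀ t < n, s ≠ t → (segment ℝ (X s) (Y s) ∩ segment ℝ (X t) (Y t)).Subsingleton
  order : ∀ t < n, h ≤ t → ∀ s < t, Disjoint (segment ℝ (X s) (Y s)) (openSegment ℝ (X t) (Y t))
  base_mem : ∀ s < n, h ≤ s → pos (base s) ∈ segment ℝ (X s) (Y s)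
  ends : ∀ s < n, h ≤ s → ∀ e, e = X s ∨ e = Y s → e = pos (base s) ∨ e ∉ Ω ∨
    ∃ t < n, e ∈ openSegment ℝ (X t) (Y t)
  line : ∀ s < n, h ≤ s → ∀ v, crs (X s) (Y s) (pos v) = 0 → v = base s
  trans : ∀ v w, Lg v w → ∀ s < n, crs (X s) (Y s) (pos v) ≠ 0 ∨ crs (X s) (Y s) (pos w) ≠ 0
  long : ∀ v w, Lg v w → ∀ z ∈ segment ℝ (pos v) (pos w), ∀ s < n, z ∈ segment ℝ (X s) (Y s) →
    z = pos v ∨ z = pos w ∨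
      (z ∈ openSegment ℝ (X s) (Y s) ∧ ∀ t < n, t ≠ s → z ∉ segment ℝ (X t) (Y t))

/-- The points that the line of a new wall has to avoid. -/
def Special {V : Type*} (pos : V → Pl) (Lg : V → V → Prop) (n : ℕ) (X Y : ℕ → Pl) : Set Pl :=
  range pos ∪ {z | ∃ s < n, z = X s ∨ z = Y s} ∪
    {z | ∃ v w s, Lg v w ∧ s < n ∧ z ∈ segment ℝ (pos v) (pos w) ∧ z ∈ segment ℝ (X s) (Y s)}

section Conf
variable {V : Type*} {pos : V → Pl} {Ω : Set Pl} {h : ℕ} {Lg : V → V → Prop} {n : ℕ}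
  {X Y : ℕ → Pl} {base : ℕ → V}

lemma Conf.finite_special [Finite V] (C : Conf pos Ω h Lg n X Y base)
    (hne : ∀ v w, Lg v w → pos v ≠ pos w) : (Special pos Lg n X Y).Finite := by
  refine Set.Finite.union (Set.Finite.union (Set.finite_range pos) ?_) ?_
  · have : {z | ∃ s < n, z = X s ∨ z = Y s} ⊆
        ((Finset.range n).image X ∪ (Finset.range n).image Y : Finset Pl) := by
      rintro z ⟨t, ht, rfl | rfl⟩
      · simp only [Finset.coe_union, Finset.coe_image, mem_union]
        exact Or.inl ⟨t, by simpa using ht, rfl⟩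
      · simp only [Finset.coe_union, Finset.coe_image, mem_union]
        exact Or.inr ⟨t, by simpa using ht, rfl⟩
    exact (Finset.finite_toSet _).subset this
  · have : {z | ∃ v w s, Lg v w ∧ s < n ∧ z ∈ segment ℝ (pos v) (pos w) ∧
        z ∈ segment ℝ (X s) (Y s)} ⊆ ⋃ q : V × V × Fin n, {z | Lg q.1 q.2.1 ∧
          z ∈ segment ℝ (pos q.1) (pos q.2.1) ∧ z ∈ segment ℝ (X q.2.2) (Y q.2.2)} := by
      rintro z ⟨v, w, s, h1, h2, h3, h4⟩
      exact mem_iUnion.2 ⟨(v, w, ⟨s, h2⟩), h1, h3, h4⟩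
    refine (Set.finite_iUnion fun q => Set.Subsingleton.finite ?_).subset this
    rintro z ⟨h1, h2, h3⟩ z' ⟨_, h2', h3'⟩
    exact eq_of_crs_zero (crs_eq_zero_of_mem h3) (crs_eq_zero_of_mem h3') (hne _ _ h1)
      (crs_eq_zero_of_mem h2) (crs_eq_zero_of_mem h2') (C.trans _ _ h1 q.2.2 q.2.2.2)

/-- Adding a wall. -/
lemma Conf.extend (C : Conf pos Ω h Lg n X Y base) (hinj : Function.Injective pos)
    (hlg : ∀ v w, Lg v w → v ≠ w ∧ segment ℝ (pos v) (pos w) ⊆ Ω ∧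
      ∀ x, pos x ∈ segment ℝ (pos v) (pos w) → x = v ∨ x = w)
    {w : V} {P Q : Pl} (hPQ : P ≠ Q) (hw : pos w ∈ segment ℝ P Q)
    (hgen : ∀ z ∈ Special pos Lg n X Y, z ≠ pos w → crs P Q z ≠ 0)
    (hdis : ∀ s < n, Disjoint (segment ℝ (X s) (Y s)) (openSegment ℝ P Q))
    (hends : ∀ e, e = P ∨ e = Q → e = pos w ∨ e ∉ Ω ∨ ∃ t < n, e ∈ openSegment ℝ (X t) (Y t))
    {X' Y' : ℕ → Pl} {base' : ℕ → V} (hX : ∀ s < n, X' s = X s) (hY : ∀ s < n, Y' s = Y s)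
    (hb : ∀ s < n, base' s = base s) (hXn : X' n = P) (hYn : Y' n = Q) (hbn : base' n = w) :
    Conf pos Ω h Lg (n + 1) X' Y' base' := by
  have cases : ∀ {s}, s < n + 1 → s < n ∨ s = n := fun hs => Nat.lt_succ_iff_lt_or_eq.1 hs
  have hends' : ∀ s < n, crs P Q (X s) ≠ 0 ∨ crs P Q (Y s) ≠ 0 := by
    intro s hs
    by_cases e : X s = pos w
    · right
      exact hgen _ (Or.inl (Or.inr ⟨s, hs, Or.inr rfl⟩)) fun e' => C.ne s hs (e.trans e'.symm)
    · left
      exact hgen _ (Or.inl (Or.inr ⟨s, hs, Or.inl rfl⟩)) e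
  have hsub : ∀ s < n, (segment ℝ (X s) (Y s) ∩ segment ℝ P Q).Subsingleton := by
    rintro s hs z ⟨h1, h2⟩ z' ⟨h1', h2'⟩
    exact eq_of_crs_zero (crs_eq_zero_of_mem h2) (crs_eq_zero_of_mem h2') (C.ne s hs)
      (crs_eq_zero_of_mem h1) (crs_eq_zero_of_mem h1') (hends' s hs)
  have hline : ∀ v, crs P Q (pos v) = 0 → v = w := by
    intro v hv
    by_contra hne
    exact hgen _ (Or.inl (Or.inl ⟨v, rfl⟩)) (fun e => hne (hinj e)) hv
  refine ⟨C.hn.trans n.le_succ, ?_, ?_, ?_, ?_, ?_, ?_, ?_, ?_⟩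
  · intro s hs
    rcases cases hs with hs | rfl
    · rw [hX s hs, hY s hs]; exact C.ne s hs
    · rwa [hXn, hYn]
  · intro s hs t ht hst
    rcases cases hs with hs | rfl <;> rcases cases ht with ht | rfl
    · rw [hX s hs, hY s hs, hX t ht, hY t ht]; exact C.sub s hs t ht hst
    · rw [hX s hs, hY s hs, hXn, hYn]; exact hsub s hs
    · rw [hX t ht, hY t ht, hXn, hYn, inter_comm]; exact hsub t ht
    · exact absurd rfl hst
  · intro t ht hht s hst
    rcases cases ht with ht | rfl
    · rw [hX s (hst.trans ht), hY s (hst.trans ht), hX t ht, hY t ht]; exact C.order t ht hht s hst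
    · rw [hX s hst, hY s hst, hXn, hYn]; exact hdis s hst
  · intro s hs hhs
    rcases cases hs with hs | rfl
    · rw [hX s hs, hY s hs, hb s hs]; exact C.base_mem s hs hhs
    · rwa [hXn, hYn, hbn]
  · intro s hs hhs e he
    have mono : (∃ t < n, e ∈ openSegment ℝ (X t) (Y t)) →
        ∃ t < n + 1, e ∈ openSegment ℝ (X' t) (Y' t) := by
      rintro ⟨t, ht, hm⟩
      exact ⟨t, ht.trans n.lt_succ_self, by rwa [hX t ht, hY t ht]⟩
    rcases cases hs with hs | rfl
    · rw [hX s hs, hY s hs] at he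
      rw [hb s hs]
      exact (C.ends s hs hhs e he).imp_right (Or.imp_right mono)
    · rw [hXn, hYn] at he
      rw [hbn]
      exact (hends e he).imp_right (Or.imp_right mono)
  · intro s hs hhs v hv
    rcases cases hs with hs | rfl
    · rw [hX s hs, hY s hs] at hv; rw [hb s hs]; exact C.line s hs hhs v hv
    · rw [hXn, hYn] at hv; rw [hbn]; exact hline v hv
  · intro v v' hv s hs
    rcases cases hs with hs | rfl
    · rw [hX s hs, hY s hs]; exact C.trans v v' hv s hs
    · rw [hXn, hYn]
      by_contra! hc
      exact (hlg v v' hv).1 ((hline v hc.1).trans (hline v' hc.2).symm)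
  · intro v v' hv z hz s hs hzs
    by_cases hzw : z = pos w
    · subst hzw
      rcases (hlg v v' hv).2.2 w hz with rfl | rfl
      · exact Or.inl rfl
      · exact Or.inr (Or.inl rfl)
    have hnew : ∀ t < n, z ∈ segment ℝ (X t) (Y t) → z ∉ segment ℝ P Q := fun t ht hzt hPQ =>
      hgen z (Or.inr ⟨v, v', t, hv, ht, hz, hzt⟩) hzw (crs_eq_zero_of_mem hPQ)
    rcases cases hs with hs | rfl
    · rw [hX s hs, hY s hs] at hzs ⊢
      rcases C.long v v' hv z hz s hs hzs with h1 | h1 | ⟨h1, h2⟩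
      · exact Or.inl h1
      · exact Or.inr (Or.inl h1)
      · refine Or.inr (Or.inr ⟨h1, fun t ht hts => ?_⟩)
        rcases cases ht with ht | rfl
        · rw [hX t ht, hY t ht]; exact h2 t ht hts
        · rw [hXn, hYn]; exact hnew s hs hzs
    · rw [hXn, hYn] at hzs ⊢
      have hend : z ≠ P ∧ z ≠ Q := by
        rw [← not_or]
        intro he
        rcases hends z he with h1 | h1 | ⟨t, ht, h1⟩
        · exact hzw h1
        · exact h1 ((hlg v v' hv).2.1 hz)
        · exact hnew t ht (openSegment_subset_segment ℝ _ _ h1) hzs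
      have ho := mem_oseg_of_mem_seg hzs hend.1 hend.2
      refine Or.inr (Or.inr ⟨ho, fun t ht hts => ?_⟩)
      rcases cases ht with ht | rfl
      · rw [hX t ht, hY t ht]
        exact fun hm => Set.disjoint_left.1 (hdis t ht) hm ho
      · exact absurd rfl hts

/-- A second family of walls extends the first one. -/
def Ext (n : ℕ) (X Y : ℕ → Pl) (base : ℕ → V) (X' Y' : ℕ → Pl) (base' : ℕ → V) : Prop :=
  ∀ s < n, X' s = X s ∧ Y' s = Y s ∧ base' s = base s

lemma ext_update (n : ℕ) (X Y : ℕ → Pl) (base : ℕ → V) (P Q : Pl) (w : V) :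
    Ext n X Y base (Function.update X n P) (Function.update Y n Q) (Function.update base n w) :=
  fun s hs => by simp [Function.update_of_ne hs.ne]

lemma Conf.extend_update (C : Conf pos Ω h Lg n X Y base) (hinj : Function.Injective pos)
    (hlg : ∀ v w, Lg v w → v ≠ w ∧ segment ℝ (pos v) (pos w) ⊆ Ω ∧
      ∀ x, pos x ∈ segment ℝ (pos v) (pos w) → x = v ∨ x = w)
    {w : V} {P Q : Pl} (hPQ : P ≠ Q) (hw : pos w ∈ segment ℝ P Q)
    (hgen : ∀ z ∈ Special pos Lg n X Y, z ≠ pos w → crs P Q z ≠ 0)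
    (hdis : ∀ s < n, Disjoint (segment ℝ (X s) (Y s)) (openSegment ℝ P Q))
    (hends : ∀ e, e = P ∨ e = Q → e = pos w ∨ e ∉ Ω ∨ ∃ t < n, e ∈ openSegment ℝ (X t) (Y t)) :
    Conf pos Ω h Lg (n + 1) (Function.update X n P) (Function.update Y n Q)
      (Function.update base n w) :=
  C.extend hinj hlg hPQ hw hgen hdis hends (fun _ hs => Function.update_of_ne hs.ne _ _)
    (fun _ hs => Function.update_of_ne hs.ne _ _) (fun _ hs => Function.update_of_ne hs.ne _ _)
    (Function.update_self ..) (Function.update_self ..) (Function.update_self ..)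

lemma Conf.exists_direction [Finite V] (C : Conf pos Ω h Lg n X Y base)
    (hne : ∀ v w, Lg v w → pos v ≠ pos w) (w : V) {U : Set Pl} (hU : IsOpen U) (hUn : U.Nonempty) :
    ∃ y ∈ U, ∀ z ∈ Special pos Lg n X Y, z ≠ pos w → crs (pos w) y z ≠ 0 := by
  classical
  set F : Finset (Pl × Pl) := ((C.finite_special hne).toFinset.erase (pos w)).image
    (fun z => (pos w, z)) with hF
  obtain ⟨y, hy, hgen⟩ := exists_generic F (by
    intro e he
    obtain ⟨z, hz, rfl⟩ := Finset.mem_image.1 he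
    exact (Finset.ne_of_mem_erase hz).symm) U hU hUn
  refine ⟨y, hy, fun z hz hzw h0 => ?_⟩
  refine hgen (pos w, z) (Finset.mem_image.2 ⟨z, Finset.mem_erase.2 ⟨hzw, by simpa using hz⟩, rfl⟩) ?_
  have : crs (pos w) z y = - crs (pos w) y z := by simp only [crs]; ring
  simp only [this, h0, neg_zero]

lemma Conf.add_ray [Finite V] (C : Conf pos Ω h Lg n X Y base) (hΩ : Bornology.IsBounded Ω)
    (hinj : Function.Injective pos)
    (hlg : ∀ v w, Lg v w → v ≠ w ∧ segment ℝ (pos v) (pos w) ⊆ Ω ∧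
      ∀ x, pos x ∈ segment ℝ (pos v) (pos w) → x = v ∨ x = w)
    (w : V) {U : Set Pl} (hU : IsOpen U) (hUn : U.Nonempty) (hwU : pos w ∉ U) :
    ∃ X' Y' base', Conf pos Ω h Lg (n + 1) X' Y' base' ∧ Ext n X Y base X' Y' base' ∧
      base' n = w ∧ X' n = pos w ∧ ∃ y ∈ U, ∃ r > 0, Y' n = pt (pos w) y r := by
  obtain ⟨y, hy, hgen⟩ := C.exists_direction (fun v v' hv e => (hlg v v' hv).1 (hinj e)) w hU hUn
  have hwy : pos w ≠ y := by rintro e; exact hwU (e ▸ hy)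
  obtain ⟨r, r0, hhit, hfree⟩ := exists_first_hit hΩ hwy C.ne
    (fun s hs => hgen _ (Or.inl (Or.inr ⟨s, hs, Or.inl rfl⟩)))
    (fun s hs => hgen _ (Or.inl (Or.inr ⟨s, hs, Or.inr rfl⟩)))
  have hPQ : pos w ≠ pt (pos w) y r := fun e => by
    have := pt_inj hwy ((pt_zero _ _).trans e); linarith
  refine ⟨_, _, _, C.extend_update (w := w) hinj hlg hPQ (left_mem_segment _ _ _) ?_ ?_ ?_,
    ext_update n X Y base _ _ w, by simp, by simp, y, hy, r, r0, by simp⟩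
  · intro z hz hzw
    rw [crs_pt_mid]
    exact mul_ne_zero r0.ne' (hgen z hz hzw)
  · intro s hs
    refine Set.disjoint_left.2 fun z hz hzo => ?_
    obtain ⟨t, t0, t1, rfl⟩ := mem_oseg.1 hzo
    have e := pt_pt (pos w) y 0 r t
    rw [pt_zero, zero_add, sub_zero] at e
    rw [e] at hz
    exact hfree _ (by positivity) (by nlinarith) s hs hz
  · rintro e (rfl | rfl)
    · exact Or.inl rfl
    · exact Or.inr hhit

lemma Conf.add_through [Finite V] (C : Conf pos Ω h Lg n X Y base) (hΩ : Bornology.IsBounded Ω)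
    (hinj : Function.Injective pos)
    (hlg : ∀ v w, Lg v w → v ≠ w ∧ segment ℝ (pos v) (pos w) ⊆ Ω ∧
      ∀ x, pos x ∈ segment ℝ (pos v) (pos w) → x = v ∨ x = w)
    (w : V) (hw : ∀ s < n, pos w ∉ segment ℝ (X s) (Y s)) :
    ∃ X' Y' base', Conf pos Ω h Lg (n + 1) X' Y' base' ∧ Ext n X Y base X' Y' base' ∧
      base' n = w ∧ pos w ∈ openSegment ℝ (X' n) (Y' n) := by
  obtain ⟨y, hy, hgen⟩ := C.exists_direction (fun v v' hv e => (hlg v v' hv).1 (hinj e)) w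
    (U := {y | (pos w).1 < y.1}) (isOpen_lt continuous_const continuous_fst)
    ⟨((pos w).1 + 1, 0), by simp⟩
  have hwy : pos w ≠ y := by rintro e; rw [← e] at hy; exact lt_irrefl (pos w).1 hy
  have hwy' : pos w ≠ pt (pos w) y (-1) := fun e => by
    have := pt_inj hwy ((pt_zero _ _).trans e); linarith
  obtain ⟨r, r0, hhit, hfree⟩ := exists_first_hit hΩ hwy C.ne
    (fun s hs => hgen _ (Or.inl (Or.inr ⟨s, hs, Or.inl rfl⟩)))
    (fun s hs => hgen _ (Or.inl (Or.inr ⟨s, hs, Or.inr rfl⟩)))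
  obtain ⟨r', r0', hhit', hfree'⟩ := exists_first_hit hΩ hwy' C.ne
    (fun s hs he => by
      rw [crs_pt_mid]
      exact mul_ne_zero (by norm_num) (hgen _ (Or.inl (Or.inr ⟨s, hs, Or.inl rfl⟩)) he))
    (fun s hs he => by
      rw [crs_pt_mid]
      exact mul_ne_zero (by norm_num) (hgen _ (Or.inl (Or.inr ⟨s, hs, Or.inr rfl⟩)) he))
  have hneg : ∀ t, pt (pos w) (pt (pos w) y (-1)) t = pt (pos w) y (-t) := by
    intro t
    have := pt_pt (pos w) y 0 (-1) t
    rw [pt_zero] at this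
    rw [this]; congr 1; ring
  rw [hneg] at hhit'
  simp only [hneg] at hfree'
  have hPQ : pt (pos w) y (-r') ≠ pt (pos w) y r := fun e => by
    have := pt_inj hwy e; linarith
  have hmem : pos w ∈ openSegment ℝ (pt (pos w) y (-r')) (pt (pos w) y r) := by
    have := (pt_mem_oseg_pt hwy (t := 0) (show -r' ≠ r by linarith)).2 (by
      rw [min_eq_left (by linarith), max_eq_right (by linarith)]; constructor <;> linarith)
    rwa [pt_zero] at this
  refine ⟨_, _, _, C.extend_update (w := w) hinj hlg hPQ (openSegment_subset_segment ℝ _ _ hmem)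
    ?_ ?_ ?_, ext_update n X Y base _ _ w, by simp, by simpa using hmem⟩
  · intro z hz hzw
    rw [crs_pt_pt]
    exact mul_ne_zero (by linarith) (hgen z hz hzw)
  · intro s hs
    refine Set.disjoint_left.2 fun z hz hzo => ?_
    obtain ⟨t, t0, t1, rfl⟩ := mem_oseg.1 hzo
    rw [pt_pt] at hz
    rcases lt_trichotomy (-r' + t * (r - -r')) 0 with hlt | heq | hlt
    · have := hfree' (-(-r' + t * (r - -r'))) (by linarith) (by nlinarith) s hs
      rw [neg_neg] at this
      exact this hz
    · rw [heq, pt_zero] at hz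
      exact hw s hs hz
    · exact hfree _ hlt (by nlinarith) s hs hz
  · rintro e (rfl | rfl)
    · exact Or.inr hhit'
    · exact Or.inr hhit

end Conf
end OnePlanar

namespace OnePlanar
open Filter Topology

/-- Three sub-segments of walls leave the point `o`, and they positively span the plane. -/
def Trip (n : ℕ) (X Y : ℕ → Pl) (o : Pl) : Prop :=
  ∃ e₁ e₂ e₃, 0 < crs o e₁ e₂ ∧ 0 < crs o e₂ e₃ ∧ 0 < crs o e₃ e₁ ∧
    ∀ e, e = e₁ ∨ e = e₂ ∨ e = e₃ → ∃ s < n, segment ℝ o e ⊆ segment ℝ (X s) (Y s)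

/-- No open half plane at `o` is free of walls. -/
def Done (n : ℕ) (X Y : ℕ → Pl) (o : Pl) : Prop :=
  (∃ t < n, o ∈ openSegment ℝ (X t) (Y t)) ∨ Trip n X Y o

lemma Trip.span {n : ℕ} {X Y : ℕ → Pl} {o : Pl} (h : Trip n X Y o) {c d : Pl} (hcd : c ≠ d) :
    ∃ y, (∀ w ∈ segment ℝ o y, ∃ t < n, w ∈ segment ℝ (X t) (Y t)) ∧ crs c d o < crs c d y := by
  obtain ⟨e₁, e₂, e₃, h₁, h₂, h₃, he⟩ := h
  by_contra! hno
  have key : ∀ e, e = e₁ ∨ e = e₂ ∨ e = e₃ → crs c d e - crs c d o ≤ 0 := fun e h => by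
    obtain ⟨s, hs, hsub⟩ := he e h
    linarith [hno e fun w hw => ⟨s, hs, hsub hw⟩]
  have k₁ := key e₁ (by simp)
  have k₂ := key e₂ (by simp)
  have k₃ := key e₃ (by simp)
  have id : crs o e₂ e₃ * (crs c d e₁ - crs c d o) + crs o e₃ e₁ * (crs c d e₂ - crs c d o) +
      crs o e₁ e₂ * (crs c d e₃ - crs c d o) = 0 := by simp only [crs]; ring
  have z₁ : crs c d e₁ - crs c d o = 0 := by
    rcases k₁.lt_or_eq with k | k
    · nlinarith [mul_neg_of_pos_of_neg h₂ k, mul_nonpos_of_nonneg_of_nonpos h₃.le k₂,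
        mul_nonpos_of_nonneg_of_nonpos h₁.le k₃]
    · exact k
  have z₂ : crs c d e₂ - crs c d o = 0 := by
    rcases k₂.lt_or_eq with k | k
    · nlinarith [mul_nonpos_of_nonneg_of_nonpos h₂.le k₁, mul_neg_of_pos_of_neg h₃ k,
        mul_nonpos_of_nonneg_of_nonpos h₁.le k₃]
    · exact k
  have w₁ : (d.1 - c.1) * crs o e₁ e₂ =
      (crs c d e₂ - crs c d o) * (e₁.1 - o.1) - (crs c d e₁ - crs c d o) * (e₂.1 - o.1) := by
    simp only [crs]; ring
  have w₂ : (d.2 - c.2) * crs o e₁ e₂ =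
      (crs c d e₂ - crs c d o) * (e₁.2 - o.2) - (crs c d e₁ - crs c d o) * (e₂.2 - o.2) := by
    simp only [crs]; ring
  rw [z₁, z₂] at w₁ w₂
  simp only [zero_mul, sub_zero, mul_eq_zero, h₁.ne', or_false] at w₁ w₂
  exact hcd (Prod.ext (by linarith) (by linarith))

section Conf
variable {V : Type*} {pos : V → Pl} {Ω : Set Pl} {h : ℕ} {Lg : V → V → Prop} {n : ℕ}
  {X Y : ℕ → Pl} {base : ℕ → V}

lemma Done.mono {n' : ℕ} {X' Y' : ℕ → Pl} {base' : ℕ → V} {o : Pl} (hd : Done n X Y o) (hn : n ≤ n')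
    (he : Ext n X Y base X' Y' base') : Done n' X' Y' o := by
  rcases hd with ⟨t, ht, hm⟩ | ⟨e₁, e₂, e₃, h₁, h₂, h₃, hs⟩
  · refine Or.inl ⟨t, ht.trans_le hn, ?_⟩
    rwa [(he t ht).1, (he t ht).2.1]
  · refine Or.inr ⟨e₁, e₂, e₃, h₁, h₂, h₃, fun e h => ?_⟩
    obtain ⟨s, hs, hsub⟩ := hs e h
    refine ⟨s, hs.trans_le hn, ?_⟩
    rwa [(he s hs).1, (he s hs).2.1]

lemma Ext.trans {n' : ℕ} {X' Y' X'' Y'' : ℕ → Pl} {base' base'' : ℕ → V}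
    (h₁ : Ext n X Y base X' Y' base') (h₂ : Ext n' X' Y' base' X'' Y'' base'') (hn : n ≤ n') :
    Ext n X Y base X'' Y'' base'' := fun s hs => by
  obtain ⟨a, b, c⟩ := h₁ s hs
  obtain ⟨a', b', c'⟩ := h₂ s (hs.trans_le hn)
  exact ⟨a'.trans a, b'.trans b, c'.trans c⟩

/-- The number `m` of new walls at `o`, in terms of the original walls. -/
def Kind (h : ℕ) (X Y : ℕ → Pl) (o : Pl) (m : ℕ) : Prop :=
  (m = 1 ∧ ∃ e₁ e₂, crs o e₁ e₂ ≠ 0 ∧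
    ∀ e, e = e₁ ∨ e = e₂ → ∃ s < h, segment ℝ o e ⊆ segment ℝ (X s) (Y s)) ∨
  (m = 2 ∧ ∃ e, o ≠ e ∧ ∃ s < h, segment ℝ o e ⊆ segment ℝ (X s) (Y s)) ∨
  (m = 1 ∧ ∀ s < h, o ∉ segment ℝ (X s) (Y s))

lemma isOpen_pos_crs (a b : Pl) : IsOpen {y | 0 < crs a b y} :=
  isOpen_lt continuous_const (continuous_crs a b)

lemma Conf.close_trip [Finite V] (C : Conf pos Ω h Lg n X Y base) (hΩ : Bornology.IsBounded Ω)
    (hinj : Function.Injective pos)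
    (hlg : ∀ v w, Lg v w → v ≠ w ∧ segment ℝ (pos v) (pos w) ⊆ Ω ∧
      ∀ x, pos x ∈ segment ℝ (pos v) (pos w) → x = v ∨ x = w)
    (w : V) {e₁ e₂ : Pl} (h12 : 0 < crs (pos w) e₁ e₂)
    (hs : ∀ e, e = e₁ ∨ e = e₂ → ∃ s < n, segment ℝ (pos w) e ⊆ segment ℝ (X s) (Y s)) :
    ∃ X' Y' base', Conf pos Ω h Lg (n + 1) X' Y' base' ∧ Ext n X Y base X' Y' base' ∧
      base' n = w ∧ Done (n + 1) X' Y' (pos w) := by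
  obtain ⟨X', Y', base', C', hE, hb, hX, y, hy, r, r0, hY⟩ := C.add_ray hΩ hinj hlg w
    (U := {y | 0 < crs (pos w) e₂ y} ∩ {y | 0 < crs e₁ (pos w) y})
    ((isOpen_pos_crs _ _).inter (isOpen_pos_crs _ _))
    ⟨pos w - (e₁ - pos w) - (e₂ - pos w), by
      simp only [mem_inter_iff, mem_ofPred_eq, crs, Prod.fst_sub, Prod.snd_sub] at h12 ⊢
      constructor <;> nlinarith⟩
    (by simp)
  refine ⟨X', Y', base', C', hE, hb, Or.inr ⟨e₁, e₂, pt (pos w) y r, h12, ?_, ?_, ?_⟩⟩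
  · rw [crs_pt_last]; simp only [crs_self_outer, zero_add, sub_zero]
    simpa using mul_pos r0 hy.1
  · rw [crs_pt_mid]
    refine mul_pos r0 ?_
    have := hy.2
    simp only [mem_ofPred_eq] at this
    rw [crs_rot] at this; exact this
  · rintro e (rfl | rfl | rfl)
    · obtain ⟨s, hs, hsub⟩ := hs e (Or.inl rfl)
      exact ⟨s, by omega, by rwa [(hE s hs).1, (hE s hs).2.1]⟩
    · obtain ⟨s, hs, hsub⟩ := hs e (Or.inr rfl)
      exact ⟨s, by omega, by rwa [(hE s hs).1, (hE s hs).2.1]⟩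
    · exact ⟨n, by omega, by rw [hX, hY]⟩

lemma Conf.add_vertex [Finite V] {X₀ Y₀ : ℕ → Pl} {base₀ : ℕ → V}
    (C : Conf pos Ω h Lg n X Y base) (hE₀ : Ext h X₀ Y₀ base₀ X Y base)
    (hΩ : Bornology.IsBounded Ω) (hinj : Function.Injective pos)
    (hlg : ∀ v w, Lg v w → v ≠ w ∧ segment ℝ (pos v) (pos w) ⊆ Ω ∧
      ∀ x, pos x ∈ segment ℝ (pos v) (pos w) → x = v ∨ x = w)
    (w : V) {m : ℕ} (hk : Kind h X₀ Y₀ (pos w) m) (hw : ∀ s < n, h ≤ s → base s ≠ w) :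
    ∃ X' Y' base', Conf pos Ω h Lg (n + m) X' Y' base' ∧ Ext n X Y base X' Y' base' ∧
      (∀ s < n + m, n ≤ s → base' s = w) ∧ 1 ≤ m ∧ Done (n + m) X' Y' (pos w) := by
  have lift : ∀ {e}, (∃ s < h, segment ℝ (pos w) e ⊆ segment ℝ (X₀ s) (Y₀ s)) →
      ∃ s < n, segment ℝ (pos w) e ⊆ segment ℝ (X s) (Y s) := by
    rintro e ⟨s, hs, hsub⟩
    exact ⟨s, hs.trans_le C.hn, by rwa [(hE₀ s hs).1, (hE₀ s hs).2.1]⟩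
  rcases hk with ⟨rfl, e₁, e₂, hc, he⟩ | ⟨rfl, e, hne, he⟩ | ⟨rfl, he⟩
  · have : ∃ e₁ e₂, 0 < crs (pos w) e₁ e₂ ∧
        ∀ e, e = e₁ ∨ e = e₂ → ∃ s < n, segment ℝ (pos w) e ⊆ segment ℝ (X s) (Y s) := by
      rcases hc.lt_or_gt with hc | hc
      · refine ⟨e₂, e₁, ?_, fun e h => lift (he e h.symm)⟩
        have : crs (pos w) e₂ e₁ = - crs (pos w) e₁ e₂ := by simp only [crs]; ring
        linarith
      · exact ⟨e₁, e₂, hc, fun e h => lift (he e h)⟩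
    obtain ⟨e₁, e₂, hc, he⟩ := this
    obtain ⟨X', Y', base', C', hE, hb, hd⟩ := C.close_trip hΩ hinj hlg w hc he
    exact ⟨X', Y', base', C', hE, fun s hs hs' => by rw [show s = n by omega, hb], le_rfl, hd⟩
  · obtain ⟨X', Y', base', C', hE, hb, hX, y, hy, r, r0, hY⟩ := C.add_ray hΩ hinj hlg w
      (U := {y | 0 < crs (pos w) e y}) (isOpen_pos_crs _ _)
      ⟨(e.1 - (e.2 - (pos w).2), e.2 + (e.1 - (pos w).1)), by
        have : 0 < (e.1 - (pos w).1) ^ 2 + (e.2 - (pos w).2) ^ 2 := by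
          by_contra! hcon
          refine hne (Prod.ext ?_ ?_) <;> nlinarith
        simp only [mem_ofPred_eq, crs]; nlinarith⟩
      (by simp)
    obtain ⟨s, hs, hsub⟩ := lift he
    obtain ⟨X'', Y'', base'', C'', hE', hb', hd⟩ := C'.close_trip hΩ hinj hlg w
      (e₁ := e) (e₂ := pt (pos w) y r)
      (by rw [crs_pt_last]; simpa using mul_pos r0 hy)
      (by
        rintro e' (rfl | rfl)
        · exact ⟨s, by omega, by rwa [(hE s hs).1, (hE s hs).2.1]⟩
        · exact ⟨n, by omega, by rw [hX, hY]⟩)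
    refine ⟨X'', Y'', base'', C'', hE.trans hE' (by omega), fun s hs hs' => ?_, by omega, hd⟩
    rcases (show s = n ∨ s = n + 1 by omega) with rfl | rfl
    · rw [(hE' s (by omega)).2.2, hb]
    · exact hb'
  · obtain ⟨X', Y', base', C', hE, hb, hd⟩ := C.add_through hΩ hinj hlg w (fun s hs hm => by
      by_cases hsh : s < h
      · exact he s hsh (by rwa [(hE₀ s hsh).1, (hE₀ s hsh).2.1] at hm)
      · exact hw s hs (by omega) (C.line s hs (by omega) w (crs_eq_zero_of_mem hm)).symm)
    exact ⟨X', Y', base', C', hE, fun s hs hs' => by rw [show s = n by omega, hb], le_rfl,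
      Or.inl ⟨n, by omega, hd⟩⟩

lemma Conf.complete [Finite V] (C : Conf pos Ω h Lg h X Y base) (hΩ : Bornology.IsBounded Ω)
    (hinj : Function.Injective pos)
    (hlg : ∀ v w, Lg v w → v ≠ w ∧ segment ℝ (pos v) (pos w) ⊆ Ω ∧
      ∀ x, pos x ∈ segment ℝ (pos v) (pos w) → x = v ∨ x = w)
    (mult : V → ℕ) (O : Finset V) (hk : ∀ w ∈ O, Kind h X Y (pos w) (mult w)) :
    ∃ X' Y' base', Conf pos Ω h Lg (h + ∑ w ∈ O, mult w) X' Y' base' ∧ Ext h X Y base X' Y' base' ∧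
      (∀ s < h + ∑ w ∈ O, mult w, h ≤ s → base' s ∈ O) ∧
      ∀ w ∈ O, Done (h + ∑ w ∈ O, mult w) X' Y' (pos w) ∧
        ∃ s < h + ∑ w ∈ O, mult w, h ≤ s ∧ base' s = w := by
  classical
  induction O using Finset.induction_on with
  | empty =>
    exact ⟨X, Y, base, C, fun s _ => ⟨rfl, rfl, rfl⟩, by simp, by simp⟩
  | insert w O hw ih =>
    obtain ⟨X', Y', base', C', hE, hb, hd⟩ := ih fun v hv => hk v (Finset.mem_insert_of_mem hv)
    rw [Finset.sum_insert hw, add_comm (mult w), ← add_assoc]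
    set n := h + ∑ w ∈ O, mult w with hn
    obtain ⟨X'', Y'', base'', C'', hE', hb', hm, hd'⟩ := C'.add_vertex hE hΩ hinj hlg w
      (hk w (Finset.mem_insert_self ..)) (fun s hs hs' e => hw (e ▸ hb s hs hs'))
    refine ⟨X'', Y'', base'', C'', hE.trans hE' C'.hn, fun s hs hs' => ?_, fun v hv => ?_⟩
    · by_cases hsn : s < n
      · rw [(hE' s hsn).2.2]; exact Finset.mem_insert_of_mem (hb s hsn hs')
      · rw [hb' s hs (by omega)]; exact Finset.mem_insert_self ..
    · rcases Finset.mem_insert.1 hv with rfl | hv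
      · exact ⟨hd', n, by omega, C'.hn, hb' n (by omega) le_rfl⟩
      · obtain ⟨h1, s, h2, h3, h4⟩ := hd v hv
        exact ⟨h1.mono (by omega) hE', s, by omega, h3, by rw [(hE' s h2).2.2, h4]⟩

end Conf

end OnePlanar

namespace OnePlanar
open Filter Topology

/-- Two drawn edges in general position meet in a common end or in a proper crossing. -/
lemma GP.meet_cases {Λ : Type*} {f : Λ → Pl} (h : GP univ f) {a b c d : Λ} (hab : a ≠ b) (hcd : c ≠ d)
    (hne : s(a, b) ≠ s(c, d)) {z : Pl} (h1 : z ∈ segment ℝ (f a) (f b))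
    (h2 : z ∈ segment ℝ (f c) (f d)) :
    (∃ x, (x = a ∨ x = b) ∧ (x = c ∨ x = d) ∧ z = f x) ∨
      (Apart a b c d ∧ z ∈ openSegment ℝ (f a) (f b) ∧ z ∈ openSegment ℝ (f c) (f d)) := by
  have col := fun {x y w} => h.col x trivial y trivial w trivial
  have s1 := segment_symm ℝ (f a) (f b)
  have s2 := segment_symm ℝ (f c) (f d)
  by_cases hac : a = c
  · subst hac
    refine Or.inl ⟨a, by simp, by simp, seg_inter_of_common (col hab hcd ?_) h1 h2⟩
    rintro rfl; exact hne rfl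
  by_cases had : a = d
  · subst had
    rw [s2] at h2
    refine Or.inl ⟨a, by simp, by simp, seg_inter_of_common (col hab hcd.symm ?_) h1 h2⟩
    rintro rfl; exact hne Sym2.eq_swap
  by_cases hbc : b = c
  · subst hbc
    rw [s1] at h1
    exact Or.inl ⟨b, by simp, by simp, seg_inter_of_common (col hab.symm hcd had) h1 h2⟩
  by_cases hbd : b = d
  · subst hbd
    rw [s1] at h1; rw [s2] at h2
    exact Or.inl ⟨b, by simp, by simp, seg_inter_of_common (col hab.symm hcd.symm hac) h1 h2⟩
  exact Or.inr ⟨⟨hac, had, hbc, hbd⟩, h.mem_oseg hac hbc hbd had hcd h1 h2,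
    h.mem_oseg (Ne.symm hac) (Ne.symm had) (Ne.symm hbd) (Ne.symm hbc) hab h2 h1⟩

lemma GP.ne_of_mem_oseg {Λ : Type*} {f : Λ → Pl} (h : GP univ f) {a b x : Λ} (hab : a ≠ b)
    (hx : f x ∈ segment ℝ (f a) (f b)) : x = a ∨ x = b := by
  by_contra! hn
  exact h.col a trivial b trivial x trivial hab hn.1.symm hn.2.symm (crs_eq_zero_of_mem hx)

lemma GP.injective {Λ : Type*} {f : Λ → Pl} (h : GP univ f) : Function.Injective f :=
  fun _ _ e => h.inj trivial trivial e

lemma GP.line_ne {Λ : Type*} {f : Λ → Pl} (h : GP univ f) {a b c d : Λ} (hab : a ≠ b) (hcd : c ≠ d)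
    (hne : s(a, b) ≠ s(c, d)) : crs (f a) (f b) (f c) ≠ 0 ∨ crs (f a) (f b) (f d) ≠ 0 := by
  by_contra! hn
  have key : ∀ x, crs (f a) (f b) (f x) = 0 → x = a ∨ x = b := fun x hx => by
    by_contra! hn
    exact h.col a trivial b trivial x trivial hab hn.1.symm hn.2.symm hx
  rcases key c hn.1 with rfl | rfl <;> rcases key d hn.2 with rfl | rfl
  · exact hcd rfl
  · exact hne rfl
  · exact hne Sym2.eq_swap
  · exact hcd rfl

/-- An arrangement whose first `h` walls are drawn edges and whose other walls start at the vertices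
of `O`. -/
structure Board {V : Type*} (pos : V → Pl) (h : ℕ) (eX eY : ℕ → V) (O : Finset V) where
  W : Arr
  hh : W.h = h
  hhn : h ≤ W.n
  X_eq : ∀ s < h, W.X s = pos (eX s)
  Y_eq : ∀ s < h, W.Y s = pos (eY s)
  mem_Ω : ∀ v, pos v ∈ W.Ω
  ray : ∀ w ∈ O, ∃ s < W.n, h ≤ s ∧ pos w ∈ W.seg s
  line : ∀ s < W.n, h ≤ s → ∀ v, pos v ∈ W.seg s → v ∈ O
  uniq : ∀ s < W.n, h ≤ s → ∀ v v', pos v ∈ W.seg s → pos v' ∈ W.seg s → v = v'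

/-- The number `m` of new walls at the vertex `w`, in terms of the original edges. -/
def VKind {V : Type*} (h : ℕ) (eX eY : ℕ → V) (w : V) (m : ℕ) : Prop :=
  (m = 1 ∧ ∃ a b, a ≠ b ∧ a ≠ w ∧ b ≠ w ∧ ∀ x, x = a ∨ x = b → ∃ s < h, s(w, x) = s(eX s, eY s)) ∨
  (m = 2 ∧ ∃ x ≠ w, ∃ s < h, s(w, x) = s(eX s, eY s)) ∨
  (m = 1 ∧ ∀ s < h, w ≠ eX s ∧ w ≠ eY s)

theorem exists_board {V : Type*} [Fintype V] {Γ : SimpleGraph V} {pos : V → Pl} (hgp : GP univ pos)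
    (ht : TouchOne Γ pos) {h : ℕ} {eX eY : ℕ → V} (hadj : ∀ s < h, Γ.Adj (eX s) (eY s))
    (hinj : ∀ s < h, ∀ t < h, s(eX s, eY s) = s(eX t, eY t) → s = t) {Lg : V → V → Prop}
    (hLg : ∀ v w, Lg v w → Γ.Adj v w) (hLH : ∀ v w, Lg v w → ∀ s < h, s(eX s, eY s) ≠ s(v, w))
    (O : Finset V) (mult : V → ℕ) (hk : ∀ w ∈ O, VKind h eX eY w (mult w))
    (hO : ∀ s < h, eX s ∈ O ∧ eY s ∈ O) :
    ∃ B : Board pos h eX eY O, B.W.n = h + ∑ w ∈ O, mult w ∧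
      ∀ v w, Lg v w → B.W.Clean (pos v) (pos w) := by
  obtain ⟨R, hR⟩ : ∃ R, ∀ v, pos v ∈ Metric.ball (0 : Pl) R := by
    obtain ⟨R, hR⟩ := (Set.finite_range pos).isBounded.subset_ball (0 : Pl)
    exact ⟨R, fun v => hR ⟨v, rfl⟩⟩
  set Ω := Metric.ball (0 : Pl) R
  have hcv : Convex ℝ Ω := convex_ball _ _
  have hlg : ∀ v w, Lg v w → v ≠ w ∧ segment ℝ (pos v) (pos w) ⊆ Ω ∧
      ∀ x, pos x ∈ segment ℝ (pos v) (pos w) → x = v ∨ x = w := fun v w hvw =>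
    ⟨(hLg v w hvw).ne, hcv.segment_subset (hR v) (hR w), fun x hx =>
      hgp.ne_of_mem_oseg (hLg v w hvw).ne hx⟩
  have touch : ∀ {a b c d : V} {z : Pl}, z ∈ openSegment ℝ (pos a) (pos b) →
      z ∈ openSegment ℝ (pos c) (pos d) → Touch (pos a) (pos b) (pos c) (pos d) :=
    fun h1 h2 => ⟨_, openSegment_subset_segment _ _ _ h1, openSegment_subset_segment _ _ _ h2⟩
  have C : Conf pos Ω h Lg h (pos ∘ eX) (pos ∘ eY) eX := by
    refine ⟨le_rfl, fun s hs => hgp.injective.ne (hadj s hs).ne, fun s hs t hts hst => ?_,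
      fun t h1 h2 => by omega, fun t h1 h2 => by omega, fun t h1 h2 => by omega,
      fun t h1 h2 => by omega, fun v w hvw s hs => ?_, fun v w hvw z hz s hs hzs => ?_⟩
    · have hne : s(eX s, eY s) ≠ s(eX t, eY t) := fun e => hst (hinj s hs t hts e)
      rintro z ⟨hz1, hz2⟩ z' ⟨hz1', hz2'⟩
      exact eq_of_crs_zero (crs_eq_zero_of_mem hz1) (crs_eq_zero_of_mem hz1')
        (hgp.injective.ne (hadj t hts).ne) (crs_eq_zero_of_mem hz2) (crs_eq_zero_of_mem hz2')
        (hgp.line_ne (hadj s hs).ne (hadj t hts).ne hne)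
    · exact hgp.line_ne (hadj s hs).ne (hLg v w hvw).ne (hLH v w hvw s hs)
    · by_cases zv : z = pos v
      · exact Or.inl zv
      by_cases zw : z = pos w
      · exact Or.inr (Or.inl zw)
      have main : ∀ t < h, z ∈ segment ℝ (pos (eX t)) (pos (eY t)) → Apart v w (eX t) (eY t) ∧
          z ∈ openSegment ℝ (pos v) (pos w) ∧ z ∈ openSegment ℝ (pos (eX t)) (pos (eY t)) := by
        intro t ht' hzt
        rcases hgp.meet_cases (hLg v w hvw).ne (hadj t ht').ne (hLH v w hvw t ht').symm hz hzt with
          ⟨x, rfl | rfl, -, e⟩ | hc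
        · exact absurd e zv
        · exact absurd e zw
        · exact hc
      refine Or.inr (Or.inr ⟨(main s hs hzs).2.2, fun t ht' hts hzt => hts ?_⟩)
      have m1 := main s hs hzs
      have m2 := main t ht' hzt
      exact (hinj s hs t ht' (ht v w (hLg v w hvw) _ _ _ _ (hadj s hs) (hadj t ht') m1.1 m2.1
        (touch m1.2.1 m1.2.2) (touch m2.2.1 m2.2.2))).symm
  have hseg : ∀ {w x : V} {s : ℕ}, s(w, x) = s(eX s, eY s) →
      segment ℝ (pos w) (pos x) ⊆ segment ℝ (pos (eX s)) (pos (eY s)) := by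
    intro w x s e
    rcases Sym2.eq_iff.1 e with ⟨rfl, rfl⟩ | ⟨rfl, rfl⟩
    · exact subset_rfl
    · rw [segment_symm]
  have hkind : ∀ w ∈ O, Kind h (pos ∘ eX) (pos ∘ eY) (pos w) (mult w) := by
    intro w hw
    rcases hk w hw with ⟨hm, a, b, hab, ha, hb, hx⟩ | ⟨hm, x, hx, s, hs, e⟩ | ⟨hm, hx⟩
    · refine Or.inl ⟨hm, pos a, pos b, hgp.col w trivial a trivial b trivial ha.symm hb.symm hab, ?_⟩
      rintro e (rfl | rfl)
      · obtain ⟨s, hs, e⟩ := hx a (Or.inl rfl); exact ⟨s, hs, hseg e⟩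
      · obtain ⟨s, hs, e⟩ := hx b (Or.inr rfl); exact ⟨s, hs, hseg e⟩
    · exact Or.inr (Or.inl ⟨hm, pos x, hgp.injective.ne hx.symm, s, hs, hseg e⟩)
    · refine Or.inr (Or.inr ⟨hm, fun s hs hmem => ?_⟩)
      rcases hgp.ne_of_mem_oseg (hadj s hs).ne hmem with e | e
      · exact (hx s hs).1 e
      · exact (hx s hs).2 e
  obtain ⟨X, Y, base, C', hE, hb, hd⟩ := C.complete Metric.isBounded_ball hgp.injective hlg mult O
    hkind
  set n := h + ∑ w ∈ O, mult w
  let W : Arr :=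
    { Ω := Ω, n := n, h := h, X := X, Y := Y, convex := hcv, isOpen := Metric.isOpen_ball,
      ne := C'.ne, sub := C'.sub, order := C'.order,
      span := by
        intro z hz s hs hzs
        have done : ∀ w ∈ O, z = pos w → (∃ t < n, z ∈ openSegment ℝ (X t) (Y t)) ∨
            ∀ c d : Pl, c ≠ d → ∃ y, (∀ w ∈ segment ℝ z y, ∃ t < n, w ∈ segment ℝ (X t) (Y t)) ∧
              crs c d z < crs c d y := by
          rintro w hw rfl
          exact (hd w hw).1.imp_right fun h c d hcd => h.span hcd
        by_cases hends : z = X s ∨ z = Y s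
        · by_cases hsh : s < h
          · rw [(hE s hsh).1, (hE s hsh).2.1] at hends
            rcases hends with e | e
            · exact done _ (hO s hsh).1 e
            · exact done _ (hO s hsh).2 e
          · rcases C'.ends s hs (by omega) z hends with e | e | e
            · exact done _ (hb s hs (by omega)) e
            · exact absurd hz e
            · exact Or.inl e
        · push Not at hends
          exact Or.inl ⟨s, hs, mem_oseg_of_mem_seg hzs hends.1 hends.2⟩ }
  have hX : ∀ s < h, X s = pos (eX s) := fun s hs => (hE s hs).1
  have hY : ∀ s < h, Y s = pos (eY s) := fun s hs => (hE s hs).2.1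
  let B : Board pos h eX eY O :=
    { W := W, hh := rfl, hhn := C'.hn
      X_eq := hX, Y_eq := hY, mem_Ω := hR
      ray := fun w hw => by
        obtain ⟨-, s, h1, h2, h3⟩ := hd w hw
        exact ⟨s, h1, h2, h3 ▸ C'.base_mem s h1 h2⟩
      line := fun s hs hhs v hv => by
        rw [C'.line s hs hhs v (crs_eq_zero_of_mem hv)]; exact hb s hs hhs
      uniq := fun s hs hhs v v' hv hv' =>
        (C'.line s hs hhs v (crs_eq_zero_of_mem hv)).trans
          (C'.line s hs hhs v' (crs_eq_zero_of_mem hv')).symm }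
  refine ⟨B, rfl, fun v w hvw z hz hzK => ?_⟩
  obtain ⟨s, hs, hzs⟩ := hzK
  have hvw' := hgp.injective.ne (hLg v w hvw).ne
  obtain ⟨zv, zw⟩ := OnePlanar.ne_of_mem_oseg hz hvw'
  have hz' := openSegment_subset_segment _ _ _ hz
  obtain ⟨hzo, hzu⟩ := ((C'.long v w hvw z hz' s hs hzs).resolve_left zv).resolve_left zw
  refine ⟨s, ⟨hs, ?_⟩, ⟨hs, (hlg v w hvw).2.1 hz', hzo, hzu⟩, fun e => ?_⟩
  · by_cases hsh : s < h
    · right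
      intro t hth _ hts
      have hth : t < h := hth
      rw [Set.disjoint_left]
      intro y hyt hys
      change y ∈ segment ℝ (X t) (Y t) at hyt
      change y ∈ openSegment ℝ (X s) (Y s) at hys
      rw [hX t hth, hY t hth] at hyt
      rw [hX s hsh, hY s hsh] at hys hzo
      have hes : y ∈ segment ℝ (pos (eX s)) (pos (eY s)) := openSegment_subset_segment _ _ _ hys
      obtain ⟨y1, y2⟩ := OnePlanar.ne_of_mem_oseg hys (hgp.injective.ne (hadj s hsh).ne)
      obtain ⟨z1, z2⟩ := OnePlanar.ne_of_mem_oseg hzo (hgp.injective.ne (hadj s hsh).ne)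
      rcases hgp.meet_cases (hadj s hsh).ne (hadj t hth).ne (fun e => hts (hinj s hsh t hth e).symm)
        hes hyt with ⟨x, rfl | rfl, -, e⟩ | ⟨a1, -, a3⟩
      · exact y1 e
      · exact y2 e
      rcases hgp.meet_cases (hadj s hsh).ne (hLg v w hvw).ne (hLH v w hvw s hsh)
        (openSegment_subset_segment _ _ _ hzo) hz' with ⟨x, rfl | rfl, -, e⟩ | ⟨b1, b2, b3⟩
      · exact z1 e
      · exact z2 e
      exact hLH v w hvw t hth (ht _ _ (hadj s hsh) _ _ _ _ (hadj t hth) (hLg v w hvw) a1 b1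
        (touch hys a3) (touch hzo hz))
    · left; exact not_lt.1 hsh
  · obtain ⟨τ, h0, h1, rfl⟩ := mem_oseg.1 hz
    have e0 : crs (X s) (Y s) (pt (pos v) (pos w) τ) = 0 := crs_eq_zero_of_mem hzs
    change crs (X s) (Y s) (pos v) = crs (X s) (Y s) (pos w) at e
    rw [crs_pt_last, ← e] at e0
    simp only [sub_self, mul_zero, add_zero] at e0
    rcases C'.trans v w hvw s hs with h | h
    · exact h e0
    · exact h (e ▸ e0)

end OnePlanar

namespace OnePlanar
open Filter Topology
namespace Arr
variable {W : Arr}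

/-- A curve from `x` to `y` that crosses the walls as listed in `l`. -/
def Conn (W : Arr) (x : Pl) (l : List (ℕ × Pl)) (y : Pl) : Prop :=
  ∃ a b, W.Sees x a ∧ W.Route a l b ∧ W.Sees y b

/-- A curve together with a point in each cell that it visits. -/
structure Curve (W : Arr) (x : Pl) (l : List (ℕ × Pl)) (y : Pl) (c : ℕ → Pl) : Prop where
  start : W.Sees x (c 0)
  finish : W.Sees y (c l.length)
  free : ∀ j (hj : j < l.length), W.Free l[j].1
  reg : ∀ j (hj : j < l.length), W.Reg l[j].1 l[j].2
  before : ∀ j (hj : j < l.length), W.Sees l[j].2 (c j)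
  after : ∀ j (hj : j < l.length), W.Sees l[j].2 (c (j + 1))
  side : ∀ j (hj : j < l.length), W.side l[j].1 (c j) * W.side l[j].1 (c (j + 1)) < 0

lemma Conn.exists_curve {x y : Pl} {l : List (ℕ × Pl)} (h : W.Conn x l y) : ∃ c, W.Curve x l y c := by
  obtain ⟨a, b, ha, hr, hb⟩ := h
  suffices ∃ c : ℕ → Pl, c 0 = a ∧ W.Vis (c l.length) b ∧
      ∀ j (hj : j < l.length), W.Free l[j].1 ∧ W.Reg l[j].1 l[j].2 ∧ W.Sees l[j].2 (c j) ∧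
        W.Sees l[j].2 (c (j + 1)) ∧ W.side l[j].1 (c j) * W.side l[j].1 (c (j + 1)) < 0 by
    obtain ⟨c, c0, cl, hc⟩ := this
    exact ⟨c, c0 ▸ ha, hb.sees_vis cl.symm, fun j hj => (hc j hj).1, fun j hj => (hc j hj).2.1,
      fun j hj => (hc j hj).2.2.1, fun j hj => (hc j hj).2.2.2.1, fun j hj => (hc j hj).2.2.2.2⟩
  clear ha
  induction l generalizing a with
  | nil => exact ⟨fun _ => a, rfl, hr, fun j hj => absurd hj (by simp)⟩
  | cons e l ih =>
    obtain ⟨h1, h2, h3, d, h4, h5, h6⟩ := hr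
    obtain ⟨c, c0, cl, hc⟩ := ih d h6
    refine ⟨fun j => if j = 0 then a else c (j - 1), by simp, by simpa using cl, fun j hj => ?_⟩
    cases j with
    | zero => simpa [c0] using ⟨h1, h2, h3, h4, h5⟩
    | succ j => simpa using hc j (by simpa using hj)

namespace Curve
variable {x y : Pl} {l : List (ℕ × Pl)} {c : ℕ → Pl}

lemma vis (h : W.Curve x l y c) {j : ℕ} (hj : j ≤ l.length) : W.Vis (c j) (c j) := by
  rcases hj.lt_or_eq with hj | rfl
  · exact (h.before j hj).self_right
  · exact h.finish.self_right

lemma route (h : W.Curve x l y c) {i j : ℕ} (hij : i ≤ j) (hj : j ≤ l.length) :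
    W.Route (c i) ((l.take j).drop i) (c j) := by
  induction j, hij using Nat.le_induction with
  | base => rw [List.drop_take_self]; exact h.vis hj
  | succ j hij ih =>
    have hj' : j < l.length := hj
    have : (l.take (j + 1)).drop i = (l.take j).drop i ++ [l[j]] := by
      rw [List.take_add_one, List.drop_append_of_le_length (by simp; omega)]
      simp [hj']
    rw [this]
    exact (ih hj'.le).append (Route.single (h.free j hj') (h.reg j hj') (h.before j hj')
      (h.after j hj') (h.side j hj'))

lemma route_take (h : W.Curve x l y c) {j : ℕ} (hj : j ≤ l.length) :
    W.Route (c 0) (l.take j) (c j) := by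
  simpa using h.route (Nat.zero_le j) hj

lemma route_drop (h : W.Curve x l y c) {j : ℕ} (hj : j ≤ l.length) :
    W.Route (c j) (l.drop j) (c l.length) := by
  simpa using h.route hj le_rfl

end Curve

lemma Conn.reverse {x y : Pl} {l : List (ℕ × Pl)} (h : W.Conn x l y) : W.Conn y l.reverse x := by
  obtain ⟨a, b, h1, h2, h3⟩ := h
  exact ⟨b, a, h3, h2.reverse, h1⟩

/-- The weight of a curve. -/
def wt (W : Arr) (l : List (ℕ × Pl)) : ℕ := (l.map fun e => 2 ^ (W.n - e.1)).sum

lemma wt_append (l l' : List (ℕ × Pl)) : W.wt (l ++ l') = W.wt l + W.wt l' := by simp [wt]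

lemma wt_cons (e : ℕ × Pl) (l : List (ℕ × Pl)) : W.wt (e :: l) = 2 ^ (W.n - e.1) + W.wt l := by
  simp [wt]

lemma wt_reverse (l : List (ℕ × Pl)) : W.wt l.reverse = W.wt l := by simp [wt]

lemma Route.lt_n {a b : Pl} {l : List (ℕ × Pl)} (h : W.Route a l b) : ∀ e ∈ l, e.1 < W.n := by
  induction l generalizing a with
  | nil => simp
  | cons e l ih =>
    obtain ⟨h1, h2, h3, d, h4, h5, h6⟩ := h
    rintro e' he
    rcases List.mem_cons.1 he with rfl | he
    · exact h1.1
    · exact ih h6 e' he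

lemma wt_lt {s : ℕ} {l : List (ℕ × Pl)} (hn : (l.map Prod.fst).Nodup)
    (hl : ∀ e ∈ l, s < e.1 ∧ e.1 < W.n) : W.wt l < 2 ^ (W.n - s) := by
  have h1 : W.wt l = ((l.map Prod.fst).map fun t => 2 ^ (W.n - t)).sum := by simp [wt, Function.comp_def]
  have h2 : ((l.map Prod.fst).map fun t => 2 ^ (W.n - t)).sum =
      ∑ t ∈ (l.map Prod.fst).toFinset, 2 ^ (W.n - t) := (List.sum_toFinset _ hn).symm
  have hm : ∀ t ∈ (l.map Prod.fst).toFinset, s < t ∧ t < W.n := by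
    intro t ht
    simp only [List.mem_toFinset, List.mem_map] at ht
    obtain ⟨e, he, rfl⟩ := ht
    exact hl e he
  have h3 : ∑ t ∈ (l.map Prod.fst).toFinset, 2 ^ (W.n - t) =
      ∑ k ∈ (l.map Prod.fst).toFinset.image (fun t => W.n - t), 2 ^ k := by
    rw [Finset.sum_image]
    intro a ha b hb e
    have := hm a ha; have := hm b hb
    simp only at e
    omega
  rw [h1, h2, h3]
  refine Nat.geomSum_lt le_rfl fun k hk => ?_
  obtain ⟨t, ht, rfl⟩ := Finset.mem_image.1 hk
  have := hm t ht
  omega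

/-- No curve with the same ends is lighter, unless it crosses more of the first walls. -/
def Tight (W : Arr) (x : Pl) (l : List (ℕ × Pl)) (y : Pl) : Prop :=
  ∀ l', W.Conn x l' y → (∀ s < W.h, (l'.map Prod.fst).count s ≤ (l.map Prod.fst).count s) →
    W.wt l ≤ W.wt l'

lemma Tight.false_of_sublist {x y : Pl} {l A m C : List (ℕ × Pl)} {e : ℕ × Pl} (h : W.Tight x l y)
    (hc : W.Conn x (A ++ (m ++ C)) y) (hm : ∀ e ∈ m, W.h ≤ e.1) (hw : W.wt m < 2 ^ (W.n - e.1))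
    (hs : List.Sublist (A ++ e :: C) l) : False := by
  have h1 := h _ hc fun s hs' => by
    have h2 := (hs.map Prod.fst).count_le s
    have h3 : (m.map Prod.fst).count s = 0 := by
      rw [List.count_eq_zero]
      intro hmem
      obtain ⟨e', he', rfl⟩ := List.mem_map.1 hmem
      exact absurd (hm e' he') (by omega)
    simp only [List.map_append, List.map_cons, List.count_append, List.count_cons] at h2 ⊢
    omega
  have h2 : W.wt (A ++ e :: C) ≤ W.wt l := (hs.map _).sum_le_sum (by simp)
  rw [wt_append, wt_cons] at h2
  rw [wt_append, wt_append] at h1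
  omega

lemma sublist_of_lt {l : List (ℕ × Pl)} {i j : ℕ} (hij : i < j) (hi : i < l.length) :
    List.Sublist (l.take i ++ l[i] :: l.drop j) l := by
  conv_rhs => rw [← List.take_append_drop i l, List.drop_eq_getElem_cons hi]
  exact (List.drop_sublist_drop_left l hij).cons_cons _ |>.append_left _

namespace Curve
variable {x y : Pl} {l : List (ℕ × Pl)} {c : ℕ → Pl}

lemma conn_of_vis (h : W.Curve x l y c) {i j : ℕ} (hi : i ≤ l.length) (hj : j ≤ l.length)
    {m : List (ℕ × Pl)} (hm : W.Route (c i) m (c j)) : W.Conn x (l.take i ++ (m ++ l.drop j)) y :=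
  ⟨c 0, c l.length, h.start, (h.route_take hi).append (hm.append (h.route_drop hj)), h.finish⟩

/-- A tight curve visits each cell only once. -/
lemma not_vis (h : W.Curve x l y c) (ht : W.Tight x l y) {i j : ℕ} (hij : i < j)
    (hj : j ≤ l.length) : ¬ W.Vis (c i) (c j) := fun hv =>
  ht.false_of_sublist (e := l[i]) (h.conn_of_vis (by omega) hj (m := []) hv) (by simp)
    (by simp [wt]) (sublist_of_lt hij (by omega))

/-- A tight curve crosses each wall only once. -/
lemma wall_ne (h : W.Curve x l y c) (ht : W.Tight x l y) {i j : ℕ} (hij : i < j)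
    (hj : j < l.length) : l[i].1 ≠ l[j].1 := by
  intro e
  have hi : i < l.length := by omega
  have ri := h.reg i hi
  obtain ⟨a, m, h1, h2, h3, h4, h5⟩ := (h.reg j hj).exists_chain (h.free j hj) (h.after j hj)
    (x := l[i].2) (by rw [← e]; exact oseg_subset _ ri.2.2.1) ri.2.1
  have hw : W.wt m < 2 ^ (W.n - l[j].1) := wt_lt h4 fun e he => ⟨(h5 e he).1, h2.lt_n e he⟩
  have hm : ∀ e ∈ m, W.h ≤ e.1 := fun e he => (h5 e he).2
  rcases (mul_ne_zero (ri.side_ne (h.before i hi)) (ri.side_ne h1)).lt_or_gt with hs | hs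
  · have hr : W.Route (c i) ([l[i]] ++ m) (c (j + 1)) :=
      (Route.single (h.free i hi) ri (h.before i hi) h1 hs).append h2
    have hc := h.conn_of_vis hi.le hj hr
    refine ht.false_of_sublist (e := l[j]) (A := l.take i ++ [l[i]]) (m := m)
      (C := l.drop (j + 1)) (by simpa only [List.append_assoc] using hc) hm hw ?_
    conv_rhs => rw [← List.take_append_drop i l, List.drop_eq_getElem_cons hi]
    rw [List.append_assoc]
    refine List.Sublist.append_left (List.Sublist.cons_cons _ ?_) _
    change List.Sublist (l[j] :: l.drop (j + 1)) _
    rw [← List.drop_eq_getElem_cons hj]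
    exact List.drop_sublist_drop_left l hij
  · have hr : W.Route (c i) m (c (j + 1)) := h2.vis_left (ri.vis h1 (h.before i hi) (by rwa [mul_comm]))
    exact ht.false_of_sublist (e := l[i]) (h.conn_of_vis hi.le hj hr) hm (by rwa [e])
      (sublist_of_lt (by omega) hi)

/-- A tight curve does not cross the walls through its ends. -/
lemma left_notMem (h : W.Curve x l y c) (ht : W.Tight x l y) {j : ℕ} (hj : j < l.length) :
    x ∉ W.seg l[j].1 := by
  intro hx
  obtain ⟨a, m, h1, h2, h3, h4, h5⟩ := (h.reg j hj).exists_chain (h.free j hj) (h.after j hj)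
    hx h.start.1
  have hw : W.wt m < 2 ^ (W.n - l[j].1) := wt_lt h4 fun e he => ⟨(h5 e he).1, h2.lt_n e he⟩
  refine ht.false_of_sublist (e := l[j]) (A := []) (m := m) (C := l.drop (j + 1))
    ⟨a, _, h1, h2.append (h.route_drop hj), h.finish⟩ (fun e he => (h5 e he).2) hw ?_
  rw [List.nil_append, ← List.drop_eq_getElem_cons hj]
  exact List.drop_sublist _ _

lemma right_notMem (h : W.Curve x l y c) (ht : W.Tight x l y) {j : ℕ} (hj : j < l.length) :
    y ∉ W.seg l[j].1 := by
  intro hy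
  obtain ⟨a, m, h1, h2, h3, h4, h5⟩ := (h.reg j hj).exists_chain (h.free j hj) (h.before j hj)
    hy h.finish.1
  have hw : W.wt m < 2 ^ (W.n - l[j].1) := wt_lt h4 fun e he => ⟨(h5 e he).1, h2.lt_n e he⟩
  refine ht.false_of_sublist (e := l[j]) (A := l.take j) (m := m.reverse) (C := [])
    ⟨_, a, h.start, (h.route_take hj.le).append (by simpa using h2.reverse), h1⟩
    (fun e he => (h5 e (by simpa using he)).2) (by rwa [wt_reverse]) ?_
  have : l.take j ++ [l[j]] = l.take (j + 1) := by simp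
  rw [this]
  exact List.take_sublist _ _

end Curve

/-- The corners of a curve. -/
def nd (x : Pl) (l : List (ℕ × Pl)) (y : Pl) (j : ℕ) : Pl :=
  if j = 0 then x else if hj : j - 1 < l.length then l[j - 1].2 else y

section nd
variable (x y : Pl) (l : List (ℕ × Pl))
@[simp] lemma nd_zero : nd x l y 0 = x := by simp [nd]
@[simp] lemma nd_last : nd x l y (l.length + 1) = y := by simp [nd]
lemma nd_succ {j : ℕ} (hj : j < l.length) : nd x l y (j + 1) = l[j].2 := by simp [nd, hj]
end nd

namespace Curve
variable {x y : Pl} {l : List (ℕ × Pl)} {c : ℕ → Pl}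

lemma nd_left (h : W.Curve x l y c) {j : ℕ} (hj : j ≤ l.length) : W.Sees (nd x l y j) (c j) := by
  cases j with
  | zero => simpa using h.start
  | succ j => rw [nd_succ _ _ _ (by omega)]; exact h.after j (by omega)

lemma nd_right (h : W.Curve x l y c) {j : ℕ} (hj : j ≤ l.length) :
    W.Sees (nd x l y (j + 1)) (c j) := by
  rcases hj.lt_or_eq with hj | rfl
  · rw [nd_succ _ _ _ hj]; exact h.before j hj
  · simpa using h.finish

lemma no_wall (h : W.Curve x l y c) (ht : W.Tight x l y) (hl : l ≠ []) {j : ℕ} (hj : j ≤ l.length)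
    {s : ℕ} (hs : s < W.n) (h1 : nd x l y j ∈ W.seg s) (h2 : nd x l y (j + 1) ∈ W.seg s) : False := by
  have hl' := List.length_pos_iff.2 hl
  rcases Nat.eq_zero_or_pos j with rfl | hj0
  · rw [nd_succ _ _ _ hl'] at h2
    rw [(h.reg 0 hl').eq hs h2] at h1
    exact h.left_notMem ht hl' (by simpa using h1)
  obtain ⟨k, rfl⟩ : ∃ k, j = k + 1 := ⟨j - 1, by omega⟩
  rw [nd_succ _ _ _ (by omega)] at h1
  have e := (h.reg k (by omega)).eq hs h1
  rcases hj.lt_or_eq with hj | hj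
  · rw [nd_succ _ _ _ hj] at h2
    exact h.wall_ne ht (i := k) (j := k + 1) (by omega) hj (e.symm.trans ((h.reg _ hj).eq hs h2))
  · rw [hj, nd_last, e] at h2
    exact h.right_notMem ht (by omega) h2

lemma nd_mem_K (h : W.Curve x l y c) (hx : x ∈ W.K) (hy : y ∈ W.K) {j : ℕ}
    (hj : j ≤ l.length + 1) : nd x l y j ∈ W.K := by
  cases j with
  | zero => simpa using hx
  | succ j =>
    rcases (show j ≤ l.length by omega).lt_or_eq with hj | rfl
    · rw [nd_succ _ _ _ hj]; exact (h.reg j hj).mem_K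
    · simpa using hy

lemma nd_ne (h : W.Curve x l y c) (ht : W.Tight x l y) (hl : l ≠ []) (hx : x ∈ W.K) (hy : y ∈ W.K)
    {j : ℕ} (hj : j ≤ l.length) : nd x l y j ≠ nd x l y (j + 1) := by
  intro e
  obtain ⟨s, hs, hm⟩ := h.nd_mem_K hx hy (j := j) (by omega)
  exact h.no_wall ht hl hj hs hm (by rwa [e] at hm)

/-- The pieces of a tight curve that crosses some wall do not run along walls. -/
lemma notMem_K (h : W.Curve x l y c) (ht : W.Tight x l y) (hl : l ≠ []) (hx : x ∈ W.K) (hy : y ∈ W.K)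
    {j : ℕ} (hj : j ≤ l.length) {z : Pl} (hz : z ∈ openSegment ℝ (nd x l y j) (nd x l y (j + 1))) :
    z ∉ W.K := fun hzK => by
  obtain ⟨s, hs, h1, h2, -⟩ := bottom (h.nd_left hj) (h.nd_right hj) (h.nd_ne ht hl hx hy hj) hz hzK
  exact h.no_wall ht hl hj hs h1 h2

lemma vis_of_mem (h : W.Curve x l y c) {j : ℕ} (hj : j ≤ l.length) {z : Pl} (hzK : z ∉ W.K)
    (hz : z ∈ segment ℝ (nd x l y j) (nd x l y (j + 1))) : W.Vis (c j) z :=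
  (h.nd_left hj).seg_vis (h.nd_right hj) hz hzK

end Curve
end Arr
end OnePlanar

namespace OnePlanar
open Filter Topology

/-- The Euclidean distance. -/
def ed (a b : Pl) : ℝ := dist (⟨a.1, a.2⟩ : ℂ) ⟨b.1, b.2⟩

lemma ed_comm (a b : Pl) : ed a b = ed b a := dist_comm _ _

lemma ed_triangle (a z b : Pl) : ed a b ≤ ed a z + ed z b := dist_triangle _ _ _

lemma ed_eq_iff (a z b : Pl) : ed a z + ed z b = ed a b ↔ z ∈ segment ℝ a b := by
  rw [ed, ed, ed, dist_add_dist_eq_iff, mem_seg]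
  constructor
  · rintro ⟨t, ⟨h0, h1⟩, e⟩
    refine ⟨t, h0, h1, ?_⟩
    rw [AffineMap.lineMap_apply] at e
    have h1 := congrArg Complex.re e
    have h2 := congrArg Complex.im e
    simp at h1 h2
    refine Prod.ext ?_ ?_
    · rw [pt_fst]; linarith
    · rw [pt_snd]; linarith
  · rintro ⟨t, h0, h1, rfl⟩
    refine ⟨t, ⟨h0, h1⟩, ?_⟩
    rw [AffineMap.lineMap_apply]
    apply Complex.ext <;> simp [pt_fst, pt_snd] <;> ring

lemma ed_lt {a z b : Pl} (h : z ∉ segment ℝ a b) : ed a b < ed a z + ed z b :=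
  (ed_triangle a z b).lt_of_ne fun e => h ((ed_eq_iff a z b).1 e.symm)

/-- The length of the polygonal line with the given corners. -/
def plen : Pl → List (ℕ × Pl) → Pl → ℝ
  | x, [], y => ed x y
  | x, e :: l, y => ed x e.2 + plen e.2 l y

lemma plen_concat (x y : Pl) (l : List (ℕ × Pl)) (e : ℕ × Pl) :
    plen x (l ++ [e]) y = plen x l e.2 + ed e.2 y := by
  induction l generalizing x with
  | nil => rfl
  | cons a l ih => simp only [List.cons_append, plen, ih]; ring

lemma plen_reverse (x y : Pl) (l : List (ℕ × Pl)) : plen y l.reverse x = plen x l y := by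
  induction l generalizing x with
  | nil => exact ed_comm _ _
  | cons a l ih => rw [List.reverse_cons, plen_concat, ih, plen, ed_comm]; ring

namespace Arr

lemma nd_cons (x y : Pl) (e : ℕ × Pl) (l : List (ℕ × Pl)) (j : ℕ) :
    nd x (e :: l) y (j + 1) = nd e.2 l y j := by
  cases j with
  | zero => simp [nd]
  | succ j => simp [nd]

lemma nd_start (x x' y : Pl) (l : List (ℕ × Pl)) {j : ℕ} (hj : 0 < j) : nd x l y j = nd x' l y j := by
  simp [nd, hj.ne']

lemma nd_drop (x x' y : Pl) (l : List (ℕ × Pl)) (i j : ℕ) (hj : 0 < j) (hi : i ≤ l.length) :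
    nd x' (l.drop i) y j = nd x l y (i + j) := by
  induction i generalizing l x with
  | zero => rw [List.drop_zero, zero_add]; exact nd_start _ _ _ _ hj
  | succ i ih =>
    cases l with
    | nil => simp at hi
    | cons e l =>
      rw [List.drop_succ_cons, ih e.2 l (by simpa using hi), show i + 1 + j = (i + j) + 1 by ring,
        nd_cons]

end Arr
open Arr

lemma plen_le (x y z : Pl) (A B : List (ℕ × Pl)) : plen x (A ++ B) y ≤ plen x A z + plen z B y := by
  induction A generalizing x with
  | nil =>
    cases B with
    | nil => exact ed_triangle _ _ _
    | cons e B => simp only [List.nil_append, plen]; linarith [ed_triangle x z e.2]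
  | cons a A ih => simp only [List.cons_append, plen]; linarith [ih a.2]

lemma plen_lt {x y z : Pl} {A B : List (ℕ × Pl)}
    (h : z ∉ segment ℝ (nd x (A ++ B) y A.length) (nd x (A ++ B) y (A.length + 1))) :
    plen x (A ++ B) y < plen x A z + plen z B y := by
  induction A generalizing x with
  | nil =>
    cases B with
    | nil => exact ed_lt (by simpa [nd] using h)
    | cons e B =>
      simp only [List.nil_append, plen]
      linarith [ed_lt (a := x) (b := e.2) (z := z) (by simpa [nd] using h)]
  | cons a A ih =>
    simp only [List.cons_append, plen, List.length_cons, nd_cons] at h ⊢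
    linarith [ih h]

lemma plen_eq {x y z : Pl} {A B : List (ℕ × Pl)}
    (h : z ∈ segment ℝ (nd x (A ++ B) y A.length) (nd x (A ++ B) y (A.length + 1))) :
    plen x (A ++ B) y = plen x A z + plen z B y := by
  induction A generalizing x with
  | nil =>
    cases B with
    | nil => exact ((ed_eq_iff _ _ _).2 (by simpa [nd] using h)).symm
    | cons e B =>
      simp only [List.nil_append, plen]
      linarith [(ed_eq_iff x z e.2).2 (by simpa [nd] using h)]
  | cons a A ih =>
    simp only [List.cons_append, plen, List.length_cons, nd_cons] at h ⊢
    linarith [ih h]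

lemma plen_split {x y z : Pl} {l : List (ℕ × Pl)} {j : ℕ} (hj : j ≤ l.length)
    (h : z ∈ segment ℝ (nd x l y j) (nd x l y (j + 1))) :
    plen x l y = plen x (l.take j) z + plen z (l.drop j) y := by
  have := plen_eq (x := x) (y := y) (z := z) (A := l.take j) (B := l.drop j)
  rw [List.take_append_drop, List.length_take_of_le hj] at this
  exact this h

lemma plen_split_two {x y z z' : Pl} {l : List (ℕ × Pl)} {i j : ℕ} (hij : i < j) (hj : j ≤ l.length)
    (h : z ∈ segment ℝ (nd x l y i) (nd x l y (i + 1)))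
    (h' : z' ∈ segment ℝ (nd x l y j) (nd x l y (j + 1))) :
    plen x l y = plen x (l.take i) z + (plen z ((l.take j).drop i) z' + plen z' (l.drop j) y) := by
  rw [plen_split (by omega) h, plen_split (x := z) (l := l.drop i) (j := j - i) (z := z')
    (by rw [List.length_drop]; omega), List.drop_drop, List.drop_take,
    show i + (j - i) = j by omega]
  rw [nd_drop x _ _ _ _ _ (by omega) (by omega), nd_drop x _ _ _ _ _ (by omega) (by omega)]
  rw [show i + (j - i) = j by omega, show i + (j - i + 1) = j + 1 by omega]
  exact h'

/-- Exchanging the ends of two crossing segments gives segments that avoid the crossing. -/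
lemma notMem_seg_of_exchange {p q p' q' z : Pl} (h : z ∈ openSegment ℝ p q)
    (h' : z ∈ openSegment ℝ p' q') (hpq : p ≠ q) (hpq' : p' ≠ q') (hqq : q ≠ q')
    (hq : q ∉ openSegment ℝ p' q') (hq' : q' ∉ openSegment ℝ p q) : z ∉ segment ℝ p q' := by
  intro hz
  have zp := (ne_of_mem_oseg h hpq).1
  have zq' := (ne_of_mem_oseg h' hpq').2
  have hz2 := mem_oseg_of_mem_seg hz zp zq'
  obtain ⟨α, a0, a1, e1⟩ := mem_oseg.1 h
  obtain ⟨β, b0, b1, e2⟩ := mem_oseg.1 hz2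
  have inv : ∀ {γ : ℝ} {w : Pl}, 0 < γ → z = pt p w γ → w = pt p z γ⁻¹ := by
    intro γ w g e
    rw [e]
    refine Prod.ext ?_ ?_ <;> simp only [pt_fst, pt_snd] <;> field_simp <;> ring
  have f1 := inv a0 e1
  have f2 := inv b0 e2
  have ha : 1 < α⁻¹ := (one_lt_inv₀ a0).2 a1
  have hb : 1 < β⁻¹ := (one_lt_inv₀ b0).2 b1
  have hz1 : z = pt p z 1 := (pt_one _ _).symm
  have mem : ∀ {s t : ℝ}, 1 < s → s < t → pt p z s ∈ openSegment ℝ z (pt p z t) := by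
    intro s t hs hst
    have := (pt_mem_oseg_pt zp.symm (r := 1) (s := t) (t := s) (by linarith)).2
      ⟨by rw [min_eq_left (by linarith)]; exact hs, by rw [max_eq_right (by linarith)]; exact hst⟩
    rwa [pt_one] at this
  rcases lt_trichotomy α⁻¹ β⁻¹ with hlt | heq | hlt
  · refine hq (oseg_right_subset h' ?_)
    rw [f1, f2]; exact mem ha hlt
  · exact hqq (by rw [f1, f2, heq])
  · refine hq' (oseg_right_subset h ?_)
    rw [f1, f2]; exact mem hb hlt

namespace Arr
variable {W : Arr}

lemma Curve.exchange {x₁ y₁ x₂ y₂ z z' : Pl} {l₁ l₂ : List (ℕ × Pl)} {c₁ c₂ : ℕ → Pl}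
    (h₁ : W.Curve x₁ l₁ y₁ c₁) (h₂ : W.Curve x₂ l₂ y₂ c₂) {i₁ j₁ i₂ j₂ : ℕ} (hij₁ : i₁ < j₁)
    (hj₁ : j₁ ≤ l₁.length) (hij₂ : i₂ < j₂) (hj₂ : j₂ ≤ l₂.length) (hz : z ∉ W.K) (hz' : z' ∉ W.K)
    (m₁ : z ∈ openSegment ℝ (nd x₁ l₁ y₁ i₁) (nd x₁ l₁ y₁ (i₁ + 1)))
    (m₂ : z ∈ openSegment ℝ (nd x₂ l₂ y₂ i₂) (nd x₂ l₂ y₂ (i₂ + 1)))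
    (n₁ : z' ∈ segment ℝ (nd x₁ l₁ y₁ j₁) (nd x₁ l₁ y₁ (j₁ + 1)))
    (n₂ : z' ∈ segment ℝ (nd x₂ l₂ y₂ j₂) (nd x₂ l₂ y₂ (j₂ + 1)))
    (d₁ : nd x₁ l₁ y₁ i₁ ≠ nd x₁ l₁ y₁ (i₁ + 1)) (d₂ : nd x₂ l₂ y₂ i₂ ≠ nd x₂ l₂ y₂ (i₂ + 1))
    (d : nd x₁ l₁ y₁ (i₁ + 1) ≠ nd x₂ l₂ y₂ (i₂ + 1))
    (f₁ : nd x₁ l₁ y₁ (i₁ + 1) ∉ openSegment ℝ (nd x₂ l₂ y₂ i₂) (nd x₂ l₂ y₂ (i₂ + 1)))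
    (f₂ : nd x₂ l₂ y₂ (i₂ + 1) ∉ openSegment ℝ (nd x₁ l₁ y₁ i₁) (nd x₁ l₁ y₁ (i₁ + 1))) :
    ∃ l₁' l₂', W.Conn x₁ l₁' y₁ ∧ W.Conn x₂ l₂' y₂ ∧ (l₁' ++ l₂').Perm (l₁ ++ l₂) ∧
      plen x₁ l₁' y₁ + plen x₂ l₂' y₂ < plen x₁ l₁ y₁ + plen x₂ l₂ y₂ := by
  have os := fun {a b : Pl} => openSegment_subset_segment ℝ a b
  have v : W.Vis (c₁ i₁) (c₂ i₂) := (h₁.vis_of_mem (by omega) hz (os m₁)).trans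
    (h₂.vis_of_mem (by omega) hz (os m₂)).symm
  have v' : W.Vis (c₁ j₁) (c₂ j₂) := (h₁.vis_of_mem hj₁ hz' n₁).trans
    (h₂.vis_of_mem hj₂ hz' n₂).symm
  refine ⟨l₁.take i₁ ++ ((l₂.take j₂).drop i₂ ++ l₁.drop j₁),
    l₂.take i₂ ++ ((l₁.take j₁).drop i₁ ++ l₂.drop j₂), ?_, ?_, ?_, ?_⟩
  · exact h₁.conn_of_vis (by omega) hj₁ (((h₂.route hij₂.le hj₂).vis_left v.symm).vis_right v'.symm)
  · exact h₂.conn_of_vis (by omega) hj₂ (((h₁.route hij₁.le hj₁).vis_left v).vis_right v')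
  · have dec : ∀ {l : List (ℕ × Pl)} {i j : ℕ}, i < j → j ≤ l.length →
        l = l.take i ++ ((l.take j).drop i ++ l.drop j) := by
      intro l i j hij hj
      conv_lhs => rw [← List.take_append_drop j l, ← List.take_append_drop i (l.take j)]
      rw [List.take_take, min_eq_left hij.le, List.append_assoc]
    conv_rhs => rw [dec hij₁ hj₁, dec hij₂ hj₂]
    rw [← Multiset.coe_eq_coe]
    simp only [← Multiset.coe_add]
    abel
  · rw [plen_split_two hij₁ hj₁ (os m₁) n₁, plen_split_two hij₂ hj₂ (os m₂) n₂]
    have e₁ : plen x₁ (l₁.take i₁ ++ ((l₂.take j₂).drop i₂ ++ l₁.drop j₁)) y₁ <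
        plen x₁ (l₁.take i₁) z + plen z ((l₂.take j₂).drop i₂ ++ l₁.drop j₁) y₁ := by
      apply plen_lt
      have hlen : (l₁.take i₁).length = i₁ := List.length_take_of_le (by omega)
      have hn1 : nd x₁ (l₁.take i₁ ++ ((l₂.take j₂).drop i₂ ++ l₁.drop j₁)) y₁ i₁ =
          nd x₁ l₁ y₁ i₁ := by
        cases i₁ with
        | zero => simp
        | succ k =>
          rw [nd_succ _ _ _ (by simp; omega), nd_succ _ _ _ (by omega)]
          rw [List.getElem_append_left (by rw [hlen]; omega)]
          simp
      have hn2 : nd x₁ (l₁.take i₁ ++ ((l₂.take j₂).drop i₂ ++ l₁.drop j₁)) y₁ (i₁ + 1) =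
          nd x₂ l₂ y₂ (i₂ + 1) := by
        have hlt : 0 < ((l₂.take j₂).drop i₂).length := by simp; omega
        rw [nd_succ _ _ _ (by rw [List.length_append, List.length_append, hlen]; omega),
          nd_succ _ _ _ (by omega), List.getElem_append_right (by rw [hlen]),
          List.getElem_append_left (by rw [hlen, Nat.sub_self]; exact hlt)]
        simp
        simp only [Nat.sub_self, Nat.add_zero, show min i₁ l₁.length = i₁ by omega]
      rw [hlen, hn1, hn2]
      exact notMem_seg_of_exchange m₁ m₂ d₁ d₂ d f₁ f₂
    have e₂ := plen_le x₂ y₂ z (l₂.take i₂) ((l₁.take j₁).drop i₁ ++ l₂.drop j₂)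
    have e₃ := plen_le z y₁ z' ((l₂.take j₂).drop i₂) (l₁.drop j₁)
    have e₄ := plen_le z y₂ z' ((l₁.take j₁).drop i₁) (l₂.drop j₂)
    linarith

end Arr
end OnePlanar

namespace OnePlanar
open Filter Topology
namespace Arr
variable {W : Arr}

lemma Reg.exists_slide {s : ℕ} {q a c : Pl} (h : W.Reg s q) (ha : W.Sees q a) (hc : W.Sees q c)
    {F : Set Pl} (hF : F.Finite) : ∃ q', q' ∉ F ∧ W.Reg s q' ∧ W.Sees q' a ∧ W.Sees q' c := by
  have hq : q ≠ W.Y s := (ne_of_mem_oseg h.2.2.1 (W.ne s h.1)).2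
  have h1 := (tendsto_pt q (W.Y s)).eventually (h.slide ha)
  have h2 := (tendsto_pt q (W.Y s)).eventually (h.slide hc)
  have h3 := (tendsto_pt q (W.Y s)).eventually
    ((hF.subset sdiff_subset).isClosed.isOpen_compl.mem_nhds (show q ∈ (F \ {q})ᶜ by simp))
  have h4 : ∀ᶠ ε in 𝓝[>] (0 : ℝ), ε < 1 := eventually_small.mono fun _ h => h.2
  obtain ⟨ε, h1, h2, h3, h4, h0⟩ :=
    (h1.and (h2.and (h3.and (h4.and self_mem_nhdsWithin)))).exists
  have hm : pt q (W.Y s) ε ∈ W.oseg s := by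
    obtain ⟨t, t0, t1, e⟩ := mem_oseg.1 h.2.2.1
    have h0 : 0 < ε := h0
    refine mem_oseg.2 ⟨t + ε * (1 - t), by nlinarith, by nlinarith, ?_⟩
    have := pt_pt (W.X s) (W.Y s) t 1 ε
    rwa [pt_one, ← e] at this
  refine ⟨pt q (W.Y s) ε, fun hF' => h3 ⟨hF', fun e => ?_⟩, (h1 hm).1, (h1 hm).2, (h2 hm).2⟩
  have e : pt q (W.Y s) ε = pt q (W.Y s) 0 := by simpa using e
  exact (ne_of_gt h0) (pt_inj hq e)

lemma Route.perturb {a b : Pl} {l : List (ℕ × Pl)} (h : W.Route a l b) {F : Set Pl}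
    (hF : F.Finite) : ∃ l', W.Route a l' b ∧ l'.map Prod.fst = l.map Prod.fst ∧
      (l'.map Prod.snd).Nodup ∧ ∀ e ∈ l', e.2 ∉ F := by
  induction l generalizing a F with
  | nil => exact ⟨[], h, rfl, by simp, by simp⟩
  | cons e l ih =>
    obtain ⟨h1, h2, h3, d, h4, h5, h6⟩ := h
    obtain ⟨q, qF, q1, q2, q3⟩ := h2.exists_slide h3 h4 hF
    obtain ⟨l', r, r1, r2, r3⟩ := ih h6 (hF.insert q)
    refine ⟨(e.1, q) :: l', ⟨h1, q1, q2, d, q3, h5, r⟩, by simp [r1], ?_, ?_⟩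
    · simp only [List.map_cons, List.nodup_cons]
      refine ⟨fun hm => ?_, r2⟩
      obtain ⟨e', he', e''⟩ := List.mem_map.1 hm
      exact r3 e' he' (Or.inl e'')
    · intro e' he'
      rcases List.mem_cons.1 he' with rfl | he'
      · exact qF
      · exact fun hf => r3 e' he' (Or.inr hf)

lemma exists_perturb {ι : Type*} [Fintype ι] {x y : ι → Pl} {l : ι → List (ℕ × Pl)}
    (h : ∀ i, W.Conn (x i) (l i) (y i)) {F : Set Pl} (hF : F.Finite) :
    ∃ l' : ι → List (ℕ × Pl), (∀ i, W.Conn (x i) (l' i) (y i)) ∧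
      (∀ i, (l' i).map Prod.fst = (l i).map Prod.fst) ∧ (∀ i, ∀ e ∈ l' i, e.2 ∉ F) ∧
      (∀ i, ((l' i).map Prod.snd).Nodup) ∧
      ∀ i k, i ≠ k → ∀ e ∈ l' i, ∀ e' ∈ l' k, e.2 ≠ e'.2 := by
  classical
  suffices ∀ S : Finset ι, ∃ l' : ι → List (ℕ × Pl), (∀ i, W.Conn (x i) (l' i) (y i)) ∧
      (∀ i, (l' i).map Prod.fst = (l i).map Prod.fst) ∧ (∀ i ∈ S, ∀ e ∈ l' i, e.2 ∉ F) ∧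
      (∀ i ∈ S, ((l' i).map Prod.snd).Nodup) ∧
      ∀ i ∈ S, ∀ k ∈ S, i ≠ k → ∀ e ∈ l' i, ∀ e' ∈ l' k, e.2 ≠ e'.2 by
    simpa using this Finset.univ
  intro S
  induction S using Finset.induction_on with
  | empty => exact ⟨l, h, by simp, by simp, by simp, by simp⟩
  | insert i₀ S hi ih =>
    obtain ⟨l', h1, h2, h3, h4, h5⟩ := ih
    obtain ⟨a, b, ha, hr, hb⟩ := h1 i₀
    obtain ⟨m, r, r1, r2, r3⟩ := hr.perturb
      (F := F ∪ ⋃ i ∈ S, {q | q ∈ (l' i).map Prod.snd})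
      (hF.union (S.finite_toSet.biUnion fun i _ => List.finite_toSet _))
    have ne : ∀ {i}, i ∈ S → i ≠ i₀ := fun hS e => hi (e ▸ hS)
    have mS : ∀ e ∈ m, ∀ i ∈ S, ∀ e' ∈ l' i, e.2 ≠ e'.2 := fun e he i hi e' he' e'' =>
      r3 e he (Or.inr (mem_biUnion hi (show e.2 ∈ (l' i).map Prod.snd from
        e'' ▸ List.mem_map_of_mem he')))
    refine ⟨Function.update l' i₀ m, fun i => ?_, fun i => ?_, fun i hiS => ?_, fun i hiS => ?_,
      fun i hiS k hkS hik => ?_⟩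
    · rcases eq_or_ne i i₀ with rfl | hne
      · simpa using ⟨a, b, ha, r, hb⟩
      · simpa [hne] using h1 i
    · rcases eq_or_ne i i₀ with rfl | hne
      · simp [r1, h2]
      · simpa [hne] using h2 i
    · rcases Finset.mem_insert.1 hiS with rfl | hiS
      · simpa using fun s q he hq => r3 (s, q) he (Or.inl hq)
      · rw [Function.update_of_ne (ne hiS)]; exact h3 i hiS
    · rcases Finset.mem_insert.1 hiS with rfl | hiS
      · simpa using r2
      · rw [Function.update_of_ne (ne hiS)]; exact h4 i hiS
    · rcases Finset.mem_insert.1 hiS with rfl | hi' <;> rcases Finset.mem_insert.1 hkS with rfl | hk'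
      · exact absurd rfl hik
      · rw [Function.update_self, Function.update_of_ne (ne hk')]
        exact fun e he => mS e he k hk'
      · rw [Function.update_self, Function.update_of_ne (ne hi')]
        exact fun e he e' he' => (mS e' he' i hi' e he).symm
      · rw [Function.update_of_ne (ne hi'), Function.update_of_ne (ne hk')]
        exact h5 i hi' k hk' hik

lemma nd_reverse (x y : Pl) (l : List (ℕ × Pl)) {j : ℕ} (hj : j ≤ l.length + 1) :
    nd y l.reverse x j = nd x l y (l.length + 1 - j) := by
  cases j with
  | zero => simp
  | succ j =>
    rcases (show j ≤ l.length by omega).lt_or_eq with hj | rfl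
    · rw [nd_succ _ _ _ (by simpa using hj), show l.length + 1 - (j + 1) = (l.length - 1 - j) + 1 by omega,
        nd_succ _ _ _ (by omega), List.getElem_reverse]
    · have := nd_last y x l.reverse
      rw [List.length_reverse] at this
      rw [this]; simp

end Arr
end OnePlanar

namespace OnePlanar
open Filter Topology

lemma exists_sum_update {ι α A : Type*} [Fintype ι] [DecidableEq ι] [AddCommMonoid A] (g : ι → α → A)
    (l : ι → α) (i : ι) : ∃ R, ∑ j, g j (l j) = g i (l i) + R ∧
      ∀ a, ∑ j, g j (Function.update l i a j) = g i a + R := by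
  refine ⟨∑ j ∈ Finset.univ.erase i, g j (l j), (Finset.add_sum_erase _ _ (Finset.mem_univ i)).symm,
    fun a => ?_⟩
  rw [← Finset.add_sum_erase _ _ (Finset.mem_univ i), Function.update_self]
  congr 1
  exact Finset.sum_congr rfl fun j hj => by rw [Function.update_of_ne (Finset.ne_of_mem_erase hj)]

lemma exists_sum_update_two {ι α A : Type*} [Fintype ι] [DecidableEq ι] [AddCommMonoid A]
    (g : ι → α → A) (l : ι → α) {i k : ι} (hik : i ≠ k) :
    ∃ R, ∑ j, g j (l j) = g i (l i) + g k (l k) + R ∧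
      ∀ a b, ∑ j, g j (Function.update (Function.update l i a) k b j) = g i a + g k b + R := by
  refine ⟨∑ j ∈ (Finset.univ.erase i).erase k, g j (l j), ?_, fun a b => ?_⟩
  · rw [← Finset.add_sum_erase _ _ (Finset.mem_univ i), add_assoc,
      Finset.add_sum_erase _ (fun j => g j (l j)) (Finset.mem_erase.2 ⟨hik.symm, Finset.mem_univ k⟩)]
  · rw [← Finset.add_sum_erase _ _ (Finset.mem_univ i), Function.update_of_ne hik,
      Function.update_self, add_assoc]
    congr 1
    rw [← Finset.add_sum_erase _ _ (Finset.mem_erase.2 ⟨hik.symm, Finset.mem_univ k⟩),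
      Function.update_self]
    congr 1
    refine Finset.sum_congr rfl fun j hj => ?_
    rw [Function.update_of_ne (Finset.ne_of_mem_erase hj),
      Function.update_of_ne (Finset.ne_of_mem_erase (Finset.mem_of_mem_erase hj))]

lemma sum_sum_eq {ι α : Type*} [Fintype ι] (l l' : ι → List α)
    (h : ∑ i, (l i : Multiset α) = ∑ i, (l' i : Multiset α)) (f : α → ℕ) :
    ∑ i, ((l i).map f).sum = ∑ i, ((l' i).map f).sum := by
  have key : ∀ l : ι → List α, ∑ i, ((l i).map f).sum =
      ((∑ i, (l i : Multiset α)).map f).sum := by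
    intro l
    rw [← Multiset.coe_mapAddMonoidHom, map_sum, Multiset.sum_sum]
    exact Finset.sum_congr rfl fun i _ => by simp
  rw [key, key, h]

lemma sum_count_eq {ι α β : Type*} [Fintype ι] [BEq β] [LawfulBEq β] (l l' : ι → List α)
    (h : ∑ i, (l i : Multiset α) = ∑ i, (l' i : Multiset α)) (f : α → β) (b : β) :
    ∑ i, ((l i).map f).count b = ∑ i, ((l' i).map f).count b := by
  have key : ∀ l : List α, (l.map f).count b = (l.map fun a => if f a == b then 1 else 0).sum := by
    intro l
    induction l with
    | nil => simp
    | cons a l ih => rw [List.map_cons, List.count_cons, ih, List.map_cons, List.sum_cons, add_comm]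
  simp only [key]
  exact sum_sum_eq l l' h _

lemma finite_systems {ι α : Type*} [Fintype ι] (M : Multiset α) :
    {l : ι → List α | ∑ i, (l i : Multiset α) = M}.Finite := by
  classical
  have h : {l : List α | (l : Multiset α) ≤ M}.Finite := by
    have h1 : {m : Multiset α | m ≤ M}.Finite := (Finset.Iic M).finite_toSet.subset (by intro m hm; simpa using hm)
    refine (h1.biUnion (t := fun m => {l : List α | (l : Multiset α) = m}) fun m _ => ?_).subset
      fun l hl => mem_biUnion hl rfl
    induction m using Quotient.inductionOn with
    | h l₀ =>
      refine (List.finite_toSet l₀.permutations).subset fun l hl => ?_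
      exact List.mem_permutations.2 (Quotient.exact hl)
  refine (Set.Finite.pi' fun _ : ι => h).subset fun l hl i => ?_
  rw [mem_ofPred_eq, ← show ∑ i, (l i : Multiset α) = M from hl]
  exact Finset.single_le_sum (f := fun i => (l i : Multiset α)) (fun _ _ => Multiset.zero_le _)
    (Finset.mem_univ i)

namespace Arr
variable {W : Arr}

lemma wt_eq_of_fst {l l' : List (ℕ × Pl)} (h : l.map Prod.fst = l'.map Prod.fst) :
    W.wt l = W.wt l' := by
  have key : ∀ l : List (ℕ × Pl), W.wt l = ((l.map Prod.fst).map fun s => 2 ^ (W.n - s)).sum := by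
    intro l; simp [wt, Function.comp_def]
  rw [key, key, h]

/-- A family of curves that is as short as possible: no two curves meet twice. -/
structure Optimal {ι : Type*} [Fintype ι] (W : Arr) (x y : ι → Pl) (F : Set Pl)
    (l : ι → List (ℕ × Pl)) (c : ι → ℕ → Pl) : Prop where
  curve : ∀ i, W.Curve (x i) (l i) (y i) (c i)
  cap : ∀ s < W.h, ∑ i, ((l i).map Prod.fst).count s ≤ 1
  tight : ∀ i, W.Tight (x i) (l i) (y i)
  notMem : ∀ i, ∀ e ∈ l i, e.2 ∉ F
  port : ∀ i k, ∀ (j : ℕ) (hj : j < (l i).length) (j' : ℕ) (hj' : j' < (l k).length),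
    (l i)[j].2 = (l k)[j'].2 → i = k ∧ j = j'
  once : ∀ i k, i ≠ k → l i ≠ [] → l k ≠ [] → ∀ {i₁ j₁ i₂ j₂ : ℕ}, i₁ ≤ (l i).length →
    j₁ ≤ (l i).length → i₂ ≤ (l k).length → j₂ ≤ (l k).length → ∀ {z z' : Pl},
    z ∈ openSegment ℝ (nd (x i) (l i) (y i) i₁) (nd (x i) (l i) (y i) (i₁ + 1)) →
    z ∈ openSegment ℝ (nd (x k) (l k) (y k) i₂) (nd (x k) (l k) (y k) (i₂ + 1)) →
    z' ∈ openSegment ℝ (nd (x i) (l i) (y i) j₁) (nd (x i) (l i) (y i) (j₁ + 1)) →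
    z' ∈ openSegment ℝ (nd (x k) (l k) (y k) j₂) (nd (x k) (l k) (y k) (j₂ + 1)) →
    i₁ = j₁ ∧ i₂ = j₂

lemma Curve.exchange_tight {x₁ y₁ x₂ y₂ z z' : Pl} {l₁ l₂ : List (ℕ × Pl)} {c₁ c₂ : ℕ → Pl}
    (h₁ : W.Curve x₁ l₁ y₁ c₁) (h₂ : W.Curve x₂ l₂ y₂ c₂) (t₁ : W.Tight x₁ l₁ y₁)
    (t₂ : W.Tight x₂ l₂ y₂) (e₁ : l₁ ≠ []) (e₂ : l₂ ≠ []) (hx₁ : x₁ ∈ W.K) (hy₁ : y₁ ∈ W.K)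
    (hx₂ : x₂ ∈ W.K) (hy₂ : y₂ ∈ W.K)
    (hp : ∀ e ∈ l₁, ∀ e' ∈ l₂, e.2 ≠ e'.2) {i₁ j₁ i₂ j₂ : ℕ} (hij₁ : i₁ < j₁)
    (hj₁ : j₁ ≤ l₁.length) (hij₂ : i₂ < j₂) (hj₂ : j₂ ≤ l₂.length)
    (m₁ : z ∈ openSegment ℝ (nd x₁ l₁ y₁ i₁) (nd x₁ l₁ y₁ (i₁ + 1)))
    (m₂ : z ∈ openSegment ℝ (nd x₂ l₂ y₂ i₂) (nd x₂ l₂ y₂ (i₂ + 1)))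
    (n₁ : z' ∈ openSegment ℝ (nd x₁ l₁ y₁ j₁) (nd x₁ l₁ y₁ (j₁ + 1)))
    (n₂ : z' ∈ openSegment ℝ (nd x₂ l₂ y₂ j₂) (nd x₂ l₂ y₂ (j₂ + 1))) :
    ∃ l₁' l₂', W.Conn x₁ l₁' y₁ ∧ W.Conn x₂ l₂' y₂ ∧ (l₁' ++ l₂').Perm (l₁ ++ l₂) ∧
      plen x₁ l₁' y₁ + plen x₂ l₂' y₂ < plen x₁ l₁ y₁ + plen x₂ l₂ y₂ := by
  have i1 : i₁ ≤ l₁.length := by omega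
  have i2 : i₂ ≤ l₂.length := by omega
  refine h₁.exchange h₂ hij₁ hj₁ hij₂ hj₂ (h₁.notMem_K t₁ e₁ hx₁ hy₁ i1 m₁)
    (h₁.notMem_K t₁ e₁ hx₁ hy₁ hj₁ n₁) m₁ m₂ (openSegment_subset_segment _ _ _ n₁)
    (openSegment_subset_segment _ _ _ n₂) (h₁.nd_ne t₁ e₁ hx₁ hy₁ i1) (h₂.nd_ne t₂ e₂ hx₂ hy₂ i2) ?_
    (fun hm => h₂.notMem_K t₂ e₂ hx₂ hy₂ i2 hm (h₁.nd_mem_K hx₁ hy₁ (by omega)))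
    (fun hm => h₁.notMem_K t₁ e₁ hx₁ hy₁ i1 hm (h₂.nd_mem_K hx₂ hy₂ (by omega)))
  rw [nd_succ _ _ _ (by omega), nd_succ _ _ _ (by omega)]
  exact hp _ (List.getElem_mem _) _ (List.getElem_mem _)

lemma Tight.reverse {x y : Pl} {l : List (ℕ × Pl)} (h : W.Tight x l y) : W.Tight y l.reverse x := by
  intro l' hl' hc
  rw [wt_reverse, ← wt_reverse l']
  refine h _ hl'.reverse fun s hs => ?_
  have := hc s hs
  simpa using this

theorem exists_optimal {ι : Type*} [Fintype ι] {x y : ι → Pl} (hx : ∀ i, x i ∈ W.K)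
    (hy : ∀ i, y i ∈ W.K) {l₀ : ι → List (ℕ × Pl)} (h₀ : ∀ i, W.Conn (x i) (l₀ i) (y i))
    (hc : ∀ s < W.h, ∑ i, ((l₀ i).map Prod.fst).count s ≤ 1) {F : Set Pl} (hF : F.Finite) :
    ∃ l c, W.Optimal x y F l c := by
  classical
  obtain ⟨l₁, ⟨h₁, hc₁⟩, hmin⟩ := (measure fun l : ι → List (ℕ × Pl) => ∑ i, W.wt (l i)).wf.has_min
    {l | (∀ i, W.Conn (x i) (l i) (y i)) ∧ ∀ s < W.h, ∑ i, ((l i).map Prod.fst).count s ≤ 1}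
    ⟨l₀, h₀, hc⟩
  obtain ⟨l₂, h₂, hfst, hF₂, hnd, hcr⟩ := exists_perturb h₁ hF
  have cnt₂ : ∀ q, ∑ i, ((l₂ i).map Prod.snd).count q ≤ 1 := by
    intro q
    by_cases hq : ∃ i, q ∈ (l₂ i).map Prod.snd
    · obtain ⟨i, hi⟩ := hq
      rw [Finset.sum_eq_single i]
      · exact List.nodup_iff_count_le_one.1 (hnd i) q
      · intro k _ hk
        refine List.count_eq_zero.2 fun hm => ?_
        obtain ⟨e, he, rfl⟩ := List.mem_map.1 hi
        obtain ⟨e', he', e''⟩ := List.mem_map.1 hm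
        exact hcr i k hk.symm e he e' he' e''.symm
      · simp
    · push Not at hq
      simp [fun i => List.count_eq_zero.2 (hq i)]
  have fin := (finite_systems (∑ i, (l₂ i : Multiset (ℕ × Pl)))).subset
    (show {l : ι → List (ℕ × Pl) | ∑ i, (l i : Multiset (ℕ × Pl)) = ∑ i, (l₂ i : Multiset (ℕ × Pl)) ∧
      ∀ i, W.Conn (x i) (l i) (y i)} ⊆ _ from fun l hl => hl.1)
  obtain ⟨l, ⟨hM, hl⟩, hlmin⟩ := exists_min_image _ (fun l => ∑ i, plen (x i) (l i) (y i)) fin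
    ⟨l₂, rfl, h₂⟩
  have cap : ∀ s < W.h, ∑ i, ((l i).map Prod.fst).count s ≤ 1 := by
    intro s hs
    rw [sum_count_eq l l₂ hM]
    simpa only [hfst] using hc₁ s hs
  have cnt : ∀ q, ∑ i, ((l i).map Prod.snd).count q ≤ 1 := fun q => by
    rw [sum_count_eq l l₂ hM]; exact cnt₂ q
  have wmin : ∀ l' : ι → List (ℕ × Pl), (∀ i, W.Conn (x i) (l' i) (y i)) →
      (∀ s < W.h, ∑ i, ((l' i).map Prod.fst).count s ≤ 1) → ∑ i, W.wt (l i) ≤ ∑ i, W.wt (l' i) := by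
    intro l' h1 h2
    have e : ∑ i, W.wt (l i) = ∑ i, W.wt (l₁ i) := by
      rw [← Finset.sum_congr rfl fun i _ => wt_eq_of_fst (hfst i)]
      exact sum_sum_eq l l₂ hM _
    rw [e]
    exact not_lt.1 (hmin l' ⟨h1, h2⟩)
  have tight : ∀ i, W.Tight (x i) (l i) (y i) := by
    intro i l' hl' hle
    obtain ⟨R, e1, e2⟩ := exists_sum_update (fun _ => W.wt) l i
    have := wmin (Function.update l i l') (fun k => ?_) fun s hs => ?_
    · rw [e1, e2] at this; omega
    · rcases eq_or_ne k i with rfl | hk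
      · simpa using hl'
      · simpa [hk] using hl k
    · obtain ⟨R, e1, e2⟩ := exists_sum_update (fun _ m => (m.map Prod.fst).count s) l i
      have h1 := cap s hs
      have h2 := hle s hs
      rw [e2]; rw [e1] at h1; omega
  have port : ∀ i k, ∀ (j : ℕ) (hj : j < (l i).length) (j' : ℕ) (hj' : j' < (l k).length),
      (l i)[j].2 = (l k)[j'].2 → i = k ∧ j = j' := by
    intro i k j hj j' hj' e
    have m1 : (l i)[j].2 ∈ (l i).map Prod.snd := List.mem_map_of_mem (List.getElem_mem _)
    have m2 : (l i)[j].2 ∈ (l k).map Prod.snd := e ▸ List.mem_map_of_mem (List.getElem_mem _)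
    have hik : i = k := by
      by_contra hik
      have h1 := cnt (l i)[j].2
      obtain ⟨R, e1, -⟩ := exists_sum_update_two
        (fun _ m => (m.map Prod.snd).count (l i)[j].2) l hik
      have h2 := List.count_pos_iff.2 m1
      have h3 := List.count_pos_iff.2 m2
      rw [e1] at h1
      omega
    subst hik
    refine ⟨rfl, ?_⟩
    have nd : ((l i).map Prod.snd).Nodup := List.nodup_iff_count_le_one.2 fun q =>
      (Finset.single_le_sum (f := fun i => ((l i).map Prod.snd).count q) (fun _ _ => Nat.zero_le _)
        (Finset.mem_univ i)).trans (cnt q)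
    exact (nd.getElem_inj_iff (i := j) (j := j') (hi := by simpa using hj) (hj := by simpa using hj')).1
      (by simpa using e)
  choose c hc' using fun i => (hl i).exists_curve
  have noex : ∀ i k, i ≠ k → ∀ l₁' l₂', W.Conn (x i) l₁' (y i) → W.Conn (x k) l₂' (y k) →
      (l₁' ++ l₂').Perm (l i ++ l k) →
      plen (x i) l₁' (y i) + plen (x k) l₂' (y k) < plen (x i) (l i) (y i) + plen (x k) (l k) (y k) →
      False := by
    intro i k hik a b ha hb hp hlt
    have := hlmin (Function.update (Function.update l i a) k b) ⟨?_, fun j => ?_⟩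
    · obtain ⟨R, e1, e2⟩ := exists_sum_update_two (fun i m => plen (x i) m (y i)) l hik
      rw [e1, e2] at this; linarith
    · obtain ⟨R, e1, e2⟩ := exists_sum_update_two (fun _ (m : List (ℕ × Pl)) => (m : Multiset (ℕ × Pl))) l hik
      rw [← hM, e1, e2]
      congr 1
      exact Quotient.sound hp
    · rcases eq_or_ne j k with rfl | hk
      · simpa using hb
      · rw [Function.update_of_ne hk]
        rcases eq_or_ne j i with rfl | hj
        · simpa using ha
        · simpa [hj] using hl j
  have lt : ∀ i k, i ≠ k → l i ≠ [] → l k ≠ [] → ∀ {i₁ j₁ i₂ j₂ : ℕ}, i₁ < j₁ →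
      j₁ ≤ (l i).length → i₂ ≤ (l k).length → j₂ ≤ (l k).length → ∀ {z z' : Pl},
      z ∈ openSegment ℝ (nd (x i) (l i) (y i) i₁) (nd (x i) (l i) (y i) (i₁ + 1)) →
      z ∈ openSegment ℝ (nd (x k) (l k) (y k) i₂) (nd (x k) (l k) (y k) (i₂ + 1)) →
      z' ∈ openSegment ℝ (nd (x i) (l i) (y i) j₁) (nd (x i) (l i) (y i) (j₁ + 1)) →
      z' ∈ openSegment ℝ (nd (x k) (l k) (y k) j₂) (nd (x k) (l k) (y k) (j₂ + 1)) → False := by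
    intro i k hik li lk i₁ j₁ i₂ j₂ h1 h2 h3 h4 z z' m₁ m₂ n₁ n₂
    have hp : ∀ e ∈ l i, ∀ e' ∈ l k, e.2 ≠ e'.2 := by
      intro e he e' he' e''
      obtain ⟨j, hj, rfl⟩ := List.getElem_of_mem he
      obtain ⟨j', hj', rfl⟩ := List.getElem_of_mem he'
      exact hik (port i k j hj j' hj' e'').1
    rcases lt_trichotomy i₂ j₂ with h5 | h5 | h5
    · obtain ⟨a, b, ha, hb, hperm, hlt⟩ := (hc' i).exchange_tight (hc' k) (tight i) (tight k) li lk
        (hx i) (hy i) (hx k) (hy k) hp h1 h2 h5 h4 m₁ m₂ n₁ n₂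
      exact noex i k hik a b ha hb hperm hlt
    · subst h5
      have os := fun {a b : Pl} => openSegment_subset_segment ℝ a b
      have hz := (hc' i).notMem_K (tight i) li (hx i) (hy i) (by omega) m₁
      have hz' := (hc' i).notMem_K (tight i) li (hx i) (hy i) h2 n₁
      refine (hc' i).not_vis (tight i) h1 h2 ?_
      exact ((hc' i).vis_of_mem (by omega) hz (os m₁)).trans
        ((((hc' k).vis_of_mem h3 hz (os m₂)).symm.trans ((hc' k).vis_of_mem h3 hz' (os n₂))).trans
          ((hc' i).vis_of_mem h2 hz' (os n₁)).symm)
    · obtain ⟨c', hcr'⟩ := (hl k).reverse.exists_curve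
      have rv : ∀ {m : ℕ} {w : Pl}, m ≤ (l k).length →
          w ∈ openSegment ℝ (nd (x k) (l k) (y k) m) (nd (x k) (l k) (y k) (m + 1)) →
          w ∈ openSegment ℝ (nd (y k) (l k).reverse (x k) ((l k).length - m))
            (nd (y k) (l k).reverse (x k) ((l k).length - m + 1)) := by
        intro m w hm hw
        rw [nd_reverse _ _ _ (by omega), nd_reverse _ _ _ (by omega), openSegment_symm,
          show (l k).length + 1 - ((l k).length - m + 1) = m by omega,
          show (l k).length + 1 - ((l k).length - m) = m + 1 by omega]
        exact hw
      obtain ⟨a, b, ha, hb, hperm, hlt⟩ := (hc' i).exchange_tight hcr' (tight i) (tight k).reverse li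
        (by simpa using lk) (hx i) (hy i) (hy k) (hx k)
        (fun e he e' he' => hp e he e' (List.mem_reverse.1 he')) h1 h2
        (i₂ := (l k).length - i₂) (j₂ := (l k).length - j₂) (by omega) (by simp)
        m₁ (rv h3 m₂) n₁ (rv h4 n₂)
      refine noex i k hik a b.reverse ha hb.reverse ?_ ?_
      · exact ((List.reverse_perm b).append_left a).trans
          (hperm.trans ((List.reverse_perm (l k)).append_left (l i)))
      · rw [plen_reverse] at hlt ⊢; exact hlt
  refine ⟨l, c, hc', cap, tight, fun i e he => ?_, port, ?_⟩
  · have hm : e ∈ ∑ i, (l i : Multiset (ℕ × Pl)) := Multiset.mem_sum.2 ⟨i, Finset.mem_univ i, he⟩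
    rw [hM] at hm
    obtain ⟨k, -, hk⟩ := Multiset.mem_sum.1 hm
    exact hF₂ k e hk
  · intro i k hik li lk i₁ j₁ i₂ j₂ a1 a2 a3 a4 z z' m₁ m₂ n₁ n₂
    constructor
    · rcases lt_trichotomy i₁ j₁ with hh | hh | hh
      · exact (lt i k hik li lk hh a2 a3 a4 m₁ m₂ n₁ n₂).elim
      · exact hh
      · exact (lt i k hik li lk hh a1 a4 a3 n₁ n₂ m₁ m₂).elim
    · rcases lt_trichotomy i₂ j₂ with hh | hh | hh
      · exact (lt k i hik.symm lk li hh a4 a1 a2 m₂ m₁ n₂ n₁).elim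
      · exact hh
      · exact (lt k i hik.symm lk li hh a3 a2 a1 n₂ n₁ m₂ m₁).elim

end Arr
end OnePlanar

namespace OnePlanar
open Filter Topology

lemma Arr.Conn.append {W : Arr} {x y z : Pl} {l l' : List (ℕ × Pl)} (h : W.Conn x l y)
    (h' : W.Conn y l' z) (hy : y ∉ W.K) : W.Conn x (l ++ l') z := by
  obtain ⟨a, b, ha, hr, hb⟩ := h
  obtain ⟨a', b', ha', hr', hb'⟩ := h'
  exact ⟨a, b', ha, hr.append (hr'.vis_left ((ha'.vis hy).symm.trans (hb.vis hy))), hb'⟩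

section
variable {V ι : Type*} {G : SimpleGraph V} {u v : ι → V} {P : ∀ i, G.Walk (u i) (v i)}

/-- The edges `s(eX s, eY s)` with `s < h` are the edges of the short paths. -/
structure ShortEnum (P : ∀ i, G.Walk (u i) (v i)) (Sh : ι → Prop) (h : ℕ) (eX eY : ℕ → V) : Prop where
  of_short : ∀ i, Sh i → ∀ k < (P i).length, ∃ s < h,
    s((P i).getVert k, (P i).getVert (k + 1)) = s(eX s, eY s)
  short : ∀ s < h, ∃ i, Sh i ∧ ∃ k < (P i).length,
    s((P i).getVert k, (P i).getVert (k + 1)) = s(eX s, eY s)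
  inj : ∀ s < h, ∀ t < h, s(eX s, eY s) = s(eX t, eY t) → s = t

open Classical in
lemma exists_shortEnum [Nonempty V] [Fintype ι] (P : ∀ i, G.Walk (u i) (v i)) (Sh : ι → Prop) :
    ∃ h eX eY, ShortEnum P Sh h eX eY ∧ h ≤ ∑ i with Sh i, (P i).length := by
  set E : Finset (Sym2 V) := (Finset.univ.filter Sh).biUnion fun i => (P i).edges.toFinset with hE
  have mE : ∀ e, e ∈ E ↔ ∃ i, Sh i ∧ ∃ k < (P i).length,
      e = s((P i).getVert k, (P i).getVert (k + 1)) := by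
    intro e
    simp [hE, mem_edges_iff_getVert]
  obtain ⟨w⟩ := ‹Nonempty V›
  choose f hf using fun e : Sym2 V => (show ∃ q : V × V, s(q.1, q.2) = e from
    Sym2.ind (fun a b => ⟨(a, b), rfl⟩) e)
  have hg : ∀ s (hs : s < E.toList.length), s((f (E.toList.getD s s(w, w))).1,
      (f (E.toList.getD s s(w, w))).2) = E.toList[s] := fun s hs => by
    rw [hf, List.getD_eq_getElem _ _ hs]
  refine ⟨E.toList.length, fun s => (f (E.toList.getD s s(w, w))).1,
    fun s => (f (E.toList.getD s s(w, w))).2, ⟨?_, ?_, ?_⟩, ?_⟩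
  · intro i hi k hk
    have := (mE _).2 ⟨i, hi, k, hk, rfl⟩
    obtain ⟨s, hs, e⟩ := List.getElem_of_mem (Finset.mem_toList.2 this)
    exact ⟨s, hs, by rw [hg s hs, e]⟩
  · intro s hs
    obtain ⟨i, hi, k, hk, e⟩ := (mE _).1 (Finset.mem_toList.1 (List.getElem_mem hs))
    exact ⟨i, hi, k, hk, by rw [hg s hs, e]⟩
  · intro s hs t ht e
    rw [hg s hs, hg t ht] at e
    exact E.nodup_toList.getElem_inj_iff.1 e
  · rw [Finset.length_toList]
    refine Finset.card_biUnion_le.trans (Finset.sum_le_sum fun i _ => ?_)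
    exact (List.toFinset_card_le _).trans (by simp)

variable {Sh : ι → Prop} {h : ℕ} {eX eY : ℕ → V}

lemma ShortEnum.adj (hE : ShortEnum P Sh h eX eY) {s : ℕ} (hs : s < h) : G.Adj (eX s) (eY s) := by
  obtain ⟨i, -, k, hk, e⟩ := hE.short s hs
  rw [← SimpleGraph.mem_edgeSet, ← e, SimpleGraph.mem_edgeSet]
  exact (P i).adj_getVert_succ hk

lemma ShortEnum.end_eq (hE : ShortEnum P Sh h eX eY) {s : ℕ} (hs : s < h) {w : V}
    (hw : w = eX s ∨ w = eY s) : ∃ i, Sh i ∧ ∃ k ≤ (P i).length, w = (P i).getVert k := by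
  obtain ⟨i, hi, k, hk, e⟩ := hE.short s hs
  refine ⟨i, hi, ?_⟩
  have : w ∈ s((P i).getVert k, (P i).getVert (k + 1)) := by rw [e]; simpa using hw
  rcases Sym2.mem_iff.1 this with rfl | rfl
  · exact ⟨k, hk.le, rfl⟩
  · exact ⟨k + 1, hk, rfl⟩

variable [Fintype V] [DecidableRel G.Adj]

lemma PathSys.edge_inj (hS : PathSys G u v P) {i i' : ι} {k k' : ℕ} (hk : k < (P i).length)
    (hk' : k' < (P i').length)
    (e : s((P i).getVert k, (P i).getVert (k + 1)) = s((P i').getVert k', (P i').getVert (k' + 1))) :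
    i = i' ∧ k = k' := by
  refine hS.shortVert_same (N := fun i => (P i).length) (fun _ => le_rfl) hS.pos (fun _ h => h) hk hk' ?_
  rw [shortVert_full hk.le, shortVert_full hk, shortVert_full hk'.le, shortVert_full hk', e]

lemma PathSys.not_branch (hS : PathSys G u v P) {i i' : ι} {k : ℕ} (h0 : 0 < k)
    (hk : k < (P i).length) : ¬ (u i' = (P i).getVert k ∨ v i' = (P i).getVert k) := by
  have := hS.degree_inner h0 hk
  rintro (e | e)
  · exact (hS.max i').1 (e ▸ this)
  · exact (hS.max i').2 (e ▸ this)

open Classical in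
/-- The vertices at which walls start. -/
def wallEnds [Fintype ι] (P : ∀ i, G.Walk (u i) (v i)) (Sh : ι → Prop) : Finset V :=
  Finset.univ.filter fun w => (∃ i, u i = w ∨ v i = w) ∨
    ∃ i, Sh i ∧ ∃ k, 0 < k ∧ k < (P i).length ∧ w = (P i).getVert k

open Classical in
lemma card_wallEnds_le [Fintype ι] (hS : PathSys G u v P) (Sh : ι → Prop) :
    (wallEnds P Sh).card ≤ Fintype.card ι + ∑ i with Sh i, ((P i).length - 1) := by
  have hsub : wallEnds P Sh ⊆ (Finset.univ.filter fun w => ∃ i, u i = w ∨ v i = w) ∪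
      (Finset.univ.filter Sh).biUnion fun i =>
        (Finset.range ((P i).length - 1)).image fun k => (P i).getVert (k + 1) := by
    intro w hw
    rcases (Finset.mem_filter.1 hw).2 with hw | ⟨i, hi, k, k0, hk, rfl⟩
    · exact Finset.mem_union_left _ (by simpa using hw)
    · refine Finset.mem_union_right _ (Finset.mem_biUnion.2 ⟨i, by simpa using hi, ?_⟩)
      exact Finset.mem_image.2 ⟨k - 1, by simp; omega, by rw [Nat.sub_add_cancel k0]⟩
  refine (Finset.card_le_card hsub).trans ((Finset.card_union_le _ _).trans
    (add_le_add hS.card_branch_le (Finset.card_biUnion_le.trans (Finset.sum_le_sum fun i _ => ?_))))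
  exact Finset.card_image_le.trans (by simp)

open Classical in
lemma sum_wallEnds_le [Fintype ι] (hS : PathSys G u v P) (hE : ShortEnum P Sh h eX eY) :
    ∑ w ∈ wallEnds P Sh, (if (∃ i, u i = w ∨ v i = w) ∧ ∃ s < h, w = eX s ∨ w = eY s then 2 else 1) ≤
      Fintype.card ι + (Finset.univ.filter Sh).card + ∑ i with Sh i, (P i).length := by
  have e1 : ∀ w, (if (∃ i, u i = w ∨ v i = w) ∧ ∃ s < h, w = eX s ∨ w = eY s then 2 else 1) =
      1 + if (∃ i, u i = w ∨ v i = w) ∧ ∃ s < h, w = eX s ∨ w = eY s then 1 else 0 := by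
    intro w; split_ifs <;> rfl
  rw [Finset.sum_congr rfl fun w _ => e1 w, Finset.sum_add_distrib, Finset.sum_boole,
    Finset.sum_const, smul_eq_mul, mul_one]
  have h1 : ((wallEnds P Sh).filter fun w =>
      (∃ i, u i = w ∨ v i = w) ∧ ∃ s < h, w = eX s ∨ w = eY s).card ≤
      (Finset.univ.filter Sh).card + (Finset.univ.filter Sh).card := by
    refine (Finset.card_le_card (t := (Finset.univ.filter Sh).image u ∪
      (Finset.univ.filter Sh).image v) fun w hw => ?_).trans ((Finset.card_union_le _ _).trans
      (add_le_add Finset.card_image_le Finset.card_image_le))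
    obtain ⟨⟨i', hi'⟩, s, hs, hw⟩ := (Finset.mem_filter.1 hw).2
    obtain ⟨i, hi, k, hk, rfl⟩ := hE.end_eq hs hw
    rcases Nat.eq_zero_or_pos k with rfl | k0
    · exact Finset.mem_union_left _ (Finset.mem_image.2 ⟨i, by simpa using hi, by simp⟩)
    rcases hk.lt_or_eq with hk | rfl
    · exact absurd hi' (hS.not_branch k0 hk)
    · exact Finset.mem_union_right _ (Finset.mem_image.2 ⟨i, by simpa using hi, by simp⟩)
  have h2 : ∑ i with Sh i, ((P i).length - 1) + (Finset.univ.filter Sh).card =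
      ∑ i with Sh i, (P i).length := by
    rw [Finset.card_eq_sum_ones, ← Finset.sum_add_distrib]
    exact Finset.sum_congr rfl fun i _ => Nat.sub_add_cancel (hS.pos i)
  have h3 := card_wallEnds_le hS Sh
  simp only [Nat.cast_id]
  omega

open Classical in
lemma vkind_wallEnds [Fintype ι] (hS : PathSys G u v P) (hE : ShortEnum P Sh h eX eY) {w : V}
    (hw : w ∈ wallEnds P Sh) : VKind h eX eY w
      (if (∃ i, u i = w ∨ v i = w) ∧ ∃ s < h, w = eX s ∨ w = eY s then 2 else 1) := by
  by_cases hb : ∃ i, u i = w ∨ v i = w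
  · by_cases hs : ∃ s < h, w = eX s ∨ w = eY s
    · rw [if_pos ⟨hb, hs⟩]
      obtain ⟨s, hs, rfl | rfl⟩ := hs
      · exact Or.inr (Or.inl ⟨rfl, eY s, (hE.adj hs).ne', s, hs, rfl⟩)
      · exact Or.inr (Or.inl ⟨rfl, eX s, (hE.adj hs).ne, s, hs, Sym2.eq_swap⟩)
    · rw [if_neg fun hh => hs hh.2]
      push Not at hs
      exact Or.inr (Or.inr ⟨rfl, hs⟩)
  · rw [if_neg fun hh => hb hh.1]
    rcases (Finset.mem_filter.1 hw).2 with hw | ⟨i, hi, k, k0, hk, rfl⟩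
    · exact absurd hw hb
    obtain ⟨k, rfl⟩ : ∃ k', k = k' + 1 := ⟨k - 1, by omega⟩
    refine Or.inl ⟨rfl, (P i).getVert k, (P i).getVert (k + 2), fun e => ?_,
      ((P i).adj_getVert_succ (by omega)).ne, ((P i).adj_getVert_succ hk).ne', ?_⟩
    · have := (hS.path i).getVert_injOn (x₁ := k) (x₂ := k + 2) (by simp; omega) (by simp; omega) e
      omega
    · rintro x (rfl | rfl)
      · obtain ⟨s, hs, e⟩ := hE.of_short i hi k (by omega)
        exact ⟨s, hs, by rw [← e, Sym2.eq_swap]⟩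
      · obtain ⟨s, hs, e⟩ := hE.of_short i hi (k + 1) (by omega)
        exact ⟨s, hs, by rw [← e]⟩

end
end OnePlanar

namespace OnePlanar
open Filter Topology
lemma Board.seg_eq {V : Type*} {h : ℕ} {eX eY : ℕ → V} {pos : V → Pl} {O : Finset V} (B : Board pos h eX eY O) {s : ℕ} (hs : s < h) :
    B.W.seg s = segment ℝ (pos (eX s)) (pos (eY s)) := by
  rw [Arr.seg, B.X_eq s hs, B.Y_eq s hs]

lemma Board.oseg_eq {V : Type*} {h : ℕ} {eX eY : ℕ → V} {pos : V → Pl} {O : Finset V} (B : Board pos h eX eY O) {s : ℕ} (hs : s < h) :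
    B.W.oseg s = openSegment ℝ (pos (eX s)) (pos (eY s)) := by
  rw [Arr.oseg, B.X_eq s hs, B.Y_eq s hs]

lemma GP.apart_of_mem_oseg {Λ : Type*} {f : Λ → Pl} (h : GP univ f) {a b c d : Λ} (hab : a ≠ b)
    (hcd : c ≠ d) (hne : s(a, b) ≠ s(c, d)) {z : Pl} (h1 : z ∈ openSegment ℝ (f a) (f b))
    (h2 : z ∈ openSegment ℝ (f c) (f d)) : Apart a b c d ∧ Touch (f a) (f b) (f c) (f d) := by
  have o1 := openSegment_subset_segment ℝ _ _ h1
  have o2 := openSegment_subset_segment ℝ _ _ h2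
  refine ⟨?_, z, o1, o2⟩
  rcases h.meet_cases hab hcd hne o1 o2 with ⟨x, hx, -, e⟩ | hh
  · have := OnePlanar.ne_of_mem_oseg h1 (h.injective.ne hab)
    rcases hx with rfl | rfl
    · exact absurd e this.1
    · exact absurd e this.2
  · exact hh.1

section
variable {V ι : Type*} [Fintype V] {G : SimpleGraph V} [DecidableRel G.Adj] {u v : ι → V}
  {P : ∀ i, G.Walk (u i) (v i)} {Sh : ι → Prop} {h : ℕ} {eX eY : ℕ → V}

open Classical in
/-- The walls of the board do not meet inner vertices of long paths. -/
lemma Board.inner_notMem_K [Fintype ι] {pos : V → Pl} (hgp : GP univ pos) (hS : PathSys G u v P)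
    (hE : ShortEnum P Sh h eX eY) (B : Board pos h eX eY (wallEnds P Sh)) {i : ι} (hi : ¬ Sh i) {k : ℕ}
    (k0 : 0 < k) (hk : k < (P i).length) : pos ((P i).getVert k) ∉ B.W.K := by
  rintro ⟨s, hs, hm⟩
  rcases lt_or_ge s h with hsh | hsh
  · rw [B.seg_eq hsh] at hm
    obtain ⟨i', hi', k', hk', e⟩ := hE.end_eq hsh (hgp.ne_of_mem_oseg (hE.adj hsh).ne hm)
    obtain ⟨rfl, -⟩ := hS.inner k0 hk hk' e
    exact hi hi'
  · rcases (Finset.mem_filter.1 (B.line s hs hsh _ hm)).2 with ⟨i', hb⟩ | ⟨i', hi', k', k0', hk', e⟩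
    · exact hS.not_branch k0 hk hb
    · obtain ⟨rfl, -⟩ := hS.inner k0 hk hk'.le e
      exact hi hi'

open Classical in
theorem exists_layout [Nonempty V] [Fintype ι] (hS : PathSys G u v P) (Sh : ι → Prop)
    {pos : V → Pl} (hgp : GP univ pos) (ht : TouchOne G pos) :
    ∃ h eX eY, ShortEnum P Sh h eX eY ∧ ∃ B : Board pos h eX eY (wallEnds P Sh),
      B.W.n ≤ 2 * (∑ i with Sh i, (P i).length) + (Finset.univ.filter Sh).card + Fintype.card ι ∧
      ∃ l : {i // ¬ Sh i} → List (ℕ × Pl), (∀ i : {i // ¬ Sh i}, B.W.Conn (pos (u i)) (l i) (pos (v i))) ∧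
        ∀ s < B.W.h, ∑ i, ((l i).map Prod.fst).count s ≤ 1 := by
  obtain ⟨h, eX, eY, hE, hh⟩ := exists_shortEnum P Sh
  set Lg : V → V → Prop := fun a b => ∃ i, ¬ Sh i ∧ ∃ k < (P i).length,
    s(a, b) = s((P i).getVert k, (P i).getVert (k + 1)) with hLg
  have ladj : ∀ a b, Lg a b → G.Adj a b := by
    rintro a b ⟨i, -, k, hk, e⟩
    rw [← SimpleGraph.mem_edgeSet, e, SimpleGraph.mem_edgeSet]
    exact (P i).adj_getVert_succ hk
  have lne : ∀ a b, Lg a b → ∀ s < h, s(eX s, eY s) ≠ s(a, b) := by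
    rintro a b ⟨i, hi, k, hk, e⟩ s hs e'
    obtain ⟨i', hi', k', hk', e''⟩ := hE.short s hs
    obtain ⟨rfl, -⟩ := hS.edge_inj hk' hk (e''.trans (e'.trans e))
    exact hi hi'
  obtain ⟨B, hn, hcl⟩ := exists_board hgp ht (fun s hs => hE.adj hs) hE.inj ladj lne (wallEnds P Sh)
    (fun w => if (∃ i, u i = w ∨ v i = w) ∧ ∃ s < h, w = eX s ∨ w = eY s then 2 else 1)
    (fun w hw => vkind_wallEnds hS hE hw) (by
      intro s hs
      have key : ∀ w, w = eX s ∨ w = eY s → w ∈ wallEnds P Sh := by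
        intro w hw
        obtain ⟨i, hi, k, hk, rfl⟩ := hE.end_eq hs hw
        rw [wallEnds, Finset.mem_filter]
        refine ⟨Finset.mem_univ _, ?_⟩
        rcases Nat.eq_zero_or_pos k with rfl | k0
        · exact Or.inl ⟨i, by simp⟩
        rcases hk.lt_or_eq with hk | rfl
        · exact Or.inr ⟨i, hi, k, k0, hk, rfl⟩
        · exact Or.inl ⟨i, by simp⟩
      exact ⟨key _ (Or.inl rfl), key _ (Or.inr rfl)⟩)
  refine ⟨h, eX, eY, hE, B, ?_, ?_⟩
  · have := sum_wallEnds_le hS hE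
    rw [hn]; omega
  have route : ∀ (i : {i // ¬ Sh i}) (k : ℕ), ∃ l : List (ℕ × Pl), k < (P i).length →
      B.W.Conn (pos ((P i).getVert k)) l (pos ((P i).getVert (k + 1))) ∧
      (∀ e ∈ l, e.2 ∈ openSegment ℝ (pos ((P i).getVert k)) (pos ((P i).getVert (k + 1))) ∧
        B.W.Reg e.1 e.2) ∧ (l.map Prod.fst).Nodup := by
    intro i k
    by_cases hk : k < (P i).length
    · obtain ⟨a, -, b, -, l, h1, h2, h3, h4, h5⟩ := (hcl _ _ ⟨i, i.2, k, hk, rfl⟩).exists_route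
        (hgp.injective.ne ((P i).adj_getVert_succ hk).ne) (B.mem_Ω _) (B.mem_Ω _)
      exact ⟨l, fun _ => ⟨⟨a, b, h1, h2, h3⟩, h4, h5⟩⟩
    · exact ⟨[], fun hk' => absurd hk' hk⟩
  choose r hr using route
  refine ⟨fun i => (List.range (P i).length).flatMap (r i), fun i => ?_, fun s hs => ?_⟩
  · have key : ∀ k < (P i).length, B.W.Conn (pos (u i)) ((List.range (k + 1)).flatMap (r i))
        (pos ((P i).getVert (k + 1))) := by
      intro k hk
      induction k with
      | zero => simpa using (hr i 0 hk).1
      | succ k ih =>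
        rw [List.range_succ, List.flatMap_append, List.flatMap_singleton]
        exact (ih (by omega)).append (hr i (k + 1) hk).1
          (B.inner_notMem_K hgp hS hE i.2 k.succ_pos hk)
    have hp := hS.pos i
    have := key ((P i).length - 1) (by omega)
    rwa [Nat.sub_add_cancel hp, SimpleGraph.Walk.getVert_length] at this
  · rw [B.hh] at hs
    have key : ∀ (i : {i // ¬ Sh i}), ∀ k < (P i).length, ∀ (i' : {i // ¬ Sh i}), ∀ k' < (P i').length,
        s ∈ (r i k).map Prod.fst → s ∈ (r i' k').map Prod.fst → i = i' ∧ k = k' := by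
      have tch : ∀ (i : {i // ¬ Sh i}), ∀ k < (P i).length, s ∈ (r i k).map Prod.fst →
          Apart (eX s) (eY s) ((P i).getVert k) ((P i).getVert (k + 1)) ∧
          Touch (pos (eX s)) (pos (eY s)) (pos ((P i).getVert k)) (pos ((P i).getVert (k + 1))) := by
        intro i k hk hm
        obtain ⟨e, he, rfl⟩ := List.mem_map.1 hm
        obtain ⟨h1, h2⟩ := (hr i k hk).2.1 e he
        refine hgp.apart_of_mem_oseg (hE.adj hs).ne ((P i).adj_getVert_succ hk).ne
          (lne _ _ ⟨i, i.2, k, hk, rfl⟩ _ hs) (z := e.2) ?_ h1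
        rw [← B.oseg_eq hs]; exact h2.2.2.1
      intro i k hk i' k' hk' hm hm'
      obtain ⟨a1, a2⟩ := tch i k hk hm
      obtain ⟨b1, b2⟩ := tch i' k' hk' hm'
      obtain ⟨e1, e2⟩ := hS.edge_inj hk hk' (ht _ _ (hE.adj hs) _ _ _ _ ((P i).adj_getVert_succ hk)
        ((P i').adj_getVert_succ hk') a1 b1 a2 b2)
      exact ⟨Subtype.ext e1, e2⟩
    have cnt : ∀ i : {i // ¬ Sh i}, (((List.range (P i).length).flatMap (r i)).map Prod.fst).count s =
        ∑ k ∈ Finset.range (P i).length, ((r i k).map Prod.fst).count s := by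
      intro i
      rw [List.map_flatMap, List.count_flatMap]
      rfl
    simp only [cnt]
    by_cases hex : ∃ i : {i // ¬ Sh i}, ∃ k < (P i).length, s ∈ (r i k).map Prod.fst
    · obtain ⟨i, k, hk, hm⟩ := hex
      rw [Finset.sum_eq_single i, Finset.sum_eq_single k]
      · exact List.nodup_iff_count_le_one.1 (hr i k hk).2.2 s
      · intro k' hk' hne
        exact List.count_eq_zero.2 fun hm' => hne
          (key i k hk i k' (Finset.mem_range.1 hk') hm hm').2.symm
      · intro hk'; exact absurd (Finset.mem_range.2 hk) hk'
      · intro i' _ hne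
        refine Finset.sum_eq_zero fun k' hk' => List.count_eq_zero.2 fun hm' => hne
          (key i k hk i' k' (Finset.mem_range.1 hk') hm hm').1.symm
      · simp
    · push Not at hex
      refine le_of_eq_of_le (Finset.sum_eq_zero fun i _ => Finset.sum_eq_zero fun k hk =>
        List.count_eq_zero.2 (hex i k (Finset.mem_range.1 hk))) zero_le_one

end
end OnePlanar

namespace OnePlanar
open Filter Topology
open Arr

/-- The nodes of the final drawing: the vertices and the corners of the curves. -/
abbrev Lab (V : Type*) {κ : Type*} (l : κ → List (ℕ × Pl)) := V ⊕ ((i : κ) × Fin (l i).length)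

section
variable {V κ : Type*}

/-- The nodes along the `i`-th curve. -/
def lab (x y : κ → V) (l : κ → List (ℕ × Pl)) (i : κ) (k : ℕ) : Lab V l :=
  if k = 0 then Sum.inl (x i) else
    if hk : k - 1 < (l i).length then Sum.inr ⟨i, k - 1, hk⟩ else Sum.inl (y i)

/-- The positions of the nodes: corners are pushed forward by `η`. -/
def place (pos : V → Pl) (x y : κ → V) (l : κ → List (ℕ × Pl)) (η : ℝ) : Lab V l → Pl
  | Sum.inl w => pos w
  | Sum.inr q => pt (nd (pos (x q.1)) (l q.1) (pos (y q.1)) (q.2 + 1))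
      (nd (pos (x q.1)) (l q.1) (pos (y q.1)) (q.2 + 2)) η

variable {pos : V → Pl} {x y : κ → V} {l : κ → List (ℕ × Pl)}

@[simp] lemma lab_zero (i : κ) : lab x y l i 0 = Sum.inl (x i) := by simp [lab]

@[simp] lemma lab_last (i : κ) : lab x y l i ((l i).length + 1) = Sum.inl (y i) := by simp [lab]

lemma lab_succ {i : κ} {k : ℕ} (hk : k < (l i).length) :
    lab x y l i (k + 1) = Sum.inr ⟨i, k, hk⟩ := by simp [lab, hk]

lemma place_zero_lab (i : κ) (k : ℕ) :
    place pos x y l 0 (lab x y l i k) = nd (pos (x i)) (l i) (pos (y i)) k := by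
  rcases k with - | k
  · simp [place]
  by_cases hk : k < (l i).length
  · rw [lab_succ hk]; simp [place]
  · simp [place, lab, nd, hk]

lemma lab_inj {i i' : κ} {k k' : ℕ} (k0 : 0 < k) (hk : k ≤ (l i).length)
    (e : lab x y l i k = lab x y l i' k') : i = i' ∧ k = k' := by
  obtain ⟨k, rfl⟩ := Nat.exists_eq_succ_of_ne_zero k0.ne'
  rw [Nat.succ_eq_add_one, lab_succ (by omega)] at e
  rcases k' with - | k'
  · simp at e
  by_cases hk' : k' < (l i').length
  · rw [lab_succ hk'] at e
    have e := Sum.inr.inj e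
    obtain rfl : i = i' := congrArg Sigma.fst e
    simpa using e
  · simp [lab, hk'] at e

lemma tendsto_place (a : Lab V l) :
    Tendsto (fun η => place pos x y l η a) (𝓝[>] 0) (𝓝 (place pos x y l 0 a)) := by
  rcases a with w | q
  · exact tendsto_const_nhds
  · simpa [place] using tendsto_pt _ _

lemma eventually_touch [Finite V] [Finite κ] : ∀ᶠ η in 𝓝[>] (0 : ℝ), ∀ a b a' b' : Lab V l,
    Touch (place pos x y l η a) (place pos x y l η b) (place pos x y l η a') (place pos x y l η b') →
    Touch (place pos x y l 0 a) (place pos x y l 0 b) (place pos x y l 0 a') (place pos x y l 0 b') := by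
  simp only [eventually_all]
  intro a b a' b'
  by_cases h : Touch (place pos x y l 0 a) (place pos x y l 0 b) (place pos x y l 0 a') (place pos x y l 0 b')
  · exact Eventually.of_forall fun _ _ => h
  obtain ⟨ε, ε0, hε⟩ := exists_stable_of_not_touch h
  have key : ∀ a : Lab V l, ∀ᶠ η in 𝓝[>] (0 : ℝ), dist (place pos x y l η a) (place pos x y l 0 a) < ε :=
    fun a => (tendsto_place a).eventually (Metric.ball_mem_nhds _ ε0)
  filter_upwards [key a, key b, key a', key b'] with η h1 h2 h3 h4 h5
  exact absurd h5 (hε _ _ _ _ h1 h2 h3 h4)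

/-- The points of a piece on the walls are its ends. -/
lemma eq_lab_of_mem_K {h : ℕ} {eX eY : ℕ → V} {O : Finset V} {B : Board pos h eX eY O} {i : κ} {k : ℕ}
    (ho : ∀ z ∈ openSegment ℝ (nd (pos (x i)) (l i) (pos (y i)) k) (nd (pos (x i)) (l i) (pos (y i)) (k + 1)),
      z ∉ B.W.K) {z : Pl}
    (hz : z ∈ segment ℝ (nd (pos (x i)) (l i) (pos (y i)) k) (nd (pos (x i)) (l i) (pos (y i)) (k + 1)))
    (hzK : z ∈ B.W.K) : z = place pos x y l 0 (lab x y l i k) ∨ z = place pos x y l 0 (lab x y l i (k + 1)) := by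
  rw [place_zero_lab, place_zero_lab]
  by_contra! hn
  exact ho z (mem_oseg_of_mem_seg hz hn.1 hn.2) hzK

/-- A shortest family of curves on a board. -/
structure Scene [Fintype κ] {h : ℕ} {eX eY : ℕ → V} {O : Finset V} (B : Board pos h eX eY O)
    (x y : κ → V) (l : κ → List (ℕ × Pl)) (c : κ → ℕ → Pl) : Prop where
  gp : GP univ pos
  ne : ∀ s < h, eX s ≠ eY s
  left : ∀ i, x i ∈ O
  right : ∀ i, y i ∈ O
  xy : ∀ i, x i ≠ y i
  opt : B.W.Optimal (fun i => pos (x i)) (fun i => pos (y i)) (range pos) l c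

namespace Scene
variable [Fintype κ] {h : ℕ} {eX eY : ℕ → V} {O : Finset V} {B : Board pos h eX eY O}
  {c : κ → ℕ → Pl}

lemma left_mem_K (S : Scene B x y l c) (i : κ) : pos (x i) ∈ B.W.K := by
  obtain ⟨s, hs, -, hm⟩ := B.ray _ (S.left i); exact ⟨s, hs, hm⟩

lemma right_mem_K (S : Scene B x y l c) (i : κ) : pos (y i) ∈ B.W.K := by
  obtain ⟨s, hs, -, hm⟩ := B.ray _ (S.right i); exact ⟨s, hs, hm⟩

lemma place_zero_injective (S : Scene B x y l c) : Function.Injective (place pos x y l 0) := by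
  rintro (w | ⟨i, j, hj⟩) (w' | ⟨i', j', hj'⟩) e
  · exact congrArg _ (S.gp.injective e)
  · refine absurd ⟨w, ?_⟩ (S.opt.notMem i' _ (List.getElem_mem hj'))
    simpa [place, nd_succ, hj'] using e
  · refine absurd ⟨w', ?_⟩ (S.opt.notMem i _ (List.getElem_mem hj))
    simpa [place, nd_succ, hj] using e.symm
  · simp only [place, pt_zero, nd_succ _ _ _ hj, nd_succ _ _ _ hj'] at e
    obtain ⟨rfl, rfl⟩ := S.opt.port i i' j hj j' hj' e
    rfl

lemma off_of_ne_nil (S : Scene B x y l c) {i : κ} (hi : l i ≠ []) {k : ℕ} (hk : k ≤ (l i).length) :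
    ∀ z ∈ openSegment ℝ (nd (pos (x i)) (l i) (pos (y i)) k) (nd (pos (x i)) (l i) (pos (y i)) (k + 1)),
      z ∉ B.W.K := fun _ hz =>
  (S.opt.curve i).notMem_K (S.opt.tight i) hi (S.left_mem_K i) (S.right_mem_K i) hk hz

/-- A chord runs along an edge or avoids the walls. -/
lemma off_or_along (S : Scene B x y l c) {i : κ} (hi : l i = []) :
    (∀ z ∈ openSegment ℝ (pos (x i)) (pos (y i)), z ∉ B.W.K) ∨
    ∃ s < h, s(x i, y i) = s(eX s, eY s) ∧
      ∀ r < B.W.n, ∀ z ∈ openSegment ℝ (pos (x i)) (pos (y i)), z ∈ B.W.oseg r → r = s := by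
  by_contra! hn
  obtain ⟨⟨z, hz, hzK⟩, hn⟩ := hn
  have cu := S.opt.curve i
  have h2 := cu.finish
  rw [hi] at h2
  obtain ⟨s, hs, a1, a2, -, a3⟩ := bottom cu.start h2 (S.gp.injective.ne (S.xy i)) hz hzK
  rcases lt_or_ge s h with hsh | hsh
  · rw [B.seg_eq hsh] at a1 a2
    have b1 := S.gp.ne_of_mem_oseg (S.ne s hsh) a1
    have b2 := S.gp.ne_of_mem_oseg (S.ne s hsh) a2
    have hxy := S.xy i
    obtain ⟨r, hr, w, hw, hw', hne⟩ := hn s hsh (by grind [Sym2.eq_iff])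
    exact hne (a3 r hr w hw hw')
  · exact S.xy i (B.uniq s hs hsh _ _ a1 a2)

/-- After crossing a wall, a curve is off its line. -/
lemma side_ne (S : Scene B x y l c) {i : κ} {k : ℕ} (hk : k < (l i).length) :
    B.W.side (l i)[k].1 (nd (pos (x i)) (l i) (pos (y i)) (k + 2)) ≠ 0 := by
  intro h0
  have cu := S.opt.curve i
  have hne : l i ≠ [] := by rintro e; simp [e] at hk
  have r := cu.reg k hk
  set a := nd (pos (x i)) (l i) (pos (y i)) (k + 1) with ha
  set b := nd (pos (x i)) (l i) (pos (y i)) (k + 2) with hb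
  have ea : a = (l i)[k].2 := nd_succ _ _ _ hk
  have h1 := (tendsto_pt a b).eventually (eventually_mem_oseg (B.W.ne _ r.1) (z := a) (ea ▸ r.2.2.1))
  obtain ⟨ε, ⟨e0, e1⟩, hε⟩ := (eventually_small.and h1).exists
  refine S.off_of_ne_nil hne (k := k + 1) (by omega) (pt a b ε) (pt_mem_oseg _ _ e0 e1)
    ⟨_, r.1, oseg_subset _ (hε ?_)⟩
  change B.W.side _ _ = 0
  rw [side_pt, h0, ea, side_seg (oseg_subset _ r.2.2.1)]
  ring

lemma eventually_off (S : Scene B x y l c) : ∀ᶠ η in 𝓝[>] (0 : ℝ), ∀ i, ∀ k : Fin (l i).length,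
    ¬ Touch (place pos x y l η (lab x y l i (k + 1))) (place pos x y l η (lab x y l i (k + 2)))
      (B.W.X (l i)[k].1) (B.W.Y (l i)[k].1) := by
  simp only [eventually_all]
  rintro i ⟨k, hk⟩
  set b := nd (pos (x i)) (l i) (pos (y i)) (k + 2) with hb
  set s := (l i)[k].1 with hs
  have h0 : B.W.side s b ≠ 0 := S.side_ne hk
  have h1 : ∀ᶠ η in 𝓝[>] (0 : ℝ), 0 < B.W.side s b * B.W.side s (place pos x y l η (lab x y l i (k + 2))) := by
    have := ((continuous_crs (B.W.X s) (B.W.Y s)).tendsto _).comp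
      (tendsto_place (pos := pos) (x := x) (y := y) (lab x y l i (k + 2)))
    rw [place_zero_lab] at this
    exact (this.const_mul (B.W.side s b)).eventually (lt_mem_nhds (mul_self_pos.2 h0))
  filter_upwards [h1, eventually_small] with η h2 ⟨e0, e1⟩
  rintro ⟨z, hz, hz'⟩
  have hzs : B.W.side s z = 0 := side_seg hz'
  obtain ⟨t, t0, t1, rfl⟩ := mem_seg.1 hz
  have r := (S.opt.curve i).reg k hk
  have hp : B.W.side s (place pos x y l η (lab x y l i (k + 1))) = η * B.W.side s b := by
    rw [lab_succ hk]
    simp only [place]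
    rw [side_pt, nd_succ _ _ _ hk, side_seg (oseg_subset _ r.2.2.1)]
    ring
  rw [side_pt, hp] at hzs
  have h3 := mul_self_pos.2 h0
  have h4 : (1 - t) * (η * (B.W.side s b * B.W.side s b)) + t * (B.W.side s b *
      B.W.side s (place pos x y l η (lab x y l i (k + 2)))) = 0 := by linear_combination B.W.side s b * hzs
  have h5 := mul_pos e0 h3
  rcases t1.lt_or_eq with t1 | rfl
  · nlinarith [mul_pos (sub_pos.2 t1) h5, mul_nonneg t0 h2.le]
  · linarith

end Scene
end
end OnePlanar

namespace OnePlanar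
open Filter Topology
open Arr

lemma Apart.symm {Λ : Type*} {a b c d : Λ} (h : Apart a b c d) : Apart c d a b :=
  ⟨h.1.symm, h.2.2.1.symm, h.2.1.symm, h.2.2.2.symm⟩

lemma Apart.ne {Λ : Type*} {a b c d : Λ} (h : Apart a b c d) : s(a, b) ≠ s(c, d) := by
  obtain ⟨h1, h2, -, -⟩ := h
  rw [Ne, Sym2.eq_iff]
  tauto

/-- Two segments given by nodes have no common ends but touch. -/
def Meets {Λ : Type*} (f : Λ → Pl) (a b c d : Λ) : Prop := Apart a b c d ∧ Touch (f a) (f b) (f c) (f d)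

lemma Meets.symm {Λ : Type*} {f : Λ → Pl} {a b c d : Λ} (h : Meets f a b c d) : Meets f c d a b :=
  ⟨h.1.symm, touch_comm.1 h.2⟩

lemma Meets.of_eq {Λ : Type*} {f : Λ → Pl} {a b c d c' d' : Λ} (h : Meets f a b c d)
    (e : s(c, d) = s(c', d')) : Meets f a b c' d' := by
  rcases Sym2.eq_iff.1 e with ⟨rfl, rfl⟩ | ⟨rfl, rfl⟩
  · exact h
  · exact ⟨⟨h.1.2.1, h.1.1, h.1.2.2.2, h.1.2.2.1⟩, touch_swap_right.1 h.2⟩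

namespace Scene
variable {V κ : Type*} {pos : V → Pl} {x y : κ → V} {l : κ → List (ℕ × Pl)} [Fintype κ] {h : ℕ}
  {eX eY : ℕ → V} {O : Finset V} {B : Board pos h eX eY O} {c : κ → ℕ → Pl} {η : ℝ}

/-- The shift of the corners is small enough. -/
structure Tame (B : Board pos h eX eY O) (x y : κ → V) (l : κ → List (ℕ × Pl)) (η : ℝ) : Prop where
  touch : ∀ a b a' b' : Lab V l, Touch (place pos x y l η a) (place pos x y l η b)
    (place pos x y l η a') (place pos x y l η b') → Touch (place pos x y l 0 a) (place pos x y l 0 b)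
    (place pos x y l 0 a') (place pos x y l 0 b')
  off : ∀ i, ∀ k : Fin (l i).length,
    ¬ Touch (place pos x y l η (lab x y l i (k + 1))) (place pos x y l η (lab x y l i (k + 2)))
      (B.W.X (l i)[k].1) (B.W.Y (l i)[k].1)

lemma exists_tame [Finite V] (S : Scene B x y l c) : ∃ η, Tame B x y l η := by
  obtain ⟨η, h1, h2⟩ := (eventually_touch (pos := pos) (x := x) (y := y) (l := l)).and
    S.eventually_off |>.exists
  exact ⟨η, h1, h2⟩

lemma wall_of_mem (S : Scene B x y l c) {i : κ} {j s : ℕ} (hj : j ≤ (l i).length + 1) (hs : s < h)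
    (hX : lab x y l i j ≠ Sum.inl (eX s)) (hY : lab x y l i j ≠ Sum.inl (eY s))
    (hm : place pos x y l 0 (lab x y l i j) ∈ B.W.seg s) :
    ∃ k, ∃ hk : k < (l i).length, j = k + 1 ∧ (l i)[k].1 = s := by
  have key : ∀ w : V, lab x y l i j = Sum.inl w → False := by
    intro w e
    rw [e, B.seg_eq hs] at hm
    rcases S.gp.ne_of_mem_oseg (S.ne s hs) hm with rfl | rfl
    · exact hX e
    · exact hY e
  rcases j with - | j
  · exact (key _ (lab_zero i)).elim
  rcases (show j ≤ (l i).length by omega).lt_or_eq with hj | rfl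
  · rw [place_zero_lab, nd_succ _ _ _ hj] at hm
    exact ⟨j, hj, rfl, (((S.opt.curve i).reg j hj).eq (hs.trans_le B.hhn) hm).symm⟩
  · exact (key _ (lab_last i)).elim

/-- A piece of a curve meets an edge only when the curve crosses that edge at its end. -/
lemma hit (S : Scene B x y l c) (T : Tame B x y l η) {i : κ} (hi : l i ≠ []) {k s : ℕ}
    (hk : k ≤ (l i).length) (hs : s < h)
    (hm : Meets (place pos x y l η) (lab x y l i k) (lab x y l i (k + 1)) (Sum.inl (eX s)) (Sum.inl (eY s))) :
    ∃ hk : k < (l i).length, (l i)[k].1 = s := by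
  obtain ⟨ha, ht⟩ := hm
  obtain ⟨z, hz, hz'⟩ := T.touch _ _ _ _ ht
  have hzs : z ∈ B.W.seg s := by rw [B.seg_eq hs]; exact hz'
  rw [place_zero_lab, place_zero_lab] at hz
  rcases eq_lab_of_mem_K (B := B) (S.off_of_ne_nil hi hk) hz ⟨s, hs.trans_le B.hhn, hzs⟩ with rfl | rfl
  · obtain ⟨j, hj, rfl, rfl⟩ := S.wall_of_mem (by omega) hs ha.1 ha.2.1 hzs
    refine absurd ?_ (T.off i ⟨j, hj⟩)
    have h1 := B.X_eq _ hs
    have h2 := B.Y_eq _ hs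
    simp only [Fin.getElem_fin] at h1 h2 ⊢
    rw [h1, h2]
    exact ht
  · obtain ⟨j, hj, e, rfl⟩ := S.wall_of_mem (by omega) hs ha.2.2.1 ha.2.2.2 hzs
    obtain rfl : k = j := by omega
    exact ⟨hj, rfl⟩

/-- A chord meets no edge. -/
lemma chord_not_meets (S : Scene B x y l c) {i : κ} (hi : l i = []) {s : ℕ} (hs : s < h)
    (ha : Apart (x i) (y i) (eX s) (eY s)) :
    ¬ Touch (pos (x i)) (pos (y i)) (pos (eX s)) (pos (eY s)) := by
  rintro ⟨z, hz, hz'⟩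
  obtain ⟨w, hw, hw', -⟩ | ⟨-, o1, o2⟩ := S.gp.meet_cases (S.xy i) (S.ne s hs) ha.ne hz hz'
  · obtain ⟨a1, a2, a3, a4⟩ := ha
    grind
  rw [← B.oseg_eq hs] at o2
  have hsn := hs.trans_le B.hhn
  rcases S.off_or_along hi with ho | ⟨r, hr, e, ho⟩
  · exact ho z o1 ⟨s, hsn, oseg_subset s o2⟩
  · obtain rfl := ho s hsn z o1 o2
    exact ha.ne e

lemma nd_mem_K (S : Scene B x y l c) (i : κ) {k : ℕ} (hk : k ≤ (l i).length + 1) :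
    nd (pos (x i)) (l i) (pos (y i)) k ∈ B.W.K :=
  (S.opt.curve i).nd_mem_K (S.left_mem_K i) (S.right_mem_K i) hk

/-- Pieces outside the walls meet at inner points. -/
lemma meet (S : Scene B x y l c) (T : Tame B x y l η) {i i' : κ} {k k' : ℕ}
    (ho : ∀ z ∈ openSegment ℝ (nd (pos (x i)) (l i) (pos (y i)) k) (nd (pos (x i)) (l i) (pos (y i)) (k + 1)),
      z ∉ B.W.K)
    (ho' : ∀ z ∈ openSegment ℝ (nd (pos (x i')) (l i') (pos (y i')) k')
      (nd (pos (x i')) (l i') (pos (y i')) (k' + 1)), z ∉ B.W.K)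
    (hk : k ≤ (l i).length) (hk' : k' ≤ (l i').length)
    (hm : Meets (place pos x y l η) (lab x y l i k) (lab x y l i (k + 1)) (lab x y l i' k')
      (lab x y l i' (k' + 1))) :
    ∃ z ∉ B.W.K, z ∈ openSegment ℝ (nd (pos (x i)) (l i) (pos (y i)) k) (nd (pos (x i)) (l i) (pos (y i)) (k + 1)) ∧
      z ∈ openSegment ℝ (nd (pos (x i')) (l i') (pos (y i')) k') (nd (pos (x i')) (l i') (pos (y i')) (k' + 1)) := by
  obtain ⟨⟨a1, a2, a3, a4⟩, ht⟩ := hm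
  obtain ⟨z, hz, hz'⟩ := T.touch _ _ _ _ ht
  simp only [place_zero_lab] at hz hz'
  have hzK : z ∉ B.W.K := by
    intro hzK
    have inj := S.place_zero_injective
    rcases eq_lab_of_mem_K (B := B) ho hz hzK with rfl | rfl <;>
      rcases eq_lab_of_mem_K (B := B) ho' hz' hzK with e | e
    · exact a1 (inj e)
    · exact a2 (inj e)
    · exact a3 (inj e)
    · exact a4 (inj e)
  refine ⟨z, hzK, mem_oseg_of_mem_seg hz ?_ ?_, mem_oseg_of_mem_seg hz' ?_ ?_⟩ <;> rintro rfl <;>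
    exact hzK (S.nd_mem_K _ (by omega))

lemma eq_of_vis (S : Scene B x y l c) {i : κ} {k k' : ℕ} (hk : k ≤ (l i).length) (hk' : k' ≤ (l i).length)
    (hv : B.W.Vis (c i k) (c i k')) : k = k' := by
  rcases lt_trichotomy k k' with hlt | e | hlt
  · exact absurd hv ((S.opt.curve i).not_vis (S.opt.tight i) hlt hk')
  · exact e
  · exact absurd hv.symm ((S.opt.curve i).not_vis (S.opt.tight i) hlt hk)

lemma vis_of_mem (S : Scene B x y l c) {i : κ} {k : ℕ} (hk : k ≤ (l i).length) {z : Pl} (hzK : z ∉ B.W.K)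
    (hz : z ∈ openSegment ℝ (nd (pos (x i)) (l i) (pos (y i)) k) (nd (pos (x i)) (l i) (pos (y i)) (k + 1))) :
    B.W.Vis (c i k) z :=
  (S.opt.curve i).vis_of_mem hk hzK (openSegment_subset_segment ℝ _ _ hz)

lemma wall_inj (S : Scene B x y l c) {i : κ} {k k' : ℕ} (hk : k < (l i).length) (hk' : k' < (l i).length)
    (e : (l i)[k].1 = (l i)[k'].1) : k = k' := by
  rcases lt_trichotomy k k' with hlt | e' | hlt
  · exact absurd e ((S.opt.curve i).wall_ne (S.opt.tight i) hlt hk')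
  · exact e'
  · exact absurd e.symm ((S.opt.curve i).wall_ne (S.opt.tight i) hlt hk)

lemma not_meets_self (S : Scene B x y l c) (T : Tame B x y l η) {i : κ} {k k' : ℕ}
    (hk : k ≤ (l i).length) (hk' : k' ≤ (l i).length) :
    ¬ Meets (place pos x y l η) (lab x y l i k) (lab x y l i (k + 1)) (lab x y l i k') (lab x y l i (k' + 1)) := by
  intro hm
  have hkk : k ≠ k' := by rintro rfl; exact hm.1.1 rfl
  have hi : l i ≠ [] := by rintro e; rw [e] at hk hk'; simp at hk hk'; omega
  obtain ⟨z, hzK, o1, o2⟩ := S.meet T (S.off_of_ne_nil hi hk) (S.off_of_ne_nil hi hk')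
    hk hk' hm
  exact hkk (S.eq_of_vis hk hk' ((S.vis_of_mem hk hzK o1).trans (S.vis_of_mem hk' hzK o2).symm))

lemma chord_once (S : Scene B x y l c) (T : Tame B x y l η) {i i' : κ} (hi : l i = []) (hi' : l i' ≠ [])
    {k k' : ℕ} (hk : k ≤ (l i').length) (hk' : k' ≤ (l i').length)
    (hm : Meets (place pos x y l η) (lab x y l i' k) (lab x y l i' (k + 1)) (lab x y l i 0) (lab x y l i 1))
    (hm' : Meets (place pos x y l η) (lab x y l i' k') (lab x y l i' (k' + 1)) (lab x y l i 0) (lab x y l i 1)) :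
    k = k' := by
  have e0 : (l i).length = 0 := by rw [hi]; rfl
  have e1 : lab x y l i 1 = Sum.inl (y i) := by rw [← lab_last, e0]
  have n1 : nd (pos (x i)) (l i) (pos (y i)) 1 = pos (y i) := by
    simpa [e0] using nd_last (pos (x i)) (pos (y i)) (l i)
  rcases S.off_or_along hi with ho | ⟨r, hr, e, -⟩
  · have ho : ∀ z ∈ openSegment ℝ (nd (pos (x i)) (l i) (pos (y i)) 0)
        (nd (pos (x i)) (l i) (pos (y i)) (0 + 1)), z ∉ B.W.K := by
      simpa [n1] using ho
    obtain ⟨z, hzK, o1, o2⟩ := S.meet T (S.off_of_ne_nil hi' hk) ho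
      hk (Nat.zero_le _) hm
    obtain ⟨w, hwK, p1, p2⟩ := S.meet T (S.off_of_ne_nil hi' hk') ho
      hk' (Nat.zero_le _) hm'
    exact S.eq_of_vis hk hk' (((S.vis_of_mem hk hzK o1).trans
      (S.vis_of_mem (Nat.zero_le _) hzK o2).symm).trans ((S.vis_of_mem (Nat.zero_le _) hwK p2).trans
      (S.vis_of_mem hk' hwK p1).symm))
  · rw [lab_zero, e1] at hm hm'
    have e' : (s(Sum.inl (x i), Sum.inl (y i)) : Sym2 (Lab V l)) = s(Sum.inl (eX r), Sum.inl (eY r)) := by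
      simpa using congrArg (Sym2.map (Sum.inl : V → Lab V l)) e
    obtain ⟨j1, q1⟩ := S.hit T hi' hk hr (hm.of_eq e')
    obtain ⟨j2, q2⟩ := S.hit T hi' hk' hr (hm'.of_eq e')
    exact S.wall_inj j1 j2 (q1.trans q2.symm)

/-- Two curves meet at most once. -/
lemma meets_once (S : Scene B x y l c) (T : Tame B x y l η) {i i' : κ} (hne : i ≠ i') {k k' j j' : ℕ}
    (hk : k ≤ (l i).length) (hk' : k' ≤ (l i').length) (hj : j ≤ (l i).length) (hj' : j' ≤ (l i').length)
    (hm : Meets (place pos x y l η) (lab x y l i k) (lab x y l i (k + 1)) (lab x y l i' k')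
      (lab x y l i' (k' + 1)))
    (hm' : Meets (place pos x y l η) (lab x y l i j) (lab x y l i (j + 1)) (lab x y l i' j')
      (lab x y l i' (j' + 1))) : k = j ∧ k' = j' := by
  have z0 : ∀ {i : κ} {k : ℕ}, l i = [] → k ≤ (l i).length → k = 0 := by
    intro i k e hk; rw [e] at hk; simpa using hk
  by_cases hi : l i = []
  · obtain rfl := z0 hi hk
    obtain rfl := z0 hi hj
    refine ⟨rfl, ?_⟩
    by_cases hi' : l i' = []
    · rw [z0 hi' hk', z0 hi' hj']
    · exact S.chord_once T hi hi' hk' hj' hm.symm hm'.symm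
  by_cases hi' : l i' = []
  · obtain rfl := z0 hi' hk'
    obtain rfl := z0 hi' hj'
    exact ⟨S.chord_once T hi' hi hk hj hm hm', rfl⟩
  obtain ⟨z, hzK, o1, o2⟩ := S.meet T (S.off_of_ne_nil hi hk) (S.off_of_ne_nil hi' hk')
    hk hk' hm
  obtain ⟨w, hwK, p1, p2⟩ := S.meet T (S.off_of_ne_nil hi hj) (S.off_of_ne_nil hi' hj')
    hj hj' hm'
  exact S.opt.once i i' hne hi hi' hk hj hk' hj' o1 o2 p1 p2

/-- An edge is crossed by at most one curve, and only if it crosses no other edge. -/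
lemma hit_unique (S : Scene B x y l c) {i i' : κ} {k k' s : ℕ} (hs : s < h) (hk : k < (l i).length)
    (hk' : k' < (l i').length) (e : (l i)[k].1 = s) (e' : (l i')[k'].1 = s) : i = i' ∧ k = k' := by
  have one : ∀ {i k} (hk : k < (l i).length), (l i)[k].1 = s → 0 < ((l i).map Prod.fst).count s := by
    intro i k hk e
    exact List.count_pos_iff.2 (List.mem_map.2 ⟨_, List.getElem_mem hk, e⟩)
  have hii : i = i' := by
    by_contra hne
    have h1 := S.opt.cap s (by rwa [B.hh])
    have h2 := Finset.add_le_sum (s := Finset.univ) (f := fun i => ((l i).map Prod.fst).count s)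
      (fun _ _ => Nat.zero_le _) (Finset.mem_univ i) (Finset.mem_univ i') hne
    have h3 := one hk e
    have h4 := one hk' e'
    omega
  subst hii
  exact ⟨rfl, S.wall_inj hk hk' (e.trans e'.symm)⟩

lemma not_touch_of_hit (S : Scene B x y l c) {i : κ} {k s r : ℕ} (hs : s < h) (hr : r < h)
    (hk : k < (l i).length) (e : (l i)[k].1 = s) (ha : Apart (eX s) (eY s) (eX r) (eY r)) :
    ¬ Touch (pos (eX s)) (pos (eY s)) (pos (eX r)) (pos (eY r)) := by
  rintro ⟨z, hz, hz'⟩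
  obtain ⟨w, hw, hw', -⟩ | ⟨-, o1, -⟩ := S.gp.meet_cases (S.ne s hs) (S.ne r hr) ha.ne hz hz'
  · obtain ⟨a1, a2, a3, a4⟩ := ha
    grind
  have f := (S.opt.curve i).free k hk
  rw [e] at f
  rcases f.2 with f | f
  · rw [B.hh] at f; omega
  · have hrs : r ≠ s := by rintro rfl; exact ha.1 rfl
    rw [← B.seg_eq hr] at hz'
    rw [← B.oseg_eq hs] at o1
    exact Set.disjoint_left.1 (f r (by rwa [B.hh]) (hr.trans_le B.hhn) hrs) hz' o1

/-- A shortest curve crosses each wall at most once, and avoids the walls through its ends. -/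
lemma length_le (S : Scene B x y l c) (i : κ) : (l i).length + 2 ≤ B.W.n := by
  obtain ⟨s, hs, hsh, h1⟩ := B.ray _ (S.left i)
  obtain ⟨r, hr, hrh, h2⟩ := B.ray _ (S.right i)
  have hsr : s ≠ r := by rintro rfl; exact S.xy i (B.uniq s hs hsh _ _ h1 h2)
  have cu := S.opt.curve i
  have h3 : ((Finset.univ : Finset (Fin (l i).length)).image fun k => (l i)[k.1].1) ⊆
      ((Finset.range B.W.n).erase s).erase r := by
    intro t ht
    obtain ⟨k, -, rfl⟩ := Finset.mem_image.1 ht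
    have := (cu.reg k k.2).1
    refine Finset.mem_erase.2 ⟨?_, Finset.mem_erase.2 ⟨?_, Finset.mem_range.2 this⟩⟩
    · intro e; exact cu.right_notMem (S.opt.tight i) k.2 (by rw [e]; exact h2)
    · intro e; exact cu.left_notMem (S.opt.tight i) k.2 (by rw [e]; exact h1)
  have h4 := Finset.card_le_card h3
  rw [Finset.card_image_of_injective _ (fun k k' e => Fin.ext (S.wall_inj k.2 k'.2 e)),
    Finset.card_erase_of_mem (Finset.mem_erase.2 ⟨hsr.symm, Finset.mem_range.2 hr⟩),
    Finset.card_erase_of_mem (Finset.mem_range.2 hs), Finset.card_range, Finset.card_univ,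
    Fintype.card_fin] at h4
  have h5 : 1 < B.W.n := by omega
  omega

end Scene
end OnePlanar

namespace OnePlanar
open Filter Topology
open Arr

lemma Net.node_inj {V ι Λ : Type*} {u v : ι → V} {m : ι → ℕ} {e : V → Λ} {ν : ι → ℕ → Λ}
    (hn : Net u v m e ν) {i : ι} {k k' : ℕ} (hk : k ≤ m i) (hk' : k' ≤ m i) (h : ν i k = ν i k') :
    k = k' := by
  by_cases h1 : 0 < k ∧ k < m i
  · exact (hn.inner i k i k' h1.1 h1.2 hk' h).2
  by_cases h2 : 0 < k' ∧ k' < m i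
  · exact (hn.inner i k' i k h2.1 h2.2 hk h.symm).2.symm
  have huv : e (u i) ≠ e (v i) := hn.inj.ne (hn.ne i)
  have h3 : k = 0 ∨ k = m i := by omega
  have h4 : k' = 0 ∨ k' = m i := by omega
  rcases h3 with rfl | rfl <;> rcases h4 with rfl | rfl
  · rfl
  · rw [hn.left, hn.right] at h; exact absurd h huv
  · rw [hn.left, hn.right] at h; exact absurd h.symm huv
  · rfl

lemma Net.piece_inj {V ι Λ : Type*} {u v : ι → V} {m : ι → ℕ} {e : V → Λ} {ν : ι → ℕ → Λ}
    (hn : Net u v m e ν) {i i' : ι} (hi : 2 ≤ m i) {k k' : ℕ} (hk : k < m i) (hk' : k' < m i')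
    (h : s(ν i k, ν i (k + 1)) = s(ν i' k', ν i' (k' + 1))) : i = i' ∧ k = k' := by
  have hii : i = i' := by
    obtain ⟨j, hj0, hj1, hj⟩ : ∃ j, 0 < j ∧ j < m i ∧ ν i j ∈ s(ν i k, ν i (k + 1)) := by
      rcases Nat.eq_zero_or_pos k with rfl | hk0
      · exact ⟨1, by omega, by omega, by simp⟩
      · exact ⟨k, hk0, hk, by simp⟩
    rw [h, Sym2.mem_iff] at hj
    rcases hj with hj | hj
    · exact (hn.inner i j i' _ hj0 hj1 hk'.le hj).1
    · exact (hn.inner i j i' _ hj0 hj1 hk' hj).1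
  subst hii
  refine ⟨rfl, ?_⟩
  rcases Sym2.eq_iff.1 h with ⟨h1, -⟩ | ⟨h1, h2⟩
  · exact hn.node_inj hk.le hk'.le h1
  · have := hn.node_inj hk.le hk' h1
    have := hn.node_inj hk hk'.le h2
    omega

lemma meets_inl {V Λ : Type*} {pos : V → Pl} {f : V ⊕ Λ → Pl} (hf : ∀ w, f (Sum.inl w) = pos w)
    {a b c d : V} : Meets f (Sum.inl a) (Sum.inl b) (Sum.inl c) (Sum.inl d) ↔ Meets pos a b c d := by
  simp [Meets, Apart, hf]

lemma sym2_inl {V Λ : Type*} {a b c d : V} :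
    (s(Sum.inl a, Sum.inl b) : Sym2 (V ⊕ Λ)) = s(Sum.inl c, Sum.inl d) ↔ s(a, b) = s(c, d) := by
  simp

lemma lab_eq_inl {V κ : Type*} {x y : κ → V} {l : κ → List (ℕ × Pl)} {i : κ} {k : ℕ} {w : V}
    (e : lab x y l i k = Sum.inl w) : x i = w ∨ y i = w := by
  unfold lab at e
  split_ifs at e
  · exact Or.inl (Sum.inl.inj e)
  · exact Or.inr (Sum.inl.inj e)

namespace PathSys
variable {V ι : Type*} [Fintype V] {G : SimpleGraph V} [DecidableRel G.Adj] {u v : ι → V}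
  {P : ∀ i, G.Walk (u i) (v i)}

open Classical in
/-- A drawing of the graph yields a drawing of the graph with shortened long paths. -/
theorem geomOnePlanar_short [Fintype ι] [Nonempty V] (hS : PathSys G u v P) (Sh : ι → Prop)
    {N : ι → ℕ} (hN : ∀ i, N i ≤ (P i).length) (h1 : ∀ i, 1 ≤ N i)
    (hsh : ∀ i, Sh i → N i = (P i).length)
    (hlg : ∀ i, ¬ Sh i → 2 * (∑ i with Sh i, (P i).length) + 2 * Fintype.card ι ≤ N i + 2)
    (hlg' : ∀ i, ¬ Sh i → (Finset.univ.filter fun i => ¬ Sh i).card + 1 ≤ N i) {Γ : SimpleGraph V}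
    (hΓ : ∀ a b, Γ.Adj a b → ∃ i, ∃ k < N i, s(a, b) = s(shortVert P N i k, shortVert P N i (k + 1)))
    (hG : GeomOnePlanar G) : GeomOnePlanar Γ := by
  obtain ⟨pos, hgp, ht⟩ := exists_GP_touchOne hG
  obtain ⟨h, eX, eY, hE, B, hBn, l₀, hc₀, hcap⟩ := exists_layout hS Sh hgp ht
  set x : {i // ¬ Sh i} → V := fun i => u i with hx
  set y : {i // ¬ Sh i} → V := fun i => v i with hy
  have hxO : ∀ i, x i ∈ wallEnds P Sh := fun i =>
    Finset.mem_filter.2 ⟨Finset.mem_univ _, Or.inl ⟨i, Or.inl rfl⟩⟩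
  have hyO : ∀ i, y i ∈ wallEnds P Sh := fun i =>
    Finset.mem_filter.2 ⟨Finset.mem_univ _, Or.inl ⟨i, Or.inr rfl⟩⟩
  have memK : ∀ w ∈ wallEnds P Sh, pos w ∈ B.W.K := fun w hw => by
    obtain ⟨s, hs, -, hm⟩ := B.ray _ hw; exact ⟨s, hs, hm⟩
  obtain ⟨l, c, hopt⟩ := exists_optimal (x := fun i => pos (x i)) (y := fun i => pos (y i))
    (fun i => memK _ (hxO i)) (fun i => memK _ (hyO i)) hc₀ hcap (finite_range pos)
  have S : Scene B x y l c := ⟨hgp, fun s hs => (hE.adj hs).ne, hxO, hyO, fun i => hS.ne i, hopt⟩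
  obtain ⟨η, T⟩ := S.exists_tame
  clear hc₀ hcap l₀ hxO hyO memK
  obtain ⟨m, mS, mL⟩ : ∃ m : ι → ℕ, (∀ i, Sh i → m i = (P i).length) ∧
      ∀ i (hi : ¬ Sh i), m i = (l ⟨i, hi⟩).length + 1 :=
    ⟨fun i => if hi : Sh i then (P i).length else (l ⟨i, hi⟩).length + 1,
      fun i hi => dif_pos hi, fun i hi => dif_neg hi⟩
  obtain ⟨ν, νS, νL⟩ : ∃ ν : ι → ℕ → Lab V l, (∀ i, Sh i → ∀ k, ν i k = Sum.inl ((P i).getVert k)) ∧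
      ∀ i (hi : ¬ Sh i) k, ν i k = lab x y l ⟨i, hi⟩ k :=
    ⟨fun i k => if hi : Sh i then Sum.inl ((P i).getVert k) else lab x y l ⟨i, hi⟩ k,
      fun i hi k => dif_pos hi, fun i hi k => dif_neg hi⟩
  set f := place pos x y l η with hf
  have fl : ∀ w, f (Sum.inl w) = pos w := fun w => rfl
  have hn : Net u v m Sum.inl ν := by
    refine ⟨fun i => ?_, Sum.inl_injective, hS.ne, fun i => ?_, fun i => ?_, fun i k i' k' k0 hk hk' e => ?_⟩
    · by_cases hi : Sh i
      · rw [mS i hi]; exact hS.pos i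
      · rw [mL i hi]; omega
    · by_cases hi : Sh i
      · rw [νS i hi]; simp
      · rw [νL i hi, lab_zero]
    · by_cases hi : Sh i
      · rw [νS i hi, mS i hi]; simp
      · rw [νL i hi, mL i hi, lab_last]
    · by_cases hi : Sh i
      · rw [mS i hi] at hk
        by_cases hi' : Sh i'
        · rw [mS i' hi'] at hk'
          rw [νS i hi, νS i' hi'] at e
          exact hS.inner k0 hk hk' (Sum.inl.inj e)
        · rw [νS i hi, νL i' hi'] at e
          exact absurd (lab_eq_inl e.symm) (hS.not_branch k0 hk)
      · rw [mL i hi] at hk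
        by_cases hi' : Sh i'
        · rw [νL i hi, νS i' hi'] at e
          obtain ⟨k, rfl⟩ := Nat.exists_eq_succ_of_ne_zero k0.ne'
          rw [Nat.succ_eq_add_one, lab_succ (by omega)] at e
          cases e
        · rw [νL i hi, νL i' hi'] at e
          obtain ⟨e1, e2⟩ := lab_inj k0 (by omega) e
          exact ⟨congrArg Subtype.val e1, e2⟩
  -- the crossings of an edge of a short path
  have shortHit : ∀ i, Sh i → ∀ k < (P i).length, ∀ s < h,
      s((P i).getVert k, (P i).getVert (k + 1)) = s(eX s, eY s) → ∀ i' (hi' : ¬ Sh i') k', k' < m i' →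
      Meets f (ν i' k') (ν i' (k' + 1)) (ν i k) (ν i (k + 1)) →
      ∃ hk : k' < (l ⟨i', hi'⟩).length, (l ⟨i', hi'⟩)[k'].1 = s := by
    intro i hi k hk s hs e i' hi' k' hk' hm
    rw [νS i hi, νS i hi] at hm
    replace hm := hm.of_eq (sym2_inl.2 e)
    rw [νL i' hi', νL i' hi'] at hm
    rw [mL i' hi'] at hk'
    by_cases hl : l ⟨i', hi'⟩ = []
    · have l0 : (l ⟨i', hi'⟩).length = 0 := by rw [hl]; rfl
      obtain rfl : k' = 0 := by omega
      have e1 : lab x y l ⟨i', hi'⟩ (0 + 1) = Sum.inl (y ⟨i', hi'⟩) := by rw [← lab_last, l0]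
      rw [lab_zero, e1, meets_inl fl] at hm
      exact absurd hm.2 (S.chord_not_meets hl hs hm.1)
    · exact S.hit T hl (by omega) hs hm
  have shortShort : ∀ i, Sh i → ∀ k i', Sh i' → ∀ k',
      Meets f (ν i k) (ν i (k + 1)) (ν i' k') (ν i' (k' + 1)) →
      Meets pos ((P i).getVert k) ((P i).getVert (k + 1)) ((P i').getVert k') ((P i').getVert (k' + 1)) := by
    intro i hi k i' hi' k' hm
    rwa [νS i hi, νS i hi, νS i' hi', νS i' hi', meets_inl fl] at hm
  have shortCard : ∀ i, Sh i → ∀ k < (P i).length, (touched m ν f i k).card ≤ 1 := by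
    intro i hi k hk
    obtain ⟨s, hs, e⟩ := hE.of_short i hi k hk
    have mixed : ∀ i₁, Sh i₁ → ∀ k₁ < (P i₁).length, ∀ i₂ (hi₂ : ¬ Sh i₂) k₂, k₂ < m i₂ →
        Meets f (ν i k) (ν i (k + 1)) (ν i₁ k₁) (ν i₁ (k₁ + 1)) →
        Meets f (ν i k) (ν i (k + 1)) (ν i₂ k₂) (ν i₂ (k₂ + 1)) → False := by
      intro i₁ hi₁ k₁ hk₁ i₂ hi₂ k₂ hk₂ m1 m2
      obtain ⟨hk', e'⟩ := shortHit i hi k hk s hs e i₂ hi₂ k₂ hk₂ m2.symm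
      obtain ⟨r, hr, e''⟩ := hE.of_short i₁ hi₁ k₁ hk₁
      have m3 := ((shortShort i hi k i₁ hi₁ k₁ m1).of_eq e'').symm.of_eq e
      exact S.not_touch_of_hit hs hr hk' e' m3.symm.1 m3.symm.2
    refine Finset.card_le_one.2 ?_
    rintro ⟨i₁, k₁⟩ hq ⟨i₂, k₂⟩ hq'
    obtain ⟨a1, a2⟩ := mem_touched.1 hq
    obtain ⟨b1, b2⟩ := mem_touched.1 hq'
    simp only at a1 b1
    by_cases hi₁ : Sh i₁ <;> by_cases hi₂ : Sh i₂
    · rw [mS i₁ hi₁] at a1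
      rw [mS i₂ hi₂] at b1
      have m1 := shortShort i hi k i₁ hi₁ k₁ a2
      have m2 := shortShort i hi k i₂ hi₂ k₂ b2
      obtain ⟨rfl, rfl⟩ := hS.edge_inj a1 b1 (ht _ _ ((P i).adj_getVert_succ hk) _ _ _ _
        ((P i₁).adj_getVert_succ a1) ((P i₂).adj_getVert_succ b1) m1.1 m2.1 m1.2 m2.2)
      rfl
    · exact (mixed i₁ hi₁ k₁ (mS i₁ hi₁ ▸ a1) i₂ hi₂ k₂ b1 a2 b2).elim
    · exact (mixed i₂ hi₂ k₂ (mS i₂ hi₂ ▸ b1) i₁ hi₁ k₁ a1 b2 a2).elim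
    · obtain ⟨p1, p2⟩ := shortHit i hi k hk s hs e i₁ hi₁ k₁ a1 (Meets.symm a2)
      obtain ⟨q1, q2⟩ := shortHit i hi k hk s hs e i₂ hi₂ k₂ b1 (Meets.symm b2)
      obtain ⟨e1, rfl⟩ := S.hit_unique hs p1 q1 p2 q2
      obtain rfl : i₁ = i₂ := congrArg Subtype.val e1
      rfl
  -- the crossings of a long path with short paths
  have longShort : ∀ i (hi : ¬ Sh i) k, k < m i → ((touched m ν f i k).filter fun q => Sh q.1).card ≤ 1 := by
    intro i hi k hk
    refine Finset.card_le_one.2 ?_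
    rintro ⟨i₁, k₁⟩ hq ⟨i₂, k₂⟩ hq'
    obtain ⟨hq, hi₁⟩ := Finset.mem_filter.1 hq
    obtain ⟨hq', hi₂⟩ := Finset.mem_filter.1 hq'
    obtain ⟨a1, a2⟩ := mem_touched.1 hq
    obtain ⟨b1, b2⟩ := mem_touched.1 hq'
    simp only at a1 b1 hi₁ hi₂
    rw [mS i₁ hi₁] at a1
    rw [mS i₂ hi₂] at b1
    obtain ⟨s, hs, e⟩ := hE.of_short i₁ hi₁ k₁ a1
    obtain ⟨r, hr, e'⟩ := hE.of_short i₂ hi₂ k₂ b1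
    obtain ⟨p1, p2⟩ := shortHit i₁ hi₁ k₁ a1 s hs e i hi k hk a2
    obtain ⟨q1, q2⟩ := shortHit i₂ hi₂ k₂ b1 r hr e' i hi k hk b2
    obtain rfl : s = r := p2.symm.trans q2
    obtain ⟨rfl, rfl⟩ := hS.edge_inj a1 b1 (e.trans e'.symm)
    rfl
  -- the crossings of a long path with long paths
  have longLong : ∀ i, ¬ Sh i → ∑ k ∈ Finset.range (m i),
      ((touched m ν f i k).filter fun q => ¬ Sh q.1).card + 1 ≤ (Finset.univ.filter fun i => ¬ Sh i).card := by
    intro i hi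
    rw [← Finset.card_sigma, ← Finset.card_erase_add_one (a := i) (s := Finset.univ.filter fun i => ¬ Sh i)
      (by simpa using hi)]
    refine Nat.add_le_add_right (Finset.card_le_card_of_injOn (fun q => q.2.1) ?_ ?_) 1
    · rintro ⟨k, i', k'⟩ hq
      obtain ⟨hk, hq⟩ := Finset.mem_sigma.1 (Finset.mem_coe.1 hq)
      obtain ⟨hq, hi'⟩ := Finset.mem_filter.1 hq
      obtain ⟨a1, a2⟩ := mem_touched.1 hq
      simp only [Finset.mem_range] at hk a1 a2 hi' ⊢
      refine Finset.mem_coe.2 (Finset.mem_erase.2 ⟨?_, by simpa using hi'⟩)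
      rintro rfl
      rw [mL _ hi] at hk a1
      simp only [νL _ hi] at a2
      exact S.not_meets_self T (by omega) (by omega) a2
    · rintro ⟨k, i₁, k₁⟩ hq ⟨j, i₂, k₂⟩ hq' e
      obtain ⟨hk, hq⟩ := Finset.mem_sigma.1 (Finset.mem_coe.1 hq)
      obtain ⟨hj, hq'⟩ := Finset.mem_sigma.1 (Finset.mem_coe.1 hq')
      obtain ⟨hq, hi₁⟩ := Finset.mem_filter.1 hq
      obtain ⟨hq', hi₂⟩ := Finset.mem_filter.1 hq'
      obtain ⟨a1, a2⟩ := mem_touched.1 hq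
      obtain ⟨b1, b2⟩ := mem_touched.1 hq'
      simp only [Finset.mem_range] at hk hj a1 a2 b1 b2 hi₁ hi₂ e
      subst e
      rw [mL _ hi] at hk hj
      rw [mL _ hi₁] at a1 b1
      simp only [νL _ hi, νL _ hi₁] at a2 b2
      by_cases hii : i = i₁
      · subst hii
        exact absurd a2 (S.not_meets_self T (by omega) (by omega))
      · obtain ⟨rfl, rfl⟩ := S.meets_once T (i := ⟨i, hi⟩) (i' := ⟨i₁, hi₁⟩) (by simpa using hii)
          (by omega) (by omega) (by omega) (by omega) a2 b2
        rfl
  have split : ∀ i k, (touched m ν f i k).card = ((touched m ν f i k).filter fun q => Sh q.1).card +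
      ((touched m ν f i k).filter fun q => ¬ Sh q.1).card := fun i k =>
    (Finset.card_filter_add_card_filter_not _).symm
  refine realize_direct (hS.chains hN h1 hΓ) (Finset.univ.filter fun i => ∃ hi : ¬ Sh i, l ⟨i, hi⟩ = [])
    hn f ?_ ?_ ?_ ?_
  · intro i hi
    obtain ⟨hi, hl⟩ := (Finset.mem_filter.1 hi).2
    rw [mL i hi, hl]; rfl
  · intro i k hk i' k' hk' e
    simp only [Finset.mem_filter, Finset.mem_univ, true_and]
    have big : ∀ i, ¬ Sh i → (¬ ∃ hi : ¬ Sh i, l ⟨i, hi⟩ = []) → 2 ≤ m i := by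
      intro i hi hD
      have := List.length_pos_iff.2 fun e => hD ⟨hi, e⟩
      rw [mL i hi]; omega
    by_cases hi : Sh i
    · by_cases hi' : Sh i'
      · rw [mS i hi] at hk
        rw [mS i' hi'] at hk'
        rw [νS i hi, νS i hi, νS i' hi', νS i' hi', sym2_inl] at e
        exact Or.inl (hS.edge_inj hk hk' e)
      · by_cases hD : ∃ hi' : ¬ Sh i', l ⟨i', hi'⟩ = []
        · exact Or.inr (Or.inr hD)
        · obtain ⟨e1, e2⟩ := hn.piece_inj (big i' hi' hD) hk' hk e.symm
          exact Or.inl ⟨e1.symm, e2.symm⟩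
    · by_cases hD : ∃ hi : ¬ Sh i, l ⟨i, hi⟩ = []
      · exact Or.inr (Or.inl hD)
      · exact Or.inl (hn.piece_inj (big i hi hD) hk hk' e)
  · intro i _
    by_cases hi : Sh i
    · rw [hsh i hi, mS i hi]
      refine le_trans (Finset.sum_le_card_nsmul _ _ 1 fun k hk => ?_) (by simp)
      exact Nat.max_le.2 ⟨le_rfl, shortCard i hi k (Finset.mem_range.1 hk)⟩
    · have h3 : ∑ k ∈ Finset.range (m i), Max.max 1 (touched m ν f i k).card ≤ ∑ k ∈ Finset.range (m i),
          (1 + ((touched m ν f i k).filter fun q => ¬ Sh q.1).card) := by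
        refine Finset.sum_le_sum fun k hk => ?_
        have := longShort i hi k (Finset.mem_range.1 hk)
        rw [split i k]
        omega
      rw [Finset.sum_add_distrib, Finset.sum_const, Finset.card_range, smul_eq_mul, mul_one] at h3
      have h4 := longLong i hi
      have h5 := S.length_le ⟨i, hi⟩
      have h6 := hlg i hi
      have h7 : (Finset.univ.filter Sh).card + (Finset.univ.filter fun i => ¬ Sh i).card = Fintype.card ι :=
        Finset.card_filter_add_card_filter_not _
      have h8 := mL i hi
      omega
  · intro i hi
    obtain ⟨hi, hl⟩ := (Finset.mem_filter.1 hi).2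
    have m1 : m i = 1 := by rw [mL i hi, hl]; rfl
    have h4 := longLong i hi
    rw [m1, Finset.sum_range_one] at h4
    have h5 : ((touched m ν f i 0).filter fun q => Sh q.1).card = 0 := by
      rw [Finset.card_eq_zero, Finset.filter_eq_empty_iff]
      rintro ⟨i', k'⟩ hq hi'
      obtain ⟨a1, a2⟩ := mem_touched.1 hq
      simp only at a1 hi'
      rw [mS i' hi'] at a1
      obtain ⟨s, hs, e⟩ := hE.of_short i' hi' k' a1
      obtain ⟨hk, -⟩ := shortHit i' hi' k' a1 s hs e i hi 0 (by omega) a2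
      rw [hl] at hk
      simp at hk
    have h6 := hlg' i hi
    have h7 := split i 0
    omega

end PathSys
end OnePlanar

namespace OnePlanar
open Filter Topology

lemma geomOnePlanar_top_two : GeomOnePlanar (⊤ : SimpleGraph (Fin 2)) := by
  have h2 : ∀ a b x y : Fin 2, a ≠ b → x ≠ y → s(a, b) = s(x, y) := by decide
  refine ⟨fun i => ((i : ℕ), 0), ⟨?_, ?_, ?_⟩, ?_⟩
  · intro a b h
    simpa [Fin.ext_iff] using h
  · intro a b h w _
    have h3 : ∀ a b w : Fin 2, a ≠ b → w = a ∨ w = b := by decide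
    exact h3 a b w h
  · intro a b x y h h' hne
    exact absurd (h2 a b x y h h') hne
  · rintro a b - e he e' he'
    induction e with | _ x y
    induction e' with | _ x' y'
    exact h2 x y x' y' he.1 he'.1

open Classical in
/-- The edges of the graph in which all paths from the `j`-th on are shortened to the length of
the `j`-th path are the pieces of the shortened paths. -/
lemma mem_kernel_iff {V : Type*} {G : SimpleGraph V} {p : ℕ} {u v : Fin p → V}
    (P : ∀ i, G.Walk (u i) (v i)) (j : Fin p) (hj : 1 ≤ (P j).length) (e : Sym2 V) :
    e ∈ ({e | ∃ i : Fin p, i < j ∧ e ∈ (P i).edges} ∪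
        {e | ∃ i : Fin p, j ≤ i ∧ e ∈ shortEdges (P i) (P j).length}) ↔
      ∃ i, ∃ k < (if i < j then (P i).length else (P j).length),
        e = s(shortVert P (fun i => if i < j then (P i).length else (P j).length) i k,
          shortVert P (fun i => if i < j then (P i).length else (P j).length) i (k + 1)) := by
  have hS : ∀ i, i < j → ∀ k, k ≤ (P i).length →
      shortVert P (fun i => if i < j then (P i).length else (P j).length) i k
        = (P i).getVert k := by
    intro i hi k hk
    rw [← shortVert_full hk]
    simp [shortVert, hi]
  have hL : ∀ i, j ≤ i → ∀ k,
      shortVert P (fun i => if i < j then (P i).length else (P j).length) i k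
        = if k < (P j).length then (P i).getVert k else v i := by
    intro i hi k
    simp [shortVert, hi.not_gt]
  constructor
  · rintro (⟨i, hi, he⟩ | ⟨i, hi, ⟨k, hk, rfl⟩ | rfl⟩)
    · obtain ⟨k, hk, rfl⟩ := (mem_edges_iff_getVert _ _).1 he
      exact ⟨i, k, by rwa [if_pos hi], by rw [hS i hi k hk.le, hS i hi (k + 1) hk]⟩
    · refine ⟨i, k, by rw [if_neg hi.not_gt]; omega, ?_⟩
      rw [hL i hi, hL i hi, if_pos (by omega), if_pos (by omega)]
    · refine ⟨i, (P j).length - 1, by rw [if_neg hi.not_gt]; omega, ?_⟩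
      rw [hL i hi, hL i hi, if_pos (by omega), if_neg (by omega)]
  · rintro ⟨i, k, hk, rfl⟩
    rcases lt_or_ge i j with hi | hi
    · rw [if_pos hi] at hk
      refine Or.inl ⟨i, hi, ?_⟩
      rw [hS i hi k hk.le, hS i hi (k + 1) hk]
      exact (mem_edges_iff_getVert _ _).2 ⟨k, hk, rfl⟩
    · rw [if_neg hi.not_gt] at hk
      refine Or.inr ⟨i, hi, ?_⟩
      rw [hL i hi, hL i hi, if_pos hk]
      split_ifs with h
      · exact Or.inl ⟨k, by omega, rfl⟩
      · rw [show k = (P j).length - 1 by omega]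
        exact Or.inr rfl

open Classical in
/-- Shortening the paths from a very long one on preserves geometric 1-planarity and its
failure. -/
theorem geomOnePlanar_kernel_iff {V : Type*} [Fintype V] {G : SimpleGraph V}
    [DecidableRel G.Adj] {p : ℕ} {u v : Fin p → V} {P : ∀ i, G.Walk (u i) (v i)}
    (hS : PathSys G (fun i : {i // (P i).length ≠ 0} => u i) (fun i => v i) (fun i => P i))
    (hsorted : ∀ i j : Fin p, i ≤ j → (P i).length ≤ (P j).length) {j : Fin p}
    (hj : VeryLong P j) :
    GeomOnePlanar G ↔ GeomOnePlanar (SimpleGraph.fromEdgeSet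
      ({e | ∃ i : Fin p, i < j ∧ e ∈ (P i).edges} ∪
        {e | ∃ i : Fin p, j ≤ i ∧ e ∈ shortEdges (P i) (P j).length})) := by
  obtain ⟨j0, hlong⟩ := hj
  have hjp := j.2
  have hmem := mem_kernel_iff P j (by omega)
  set M : Fin p → ℕ := fun i => if i < j then (P i).length else (P j).length with hM
  have hMle : ∀ i, M i ≤ (P i).length := by
    intro i
    simp only [hM]
    split_ifs with h
    · exact le_rfl
    · exact hsorted j i (not_lt.1 h)
  set N : {i // (P i).length ≠ 0} → ℕ := fun i => M i with hN
  have hNle : ∀ i : {i // (P i).length ≠ 0}, N i ≤ (P i).length := fun i => hMle i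
  have hN1 : ∀ i, N i = (P i.1).length ∨ N i = (P j).length ∧ ¬ i.1 < j := by
    intro i
    simp only [hN, hM]
    split_ifs with h
    · exact Or.inl rfl
    · exact Or.inr ⟨rfl, h⟩
  have hpos : ∀ i, 1 ≤ N i := by
    intro i
    have := i.2
    rcases hN1 i with h | h <;> omega
  have hnet := hS.net hNle hpos
  constructor
  · have : Nonempty V := ⟨u j⟩
    refine hS.geomOnePlanar_short (fun i => i.1 < j) hNle hpos ?_ ?_ ?_ ?_
    · intro i hi
      simp [hN, hM, hi]
    · intro i hi
      have hNi : N i = (P j).length := by simp only [hN, hM, if_neg hi]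
      have hc : Fintype.card {i // (P i).length ≠ 0} ≤ p :=
        (Fintype.card_subtype_le _).trans_eq (Fintype.card_fin p)
      have hs : ∀ t : Finset {i // (P i).length ≠ 0}, (∀ i ∈ t, i.1 < j) →
          ∑ i ∈ t, (P i.1).length ≤
            ∑ i ∈ Finset.univ.filter (fun i : Fin p => i < j), (P i).length := by
        refine fun t ht => le_of_eq_of_le (Finset.sum_map _ (Function.Embedding.subtype _)
          fun i => (P i).length).symm (Finset.sum_le_sum_of_subset fun i hi => ?_)
        obtain ⟨i, hit, rfl⟩ := Finset.mem_map.1 hi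
        exact Finset.mem_filter.2 ⟨Finset.mem_univ _, ht i hit⟩
      refine le_trans (Nat.add_le_add (Nat.mul_le_mul_left 2 (hs _ fun i hi => ?_))
        (Nat.mul_le_mul_left 2 hc)) ?_
      · exact (@Finset.mem_filter _ _ (_) _ _).1 hi |>.2
      · rw [hNi]
        omega
    · intro i hi
      have hNi : N i = (P j).length := by simp only [hN, hM, if_neg hi]
      have hc : ∀ t : Finset {i // (P i).length ≠ 0}, (∀ i ∈ t, ¬ i.1 < j) →
          t.card ≤ ((Finset.univ : Finset (Fin p)).erase ⟨0, by omega⟩).card := by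
        refine fun t ht => Finset.card_le_card_of_injOn (fun i => i.1) (fun i hi => ?_)
          Subtype.val_injective.injOn
        refine Finset.mem_coe.2 (Finset.mem_erase.2
          ⟨fun e => ht i (Finset.mem_coe.1 hi) ?_, Finset.mem_univ _⟩)
        exact e.trans_lt j0
      rw [Finset.card_erase_of_mem (Finset.mem_univ _), Finset.card_univ, Fintype.card_fin] at hc
      refine le_trans (Nat.add_le_add_right (hc _ fun i hi => ?_) 1) ?_
      · exact (@Finset.mem_filter _ _ (_) _ _).1 hi |>.2
      · rw [hNi]
        omega
    · intro a b hab
      obtain ⟨i, k, hk, e⟩ := (hmem _).1 (SimpleGraph.fromEdgeSet_adj _ |>.1 hab).1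
      exact ⟨⟨i, (Nat.zero_lt_of_lt (hk.trans_le (hMle i))).ne'⟩, k, hk, e⟩
  · refine hS.geomOnePlanar_of_short hNle hpos ?_ ?_
    · intro i hi
      rcases hN1 i with h | h <;> omega
    · intro i k hk
      refine (SimpleGraph.fromEdgeSet_adj _).2 ⟨(hmem _).2 ⟨i, k, hk, rfl⟩, fun e => ?_⟩
      have := hnet.node_inj hk.le hk e
      omega

end OnePlanar

open Classical in
/-- Let `G` be a finite simple graph with minimum degree at least `2` and feedback edge
number `ℓ ≥ 1`, and let `P_1, …, P_p` (with `p ≤ 3ℓ − 3`) be maximal degree-2 paths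
partitioning the edge set of `G`, sorted by nondecreasing length.  Then `G` is
geometric 1-planar if and only if the kernel `Ḡ'` is:  if the shortest path has length
at least `p − 1`, `Ḡ'` is `K₂`; if no path is very long, `Ḡ' = G`; otherwise, with `j`
the least very long index, `Ḡ'` consists of all `P i` with `i < j` together with all
`P i` with `i ≥ j` shortened to length `|E(P_j)|` (preserving endpoints). -/
theorem stmt13 {V : Type*} [Fintype V] (G : SimpleGraph V) [DecidableRel G.Adj]
    (hmin : ∀ w : V, 2 ≤ G.degree w)
    (l : ℕ) (hl : feedbackEdgeNumber G = l) (hl1 : 1 ≤ l)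
    (p : ℕ) (hp : p ≤ 3 * l - 3)
    (u v : Fin p → V) (P : ∀ i, G.Walk (u i) (v i))
    (hpath : ∀ i, (P i).IsPath)
    (hdeg2 : ∀ i, ∀ w ∈ (P i).support, w ≠ u i → w ≠ v i → G.degree w = 2)
    (hmax : ∀ i, G.degree (u i) ≠ 2 ∧ G.degree (v i) ≠ 2)
    (hdisj : ∀ i j, i ≠ j → ∀ e ∈ (P i).edges, e ∉ (P j).edges)
    (hcover : ∀ e : Sym2 V, e ∈ G.edgeSet ↔ ∃ i, e ∈ (P i).edges)
    (hsorted : ∀ i j : Fin p, i ≤ j → (P i).length ≤ (P j).length) :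
    GeomOnePlanar G ↔
      (if ∀ i : Fin p, p - 1 ≤ (P i).length then
        GeomOnePlanar (⊤ : SimpleGraph (Fin 2))
      else if ∀ i : Fin p, ¬ VeryLong P i then
        GeomOnePlanar G
      else
        ∃ j : Fin p, VeryLong P j ∧ (∀ j' : Fin p, j' < j → ¬ VeryLong P j') ∧
          GeomOnePlanar (SimpleGraph.fromEdgeSet
            ({e | ∃ i : Fin p, i < j ∧ e ∈ (P i).edges} ∪
             {e | ∃ i : Fin p, j ≤ i ∧ e ∈ shortEdges (P i) (P j).length}))) := by
  have hS : OnePlanar.PathSys G (fun i : {i // (P i).length ≠ 0} => u i) (fun i => v i)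
      (fun i => P i) := by
    refine ⟨hmin, fun i => hpath i, fun i => hdeg2 i, fun i => hmax i,
      fun i j hij => hdisj i j fun e => hij (Subtype.ext e), fun e he => ?_,
      fun i => Nat.one_le_iff_ne_zero.2 i.2⟩
    obtain ⟨i, hi⟩ := (hcover e).1 he
    refine ⟨⟨i, fun h0 => ?_⟩, hi⟩
    have := List.length_pos_of_mem hi
    rw [SimpleGraph.Walk.length_edges] at this
    omega
  split_ifs with hA hB
  · refine iff_of_true (hS.geomOnePlanar_of_long fun i => ?_) OnePlanar.geomOnePlanar_top_two
    have hc : Fintype.card {i // (P i).length ≠ 0} ≤ p :=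
      (Fintype.card_subtype_le _).trans_eq (Fintype.card_fin p)
    have := hA i
    omega
  · exact Iff.rfl
  · constructor
    · intro hG
      push Not at hB
      obtain ⟨j, hj, hmn⟩ := WellFounded.has_min (wellFounded_lt (α := Fin p)) {j | VeryLong P j} hB
      exact ⟨j, hj, fun j' hlt hv => hmn j' hv hlt,
        (OnePlanar.geomOnePlanar_kernel_iff hS hsorted hj).1 hG⟩
    · rintro ⟨j, hj, -, h⟩
      exact (OnePlanar.geomOnePlanar_kernel_iff hS hsorted hj).2 h
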